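/- Let S be a closed surface (S = M_g for some g ≥ 0 or S = N_g for some g ≥ 1). For all integers i and n with 3 ≤ i < n, the homotopy group π_i(SP^n(S)) is trivial. Moreover, for every n ≥ 3, π_2(SP^n(M_g)) is isomorphic to ℤ for every g ≥ 0, and π_2(SP^n(N_g)) is trivial for every g ≥ 1. -/

import Mathlib

open scoped unitInterval Topology
open MeasureTheory
noncomputable section

/-- The `n`-th symmetric product relation on `X^n`: two tuples are related iff they
differ by a permutation of coordinates. -/
def spRel (n : ℕ) (X : Type*) (s t : Fin n → X) : Prop :=
  ∃ e : Equiv.Perm (Fin n), s ∘ e = t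

/-- The `n`-th symmetric product of a topological space `X`: the quotient of the
product space `X^n` by the permutation action of the symmetric group `S_n`,
equipped with the quotient topology. -/
def SP (n : ℕ) (X : Type*) [TopologicalSpace X] : Type _ :=
  Quot (spRel n X)

instance (n : ℕ) (X : Type*) [TopologicalSpace X] : TopologicalSpace (SP n X) :=
  inferInstanceAs (TopologicalSpace (Quot (spRel n X)))

/-- The closed unit disc (a topological model for a polygon). -/
abbrev Disc : Type := {z : ℂ // ‖z‖ ≤ 1}

/-- The point at parameter `t ∈ [0,1]` on the `k`-th of the `N` boundary edges of an
`N`-gon, realized as the closed unit disc whose boundary circle is divided into `N` arcs. -/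
def polyBP (N k : ℕ) (t : ℝ) : ℂ :=
  Complex.exp (2 * Real.pi * Complex.I * (((k : ℝ) + t) / (N : ℝ)))

/-- Boundary identifications of the `4g`-gon for the edge word
`[a₁,b₁]⋯[a_g,b_g] = a₁b₁a₁⁻¹b₁⁻¹⋯a_gb_ga_g⁻¹b_g⁻¹` : the point at parameter `t`
on edge `4j+r` (`r = 0,1`) is glued to the point at parameter `1-t` on edge `4j+r+2`. -/
def orientRel (g : ℕ) (z w : Disc) : Prop :=
  ∃ j : Fin g, ∃ r : Fin 2, ∃ t : ℝ, 0 ≤ t ∧ t ≤ 1 ∧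
    (z : ℂ) = polyBP (4 * g) (4 * (j : ℕ) + (r : ℕ)) t ∧
    (w : ℂ) = polyBP (4 * g) (4 * (j : ℕ) + (r : ℕ) + 2) (1 - t)

/-- The closed orientable surface of genus `g` : the `2`-sphere for `g = 0`, and for
`g ≥ 1` the quotient of the `4g`-gon by the boundary edge word `[a₁,b₁]⋯[a_g,b_g]`. -/
def Mg : ℕ → Type
  | 0 => Metric.sphere (0 : EuclideanSpace ℝ (Fin 3)) 1
  | (g + 1) => Quot (orientRel (g + 1))

instance (g : ℕ) : TopologicalSpace (Mg g) := by
  cases g with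
  | zero =>
      exact inferInstanceAs (TopologicalSpace (Metric.sphere (0 : EuclideanSpace ℝ (Fin 3)) 1))
  | succ g => exact inferInstanceAs (TopologicalSpace (Quot (orientRel (g + 1))))

/-- Boundary identifications of the `2g`-gon for the edge word `e₁²e₂²⋯e_g²` :
the point at parameter `t` on edge `2j` is glued to the point at parameter `t`
on edge `2j+1`. -/
def nonorientRel (g : ℕ) (z w : Disc) : Prop :=
  ∃ j : Fin g, ∃ t : ℝ, 0 ≤ t ∧ t ≤ 1 ∧
    (z : ℂ) = polyBP (2 * g) (2 * (j : ℕ)) t ∧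
    (w : ℂ) = polyBP (2 * g) (2 * (j : ℕ) + 1) t

/-- The closed non-orientable surface of genus `g ≥ 1` : the quotient of the `2g`-gon
by the boundary edge word `e₁²e₂²⋯e_g²`. -/
def Ng (g : ℕ) : Type := Quot (nonorientRel g)

instance (g : ℕ) : TopologicalSpace (Ng g) :=
  inferInstanceAs (TopologicalSpace (Quot (nonorientRel g)))

section
set_option autoImplicit false
open Topology
set_option linter.unusedSectionVars false
set_option linter.unusedSimpArgs false
set_option linter.unusedVariables false

section MSTop
universe u v
variable {X : Type u} {Y : Type v} [TopologicalSpace X] [TopologicalSpace Y]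

def msk (n : ℕ) (s : Fin n → X) : Multiset X := Finset.univ.val.map s

def msig (p : Σ n : ℕ, (Fin n → X)) : Multiset X := msk p.1 p.2

instance msTop : TopologicalSpace (Multiset X) := TopologicalSpace.coinduced (msig (X := X)) inferInstance

@[simp] lemma msk_card (n : ℕ) (s : Fin n → X) : (msk n s).card = n := by simp [msk]

lemma msk_eq_iff {n : ℕ} (s t : Fin n → X) : msk n s = msk n t ↔ ∃ e0 : Equiv.Perm (Fin n), s = t ∘ e0 := by
  constructor
  · intro h
    have h1 : Multiset.map s Finset.univ.val = Multiset.map t Finset.univ.val := h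
    have hc : ∀ x : X, Nonempty ({i // s i = x} ≃ {i // t i = x}) := by
      classical
      intro x
      refine Fintype.card_eq.1 ?_
      have := congrArg (Multiset.count x) h1
      rw [Multiset.count_map, Multiset.count_map] at this
      rw [Fintype.card_subtype, Fintype.card_subtype]
      simpa [Finset.card, eq_comm] using this
    have e := fun x => (hc x).some
    refine ⟨((Equiv.sigmaFiberEquiv s).symm.trans (Equiv.sigmaCongrRight e)).trans (Equiv.sigmaFiberEquiv t), ?_⟩
    funext i
    exact ((e (s i) ⟨i, rfl⟩).2).symm
  · rintro ⟨e0, rfl⟩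
    simp only [msk, Function.comp_def]
    have := Multiset.map_univ_val_equiv e0
    conv_rhs => rw [← this]
    rw [Multiset.map_map]; rfl

lemma msk_surj (m : Multiset X) : ∃ s : Fin m.card → X, msk m.card s = m := by
  induction m using Quotient.inductionOn with
  | h l =>
    refine ⟨l.get, ?_⟩
    have := List.ofFn_get l
    conv_rhs => rw [← this]
    rw [List.ofFn_eq_map]
    rfl

lemma msk_surj' {n : ℕ} (m : Multiset X) (h : m.card = n) : ∃ s : Fin n → X, msk n s = m := by
  subst h; exact msk_surj m

lemma continuous_msig : Continuous (msig (X := X)) := continuous_coinduced_rng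

lemma continuous_msk (n : ℕ) : Continuous (msk (X := X) n) :=
  continuous_msig.comp (continuous_sigmaMk (ι := ℕ) (i := n))

lemma isOpenMap_msk (n : ℕ) : IsOpenMap (msk (X := X) n) := by
  intro U hU
  rw [isOpen_coinduced, isOpen_sigma_iff]
  intro m
  by_cases hm : m = n
  · subst hm
    have : Sigma.mk m ⁻¹' (msig ⁻¹' (msk m '' U)) = ⋃ e0 : Equiv.Perm (Fin m), (fun s : Fin m → X => s ∘ e0) ⁻¹' U := by
      ext s
      simp only [Set.mem_preimage, Set.mem_image, Set.mem_iUnion, msig]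
      constructor
      · rintro ⟨t, ht, h⟩
        obtain ⟨e0, rfl⟩ := (msk_eq_iff _ _).1 h
        exact ⟨e0, ht⟩
      · rintro ⟨e0, h⟩
        exact ⟨_, h, (msk_eq_iff _ _).2 ⟨e0, rfl⟩⟩
    rw [this]
    exact isOpen_iUnion fun e0 => hU.preimage (by fun_prop)
  · have : Sigma.mk m ⁻¹' (msig ⁻¹' (msk n '' U)) = ∅ := by
      ext s
      simp only [Set.mem_preimage, Set.mem_image, msig, Set.mem_empty_iff_false, iff_false]
      rintro ⟨t, _, h⟩
      exact hm (by simpa using (congrArg Multiset.card h).symm)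
    rw [this]; exact isOpen_empty

lemma continuousAt_of_open {A B C : Type*} [TopologicalSpace A] [TopologicalSpace B] [TopologicalSpace C]
    {p : A → B} (hp : IsOpenMap p) {f : B → C} (hf : Continuous (f ∘ p)) (a : A) : ContinuousAt f (p a) := by
  have h1 : 𝓝 (p a) ≤ Filter.map p (𝓝 a) := hp.nhds_le a
  have h2 : Filter.Tendsto (f ∘ p) (𝓝 a) (𝓝 (f (p a))) := hf.continuousAt
  exact (Filter.map_mono h1).trans (by rw [Filter.map_map]; exact h2)

lemma continuous_ms_dom {C : Type*} [TopologicalSpace C] {f : Multiset X → C}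
    (h : ∀ n, Continuous (fun s : Fin n → X => f (msk n s))) : Continuous f := by
  rw [continuous_iff_continuousAt]
  intro m
  obtain ⟨s, hs⟩ := msk_surj m
  rw [← hs]
  exact continuousAt_of_open (isOpenMap_msk _) (h _) s

lemma continuous_ms_dom2 {C : Type*} [TopologicalSpace C] {f : Y × Multiset X → C}
    (h : ∀ n, Continuous (fun p : Y × (Fin n → X) => f (p.1, msk n p.2))) : Continuous f := by
  rw [continuous_iff_continuousAt]
  rintro ⟨y, m⟩
  obtain ⟨s, hs⟩ := msk_surj m
  rw [← hs]
  exact continuousAt_of_open (IsOpenMap.id.prodMap (isOpenMap_msk m.card)) (h _) (y, s)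

lemma msk_add {n m : ℕ} (s : Fin n → X) (t : Fin m → X) : msk n s + msk m t = msk (n + m) (Fin.append s t) := by
  have h : ∀ (k : ℕ) (r : Fin k → X), msk k r = ((List.ofFn r : List X) : Multiset X) := by
    intro k r; simp [msk, List.ofFn_eq_map]
  rw [h, h, h, List.ofFn_fin_append]; rfl

instance msAdd : ContinuousAdd (Multiset X) := by
  constructor
  rw [continuous_iff_continuousAt]
  rintro ⟨m1, m2⟩
  obtain ⟨s, hs⟩ := msk_surj m1
  obtain ⟨t, ht⟩ := msk_surj m2
  rw [← hs, ← ht]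
  refine continuousAt_of_open ((isOpenMap_msk m1.card).prodMap (isOpenMap_msk m2.card)) ?_ (s, t)
  have : ((fun p : Multiset X × Multiset X => p.1 + p.2) ∘ Prod.map (msk m1.card) (msk m2.card)) =
    fun p => msk (m1.card + m2.card) (Fin.append p.1 p.2) := by
    funext p; exact msk_add _ _
  rw [this]
  refine (continuous_msk _).comp ?_
  refine continuous_pi fun i => ?_
  refine Fin.addCases (fun i => ?_) (fun i => ?_) i
  · simp only [Fin.append_left]; fun_prop
  · simp only [Fin.append_right]; fun_prop

lemma msk_map {Z : Type*} (n : ℕ) (s : Fin n → X) (h : X → Z) : (msk n s).map h = Finset.univ.val.map (h ∘ s) := by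
  rw [msk, Multiset.map_map]

/-- parametrized additive extension -/
lemma continuous_ms_sum {A : Type*} [TopologicalSpace A] [AddCommMonoid A] [ContinuousAdd A]
    {h : Y → X → A} (hh : Continuous (fun p : Y × X => h p.1 p.2)) :
    Continuous (fun p : Y × Multiset X => (p.2.map (h p.1)).sum) := by
  refine continuous_ms_dom2 fun n => ?_
  have : ∀ p : Y × (Fin n → X), (((msk n p.2).map (h p.1)).sum) = ∑ i, h p.1 (p.2 i) := by
    intro p; rw [msk_map]; rfl
  simp only [this]
  refine continuous_finsetSum _ fun i _ => ?_
  exact hh.comp (continuous_fst.prodMk ((continuous_apply i).comp continuous_snd))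

lemma continuous_ms_sum' {A : Type*} [TopologicalSpace A] [AddCommMonoid A] [ContinuousAdd A]
    {h : X → A} (hh : Continuous h) : Continuous (fun m : Multiset X => (m.map h).sum) := by
  have := continuous_ms_sum (Y := Unit) (h := fun _ => h) (hh.comp continuous_snd)
  exact this.comp (Continuous.prodMk_right ())

lemma continuous_ms_prod' {A : Type*} [TopologicalSpace A] [CommMonoid A] [ContinuousMul A]
    {h : X → A} (hh : Continuous h) : Continuous (fun m : Multiset X => (m.map h).prod) := by
  refine continuous_ms_dom fun n => ?_
  have : ∀ p : (Fin n → X), (((msk n p).map h).prod) = ∏ i, h (p i) := by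
    intro p; rw [msk_map]; rfl
  simp only [this]
  fun_prop

lemma continuous_ms_map {Z : Type*} [TopologicalSpace Z] {h : Y → X → Z} (hh : Continuous (fun p : Y × X => h p.1 p.2)) :
    Continuous (fun p : Y × Multiset X => p.2.map (h p.1)) := by
  refine continuous_ms_dom2 fun n => ?_
  have : ∀ p : Y × (Fin n → X), ((msk n p.2).map (h p.1)) = msk n (fun i => h p.1 (p.2 i)) := by
    intro p; rw [msk_map]; rfl
  simp only [this]
  refine (continuous_msk n).comp (continuous_pi fun i => ?_)
  exact hh.comp (continuous_fst.prodMk ((continuous_apply i).comp continuous_snd))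

lemma continuous_ms_map' {Z : Type*} [TopologicalSpace Z] {h : X → Z} (hh : Continuous h) :
    Continuous (Multiset.map h) := by
  have := continuous_ms_map (Y := Unit) (h := fun _ => h) (hh.comp continuous_snd)
  exact this.comp (Continuous.prodMk_right ())

lemma continuous_ms_singleton : Continuous (fun x : X => ({x} : Multiset X)) := by
  have : (fun x : X => ({x} : Multiset X)) = fun x => msk 1 (fun _ => x) := by
    funext x; simp [msk]
  rw [this]
  exact (continuous_msk 1).comp (by fun_prop)

lemma continuous_ms_card : Continuous (Multiset.card : Multiset X → ℕ) := by
  refine continuous_ms_dom fun n => ?_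
  simp only [msk_card]; exact continuous_const

lemma isClopen_ms_card (n : ℕ) : IsClopen {m : Multiset X | m.card = n} :=
  (isClopen_discrete ({n} : Set ℕ)).preimage continuous_ms_card

lemma ms_card_eq_range (n : ℕ) : {m : Multiset X | m.card = n} = Set.range (msk (X := X) n) := by
  ext m
  constructor
  · intro h; exact msk_surj' m h
  · rintro ⟨s, rfl⟩; simp

lemma isCompact_ms_card [CompactSpace X] (n : ℕ) : IsCompact {m : Multiset X | m.card = n} := by
  rw [ms_card_eq_range]
  exact isCompact_range (continuous_msk n)

instance msT2 [NormalSpace X] [T1Space X] : T2Space (Multiset X) := by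
  classical
  rw [t2Space_iff_disjoint_nhds]
  intro s t hst
  have : ∃ x, s.count x ≠ t.count x := by
    by_contra h; push Not at h; exact hst (Multiset.ext.2 h)
  obtain ⟨x, hx⟩ := this
  obtain ⟨f, hf0, hf1, -⟩ := exists_continuous_zero_one_of_isClosed
    (s := (((s.toFinset ∪ t.toFinset).erase x : Finset X) : Set X)) (t := {x})
    (Finset.finite_toSet _).isClosed isClosed_singleton (by simp)
  have key : ∀ m : Multiset X, (∀ y ∈ m, y ∈ s.toFinset ∪ t.toFinset) → (m.map f).sum = m.count x := by
    intro m
    induction m using Multiset.induction_on with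
    | empty => simp
    | cons a m ih =>
      intro h
      rw [Multiset.map_cons, Multiset.sum_cons, ih fun y hy => h y (Multiset.mem_cons_of_mem hy)]
      by_cases hax : a = x
      · subst hax
        have : f a = 1 := hf1 (Set.mem_singleton a)
        simp [this, add_comm]
      · have : f a = 0 := hf0 (by simpa [hax] using h a (Multiset.mem_cons_self _ _))
        rw [this, Multiset.count_cons_of_ne (Ne.symm hax)]; simp
  have hc : Continuous (fun m : Multiset X => (m.map f).sum) := continuous_ms_sum' f.continuous
  have hs := key s (fun y hy => by simp [hy])
  have ht := key t (fun y hy => by simp [hy])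
  have hne : (s.map f).sum ≠ (t.map f).sum := by
    rw [hs, ht]; exact_mod_cast hx
  exact Filter.disjoint_of_map (Disjoint.mono (hc.tendsto s) (hc.tendsto t) (disjoint_nhds_nhds.2 hne))

lemma isOpenMap_ms_map {h : X → Y} (hh : IsOpenMap h) : IsOpenMap (Multiset.map h) := by
  intro U hU
  have : Multiset.map h '' U = ⋃ n, msk n '' ((Pi.map (fun _ : Fin n => h)) '' (msk n ⁻¹' U)) := by
    ext m
    simp only [Set.mem_image, Set.mem_iUnion]
    constructor
    · rintro ⟨t, ht, rfl⟩
      obtain ⟨s, hs⟩ := msk_surj t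
      refine ⟨t.card, _, ⟨s, by simpa [hs] using ht, rfl⟩, ?_⟩
      conv_rhs => rw [← hs]
      rw [msk_map]; rfl
    · rintro ⟨n, r, ⟨s, hs, rfl⟩, rfl⟩
      exact ⟨msk n s, hs, by rw [msk_map]; rfl⟩
  rw [this]
  refine isOpen_iUnion fun n => isOpenMap_msk n _ ?_
  exact IsOpenMap.piMap (fun _ => hh) (by simp [Filter.cofinite_eq_bot]) _ (hU.preimage (continuous_msk n))

lemma isOpenEmbedding_ms_map {h : X → Y} (hh : IsOpenEmbedding h) : IsOpenEmbedding (Multiset.map h) :=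
  IsOpenEmbedding.of_continuous_injective_isOpenMap (continuous_ms_map' hh.continuous)
    (Multiset.map_injective hh.injective) (isOpenMap_ms_map hh.isOpenMap)

/-- the inclusion of the symmetric product in the free commutative monoid -/
def spIn (n : ℕ) : SP n X → Multiset X := Quot.lift (msk n) (by
  rintro s t ⟨e, rfl⟩
  exact ((msk_eq_iff _ _).2 ⟨e, rfl⟩).symm)

lemma isOpenEmbedding_spIn (n : ℕ) : IsOpenEmbedding (spIn (X := X) n) := by
  refine IsOpenEmbedding.of_continuous_injective_isOpenMap ?_ ?_ ?_
  · exact continuous_quot_lift _ (continuous_msk n)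
  · rintro ⟨s⟩ ⟨t⟩ h
    obtain ⟨e, he⟩ := (msk_eq_iff t s).1 (Eq.symm h)
    exact Quot.sound ⟨e, he.symm⟩
  · intro U hU
    have : spIn n '' U = msk n '' (Quot.mk (spRel n X) ⁻¹' U) := by
      ext m; constructor
      · rintro ⟨⟨s⟩, hs, rfl⟩; exact ⟨s, hs, rfl⟩
      · rintro ⟨s, hs, rfl⟩; exact ⟨Quot.mk _ s, hs, rfl⟩
    rw [this]
    exact isOpenMap_msk n _ (hU.preimage continuous_quot_mk)

lemma range_spIn (n : ℕ) : Set.range (spIn (X := X) n) = {m | m.card = n} := by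
  rw [ms_card_eq_range]
  ext m; constructor
  · rintro ⟨⟨s⟩, rfl⟩; exact ⟨s, rfl⟩
  · rintro ⟨s, rfl⟩; exact ⟨Quot.mk _ s, rfl⟩

end MSTop

end

section
set_option autoImplicit false
open Topology
set_option linter.unusedSectionVars false
set_option linter.unusedSimpArgs false
set_option linter.unusedVariables false

section CubeHomotopy
variable {i : ℕ} {Y Z : Type*} [TopologicalSpace Y] [TopologicalSpace Z]

/-- homotopy through maps which are constant on the boundary of the cube -/
def BH (f g : (Fin i → I) → Y) : Prop :=
  ∃ H : I × (Fin i → I) → Y, Continuous H ∧ (∀ s, H (0, s) = f s) ∧ (∀ s, H (1, s) = g s) ∧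
    ∀ t, ∀ s ∈ Cube.boundary (Fin i), ∀ s' ∈ Cube.boundary (Fin i), H (t, s) = H (t, s')

lemma BH.refl {f : (Fin i → I) → Y} (hf : Continuous f)
    (hb : ∀ s ∈ Cube.boundary (Fin i), ∀ s' ∈ Cube.boundary (Fin i), f s = f s') : BH f f :=
  ⟨fun p => f p.2, hf.comp continuous_snd, fun _ => rfl, fun _ => rfl, fun _ => hb⟩

lemma BH.symm {f g : (Fin i → I) → Y} (h : BH f g) : BH g f := by
  obtain ⟨H, hc, h0, h1, hb⟩ := h
  refine ⟨fun p => H (σ p.1, p.2), hc.comp (by fun_prop), fun s => by simp [h1], fun s => by simp [h0],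
    fun t s hs s' hs' => hb _ s hs s' hs'⟩

lemma BH.cont_left {f g : (Fin i → I) → Y} (h : BH f g) : Continuous f := by
  obtain ⟨H, hc, h0, -⟩ := h
  have : f = fun s => H (0, s) := by funext s; rw [h0]
  rw [this]; exact hc.comp (by fun_prop)

lemma BH.cont_right {f g : (Fin i → I) → Y} (h : BH f g) : Continuous g := h.symm.cont_left

lemma BH.bd_left {f g : (Fin i → I) → Y} (h : BH f g) :
    ∀ s ∈ Cube.boundary (Fin i), ∀ s' ∈ Cube.boundary (Fin i), f s = f s' := by
  obtain ⟨H, hc, h0, -, hb⟩ := h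
  intro s hs s' hs'
  rw [← h0, ← h0]; exact hb 0 s hs s' hs'

lemma BH.trans {f g k : (Fin i → I) → Y} (h : BH f g) (h' : BH g k) : BH f k := by
  have hf := h.cont_left
  have hg := h.cont_right
  have hk := h'.cont_right
  obtain ⟨H, hc, h0, h1, hb⟩ := h
  obtain ⟨H', hc', h0', h1', hb'⟩ := h'
  let F : ContinuousMap.Homotopy (⟨f, hf⟩ : C(Fin i → I, Y)) ⟨g, hg⟩ := ⟨⟨H, hc⟩, h0, h1⟩
  let F' : ContinuousMap.Homotopy (⟨g, hg⟩ : C(Fin i → I, Y)) ⟨k, hk⟩ := ⟨⟨H', hc'⟩, h0', h1'⟩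
  refine ⟨F.trans F', (F.trans F').continuous, fun s => by simp, fun s => by simp, ?_⟩
  intro t s hs s' hs'
  rw [ContinuousMap.Homotopy.trans_apply, ContinuousMap.Homotopy.trans_apply]
  split_ifs
  · exact hb _ s hs s' hs'
  · exact hb' _ s hs s' hs'

lemma BH.comp {f g : (Fin i → I) → Y} (h : BH f g) {φ : Y → Z} (hφ : Continuous φ) : BH (φ ∘ f) (φ ∘ g) := by
  obtain ⟨H, hc, h0, h1, hb⟩ := h
  exact ⟨φ ∘ H, hφ.comp hc, fun s => by simp [h0], fun s => by simp [h1],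
    fun t s hs s' hs' => congrArg φ (hb t s hs s' hs')⟩

lemma BH.comp2 {f g : (Fin i → I) → Y} {f' g' : (Fin i → I) → Z} (h : BH f g) (h' : BH f' g')
    {W : Type*} [TopologicalSpace W] {φ : Y × Z → W} (hφ : Continuous φ) :
    BH (fun s => φ (f s, f' s)) (fun s => φ (g s, g' s)) := by
  obtain ⟨H, hc, h0, h1, hb⟩ := h
  obtain ⟨H', hc', h0', h1', hb'⟩ := h'
  refine ⟨fun p => φ (H p, H' p), hφ.comp (hc.prodMk hc'), fun s => by simp [h0, h0'], fun s => by simp [h1, h1'],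
    fun t s hs s' hs' => ?_⟩
  simp only [hb t s hs s' hs', hb' t s hs s' hs']

lemma BH.ofHomotopy {f : (Fin i → I) → Y} (hf : Continuous f)
    (hb : ∀ s ∈ Cube.boundary (Fin i), ∀ s' ∈ Cube.boundary (Fin i), f s = f s')
    {G : I × Y → Z} (hG : Continuous G) : BH (fun s => G (0, f s)) (fun s => G (1, f s)) := by
  refine ⟨fun p => G (p.1, f p.2), hG.comp (by fun_prop), fun _ => rfl, fun _ => rfl, ?_⟩
  intro t s hs s' hs'
  simp only [hb s hs s' hs']

def cstr (u : ℝ) (s : Fin i → I) : Fin i → I := fun j => Set.projIcc 0 1 zero_le_one ((1 + u) * ((s j : ℝ) - 1/2) + 1/2)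

lemma continuous_cstr : Continuous (fun p : ℝ × (Fin i → I) => cstr p.1 p.2) := by
  unfold cstr
  refine continuous_pi fun j => continuous_projIcc.comp ?_
  fun_prop

lemma cstr_zero (s : Fin i → I) : cstr 0 s = s := by
  funext j
  simp [cstr]

lemma cstr_bd {u : ℝ} (hu : 0 ≤ u) {s : Fin i → I} (hs : s ∈ Cube.boundary (Fin i)) : cstr u s ∈ Cube.boundary (Fin i) := by
  obtain ⟨j, hj⟩ := hs
  refine ⟨j, ?_⟩
  rcases hj with hj | hj
  · left; simp only [cstr, hj]
    apply Set.projIcc_of_le_left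
    simp; linarith
  · right; simp only [cstr, hj]
    apply Set.projIcc_of_right_le
    simp; linarith

def crad (s : Fin i → I) : ℝ := ‖(fun j => 2 * (s j : ℝ) - 1 : Fin i → ℝ)‖

lemma continuous_crad : Continuous (crad (i := i)) := by
  unfold crad
  fun_prop

lemma crad_bd {s : Fin i → I} (hs : s ∈ Cube.boundary (Fin i)) : crad s = 1 := by
  apply le_antisymm
  · rw [crad, pi_norm_le_iff_of_nonneg zero_le_one]
    intro j
    have h0 := (s j).2.1
    have h1 := (s j).2.2
    rw [Real.norm_eq_abs, abs_le]; constructor <;> linarith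
  · obtain ⟨j, hj⟩ := hs
    have := norm_le_pi_norm (fun j => 2 * (s j : ℝ) - 1 : Fin i → ℝ) j
    refine le_trans ?_ this
    rcases hj with hj | hj <;> simp [hj]; norm_num

lemma crad_le_one (s : Fin i → I) : crad s ≤ 1 := by
  rw [crad, pi_norm_le_iff_of_nonneg zero_le_one]
  intro j
  have h0 := (s j).2.1
  have h1 := (s j).2.2
  rw [Real.norm_eq_abs, abs_le]; constructor <;> linarith

lemma cstr_bd_of_crad {s : Fin i → I} (hs : 1/2 ≤ crad s) : cstr 1 s ∈ Cube.boundary (Fin i) := by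
  by_contra hcon
  have : crad s < 1/2 := by
    rw [crad, pi_norm_lt_iff (by norm_num)]
    intro j
    rw [Real.norm_eq_abs, abs_lt]
    constructor
    · by_contra h
      push Not at h
      apply hcon
      refine ⟨j, Or.inl ?_⟩
      apply Set.projIcc_of_le_left; linarith
    · by_contra h
      push Not at h
      apply hcon
      refine ⟨j, Or.inr ?_⟩
      apply Set.projIcc_of_right_le; linarith
  linarith

def cth (s : Fin i → I) : I := Set.projIcc 0 1 zero_le_one (2 - 2 * crad s)

lemma continuous_cth : Continuous (cth (i := i)) := by
  unfold cth
  exact continuous_projIcc.comp (by have := continuous_crad (i := i); fun_prop)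

lemma cth_bd {s : Fin i → I} (hs : s ∈ Cube.boundary (Fin i)) : cth s = 0 := by
  rw [cth, crad_bd hs]; norm_num

lemma cth_cases (s : Fin i → I) : cth s = 1 ∨ cstr 1 s ∈ Cube.boundary (Fin i) := by
  by_cases h : 1/2 ≤ crad s
  · exact Or.inr (cstr_bd_of_crad h)
  · left; apply Set.projIcc_of_right_le; linarith

lemma zero_mem_bd (hi : 0 < i) : (fun _ => 0 : Fin i → I) ∈ Cube.boundary (Fin i) := ⟨⟨0, hi⟩, Or.inl rfl⟩

open Topology.Homotopy in
lemma null_of_BH (hi : 0 < i) {y y' : Y} (f : GenLoop (Fin i) Y y) (h : BH (⇑f) (fun _ => y')) :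
    GenLoop.Homotopic f GenLoop.const := by
  obtain ⟨H, hc, h0, h1, hb⟩ := h
  have hbd := zero_mem_bd hi
  have hfc : Continuous f := f.1.continuous
  have hy : H (0, fun _ => 0) = y := by rw [h0]; exact f.2 _ hbd
  let f1 : C(Fin i → I, Y) := ⟨fun s => f (cstr 1 s), hfc.comp (continuous_cstr.comp (by fun_prop : Continuous fun s : Fin i → I => ((1:ℝ), s)))⟩
  let f2 : C(Fin i → I, Y) := ⟨fun s => H (cth s, fun _ => 0), hc.comp (by have := continuous_cth (i := i); fun_prop)⟩
  have e1 : f.1.HomotopicRel f1 (Cube.boundary (Fin i)) := by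
    refine ⟨⟨⟨⟨fun p => f (cstr (p.1 : ℝ) p.2), ?_⟩, ?_, ?_⟩, ?_⟩⟩
    · exact hfc.comp (continuous_cstr.comp (by fun_prop : Continuous fun p : I × (Fin i → I) => ((p.1:ℝ), p.2)))
    · intro s; simp [cstr_zero]
    · intro s; simp [f1]
    · intro t s hs
      change f (cstr (t : ℝ) s) = f s
      exact (f.2 _ (cstr_bd t.2.1 hs)).trans (f.2 _ hs).symm
  have e2 : f1.HomotopicRel f2 (Cube.boundary (Fin i)) := by
    refine ⟨⟨⟨⟨fun p => H (min p.1 (cth p.2), cstr 1 p.2), ?_⟩, ?_, ?_⟩, ?_⟩⟩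
    · refine hc.comp (Continuous.prodMk ?_ ?_)
      · exact continuous_fst.min (continuous_cth.comp continuous_snd)
      · exact continuous_cstr.comp (by fun_prop : Continuous fun p : I × (Fin i → I) => ((1:ℝ), p.2))
    · intro s
      change H (min 0 (cth s), cstr 1 s) = f (cstr 1 s)
      rw [min_eq_left (show (0:I) ≤ cth s from (cth s).2.1), h0]
    · intro s
      change H (min 1 (cth s), cstr 1 s) = H (cth s, fun _ => 0)
      rw [min_eq_right (show cth s ≤ (1:I) from (cth s).2.2)]
      rcases cth_cases s with h | h
      · rw [h, h1, h1]
      · exact hb _ _ h _ hbd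
    · intro t s hs
      change H (min t (cth s), cstr 1 s) = f (cstr 1 s)
      rw [cth_bd hs, min_eq_right (show (0:I) ≤ t from t.2.1), h0]
  have e3 : f2.HomotopicRel (GenLoop.const (x := y) (N := Fin i)).1 (Cube.boundary (Fin i)) := by
    refine ⟨⟨⟨⟨fun p => H (σ p.1 * cth p.2, fun _ => 0), ?_⟩, ?_, ?_⟩, ?_⟩⟩
    · exact hc.comp (by have := continuous_cth (i := i); fun_prop)
    · intro s
      change H (σ 0 * cth s, fun _ => 0) = H (cth s, fun _ => 0)
      simp
    · intro s
      change H (σ 1 * cth s, fun _ => 0) = y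
      simpa using hy
    · intro t s hs
      change H (σ t * cth s, fun _ => 0) = H (cth s, fun _ => 0)
      rw [cth_bd hs]; simp
  exact (e1.trans e2).trans e3

lemma BH_of_homotopic {y : Y} {f g : GenLoop (Fin i) Y y} (h : GenLoop.Homotopic f g) : BH (⇑f) (⇑g) := by
  obtain ⟨F⟩ := h
  refine ⟨F, F.continuous, fun s => F.apply_zero s, fun s => F.apply_one s, fun t s hs s' hs' => ?_⟩
  rw [F.eq_fst t hs, F.eq_fst t hs']
  exact (f.2 _ hs).trans (f.2 _ hs').symm

/-- transport along a path -/
lemma BH_transport (hi : 0 < i) {y y' : Y} {f : (Fin i → I) → Y} (hf : Continuous f)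
    (hb : ∀ s ∈ Cube.boundary (Fin i), f s = y) (γ : Path y y') :
    ∃ f' : (Fin i → I) → Y, BH f f' ∧ ∀ s ∈ Cube.boundary (Fin i), f' s = y' := by
  let P : ℝ → (Fin i → I) → Y := fun u s => if crad s ≤ 1/2 then f (cstr 1 s) else
    γ.extend (u * (2 * crad s - 1))
  have hP : Continuous (fun p : ℝ × (Fin i → I) => P p.1 p.2) := by
    refine Continuous.if_le ?_ ?_ ?_ ?_ ?_
    · exact hf.comp (continuous_cstr.comp (by fun_prop : Continuous fun p : ℝ × (Fin i → I) => ((1:ℝ), p.2)))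
    · have := continuous_crad (i := i)
      exact γ.continuous_extend.comp (by fun_prop)
    · exact continuous_crad.comp continuous_snd
    · exact continuous_const
    · rintro ⟨u, s⟩ hs
      simp only at hs
      rw [hb _ (cstr_bd_of_crad hs.ge), hs]
      simp
  have h1 : BH f (fun s => f (cstr 1 s)) := by
    refine ⟨fun p => f (cstr (p.1 : ℝ) p.2), ?_, fun s => by simp [cstr_zero], fun s => by simp, ?_⟩
    · exact hf.comp (continuous_cstr.comp (by fun_prop : Continuous fun p : I × (Fin i → I) => ((p.1:ℝ), p.2)))
    · intro t s hs s' hs'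
      simp only [hb _ (cstr_bd t.2.1 hs), hb _ (cstr_bd t.2.1 hs')]
  have hPb : ∀ u, ∀ s ∈ Cube.boundary (Fin i), P u s = γ.extend u := by
    intro u s hs
    simp only [P, crad_bd hs]
    norm_num
  refine ⟨P 1, h1.trans ⟨fun p => P p.1 p.2, ?_, ?_, fun _ => rfl, ?_⟩, ?_⟩
  · exact hP.comp (by fun_prop : Continuous fun p : I × (Fin i → I) => ((p.1:ℝ), p.2))
  · intro s
    simp only [P]
    split_ifs with h
    · rfl
    · simp only [Set.Icc.coe_zero, zero_mul, Path.extend_zero]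
      rw [hb _ (cstr_bd_of_crad (not_le.1 h).le)]
  · intro t s hs s' hs'
    simp only
    rw [hPb _ s hs, hPb _ s' hs']
  · intro s hs
    rw [hPb _ s hs]; simp

/-- BH-nullity -/
def BNull (f : (Fin i → I) → Y) : Prop := ∃ y, BH f (fun _ => y)

lemma BNull.comp {f : (Fin i → I) → Y} (h : BNull f) {φ : Y → Z} (hφ : Continuous φ) : BNull (φ ∘ f) := by
  obtain ⟨y, hy⟩ := h
  exact ⟨φ y, hy.comp hφ⟩

lemma BNull.of_BH {f g : (Fin i → I) → Y} (h : BNull g) (h' : BH f g) : BNull f := by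
  obtain ⟨y, hy⟩ := h
  exact ⟨y, h'.trans hy⟩

lemma subsingleton_pi (hi : 0 < i) {y : Y} (h : ∀ f : (Fin i → I) → Y, Continuous f →
    (∀ s ∈ Cube.boundary (Fin i), f s = y) → BNull f) : Subsingleton (π_ i Y y) := by
  have key : ∀ a : π_ i Y y, a = Quotient.mk _ GenLoop.const := by
    intro a
    induction a using Quotient.inductionOn with
    | h f =>
      obtain ⟨y', hy'⟩ := h f f.1.continuous f.2
      exact Quotient.sound (null_of_BH hi f hy')
  exact ⟨fun a b => (key a).trans (key b).symm⟩

end CubeHomotopy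

end

section
set_option autoImplicit false
open Topology
set_option linter.unusedSectionVars false
set_option linter.unusedSimpArgs false
set_option linter.unusedVariables false

section GenPos
open Module Metric

lemma GP0 {E EK K : Type} [NormedAddCommGroup E] [NormedSpace ℝ E] [FiniteDimensional ℝ E]
    [NormedAddCommGroup EK] [NormedSpace ℝ EK] [FiniteDimensional ℝ EK] [TopologicalSpace K] [CompactSpace K]
    {j : K → EK} (hj : IsClosedEmbedding j) {ic : Type} [Countable ic] {m : ℕ}
    (c : ic → (Fin m → ℝ) → E) (hc : ∀ l, ContDiff ℝ 1 (c l)) (hdim : finrank ℝ EK + m < finrank ℝ E)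
    {K0 : Set K} (hK0 : IsClosed K0) {f : K → E} (hf : ContinuousOn f K0) {ε : ℝ} (hε : 0 < ε) :
    ∃ G : K → E, Continuous G ∧ (∀ x ∈ K0, dist (G x) (f x) < ε) ∧ ∀ x l, G x ∉ Set.range (c l) := by
  have hemb : IsClosedEmbedding (fun x : K0 => j x) := hj.comp hK0.isClosedEmbedding_subtypeVal
  obtain ⟨g, hg⟩ := ContinuousMap.exists_extension (Y := E) hemb ⟨fun x : K0 => f x, hf.domRestrict⟩
  obtain ⟨G, hG, hGd, -⟩ := g.continuous.exists_contDiff_approx (F := E) 1 (ε := fun _ => ε/2) continuous_const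
    (fun _ => half_pos hε)
  have hdense : Dense (⋃ l, Set.range (fun p : EK × (Fin m → ℝ) => c l p.2 - G p.1))ᶜ := by
    apply dense_compl_of_dimH_lt_finrank
    rw [dimH_iUnion]
    refine lt_of_le_of_lt (b := ((finrank ℝ EK + m : ℕ) : ENNReal)) ?_ (by exact_mod_cast hdim)
    refine iSup_le fun l => ?_
    have h1 : ContDiff ℝ 1 (fun p : EK × (Fin m → ℝ) => c l p.2 - G p.1) :=
      ((hc l).comp contDiff_snd).sub ((hG.of_le (by norm_num)).comp contDiff_fst)
    refine h1.dimH_range_le.trans ?_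
    rw [finrank_prod]; simp
  obtain ⟨v, hv, hvd⟩ := hdense.exists_dist_lt 0 (half_pos hε)
  refine ⟨fun x => G (j x) + v, ?_, ?_, ?_⟩
  · exact (hG.continuous.comp hj.continuous).add continuous_const
  · intro x hx
    have h1 : g (j x) = f x := DFunLike.congr_fun hg (⟨x, hx⟩ : K0)
    have h2 := hGd (j x)
    rw [h1] at h2
    calc dist (G (j x) + v) (f x) ≤ dist (G (j x) + v) (G (j x)) + dist (G (j x)) (f x) := dist_triangle _ _ _
      _ < ε/2 + ε/2 := by
        refine add_lt_add ?_ h2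
        rw [dist_eq_norm]; simpa using hvd
      _ = ε := by ring
  · rintro x l ⟨y, hy⟩
    apply hv
    refine Set.mem_iUnion.2 ⟨l, (j x, y), ?_⟩
    simp [hy]

theorem GP1 {E EK K Y : Type} [NormedAddCommGroup E] [NormedSpace ℝ E] [FiniteDimensional ℝ E]
    [NormedAddCommGroup EK] [NormedSpace ℝ EK] [FiniteDimensional ℝ EK] [TopologicalSpace K] [CompactSpace K]
    [TopologicalSpace Y] [T2Space Y] (e : OpenPartialHomeomorph Y E)
    {j : K → EK} (hj : IsClosedEmbedding j) {ic : Type} [Countable ic] {m : ℕ}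
    (c : ic → (Fin m → ℝ) → E) (hc : ∀ l, ContDiff ℝ 1 (c l)) (hdim : finrank ℝ EK + m < finrank ℝ E)
    {B : Set Y} (hB : IsCompact B) (hBs : B ⊆ e.source) (hcov : ∀ y ∈ B, ∃ l, e y ∈ Set.range (c l))
    {F : K → Y} (hF : Continuous F) {O : Set Y} (hO : IsOpen O) (hFO : ∀ x, F x ∈ O)
    {A : Set K} (hA : IsClosed A) (hFA : ∀ x ∈ A, F x ∉ B) :
    ∃ H : I × K → Y, Continuous H ∧ (∀ x, H (0, x) = F x) ∧ (∀ p, H p ∈ O) ∧ (∀ x, H (1, x) ∉ B) ∧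
      ∀ t, ∀ x ∈ A, H (t, x) = F x := by
  rcases B.eq_empty_or_nonempty with rfl | hBne
  · exact ⟨fun p => F p.2, hF.comp continuous_snd, fun _ => rfl, fun p => hFO _, fun _ => by simp, fun _ _ _ => rfl⟩
  have hK : ProperSpace E := FiniteDimensional.proper ℝ E
  set D : Set E := e '' B with hD
  have hDc : IsCompact D := hB.image_of_continuousOn (e.continuousOn.mono hBs)
  have hDne : D.Nonempty := hBne.image _
  have hDt : D ⊆ e.target := by
    rintro _ ⟨y, hy, rfl⟩; exact e.map_source (hBs hy)
  obtain ⟨δ0, hδ0, hN0⟩ := hDc.exists_cthickening_subset_open e.open_target hDt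
  have hN0c : IsCompact (cthickening δ0 D) := hDc.cthickening
  have himc : IsClosed (e.symm '' cthickening δ0 D) :=
    (hN0c.image_of_continuousOn (e.continuousOn_symm.mono hN0)).isClosed
  set K0 : Set K := F ⁻¹' (e.symm '' cthickening δ0 D) with hK0
  have hK0c : IsClosed K0 := himc.preimage hF
  have hK0s : ∀ x ∈ K0, F x ∈ e.source ∧ e (F x) ∈ cthickening δ0 D := by
    rintro x ⟨z, hz, hzx⟩
    rw [← hzx, e.right_inv (hN0 hz)]
    exact ⟨e.map_target (hN0 hz), hz⟩
  have hκ : ContinuousOn (fun x => e (F x)) K0 :=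
    e.continuousOn.comp hF.continuousOn (fun x hx => (hK0s x hx).1)
  have hW : IsOpen (e.target ∩ e.symm ⁻¹' O) := e.isOpen_inter_preimage_symm hO
  obtain ⟨δ1, hδ1, hN1⟩ := (hK0c.isCompact.image_of_continuousOn hκ).exists_cthickening_subset_open hW (by
    rintro _ ⟨x, hx, rfl⟩
    refine ⟨e.map_source (hK0s x hx).1, ?_⟩
    change e.symm (e (F x)) ∈ O
    rw [e.left_inv (hK0s x hx).1]; exact hFO x)
  have hAc : IsCompact ((fun x => e (F x)) '' (A ∩ K0)) :=
    (hA.inter hK0c).isCompact.image_of_continuousOn (hκ.mono Set.inter_subset_right)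
  obtain ⟨δ2, hδ2, hN2⟩ := hDc.exists_cthickening_subset_open hAc.isClosed.isOpen_compl (by
    rintro _ ⟨y, hy, rfl⟩ ⟨x, ⟨hxA, hx0⟩, hx⟩
    have : F x = y := e.injOn (hK0s x hx0).1 (hBs hy) hx
    exact hFA x hxA (this ▸ hy))
  obtain ⟨ε, hε, he0, he1, he2⟩ : ∃ ε : ℝ, 0 < ε ∧ 2 * ε ≤ δ0 ∧ ε ≤ δ1 ∧ 2 * ε ≤ δ2 := by
    refine ⟨min (δ0/2) (min δ1 (δ2/2)), by positivity, ?_, ?_, ?_⟩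
    · have := min_le_left (δ0/2) (min δ1 (δ2/2)); linarith
    · exact (min_le_right _ _).trans (min_le_left _ _)
    · have := (min_le_right (δ0/2) (min δ1 (δ2/2))).trans (min_le_right _ _); linarith
  obtain ⟨G, hG, hGd, hGc⟩ := GP0 hj c hc hdim hK0c hκ hε
  let lam : K → ℝ := fun x => max 0 (min 1 (2 - infDist (e (F x)) D / ε))
  have hlam0 : ∀ x, 0 ≤ lam x := fun x => le_max_left _ _
  have hlam1 : ∀ x, lam x ≤ 1 := fun x => max_le zero_le_one (min_le_left _ _)
  have hlamz : ∀ x, 2 * ε ≤ infDist (e (F x)) D → lam x = 0 := by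
    intro x hx
    apply max_eq_left
    refine (min_le_right _ _).trans ?_
    have : 2 ≤ infDist (e (F x)) D / ε := by rw [le_div_iff₀ hε]; exact hx
    linarith
  have hlamo : ∀ x, infDist (e (F x)) D ≤ ε → lam x = 1 := by
    intro x hx
    have : infDist (e (F x)) D / ε ≤ 1 := by rw [div_le_one hε]; exact hx
    simp only [lam]
    rw [min_eq_left (by linarith), max_eq_right zero_le_one]
  have hlamc : ContinuousOn lam K0 := by
    have h1 : ContinuousOn (fun x => infDist (e (F x)) D) K0 := (continuous_infDist_pt D).comp_continuousOn hκ
    have h2 : Continuous (fun r : ℝ => max 0 (min 1 (2 - r / ε))) := by fun_prop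
    exact h2.comp_continuousOn h1
  let P : I × K → E := fun p => e (F p.2) + ((p.1 : ℝ) * lam p.2) • (G p.2 - e (F p.2))
  have hPd : ∀ p : I × K, p.2 ∈ K0 → dist (P p) (e (F p.2)) < ε := by
    intro p hp
    have h1 := hGd p.2 hp
    rw [dist_eq_norm] at h1 ⊢
    have h2 : P p - e (F p.2) = ((p.1 : ℝ) * lam p.2) • (G p.2 - e (F p.2)) := by simp [P]
    rw [h2, norm_smul, Real.norm_eq_abs, abs_of_nonneg (mul_nonneg p.1.2.1 (hlam0 _))]
    refine lt_of_le_of_lt ?_ h1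
    refine mul_le_of_le_one_left (norm_nonneg _) ?_
    exact mul_le_one₀ p.1.2.2 (hlam0 _) (hlam1 _)
  have hPW : ∀ p : I × K, p.2 ∈ K0 → P p ∈ e.target ∩ e.symm ⁻¹' O := by
    intro p hp
    apply hN1
    exact mem_cthickening_of_dist_le _ (e (F p.2)) _ _ ⟨p.2, hp, rfl⟩ ((hPd p hp).le.trans he1)
  have hPc : ContinuousOn P {p | p.2 ∈ K0} := by
    have h1 : ContinuousOn (fun p : I × K => e (F p.2)) {p | p.2 ∈ K0} :=
      hκ.comp continuousOn_snd (fun p hp => hp)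
    have h2 : ContinuousOn (fun p : I × K => lam p.2) {p | p.2 ∈ K0} :=
      hlamc.comp continuousOn_snd (fun p hp => hp)
    have h3 : ContinuousOn (fun p : I × K => G p.2) {p | p.2 ∈ K0} := (hG.comp continuous_snd).continuousOn
    have h4 : ContinuousOn (fun p : I × K => (p.1 : ℝ)) {p | p.2 ∈ K0} := (by fun_prop : Continuous _).continuousOn
    exact h1.add ((h4.mul h2).smul (h3.sub h1))
  have hcl : IsClosed {p : I × K | p.2 ∈ K0} := hK0c.preimage continuous_snd
  have hlz : ∀ p : I × K, p.2 ∈ K0 → lam p.2 = 0 → e.symm (P p) = F p.2 := by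
    intro p hp hl
    simp only [P, hl, mul_zero, zero_smul, add_zero]
    exact e.left_inv (hK0s _ hp).1
  classical
  refine ⟨fun p => if p.2 ∈ K0 then e.symm (P p) else F p.2, ?_, ?_, ?_, ?_, ?_⟩
  · refine continuous_if ?_ ?_ (hF.comp continuous_snd).continuousOn
    · intro p hp
      have hp0 : p.2 ∈ K0 := hcl.frontier_subset hp
      apply hlz p hp0
      apply hlamz
      by_contra hlt
      push Not at hlt
      have hop : IsOpen {q : I × K | F q.2 ∈ e.symm '' thickening δ0 D} := by
        refine IsOpen.preimage (hF.comp continuous_snd) ?_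
        exact e.symm.isOpen_image_of_subset_source isOpen_thickening ((thickening_subset_cthickening _ _).trans hN0)
      refine hp.2 ?_
      refine (interior_maximal ?_ hop) ?_
      · rintro q ⟨z, hz, hzq⟩
        exact ⟨z, thickening_subset_cthickening _ _ hz, hzq⟩
      · refine ⟨e (F p.2), ?_, e.left_inv (hK0s _ hp0).1⟩
        rw [mem_thickening_iff_infDist_lt hDne]
        linarith
    · rw [hcl.closure_eq]
      exact e.continuousOn_symm.comp hPc (fun p hp => (hPW p hp).1)
  · intro x
    by_cases hx : x ∈ K0
    · simp only [hx, if_true, P]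
      simp only [Set.Icc.coe_zero, zero_mul, zero_smul, add_zero]
      exact e.left_inv (hK0s _ hx).1
    · simp [hx]
  · intro p
    by_cases hx : p.2 ∈ K0
    · simp only [hx, if_true]
      exact (hPW p hx).2
    · simp only [hx, if_false]; exact hFO _
  · intro x hcon
    by_cases hx : x ∈ K0
    · simp only [hx, if_true] at hcon
      have hw := hPW (1, x) hx
      have hPD : P (1, x) ∈ D := ⟨_, hcon, e.right_inv hw.1⟩
      by_cases hl : infDist (e (F x)) D ≤ ε
      · have : P (1, x) = G x := by simp [P, hlamo x hl]
        obtain ⟨l, hl⟩ := hcov _ hcon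
        rw [e.right_inv hw.1, this] at hl
        exact hGc x l hl
      · have h1 := hPd (1, x) hx
        have h2 : infDist (e (F x)) D ≤ dist (e (F x)) (P (1, x)) := infDist_le_dist_of_mem hPD
        rw [dist_comm] at h1
        simp only at h1
        linarith
    · simp only [hx, if_false] at hcon
      apply hx
      refine ⟨e (F x), self_subset_cthickening _ ⟨F x, hcon, rfl⟩, e.left_inv (hBs hcon)⟩
  · intro t x hxA
    by_cases hx : x ∈ K0
    · simp only [hx, if_true]
      apply hlz (t, x) hx
      apply hlamz
      by_contra hlt
      push Not at hlt
      refine hN2 (a := e (F x)) ?_ ⟨x, ⟨hxA, hx⟩, rfl⟩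
      refine thickening_subset_cthickening _ _ ?_
      rw [mem_thickening_iff_infDist_lt hDne]; linarith
    · simp [hx]

lemma isClosed_cube_boundary (i : ℕ) : IsClosed (Cube.boundary (Fin i)) := by
  have : Cube.boundary (Fin i) = ⋃ j : Fin i, ({y : Fin i → I | y j = 0} ∪ {y | y j = 1}) := by
    ext y; simp [Cube.boundary]
  rw [this]
  refine isClosed_iUnion_of_finite fun j => IsClosed.union ?_ ?_
  · exact isClosed_eq (continuous_apply j) continuous_const
  · exact isClosed_eq (continuous_apply j) continuous_const

def cubeIn (i : ℕ) (s : Fin i → I) : Fin i → ℝ := fun j => s j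

lemma isClosedEmbedding_cubeIn (i : ℕ) : IsClosedEmbedding (cubeIn i) := by
  refine Continuous.isClosedEmbedding ?_ ?_
  · unfold cubeIn; fun_prop
  · intro s t h
    funext j
    exact Subtype.ext (congrFun h j)

lemma nonzero_null {V : Type} [NormedAddCommGroup V] [NormedSpace ℝ V] [FiniteDimensional ℝ V] {i : ℕ} (hi : 0 < i)
    (hdim : i + 1 < finrank ℝ V) {f : (Fin i → I) → {v : V // v ≠ 0}} (hf : Continuous f)
    (hb : ∀ s ∈ Cube.boundary (Fin i), ∀ s' ∈ Cube.boundary (Fin i), f s = f s') : BNull f := by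
  set v0 : V := (f (fun _ => 0)).1 with hv0
  have hv0ne : v0 ≠ 0 := (f (fun _ => 0)).2
  have hn0 : 0 < ‖v0‖ := norm_pos_iff.2 hv0ne
  have hFc : Continuous (fun s => (f s : V)) := continuous_subtype_val.comp hf
  obtain ⟨R, hR⟩ := (isCompact_range hFc.norm).bddAbove
  have hR' : ∀ s, ‖(f s : V)‖ < R + 1 := fun s => lt_of_le_of_lt (hR ⟨s, rfl⟩) (by linarith)
  have hbv : ∀ s ∈ Cube.boundary (Fin i), (f s : V) = v0 := fun s hs => by rw [hb s hs _ (zero_mem_bd hi)]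
  let B : Set V := (fun l : ℝ => -(l • v0)) '' Set.Icc 0 ((R + 1) / ‖v0‖)
  have hBc : IsCompact B := isCompact_Icc.image (by fun_prop)
  obtain ⟨H, hHc, hH0, hHO, hH1, hHA⟩ := GP1 (OpenPartialHomeomorph.refl V) (isClosedEmbedding_cubeIn i) (ic := Unit) (m := 1)
    (fun _ y => -(y 0 • v0)) (fun _ => by fun_prop) (by simpa using hdim) hBc (by simp)
    (by rintro _ ⟨l, hl, rfl⟩; exact ⟨(), fun _ => l, rfl⟩) hFc
    (O := {v | v ≠ 0 ∧ ‖v‖ < R + 1}) (IsOpen.inter isOpen_ne (isOpen_lt continuous_norm continuous_const))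
    (fun s => ⟨(f s).2, hR' s⟩) (isClosed_cube_boundary i) (by
      rintro s hs ⟨l, hl, h⟩
      rw [hbv s hs] at h
      have : (1 + l) • v0 = 0 := by rw [add_smul, one_smul]; nth_rw 1 [← h]; simp
      rcases smul_eq_zero.1 this with h | h
      · have := hl.1; linarith
      · exact hv0ne h)
  have h1 : BH f (fun s => ⟨H (1, s), (hHO (1, s)).1⟩) := by
    refine ⟨fun p => ⟨H p, (hHO p).1⟩, hHc.subtype_mk _, fun s => Subtype.ext (hH0 s), fun s => rfl, ?_⟩
    intro t s hs s' hs'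
    apply Subtype.ext
    simp only [hHA t s hs, hHA t s' hs', hbv s hs, hbv s' hs']
  have hne : ∀ p : I × (Fin i → I), (1 - (p.1 : ℝ)) • H (1, p.2) + (p.1 : ℝ) • v0 ≠ 0 := by
    rintro ⟨t, s⟩ h
    simp only at h
    by_cases ht : (t : ℝ) = 1
    · rw [ht] at h; simp at h; exact hv0ne h
    · have ht1 : 0 < 1 - (t : ℝ) := by have := t.2.2; exact sub_pos.2 (lt_of_le_of_ne this ht)
      have hG : H (1, s) = -(((t : ℝ) / (1 - t)) • v0) := by
        have h2 : (1 - (t : ℝ)) • H (1, s) = -((t : ℝ) • v0) := eq_neg_of_add_eq_zero_left h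
        have h3 := congrArg (fun w => (1 - (t : ℝ))⁻¹ • w) h2
        simp only [smul_smul, inv_mul_cancel₀ ht1.ne', one_smul, smul_neg] at h3
        rw [h3, div_eq_inv_mul]
      apply hH1 s
      refine ⟨(t : ℝ) / (1 - t), ⟨div_nonneg t.2.1 ht1.le, ?_⟩, hG.symm⟩
      rw [le_div_iff₀ hn0]
      have h4 := (hHO (1, s)).2
      rw [hG, norm_neg, norm_smul, Real.norm_eq_abs, abs_of_nonneg (div_nonneg t.2.1 ht1.le)] at h4
      exact h4.le
  refine ⟨⟨v0, hv0ne⟩, h1.trans ⟨fun p => ⟨_, hne p⟩, ?_, ?_, ?_, ?_⟩⟩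
  · refine Continuous.subtype_mk ?_ _
    have : Continuous (fun p : I × (Fin i → I) => H (1, p.2)) := hHc.comp (by fun_prop)
    fun_prop
  · intro s; apply Subtype.ext; simp
  · intro s; apply Subtype.ext; simp
  · intro t s hs s' hs'
    apply Subtype.ext
    simp only [hHA 1 s hs, hHA 1 s' hs', hbv s hs, hbv s' hs']

end GenPos

section SPLift
variable {X : Type} [TopologicalSpace X]

lemma BH_card {i : ℕ} {f g : (Fin i → I) → Multiset X} {n : ℕ} {H : I × (Fin i → I) → Multiset X}
    (hH : Continuous H) (h0 : ∀ s, (H (0, s)).card = n) : ∀ p, (H p).card = n := by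
  rintro ⟨t, s⟩
  rw [← h0 s]
  have hc : Continuous (fun t : I => (H (t, s)).card) := continuous_ms_card.comp (hH.comp (by fun_prop))
  exact PreconnectedSpace.constant (inferInstance : PreconnectedSpace I) hc

lemma BH_sp_lift {i n : ℕ} {f : (Fin i → I) → SP n X} {g : (Fin i → I) → Multiset X}
    (h : BH (fun s => spIn n (f s)) g) : ∃ g' : (Fin i → I) → SP n X, (∀ s, spIn n (g' s) = g s) ∧ BH f g' := by
  obtain ⟨H, hc, h0, h1, hb⟩ := h
  have hmem : ∀ p, H p ∈ Set.range (spIn (X := X) n) := by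
    rw [range_spIn]
    refine BH_card (f := g) (g := g) hc (fun s => ?_)
    rw [h0]
    have : spIn n (f s) ∈ Set.range (spIn (X := X) n) := ⟨_, rfl⟩
    rw [range_spIn] at this; exact this
  choose K hK using hmem
  have hKc : Continuous K := by
    rw [(isOpenEmbedding_spIn (X := X) n).isInducing.continuous_iff]
    have : spIn n ∘ K = H := by funext p; exact hK p
    rw [this]; exact hc
  have hinj := (isOpenEmbedding_spIn (X := X) n).injective
  refine ⟨fun s => K (1, s), fun s => by rw [hK, h1], K, hKc, fun s => hinj (by rw [hK, h0]), fun s => rfl, ?_⟩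
  intro t s hs s' hs'
  apply hinj
  rw [hK, hK]; exact hb t s hs s' hs'

lemma BNull_sp {i n : ℕ} {f : (Fin i → I) → SP n X} (h : BNull (fun s => spIn n (f s))) : BNull f := by
  obtain ⟨y, hy⟩ := h
  obtain ⟨g', hg, hBH⟩ := BH_sp_lift hy
  refine ⟨g' (fun _ => 0), ?_⟩
  have : g' = fun _ => g' (fun _ => 0) := by
    funext s
    exact (isOpenEmbedding_spIn (X := X) n).injective (by rw [hg, hg])
  rw [this] at hBH; exact hBH

end SPLift

end

section
set_option autoImplicit false
open Topology
set_option linter.unusedSectionVars false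
set_option linter.unusedSimpArgs false
set_option linter.unusedVariables false

section LogPart

def cubeClamp (i : ℕ) (x : Fin i → ℝ) : Fin i → I := fun j => Set.projIcc 0 1 zero_le_one (x j)

lemma continuous_cubeClamp (i : ℕ) : Continuous (cubeClamp i) :=
  continuous_pi fun j => continuous_projIcc.comp (continuous_apply j)

lemma cubeClamp_cubeIn (i : ℕ) (s : Fin i → I) : cubeClamp i (cubeIn i s) = s := by
  funext j; simp [cubeClamp, cubeIn]

lemma cube_log {i : ℕ} {L : (Fin i → I) → ℂ} (hL : Continuous L) (h0 : ∀ s, L s ≠ 0) :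
    ∃ μ : (Fin i → I) → ℂ, Continuous μ ∧ ∀ s, Complex.exp (μ s) = L s := by
  let f : C(Fin i → ℝ, {z : ℂ // z ≠ 0}) :=
    ⟨fun x => ⟨L (cubeClamp i x), h0 _⟩, (hL.comp (continuous_cubeClamp i)).subtype_mk _⟩
  obtain ⟨F, ⟨_, hF⟩, _⟩ := Complex.isCoveringMap_exp.existsUnique_continuousMap_lifts f 0
    (Complex.log (L (cubeClamp i 0))) (by
      apply Subtype.ext; exact Complex.exp_log (h0 _))
  refine ⟨fun s => F (cubeIn i s), F.continuous.comp (isClosedEmbedding_cubeIn i).continuous, fun s => ?_⟩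
  have := congrArg Subtype.val (congrFun hF (cubeIn i s))
  simpa [f, cubeClamp_cubeIn] using this

lemma cube_bd_joined {i : ℕ} (hi : 2 ≤ i) {s : Fin i → I} (hs : s ∈ Cube.boundary (Fin i)) :
    JoinedIn (Cube.boundary (Fin i)) s (fun _ => 0) := by
  obtain ⟨j, hj⟩ := hs
  obtain ⟨k, hk⟩ : ∃ k : Fin i, k ≠ j := by
    by_cases h : j = ⟨0, by omega⟩
    · exact ⟨⟨1, by omega⟩, by rw [h]; simp [Fin.ext_iff]⟩
    · exact ⟨⟨0, by omega⟩, fun h' => h h'.symm⟩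
  classical
  let m : Fin i → I := fun l => if l = j then s j else 0
  have h1 : JoinedIn (Cube.boundary (Fin i)) s m := by
    refine ⟨⟨⟨fun t l => if l = j then s j else unitInterval.symm t * s l, ?_⟩, ?_, ?_⟩, ?_⟩
    · refine continuous_pi fun l => ?_
      split_ifs
      · exact continuous_const
      · fun_prop
    · funext l
      simp only [unitInterval.symm_zero, one_mul]
      split_ifs with h
      · rw [h]
      · rfl
    · funext l
      simp [m]
    · intro t
      exact ⟨j, by simpa using hj⟩
  have h2 : JoinedIn (Cube.boundary (Fin i)) m (fun _ => 0) := by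
    refine ⟨⟨⟨fun t l => if l = j then unitInterval.symm t * s j else 0, ?_⟩, ?_, ?_⟩, ?_⟩
    · refine continuous_pi fun l => ?_
      split_ifs
      · fun_prop
      · exact continuous_const
    · funext l
      simp [m]
    · funext l
      simp
    · intro t
      exact ⟨k, by left; simp [hk]⟩
  exact h1.trans h2

lemma cube_bd_preconn {i : ℕ} (hi : 2 ≤ i) : IsPreconnected (Cube.boundary (Fin i)) := by
  have : IsPathConnected (Cube.boundary (Fin i)) :=
    ⟨fun _ => 0, zero_mem_bd (by omega), fun {y} hy => (cube_bd_joined hi hy).symm⟩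
  exact this.isConnected.isPreconnected

lemma cube_log_bd {i : ℕ} (hi : 2 ≤ i) {L : (Fin i → I) → ℂ} (hL : Continuous L) (h0 : ∀ s, L s ≠ 0)
    (hb : ∀ s ∈ Cube.boundary (Fin i), L s = L (fun _ => 0)) :
    ∃ μ : (Fin i → I) → ℂ, Continuous μ ∧ (∀ s, Complex.exp (μ s) = L s) ∧
      ∀ s ∈ Cube.boundary (Fin i), μ s = μ (fun _ => 0) := by
  obtain ⟨μ, hμ, he⟩ := cube_log hL h0
  refine ⟨μ, hμ, he, fun s hs => ?_⟩
  have hz := zero_mem_bd (i := i) (by omega)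
  have : PreconnectedSpace (Cube.boundary (Fin i)) := Subtype.preconnectedSpace (cube_bd_preconn hi)
  have key := Complex.isCoveringMap_exp.const_of_comp (A := Cube.boundary (Fin i))
    (g := fun s => μ s) (by fun_prop) (by
      intro a a'
      apply Subtype.ext
      show Complex.exp (μ a) = Complex.exp (μ a')
      rw [he, he, hb _ a.2, hb _ a'.2]) ⟨s, hs⟩ ⟨_, hz⟩
  exact key

end LogPart

section Roots
open Polynomial

/-- coefficients of the monic polynomial with given roots -/
def rootPoly (t : Multiset ℂ) : ℂ[X] := (t.map (fun a => X - C a)).prod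

lemma rootPoly_monic (t : Multiset ℂ) : (rootPoly t).Monic := monic_multiset_prod_of_monic _ _ fun a _ => monic_X_sub_C a

lemma rootPoly_natDegree (t : Multiset ℂ) : (rootPoly t).natDegree = t.card := natDegree_multiset_prod_X_sub_C_eq_card t

lemma rootPoly_roots (t : Multiset ℂ) : (rootPoly t).roots = t := roots_multiset_prod_X_sub_C t


lemma contDiff_prod_coeff {ι : Type} [Fintype ι] (s : Finset ι) (k : ℕ) :
    ContDiff ℝ 1 (fun x : ι → ℂ => (∏ i ∈ s, (X - C (x i))).coeff k) := by
  classical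
  induction s using Finset.induction_on generalizing k with
  | empty => simp only [Finset.prod_empty]; exact contDiff_const
  | insert a s ha ih =>
    simp only [Finset.prod_insert ha, sub_mul, coeff_sub, coeff_C_mul]
    refine ContDiff.sub ?_ ((contDiff_apply ℝ ℂ a).mul (ih k))
    cases k with
    | zero => simp only [coeff_X_mul_zero]; exact contDiff_const
    | succ k => simp only [coeff_X_mul]; exact ih k

lemma rootPoly_msk (m : ℕ) (x : Fin m → ℂ) : rootPoly (msk m x) = ∏ i, (X - C (x i)) := by
  rw [rootPoly, msk_map]; rfl

abbrev MSC (m : ℕ) : Type := {t : Multiset ℂ // t.card = m}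

def rootCoeff (m : ℕ) (t : MSC m) : Fin m → ℂ := fun k => (rootPoly t.1).coeff k

def vPoly {m : ℕ} (v : Fin m → ℂ) : ℂ[X] := X ^ m + ∑ k : Fin m, C (v k) * X ^ (k : ℕ)

lemma vPoly_monic {m : ℕ} (v : Fin m → ℂ) : (vPoly v).Monic := monic_X_pow_add (degree_sum_fin_lt v)

lemma vPoly_natDegree {m : ℕ} (v : Fin m → ℂ) : (vPoly v).natDegree = m := by
  have h := degree_sum_fin_lt v
  have : (vPoly v).degree = m := by
    rw [vPoly, degree_add_eq_left_of_degree_lt] <;> simp [h]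
  exact natDegree_eq_of_degree_eq_some this

lemma vPoly_coeff {m : ℕ} (v : Fin m → ℂ) (k : Fin m) : (vPoly v).coeff k = v k := by
  have hk : (k : ℕ) ≠ m := k.2.ne
  simp only [vPoly, coeff_add, coeff_X_pow, hk, if_false, zero_add, finsetSum_coeff, coeff_C_mul]
  rw [Finset.sum_eq_single k]
  · simp
  · intro b _ hb
    have : (k : ℕ) ≠ b := fun h => hb (Fin.ext h.symm)
    simp [this]
  · simp

lemma vPoly_rootCoeff {m : ℕ} (t : MSC m) : vPoly (rootCoeff m t) = rootPoly t.1 := by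
  ext k
  rcases lt_trichotomy k m with h | h | h
  · exact vPoly_coeff (rootCoeff m t) ⟨k, h⟩
  · have h1 := (vPoly_monic (rootCoeff m t)).coeff_natDegree
    have h2 := (rootPoly_monic t.1).coeff_natDegree
    rw [vPoly_natDegree] at h1
    rw [rootPoly_natDegree, t.2] at h2
    rw [h, h1, h2]
  · rw [coeff_eq_zero_of_natDegree_lt, coeff_eq_zero_of_natDegree_lt]
    · rw [rootPoly_natDegree, t.2]; exact h
    · rw [vPoly_natDegree]; exact h

lemma vPoly_card {m : ℕ} (v : Fin m → ℂ) : (vPoly v).roots.card = m := by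
  rw [IsAlgClosed.card_roots_eq_natDegree, vPoly_natDegree]

lemma rootPoly_vPoly {m : ℕ} (v : Fin m → ℂ) : rootPoly (vPoly v).roots = vPoly v :=
  ((IsAlgClosed.splits (vPoly v)).eq_prod_roots_of_monic (vPoly_monic v)).symm

def rootEquiv (m : ℕ) : MSC m ≃ (Fin m → ℂ) where
  toFun := rootCoeff m
  invFun v := ⟨(vPoly v).roots, vPoly_card v⟩
  left_inv t := by
    apply Subtype.ext
    show (vPoly (rootCoeff m t)).roots = t.1
    rw [vPoly_rootCoeff, rootPoly_roots]
  right_inv v := by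
    funext k
    show (rootPoly (vPoly v).roots).coeff k = v k
    rw [rootPoly_vPoly, vPoly_coeff]

lemma continuous_rootCoeff (m : ℕ) : Continuous (rootCoeff m) := by
  refine continuous_pi fun k => ?_
  have : Continuous (fun t : Multiset ℂ => (rootPoly t).coeff k) := by
    refine continuous_ms_dom fun n => ?_
    simp only [rootPoly_msk]
    exact (contDiff_prod_coeff Finset.univ k).continuous
  exact this.comp continuous_subtype_val

lemma root_bound {m : ℕ} {v : Fin m → ℂ} {R : ℝ} (hR : ∀ k, ‖v k‖ ≤ R) (hR0 : 0 ≤ R) {a : ℂ} (ha : a ∈ (vPoly v).roots) :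
    ‖a‖ ≤ R + 1 := by
  have h := IsRoot.norm_lt_cauchyBound (vPoly_monic v).ne_zero (isRoot_of_mem_roots ha)
  have h' : ‖a‖ ≤ ((cauchyBound (vPoly v) : NNReal) : ℝ) := h.le
  refine h'.trans ?_
  rw [cauchyBound, (vPoly_monic v).leadingCoeff, vPoly_natDegree]
  simp only [nnnorm_one, div_one, NNReal.coe_add, NNReal.coe_one]
  gcongr
  lift R to NNReal using hR0
  rw [NNReal.coe_le_coe]
  refine Finset.sup_le fun k hk => ?_
  have := hR ⟨k, Finset.mem_range.1 hk⟩
  rw [← vPoly_coeff v] at this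
  exact_mod_cast this

lemma isClosedMap_rootCoeff (m : ℕ) : IsClosedMap (rootCoeff m) := by
  refine (isProperMap_iff_isCompact_preimage.2 ⟨continuous_rootCoeff m, fun K hK => ?_⟩).isClosedMap
  obtain ⟨R, hR0, hR⟩ : ∃ R : ℝ, 0 ≤ R ∧ ∀ v ∈ K, ∀ k, ‖v k‖ ≤ R := by
    obtain ⟨R, hR⟩ := hK.isBounded.exists_norm_le
    refine ⟨max R 0, le_max_right _ _, fun v hv k => (norm_le_pi_norm v k).trans ((hR v hv).trans (le_max_left _ _))⟩
  have hc : IsCompact ((fun x : Fin m → ℂ => (⟨msk m x, msk_card m x⟩ : MSC m)) '' (Set.univ.pi fun _ => Metric.closedBall 0 (R + 1))) := by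
    refine (isCompact_univ_pi fun _ => isCompact_closedBall _ _).image ?_
    exact (continuous_msk m).subtype_mk _
  refine hc.of_isClosed_subset (hK.isClosed.preimage (continuous_rootCoeff m)) ?_
  rintro ⟨t, ht⟩ htK
  obtain ⟨x, rfl⟩ := msk_surj' t ht
  refine ⟨x, fun k _ => ?_, rfl⟩
  rw [mem_closedBall_zero_iff]
  refine root_bound (v := rootCoeff m ⟨msk m x, ht⟩) (fun k => hR _ htK k) hR0 ?_
  rw [vPoly_rootCoeff, rootPoly_roots]
  exact Multiset.mem_map.2 ⟨k, Finset.mem_univ_val k, rfl⟩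

def rootHomeo (m : ℕ) : MSC m ≃ₜ (Fin m → ℂ) :=
  (rootEquiv m).toHomeomorphOfContinuousClosed (continuous_rootCoeff m) (isClosedMap_rootCoeff m)

lemma rootHomeo_apply (m : ℕ) (t : MSC m) : rootHomeo m t = rootCoeff m t := rfl

lemma rootHomeo_symm (m : ℕ) (v : Fin m → ℂ) : ((rootHomeo m).symm v).1 = (vPoly v).roots := rfl

lemma contDiff_rootHomeo (m : ℕ) : ContDiff ℝ 1 (fun x : Fin m → ℂ => rootHomeo m ⟨msk m x, msk_card m x⟩) := by
  refine contDiff_pi.2 fun k => ?_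
  simp only [rootHomeo_apply, rootCoeff, rootPoly_msk]
  exact contDiff_prod_coeff Finset.univ k

lemma continuousAt_of_open' {A B C : Type*} [TopologicalSpace A] [TopologicalSpace B] [TopologicalSpace C]
    {p : A → B} (hp : IsOpenMap p) {f : B → C} (a : A) (hf : ContinuousAt (f ∘ p) a) : ContinuousAt f (p a) := by
  have h1 : 𝓝 (p a) ≤ Filter.map p (𝓝 a) := hp.nhds_le a
  have h2 : Filter.Tendsto (f ∘ p) (𝓝 a) (𝓝 (f (p a))) := hf
  exact (Filter.map_mono h1).trans (by rw [Filter.map_map]; exact h2)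

lemma continuousAt_ms_map {A B : Type*} [TopologicalSpace A] [TopologicalSpace B] {h : A → B} {t : Multiset A}
    (hh : ∀ a ∈ t, ContinuousAt h a) : ContinuousAt (Multiset.map h) t := by
  obtain ⟨n, hn⟩ : ∃ n, t.card = n := ⟨_, rfl⟩
  obtain ⟨x, rfl⟩ := msk_surj' t hn
  refine continuousAt_of_open' (isOpenMap_msk n) x ?_
  have : Multiset.map h ∘ msk n = msk n ∘ fun x k => h (x k) := by
    funext x; simp only [Function.comp]; rw [msk_map]; rfl
  rw [this]
  refine (continuous_msk n).continuousAt.comp (continuousAt_pi.2 fun k => ?_)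
  refine ContinuousAt.comp (hh _ (Multiset.mem_map.2 ⟨k, Finset.mem_univ_val k, rfl⟩)) (continuous_apply k).continuousAt

def cnorm (a : ℂ) : Circle := Circle.exp (Complex.arg a)

lemma cnorm_coe {a : ℂ} (h : a ≠ 0) : (cnorm a : ℂ) = a / ‖a‖ := by
  rw [cnorm, Circle.coe_exp, eq_div_iff (by simpa using h), mul_comm]
  exact Complex.norm_mul_exp_arg_mul_I a

lemma cnorm_circle (a : Circle) : cnorm a = a := Circle.exp_arg a

lemma continuousAt_cnorm {a : ℂ} (h : a ≠ 0) : ContinuousAt cnorm a := by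
  have hind : IsInducing (fun c : Circle => (c : ℂ)) := IsInducing.subtypeVal
  rw [hind.continuousAt_iff]
  have : (fun a : ℂ => a / ‖a‖) =ᶠ[𝓝 a] ((fun c : Circle => (c : ℂ)) ∘ cnorm) := by
    filter_upwards [isOpen_ne.mem_nhds h] with b hb
    exact (cnorm_coe hb).symm
  refine ContinuousAt.congr ?_ this
  refine continuousAt_id.div (by fun_prop) (by simpa using h)

/-- symmetric products of the circle have no higher homotopy -/
theorem circle_ms_null {i m : ℕ} (hi : 2 ≤ i) {f : (Fin i → I) → Multiset Circle} (hf : Continuous f)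
    (hm : ∀ s, (f s).card = m) (hb : ∀ s ∈ Cube.boundary (Fin i), f s = f (fun _ => 0)) : BNull f := by
  have hnz : ∀ a : Circle, (a : ℂ) ≠ 0 := fun a => a.coe_ne_zero
  rcases Nat.eq_zero_or_pos m with rfl | hmp
  · have : f = fun _ => 0 := by funext s; exact Multiset.card_eq_zero.1 (hm s)
    rw [this]; exact ⟨0, BH.refl continuous_const fun _ _ _ _ => rfl⟩
  let F : (Fin i → I) → MSC m := fun s => ⟨(f s).map (fun a : Circle => (a : ℂ)), by rw [Multiset.card_map, hm]⟩
  have hF : Continuous F := ((continuous_ms_map' continuous_subtype_val).comp hf).subtype_mk _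
  let z : Fin m := ⟨0, hmp⟩
  let v : (Fin i → I) → Fin m → ℂ := fun s => rootHomeo m (F s)
  have hv : Continuous v := (rootHomeo m).continuous.comp hF
  have hzero : ∀ (w : Fin m → ℂ), w z ≠ 0 ↔ ∀ a ∈ (vPoly w).roots, a ≠ 0 := by
    intro w
    have hcz : w z = (vPoly w).eval 0 := by
      rw [← coeff_zero_eq_eval_zero]; exact (vPoly_coeff w z).symm
    rw [hcz]
    constructor
    · rintro h a ha rfl
      exact h (isRoot_of_mem_roots ha)
    · intro h h0
      exact h 0 ((mem_roots (vPoly_monic w).ne_zero).2 h0) rfl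
  have hvz : ∀ s, v s z ≠ 0 := by
    intro s
    rw [hzero]
    have : (vPoly (v s)).roots = (F s).1 := by
      have := congrArg Subtype.val ((rootHomeo m).symm_apply_apply (F s))
      exact this
    rw [this]
    intro a ha
    obtain ⟨b, _, rfl⟩ := Multiset.mem_map.1 ha
    exact hnz b
  have hvb : ∀ s ∈ Cube.boundary (Fin i), v s = v (fun _ => 0) := by
    intro s hs
    have : F s = F (fun _ => 0) := Subtype.ext (by simp only [F, hb s hs])
    simp only [v, this]
  obtain ⟨μ, hμ, hμe, hμb⟩ := cube_log_bd hi (L := fun s => v s z) (by fun_prop) hvz (fun s hs => by rw [hvb s hs])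
  let o : Fin i → I := fun _ => 0
  let W : I × (Fin i → I) → Fin m → ℂ := fun p k =>
    if k = z then Complex.exp ((1 - (p.1 : ℝ) : ℂ) * μ p.2 + (p.1 : ℝ) * μ o)
    else (1 - (p.1 : ℝ) : ℂ) * v p.2 k + (p.1 : ℝ) * v o k
  have hW : Continuous W := by
    refine continuous_pi fun k => ?_
    simp only [W]
    split_ifs <;> fun_prop
  have hWz : ∀ p, W p z ≠ 0 := fun p => by simp [W, Complex.exp_ne_zero]
  refine ⟨((vPoly (W (1, o))).roots).map cnorm, fun p => ((vPoly (W p)).roots).map cnorm, ?_, ?_, ?_, ?_⟩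
  · rw [continuous_iff_continuousAt]
    intro p
    refine ContinuousAt.comp (g := Multiset.map cnorm) (f := fun p => (vPoly (W p)).roots) ?_ ?_
    · exact continuousAt_ms_map fun a ha => continuousAt_cnorm ((hzero _).1 (hWz p) a ha)
    · have : Continuous (fun p => ((rootHomeo m).symm (W p)).1) :=
        continuous_subtype_val.comp ((rootHomeo m).symm.continuous.comp hW)
      exact this.continuousAt
  · intro s
    have h1 : W (0, s) = v s := by
      funext k
      simp only [W]
      split_ifs with h
      · simp [hμe, h]
      · simp
    have : (vPoly (v s)).roots = (F s).1 := congrArg Subtype.val ((rootHomeo m).symm_apply_apply (F s))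
    show Multiset.map cnorm (vPoly (W (0, s))).roots = f s
    rw [h1, this, Multiset.map_map]
    conv_rhs => rw [← Multiset.map_id (f s)]
    exact Multiset.map_congr rfl fun a _ => cnorm_circle a
  · intro s
    have h1 : W (1, s) = W (1, o) := by
      funext k; simp only [W]; simp
    show Multiset.map cnorm (vPoly (W (1, s))).roots = _
    rw [h1]
  · intro t s hs s' hs'
    have h1 : ∀ s ∈ Cube.boundary (Fin i), W (t, s) = W (t, o) := by
      intro s hs
      funext k; simp only [W]; rw [hμb s hs, hvb s hs]
    show Multiset.map cnorm (vPoly (W (t, s))).roots = Multiset.map cnorm (vPoly (W (t, s'))).roots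
    rw [h1 s hs, h1 s' hs']

end Roots

end

section
set_option autoImplicit false
open Topology
set_option linter.unusedSectionVars false
set_option linter.unusedSimpArgs false
set_option linter.unusedVariables false

section ProjLift

structure ProjData (V Q : Type) [NormedAddCommGroup V] [NormedSpace ℝ V] [TopologicalSpace Q] where
  q : {v : V // v ≠ 0} → Q
  P : Q → V → V
  hq : Continuous q
  hP : Continuous (fun p : Q × V => P p.1 p.2)
  P_q : ∀ v, P (q v) v.1 = v.1
  q_P : ∀ y v (h : P y v ≠ 0), q ⟨P y v, h⟩ = y
  P_smul : ∀ y (r : ℝ) v, P y (r • v) = r • P y v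

variable {V Q : Type} [NormedAddCommGroup V] [NormedSpace ℝ V] [TopologicalSpace Q]

lemma ProjData.step (D : ProjData V Q) {y y' : Q} (h : ∀ u : V, ‖u‖ = 1 → ‖D.P y u - D.P y' u‖ < 1)
    {v : V} (hv : v ≠ 0) (hv' : D.P y' v = v) : D.P y v ≠ 0 := by
  intro h0
  have hn : ‖v‖ ≠ 0 := norm_ne_zero_iff.2 hv
  have hu : ‖(‖v‖⁻¹ • v)‖ = 1 := by rw [norm_smul, norm_inv, norm_norm, inv_mul_cancel₀ hn]
  have := h _ hu
  rw [D.P_smul, D.P_smul, h0, hv', smul_zero, zero_sub, norm_neg, hu] at this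
  exact lt_irrefl _ this

theorem ProjData.lift [ProperSpace V] (D : ProjData V Q) {K : Type} [TopologicalSpace K] [CompactSpace K]
    {H : I × K → Q} (hH : Continuous H) {f0 : K → {v : V // v ≠ 0}} (hf0 : Continuous f0)
    (h0 : ∀ x, D.q (f0 x) = H (0, x)) :
    ∃ F : I × K → {v : V // v ≠ 0}, Continuous F ∧ (∀ p, D.q (F p) = H p) ∧ (∀ x, F (0, x) = f0 x) ∧
      ∀ x, (∀ t, H (t, x) = H (0, x)) → ∀ t, F (t, x) = f0 x := by
  let G : C(I, C(K × Metric.sphere (0 : V) 1, V)) :=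
    ContinuousMap.curry ⟨fun p : I × (K × Metric.sphere (0 : V) 1) => D.P (H (p.1, p.2.1)) p.2.2,
      D.hP.comp ((hH.comp (by fun_prop)).prodMk (by fun_prop) : Continuous fun p : I × (K × Metric.sphere (0 : V) 1) => (H (p.1, p.2.1), (p.2.2 : V)))⟩
  have hG : UniformContinuous G := CompactSpace.uniformContinuous_of_continuous G.continuous
  obtain ⟨δ, hδ, hd⟩ := Metric.uniformContinuous_iff.1 hG 1 one_pos
  have hd' : ∀ t t' : I, dist t t' < δ → ∀ x u, ‖u‖ = 1 → ‖D.P (H (t, x)) u - D.P (H (t', x)) u‖ < 1 := by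
    intro t t' htt x u hu
    have h1 := hd htt
    have h2 := ContinuousMap.dist_apply_le_dist (f := G t) (g := G t') (x, ⟨u, by simpa using hu⟩)
    have h3 := h2.trans_lt h1
    rw [dist_eq_norm] at h3
    exact h3
  obtain ⟨N, hN⟩ := exists_nat_one_div_lt hδ
  let c : ℕ → I := fun k => Set.projIcc 0 1 zero_le_one ((k : ℝ) / (N + 1))
  have hNp : (0 : ℝ) < N + 1 := by positivity
  have hc : ∀ k, ∀ t : I, dist (t ⊓ c (k + 1)) (t ⊓ c k) < δ := by
    intro k t
    refine lt_of_le_of_lt ?_ hN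
    have e1 : ∀ a b : I, ((a ⊓ b : I) : ℝ) = min (a : ℝ) b := fun a b => (Subtype.mono_coe _).map_min
    rw [Subtype.dist_eq, Real.dist_eq, e1, e1]
    have e2 : |((c (k + 1) : I) : ℝ) - c k| ≤ 1 / (N + 1) := by
      simp only [c, Set.coe_projIcc]
      have : (((k + 1 : ℕ) : ℝ) / (N + 1)) - (k : ℝ) / (N + 1) = 1 / (N + 1) := by push_cast; ring
      calc |max 0 (min 1 (((k + 1 : ℕ) : ℝ) / (N + 1))) - max 0 (min 1 ((k : ℝ) / (N + 1)))|
          ≤ |min 1 (((k + 1 : ℕ) : ℝ) / (N + 1)) - min 1 ((k : ℝ) / (N + 1))| := by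
            have := abs_max_sub_max_le_max (0 : ℝ) (min 1 (((k + 1 : ℕ) : ℝ) / (N + 1))) 0 (min 1 ((k : ℝ) / (N + 1)))
            simpa using this
        _ ≤ |(((k + 1 : ℕ) : ℝ) / (N + 1)) - ((k : ℝ) / (N + 1))| := by
            have := abs_min_sub_min_le_max (1 : ℝ) (((k + 1 : ℕ) : ℝ) / (N + 1)) 1 ((k : ℝ) / (N + 1))
            simpa using this
        _ = 1 / (N + 1) := by rw [this, abs_of_pos (by positivity)]
    refine le_trans ?_ e2
    have := abs_min_sub_min_le_max (t : ℝ) (c (k + 1)) t (c k)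
    simpa using this
  have key : ∀ k : ℕ, ∃ F : I × K → {v : V // v ≠ 0}, Continuous F ∧ (∀ p, D.q (F p) = H (p.1 ⊓ c k, p.2)) ∧ (∀ x, F (0, x) = f0 x) ∧
      ∀ x, (∀ t, H (t, x) = H (0, x)) → ∀ t, F (t, x) = f0 x := by
    intro k
    induction k with
    | zero =>
      refine ⟨fun p => f0 p.2, by fun_prop, fun p => ?_, fun x => rfl, fun x _ t => rfl⟩
      have : c 0 = 0 := by apply Subtype.ext; simp [c]
      rw [h0, this]
      congr 2
      exact (min_eq_right (unitInterval.nonneg' (t := p.1))).symm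
    | succ k ih =>
      obtain ⟨F, hF, hFq, hF0, hFc⟩ := ih
      have hne : ∀ p, D.P (H (p.1 ⊓ c (k + 1), p.2)) (F p).1 ≠ 0 := by
        intro p
        refine D.step (y' := H (p.1 ⊓ c k, p.2)) (fun u hu => hd' _ _ (hc k p.1) p.2 u hu) (F p).2 ?_
        rw [← hFq, D.P_q]
      refine ⟨fun p => ⟨_, hne p⟩, ?_, fun p => D.q_P _ _ _, fun x => ?_, fun x hx t => ?_⟩
      · refine Continuous.subtype_mk ?_ _
        exact D.hP.comp ((hH.comp (by fun_prop)).prodMk (continuous_subtype_val.comp hF) :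
          Continuous fun p : I × K => (H (p.1 ⊓ c (k + 1), p.2), (F p).1))
      · apply Subtype.ext
        show D.P (H (0 ⊓ c (k + 1), x)) (F (0, x)).1 = (f0 x).1
        have : (0 : I) ⊓ c (k + 1) = 0 := min_eq_left (c (k + 1)).2.1
        rw [hF0, this, ← h0, D.P_q]
      · apply Subtype.ext
        show D.P (H (t ⊓ c (k + 1), x)) (F (t, x)).1 = (f0 x).1
        rw [hFc x hx, hx, ← h0, D.P_q]
  obtain ⟨F, hF, hFq, hF0, hFc⟩ := key (N + 1)
  refine ⟨F, hF, fun p => ?_, hF0, hFc⟩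
  have : c (N + 1) = 1 := by
    apply Subtype.ext
    simp only [c, Set.coe_projIcc]
    push_cast
    rw [div_self hNp.ne']; simp
  rw [hFq, this]
  congr 2
  exact min_eq_left p.1.2.2

end ProjLift

end

section
set_option autoImplicit false
open Topology
set_option linter.unusedSectionVars false
set_option linter.unusedSimpArgs false
set_option linter.unusedVariables false

section ProjNull

open Module

lemma cons_bd {i : ℕ} {t : I} {s : Fin i → I} (h : t = 0 ∨ t = 1 ∨ s ∈ Cube.boundary (Fin i)) :
    (Fin.cons t s : Fin (i + 1) → I) ∈ Cube.boundary (Fin (i + 1)) := by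
  rcases h with rfl | rfl | ⟨j, hj⟩
  · exact ⟨0, Or.inl rfl⟩
  · exact ⟨0, Or.inr rfl⟩
  · exact ⟨j.succ, by simpa using hj⟩

lemma bd_cons {i : ℕ} {s : Fin (i + 1) → I} (h : s ∈ Cube.boundary (Fin (i + 1))) :
    s 0 = 0 ∨ s 0 = 1 ∨ Fin.tail s ∈ Cube.boundary (Fin i) := by
  obtain ⟨j, hj⟩ := h
  refine Fin.cases (fun h0 => ?_) (fun j hj => ?_) j hj
  · exact h0.elim Or.inl (fun h => Or.inr (Or.inl h))
  · exact Or.inr (Or.inr ⟨j, hj⟩)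

lemma continuous_cons {i : ℕ} : Continuous (fun p : I × (Fin i → I) => (Fin.cons p.1 p.2 : Fin (i + 1) → I)) := by
  refine continuous_pi fun j => ?_
  refine Fin.cases ?_ (fun j => ?_) j
  · simpa using continuous_fst
  · simp only [Fin.cons_succ]; fun_prop

lemma continuous_tail {i : ℕ} : Continuous (fun s : Fin (i + 1) → I => (s 0, Fin.tail s)) := by
  refine Continuous.prodMk (by fun_prop) (continuous_pi fun j => ?_)
  exact continuous_apply j.succ

variable {V Q : Type} [NormedAddCommGroup V] [TopologicalSpace Q]

lemma ProjData.partial [NormedSpace ℝ V] [ProperSpace V] (D : ProjData V Q) (hs : Function.Surjective D.q) {i : ℕ}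
    {f : (Fin (i + 1) → I) → Q} (hf : Continuous f)
    (hb : ∀ s ∈ Cube.boundary (Fin (i + 1)), f s = f (fun _ => 0)) :
    ∃ v : {v : V // v ≠ 0}, ∃ F : I × (Fin i → I) → {v : V // v ≠ 0}, Continuous F ∧
      (∀ p, D.q (F p) = f (Fin.cons p.1 p.2)) ∧ (∀ s, F (0, s) = v) ∧
      (∀ t, ∀ s ∈ Cube.boundary (Fin i), F (t, s) = v) ∧ ∀ s, D.q (F (1, s)) = D.q v := by
  obtain ⟨v, hv⟩ := hs (f (fun _ => 0))
  obtain ⟨F, hF, hFq, hF0, hFc⟩ := D.lift (H := fun p : I × (Fin i → I) => f (Fin.cons p.1 p.2))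
    (hf.comp continuous_cons) (f0 := fun _ => v) continuous_const (fun x => by
      rw [hv]; exact (hb _ (cons_bd (Or.inl rfl))).symm)
  refine ⟨v, F, hF, hFq, hF0, fun t s hs => hFc s (fun t => ?_) t, fun s => ?_⟩
  · show f _ = f _
    rw [hb _ (cons_bd (Or.inr (Or.inr hs))), hb _ (cons_bd (Or.inr (Or.inr hs)))]
  · rw [hFq, hv]; exact hb _ (cons_bd (Or.inr (Or.inl rfl)))

lemma ProjData.finish [NormedSpace ℝ V] [FiniteDimensional ℝ V] (D : ProjData V Q) {i : ℕ} (hdim : i + 2 < finrank ℝ V)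
    {f : (Fin (i + 1) → I) → Q} {v : {v : V // v ≠ 0}} {F : I × (Fin i → I) → {v : V // v ≠ 0}} (hF : Continuous F)
    (hFq : ∀ p, D.q (F p) = f (Fin.cons p.1 p.2)) (h0 : ∀ s, F (0, s) = v) (h1 : ∀ s, F (1, s) = v)
    (hb : ∀ t, ∀ s ∈ Cube.boundary (Fin i), F (t, s) = v) : BNull f := by
  have hall : ∀ s ∈ Cube.boundary (Fin (i + 1)), F (s 0, Fin.tail s) = v := by
    intro s hs
    rcases bd_cons hs with h | h | h
    · rw [h, h0]
    · rw [h, h1]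
    · exact hb _ _ h
  have h := nonzero_null (V := V) (i := i + 1) (by omega) (by omega) (f := fun s => F (s 0, Fin.tail s))
    (hF.comp continuous_tail) (fun s hs s' hs' => by rw [hall s hs, hall s' hs'])
  have h' := h.comp D.hq
  have : D.q ∘ (fun s : Fin (i + 1) → I => F (s 0, Fin.tail s)) = f := by
    funext s
    simp only [Function.comp, hFq, Fin.cons_self_tail]
  rwa [this] at h'

theorem ProjData.null_real [InnerProductSpace ℝ V] [FiniteDimensional ℝ V] (D : ProjData V Q)
    (hs : Function.Surjective D.q)
    (hrat : ∀ v w, D.q v = D.q w → ∃ r : ℝ, w.1 = r • v.1)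
    (hsc : ∀ (r : ℝ) v (h : r • v.1 ≠ 0), D.q ⟨r • v.1, h⟩ = D.q v)
    {i : ℕ} (hi : 1 ≤ i) (hdim : i + 2 < finrank ℝ V) {f : (Fin (i + 1) → I) → Q} (hf : Continuous f)
    (hb : ∀ s ∈ Cube.boundary (Fin (i + 1)), f s = f (fun _ => 0)) : BNull f := by
  have hpr : ProperSpace V := FiniteDimensional.proper ℝ V
  obtain ⟨v, F, hF, hFq, hF0, hFb, hF1⟩ := D.partial hs hf hb
  have hvv : inner ℝ v.1 v.1 ≠ (0 : ℝ) := inner_self_ne_zero.2 v.2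
  let L : (Fin i → I) → ℝ := fun s => inner ℝ v.1 (F (1, s)).1 / inner ℝ v.1 v.1
  have hL : Continuous L := by
    have : Continuous (fun s => (F (1, s)).1) := continuous_subtype_val.comp (hF.comp (by fun_prop))
    exact (continuous_const.inner this).div_const _
  have hLv : ∀ s, (F (1, s)).1 = L s • v.1 := by
    intro s
    obtain ⟨r, hr⟩ := hrat v (F (1, s)) (hF1 s).symm
    have : L s = r := by
      simp only [L, hr, inner_smul_right]
      field_simp
    rw [this, hr]
  have hL0 : ∀ s, L s ≠ 0 := fun s h => (F (1, s)).2 (by rw [hLv, h, zero_smul])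
  have hL1 : L (fun _ => 0) = 1 := by
    have := hFb 1 _ (zero_mem_bd hi)
    simp only [L, this]; exact div_self hvv
  have hpos : ∀ s, 0 < L s := by
    intro s
    by_contra hneg
    push Not at hneg
    have hpc : IsPreconnected (Set.univ : Set (Fin i → I)) := isPreconnected_univ
    obtain ⟨s', _, hs'⟩ := hpc.intermediate_value (Set.mem_univ s) (Set.mem_univ (fun _ => 0)) hL.continuousOn
      (show (0 : ℝ) ∈ Set.Icc (L s) (L fun _ => 0) from ⟨hneg, by rw [hL1]; exact zero_le_one⟩)
    exact hL0 s' hs'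
  let c : I × (Fin i → I) → ℝ := fun p => (1 - (p.1 : ℝ) + p.1 * L p.2)
  have hc : ∀ p, 0 < c p := by
    intro p
    rcases eq_or_lt_of_le (unitInterval.le_one p.1) with h | h
    · simp only [c, h]; simpa using hpos p.2
    · have := mul_nonneg (unitInterval.nonneg p.1) (hpos p.2).le
      simp only [c]; linarith
  have hcc : Continuous c := by fun_prop
  have hne : ∀ p, (c p)⁻¹ • (F p).1 ≠ 0 := fun p => smul_ne_zero (inv_ne_zero (hc p).ne') (F p).2
  refine D.finish (v := v) (F := fun p => ⟨(c p)⁻¹ • (F p).1, hne p⟩) hdim ?_ ?_ ?_ ?_ ?_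
  · exact ((hcc.inv₀ fun p => (hc p).ne').smul (continuous_subtype_val.comp hF)).subtype_mk _
  · intro p; rw [hsc, hFq]
  · intro s; apply Subtype.ext; simp [c, hF0]
  · intro s; apply Subtype.ext
    simp only [c, hLv, smul_smul]
    simp [hL0]
  · intro t s hs
    apply Subtype.ext
    have h1 : L s = 1 := by
      simp only [L, hFb 1 s hs]; exact div_self hvv
    simp [c, h1, hFb t s hs]

section Cx
variable [InnerProductSpace ℂ V] [FiniteDimensional ℂ V]

/-- hypotheses for complex projective data -/
structure ProjData.IsCx (D : ProjData V Q) : Prop where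
  hs : Function.Surjective D.q
  hrat : ∀ v w, D.q v = D.q w → ∃ r : ℂ, w.1 = r • v.1
  hsc : ∀ (r : ℂ) v (h : r • v.1 ≠ 0), D.q ⟨r • v.1, h⟩ = D.q v

/-- continuous ratio of lifts -/
lemma ProjData.IsCx.ratio {D : ProjData V Q} (hD : D.IsCx) {K : Type} [TopologicalSpace K]
    {F G : K → {v : V // v ≠ 0}} (hF : Continuous F) (hG : Continuous G) (h : ∀ x, D.q (F x) = D.q (G x)) :
    ∃ L : K → ℂ, Continuous L ∧ (∀ x, L x ≠ 0) ∧ (∀ x, (G x).1 = L x • (F x).1) := by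
  have hvv : ∀ x, inner ℂ (F x).1 (F x).1 ≠ (0 : ℂ) := fun x => inner_self_ne_zero.2 (F x).2
  have hv : ∀ x, (G x).1 = (inner ℂ (F x).1 (G x).1 / inner ℂ (F x).1 (F x).1 : ℂ) • (F x).1 := by
    intro x
    obtain ⟨r, hr⟩ := hD.hrat _ _ (h x)
    have : inner ℂ (F x).1 (G x).1 / inner ℂ (F x).1 (F x).1 = r := by
      rw [hr, inner_smul_right, mul_div_assoc, div_self (hvv x), mul_one]
    rw [this, hr]
  refine ⟨fun x => inner ℂ (F x).1 (G x).1 / inner ℂ (F x).1 (F x).1, ?_, fun x h0 => ?_, hv⟩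
  · have h1 := continuous_subtype_val.comp hF
    have h2 := continuous_subtype_val.comp hG
    exact (h1.inner h2).div (h1.inner h1) hvv
  · dsimp only at h0
    have := hv x
    rw [h0, zero_smul] at this
    exact (G x).2 this

theorem ProjData.IsCx.null {D : ProjData V Q} (hD : D.IsCx)
    {i : ℕ} (hi : 2 ≤ i) (hdim : i + 2 < finrank ℝ V) {f : (Fin (i + 1) → I) → Q} (hf : Continuous f)
    (hb : ∀ s ∈ Cube.boundary (Fin (i + 1)), f s = f (fun _ => 0)) : BNull f := by
  have : FiniteDimensional ℝ V := FiniteDimensional.complexToReal V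
  have hpr : ProperSpace V := FiniteDimensional.proper ℝ V
  obtain ⟨v, F, hF, hFq, hF0, hFb, hF1⟩ := D.partial hD.hs hf hb
  obtain ⟨L, hL, hL0, hLv⟩ := hD.ratio (F := fun _ : Fin i → I => v) (G := fun s => F (1, s)) continuous_const
    (hF.comp (by fun_prop)) (fun s => (hF1 s).symm)
  have hLb : ∀ s ∈ Cube.boundary (Fin i), L s = 1 := by
    intro s hs
    have h := hLv s
    rw [hFb 1 s hs] at h
    have h2 : (L s - 1) • v.1 = 0 := by rw [sub_smul, one_smul, ← h, sub_self]
    rcases smul_eq_zero.1 h2 with h3 | h3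
    · exact sub_eq_zero.1 h3
    · exact absurd h3 v.2
  obtain ⟨μ, hμ, hμe, hμb⟩ := cube_log_bd hi hL hL0 (fun s hs => by
    rw [hLb s hs, hLb _ (zero_mem_bd (by omega))])
  let o : Fin i → I := fun _ => 0
  have ho : Complex.exp (μ o) = 1 := by rw [hμe]; exact hLb _ (zero_mem_bd (by omega))
  let c : I × (Fin i → I) → ℂ := fun p => Complex.exp (- ((p.1 : ℝ) : ℂ) * (μ p.2 - μ o))
  have hcc : Continuous c := by fun_prop
  have hne : ∀ p, c p • (F p).1 ≠ 0 := fun p => smul_ne_zero (Complex.exp_ne_zero _) (F p).2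
  refine D.finish (v := v) (F := fun p => ⟨c p • (F p).1, hne p⟩) hdim ?_ ?_ ?_ ?_ ?_
  · exact (hcc.smul (continuous_subtype_val.comp hF)).subtype_mk _
  · intro p; rw [hD.hsc, hFq]
  · intro s; apply Subtype.ext; simp [c, hF0]
  · intro s; apply Subtype.ext
    simp only [hLv, smul_smul, c, ← hμe]
    rw [← Complex.exp_add]
    have : -(((1 : I) : ℝ) : ℂ) * (μ s - μ o) + μ s = μ o := by simp
    rw [this, ho, one_smul]
  · intro t s hs
    apply Subtype.ext
    simp [c, hμb s hs, o, hFb t s hs]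

end Cx

end ProjNull

end

section
set_option autoImplicit false
open Topology
set_option linter.unusedSectionVars false
set_option linter.unusedSimpArgs false
set_option linter.unusedVariables false

section Degree
open Module

lemma continuous_vec2 : Continuous (fun p : I × I => (![p.1, p.2] : Fin 2 → I)) := by
  refine continuous_pi fun j => ?_
  fin_cases j
  · exact continuous_fst
  · exact continuous_snd

lemma sq_log {L : I × I → ℂ} (hL : Continuous L) (h0 : ∀ s, L s ≠ 0) :
    ∃ μ : I × I → ℂ, Continuous μ ∧ ∀ s, Complex.exp (μ s) = L s := by
  obtain ⟨μ, hμ, he⟩ := cube_log (i := 2) (L := fun s => L (s 0, s 1)) (hL.comp (by fun_prop)) (fun s => h0 _)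
  exact ⟨fun p => μ ![p.1, p.2], hμ.comp continuous_vec2, fun p => by rw [he]; simp⟩

lemma exp_const {A : Type} [TopologicalSpace A] [PreconnectedSpace A] {g : A → ℂ} (hg : Continuous g)
    (h : ∀ a a', Complex.exp (g a) = Complex.exp (g a')) (a a' : A) : g a = g a' :=
  Complex.isCoveringMap_exp.const_of_comp hg (fun a a' => Subtype.ext (h a a')) a a'

lemma vec2_bd {a b : I} (h : a = 0 ∨ a = 1 ∨ b = 0 ∨ b = 1) : (![a, b] : Fin 2 → I) ∈ Cube.boundary (Fin 2) := by
  rcases h with h | h | h | h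
  · exact ⟨0, Or.inl h⟩
  · exact ⟨0, Or.inr h⟩
  · exact ⟨1, Or.inl h⟩
  · exact ⟨1, Or.inr h⟩

lemma vec2_eta (s : Fin 2 → I) : (![s 0, s 1] : Fin 2 → I) = s := by
  funext j; fin_cases j <;> rfl

variable {V Q : Type} [NormedAddCommGroup V] [TopologicalSpace Q]
variable [InnerProductSpace ℂ V] [FiniteDimensional ℂ V]

def ProjData.IsDeg (D : ProjData V Q) (f : (Fin 2 → I) → Q) (k : ℤ) : Prop :=
  ∃ (v : {v : V // v ≠ 0}) (F : I × I → {v : V // v ≠ 0}) (μ : I → ℂ), Continuous F ∧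
    (∀ a b, D.q (F (a, b)) = f ![a, b]) ∧ (∀ b, F (0, b) = v) ∧ (∀ a, F (a, 0) = v) ∧ (∀ a, F (a, 1) = v) ∧
    Continuous μ ∧ (∀ b, (F (1, b)).1 = Complex.exp (μ b) • v.1) ∧ μ 1 - μ 0 = k * (2 * Real.pi * Complex.I)

lemma smul_eq_self_imp {v : V} (hv : v ≠ 0) {c : ℂ} (h : v = c • v) : c = 1 := by
  have h2 : (c - 1) • v = 0 := by rw [sub_smul, one_smul, ← h, sub_self]
  rcases smul_eq_zero.1 h2 with h3 | h3
  · exact sub_eq_zero.1 h3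
  · exact absurd h3 hv

lemma smul_cancel {v : V} (hv : v ≠ 0) {c d : ℂ} (h : c • v = d • v) : c = d := by
  have h2 : (c - d) • v = 0 := by rw [sub_smul, h, sub_self]
  rcases smul_eq_zero.1 h2 with h3 | h3
  · exact sub_eq_zero.1 h3
  · exact absurd h3 hv

theorem ProjData.IsCx.deg_BH {D : ProjData V Q} (hD : D.IsCx) {f g : (Fin 2 → I) → Q} (h : BH f g) :
    ∃ k : ℤ, D.IsDeg f k ∧ D.IsDeg g k := by
  have : FiniteDimensional ℝ V := FiniteDimensional.complexToReal V
  have hpr : ProperSpace V := FiniteDimensional.proper ℝ V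
  obtain ⟨H, hH, hH0, hH1, hHb⟩ := h
  obtain ⟨v0, hv0⟩ := hD.hs (H (0, ![0, 0]))
  obtain ⟨w, hw, hwq, hw0, -⟩ := D.lift (K := Unit) (H := fun p => H (p.1, ![0, 0])) (hH.comp (by fun_prop))
    (f0 := fun _ => v0) continuous_const (fun _ => hv0)
  have hbd : ∀ t a b, (a = 0 ∨ a = 1 ∨ b = 0 ∨ b = 1) → H (t, ![a, b]) = H (t, ![0, 0]) := by
    intro t a b h
    exact hHb t _ (vec2_bd h) _ (vec2_bd (Or.inl rfl))
  obtain ⟨G, hG, hGq, hG0, hGc⟩ := D.lift (K := I × I) (H := fun p => H (p.2.1, ![p.1, p.2.2]))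
    (hH.comp ((by fun_prop : Continuous fun p : I × (I × I) => p.2.1).prodMk
      (continuous_vec2.comp (by fun_prop : Continuous fun p : I × (I × I) => (p.1, p.2.2)))))
    (f0 := fun x => w (x.1, ())) (hw.comp (by fun_prop)) (fun x => by
      rw [hwq]; exact (hbd _ _ _ (Or.inl rfl)).symm)
  obtain ⟨L, hL, hL0, hLv⟩ := hD.ratio (K := I × I) (F := fun x => w (x.1, ())) (G := fun x => G (1, x))
    (hw.comp (by fun_prop)) (hG.comp (by fun_prop)) (fun x => by
      rw [hwq, hGq]; exact (hbd _ _ _ (Or.inr (Or.inl rfl))).symm)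
  have hGb : ∀ a t b, (b = 0 ∨ b = 1) → G (a, (t, b)) = w (t, ()) := by
    intro a t b hb
    refine hGc (t, b) (fun a => ?_) a
    show H (t, ![a, b]) = H (t, ![0, b])
    rw [hbd _ _ _ (Or.inr (Or.inr hb)), hbd _ _ _ (Or.inr (Or.inr hb))]
  have hL1 : ∀ t b, (b = 0 ∨ b = 1) → L (t, b) = 1 := by
    intro t b hb
    have := hLv (t, b)
    simp only [hGb 1 t b hb] at this
    exact smul_eq_self_imp (w (t, ())).2 this
  obtain ⟨M, hM, hMe⟩ := sq_log hL hL0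
  have hM1 : ∀ t, Complex.exp (M (t, 1) - M (t, 0)) = 1 := by
    intro t
    rw [Complex.exp_sub, hMe, hMe, hL1 _ _ (Or.inr rfl), hL1 _ _ (Or.inl rfl), div_one]
  obtain ⟨k, hk⟩ := Complex.exp_eq_one_iff.1 (hM1 0)
  have hkt : ∀ t, M (t, 1) - M (t, 0) = k * (2 * Real.pi * Complex.I) := by
    intro t
    rw [← hk]
    exact exp_const (g := fun t : I => M (t, 1) - M (t, 0)) (by fun_prop) (fun a a' => by rw [hM1, hM1]) t 0
  have hfin : ∀ t, D.IsDeg (fun s => H (t, s)) k := by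
    intro t
    refine ⟨w (t, ()), fun p => G (p.1, (t, p.2)), fun b => M (t, b), hG.comp (by fun_prop), fun a b => hGq _,
      fun b => hG0 _, fun a => hGb _ _ _ (Or.inl rfl), fun a => hGb _ _ _ (Or.inr rfl), by fun_prop, fun b => ?_, hkt t⟩
    rw [hMe]; exact hLv (t, b)
  have e0 : (fun s => H (0, s)) = f := funext hH0
  have e1 : (fun s => H (1, s)) = g := funext hH1
  refine ⟨k, ?_, ?_⟩
  · have := hfin 0; rwa [e0] at this
  · have := hfin 1; rwa [e1] at this

theorem ProjData.IsCx.deg_unique {D : ProjData V Q} (hD : D.IsCx) {f : (Fin 2 → I) → Q} {k l : ℤ}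
    (hk : D.IsDeg f k) (hl : D.IsDeg f l) : k = l := by
  obtain ⟨v, F, μ, hF, hFq, hF0, hFa, hFb, hμ, hμF, hμk⟩ := hk
  obtain ⟨v', F', μ', hF', hFq', hF0', hFa', hFb', hμ', hμF', hμk'⟩ := hl
  obtain ⟨L, hL, hL0, hLv⟩ := hD.ratio hF hF' (fun x => by rw [hFq, hFq'])
  obtain ⟨N, hN, hNe⟩ := sq_log hL hL0
  have hc : ∀ a b, (a = 0 ∨ b = 0 ∨ b = 1) → L (a, b) = L (0, 0) := by
    intro a b h
    have e1 : F (a, b) = v := by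
      rcases h with rfl | rfl | rfl
      · exact hF0 _
      · exact hFa _
      · exact hFb _
    have e2 : F' (a, b) = v' := by
      rcases h with rfl | rfl | rfl
      · exact hF0' _
      · exact hFa' _
      · exact hFb' _
    have h1 := hLv (a, b)
    have h2 := hLv (0, 0)
    rw [e1, e2] at h1
    rw [hF0, hF0'] at h2
    exact smul_cancel v.2 (h1.symm.trans h2)
  have n1 : N (1, 0) = N (0, 0) := exp_const (g := fun a : I => N (a, 0)) (by fun_prop)
    (fun a a' => by rw [hNe, hNe, hc a 0 (Or.inr (Or.inl rfl)), hc a' 0 (Or.inr (Or.inl rfl))]) 1 0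
  have n2 : N (0, 1) = N (0, 0) := exp_const (g := fun a : I => N (0, a)) (by fun_prop)
    (fun a a' => by rw [hNe, hNe, hc 0 a (Or.inl rfl), hc 0 a' (Or.inl rfl)]) 1 0
  have n3 : N (1, 1) = N (0, 1) := exp_const (g := fun a : I => N (a, 1)) (by fun_prop)
    (fun a a' => by rw [hNe, hNe, hc a 1 (Or.inr (Or.inr rfl)), hc a' 1 (Or.inr (Or.inr rfl))]) 1 0
  have hvv : v'.1 = L (0, 0) • v.1 := by have := hLv (0, 0); rwa [hF0, hF0'] at this
  have hrel : ∀ b, Complex.exp (μ' b - μ b - N (1, b)) = (L (0, 0))⁻¹ := by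
    intro b
    have h1 := hLv (1, b)
    rw [hμF, hμF', hvv, smul_smul, smul_smul] at h1
    have h2 := smul_cancel v.2 h1
    rw [Complex.exp_sub, Complex.exp_sub, hNe]
    have e1 := Complex.exp_ne_zero (μ b)
    have e2 := hL0 (1, b)
    have e3 := hL0 (0, 0)
    field_simp
    linear_combination h2
  have hd : μ' 1 - μ 1 - N (1, 1) = μ' 0 - μ 0 - N (1, 0) :=
    exp_const (g := fun b : I => μ' b - μ b - N (1, b)) (by fun_prop) (fun a a' => by rw [hrel, hrel]) 1 0
  have : (k : ℂ) * (2 * Real.pi * Complex.I) = l * (2 * Real.pi * Complex.I) := by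
    rw [← hμk, ← hμk']
    linear_combination -hd - n3 - n2 + n1
  have h2 : (2 * Real.pi * Complex.I : ℂ) ≠ 0 := by simp [Real.pi_ne_zero]
  exact_mod_cast mul_right_cancel₀ h2 this

theorem ProjData.IsCx.deg_zero {D : ProjData V Q} (hD : D.IsCx) (hdim : 3 < finrank ℝ V) {f : (Fin 2 → I) → Q}
    (h : D.IsDeg f 0) : BNull f := by
  have : FiniteDimensional ℝ V := FiniteDimensional.complexToReal V
  obtain ⟨v, F, μ, hF, hFq, hF0, hFa, hFb, hμ, hμF, hμk⟩ := h
  have h1 : Complex.exp (μ 0) = 1 := by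
    have := hμF 0
    rw [hFa] at this
    exact smul_eq_self_imp v.2 this
  let c : I × (Fin 1 → I) → ℂ := fun p => Complex.exp (- ((p.1 : ℝ) : ℂ) * (μ (p.2 0) - μ 0))
  have hcc : Continuous c := by fun_prop
  have hne : ∀ p, c p • (F (p.1, p.2 0)).1 ≠ 0 := fun p => smul_ne_zero (Complex.exp_ne_zero _) (F _).2
  refine D.finish (i := 1) (v := v) (F := fun p => ⟨c p • (F (p.1, p.2 0)).1, hne p⟩) hdim ?_ ?_ ?_ ?_ ?_
  · exact (hcc.smul (continuous_subtype_val.comp (hF.comp (by fun_prop)))).subtype_mk _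
  · intro p; rw [hD.hsc, hFq]
    congr 1
    funext j; fin_cases j <;> rfl
  · intro s; apply Subtype.ext; simp [c, hF0]
  · intro s; apply Subtype.ext
    simp only [hμF, smul_smul, c]
    rw [← Complex.exp_add]
    have : -(((1 : I) : ℝ) : ℂ) * (μ (s 0) - μ 0) + μ (s 0) = μ 0 := by simp
    rw [this, h1, one_smul]
  · rintro t s ⟨j, hj⟩
    have hj0 : j = 0 := Subsingleton.elim _ _
    subst hj0
    apply Subtype.ext
    rcases hj with hj | hj
    · simp [c, hj, hFa]
    · have : μ 1 = μ 0 := by simpa [sub_eq_zero] using hμk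
      simp [c, hj, hFb, this]

def half1 (b : I) : I := Set.projIcc 0 1 zero_le_one (2 * (b : ℝ))
def half2 (b : I) : I := Set.projIcc 0 1 zero_le_one (2 * (b : ℝ) - 1)

lemma continuous_half1 : Continuous half1 := continuous_projIcc.comp (by fun_prop)
lemma continuous_half2 : Continuous half2 := continuous_projIcc.comp (by fun_prop)

theorem ProjData.IsCx.deg_add {D : ProjData V Q} (hD : D.IsCx) {f g : (Fin 2 → I) → Q} {k l : ℤ}
    (hfg : f ![0, 0] = g ![0, 0])
    (hk : D.IsDeg f k) (hl : D.IsDeg g l) :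
    D.IsDeg (fun s => if (s 1 : ℝ) ≤ 1 / 2 then f ![s 0, half1 (s 1)] else g ![s 0, half2 (s 1)]) (k + l) := by
  obtain ⟨v, F, μ, hF, hFq, hF0, hFa, hFb, hμ, hμF, hμk⟩ := hk
  obtain ⟨v', F', μ', hF', hFq', hF0', hFa', hFb', hμ', hμF', hμk'⟩ := hl
  obtain ⟨r, hr⟩ := hD.hrat v' v (by rw [← hF0 0, ← hF0' 0, hFq, hFq', hfg])
  have hr0 : r ≠ 0 := by
    rintro rfl; exact v.2 (by rw [hr, zero_smul])
  have hh1 : ∀ b : I, (b : ℝ) = 1 / 2 → half1 b = 1 := by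
    intro b hb; apply Subtype.ext; simp [half1, hb]
  have hh2 : ∀ b : I, (b : ℝ) = 1 / 2 → half2 b = 0 := by
    intro b hb; apply Subtype.ext; simp [half2, hb]
  have h10 : half1 0 = 0 := by apply Subtype.ext; simp [half1]
  have h21 : half2 1 = 1 := by apply Subtype.ext; norm_num [half2]
  have hn1 : ¬ (((1 : I) : ℝ) ≤ 1 / 2) := by simp; norm_num
  have hp0 : (((0 : I) : ℝ) ≤ 1 / 2) := by simp
  have hne : ∀ p, r • (F' p).1 ≠ 0 := fun p => smul_ne_zero hr0 (F' p).2
  let F2 : I × I → {v : V // v ≠ 0} := fun p => ⟨r • (F' p).1, hne p⟩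
  have hF2 : Continuous F2 := ((continuous_subtype_val.comp hF').const_smul r).subtype_mk _
  have hv2 : ∀ p, F' p = v' → F2 p = v := fun p hp => Subtype.ext (by simp only [F2, hp]; exact hr.symm)
  have hμ1 : Complex.exp (μ 1) = 1 := by
    have := hμF 1
    rw [hFb] at this
    exact smul_eq_self_imp v.2 this
  have hμ0 : Complex.exp (μ' 0) = 1 := by
    have := hμF' 0
    rw [hFa'] at this
    exact smul_eq_self_imp v'.2 this
  refine ⟨v, fun p => if (p.2 : ℝ) ≤ 1 / 2 then F (p.1, half1 p.2) else F2 (p.1, half2 p.2),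
    fun b => if (b : ℝ) ≤ 1 / 2 then μ (half1 b) else μ' (half2 b) + (μ 1 - μ' 0), ?_, ?_, ?_, ?_, ?_, ?_, ?_, ?_⟩
  · refine Continuous.if_le ?_ ?_ (by fun_prop) continuous_const ?_
    · exact hF.comp (continuous_fst.prodMk (continuous_half1.comp continuous_snd))
    · exact hF2.comp (continuous_fst.prodMk (continuous_half2.comp continuous_snd))
    · intro p hp
      rw [hh1 _ hp, hh2 _ hp, hFb, hv2 _ (hFa' _)]
  · intro a b
    show D.q (if (b:ℝ) ≤ 1/2 then F (a, half1 b) else F2 (a, half2 b)) = (if (b:ℝ) ≤ 1/2 then f ![a, half1 b] else g ![a, half2 b])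
    by_cases hb : (b : ℝ) ≤ 1 / 2
    · rw [if_pos hb, if_pos hb]; exact hFq _ _
    · rw [if_neg hb, if_neg hb, ← hFq']; exact hD.hsc _ _ _
  · intro b
    dsimp only
    split_ifs
    · exact hF0 _
    · exact hv2 _ (hF0' _)
  · intro a
    dsimp only
    rw [if_pos hp0, h10, hFa]
  · intro a
    dsimp only
    rw [if_neg hn1, h21, hv2 _ (hFb' _)]
  · refine Continuous.if_le ?_ ?_ (by fun_prop) continuous_const ?_
    · exact hμ.comp continuous_half1
    · exact (hμ'.comp continuous_half2).add continuous_const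
    · intro b hb
      rw [hh1 _ hb, hh2 _ hb]; ring
  · intro b
    dsimp only
    split_ifs
    · exact hμF _
    · show r • (F' (1, half2 b)).1 = _
      rw [hμF', Complex.exp_add, Complex.exp_sub, hμ1, hμ0, hr, smul_smul, smul_smul]
      congr 1; ring
  · dsimp only
    rw [if_neg hn1, if_pos hp0, h21, h10]
    push_cast
    linear_combination hμk + hμk'

/-- Abstract computation of a second homotopy group. -/
theorem ProjData.IsCx.pi2 {D : ProjData V Q} (hD : D.IsCx) (hdim : 3 < finrank ℝ V) {Y : Type} [TopologicalSpace Y]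
    {φ : Y → Q} (hφ : Continuous φ) (y : Y)
    (hinj : ∀ f : (Fin 2 → I) → Y, Continuous f → (∀ s ∈ Cube.boundary (Fin 2), f s = y) → BNull (φ ∘ f) → BNull f)
    (hnt : ∃ f : (Fin 2 → I) → Y, Continuous f ∧ (∀ s ∈ Cube.boundary (Fin 2), f s = y) ∧ ¬ BNull (φ ∘ f)) :
    Nonempty ((π_ 2 Y y) ≃* Multiplicative ℤ) := by
  classical
  have hex : ∀ f : GenLoop (Fin 2) Y y, ∃ k : ℤ, D.IsDeg (φ ∘ f) k := by
    intro f
    have h : BH (φ ∘ f) (φ ∘ f) := by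
      refine BH.refl (hφ.comp f.1.continuous) fun s hs s' hs' => ?_
      show φ (f.1 s) = φ (f.1 s')
      rw [f.2 s hs, f.2 s' hs']
    obtain ⟨k, hk, _⟩ := hD.deg_BH h
    exact ⟨k, hk⟩
  choose dg hdg using hex
  have hdgh : ∀ f g : GenLoop (Fin 2) Y y, GenLoop.Homotopic f g → dg f = dg g := by
    intro f g h
    obtain ⟨k, h1, h2⟩ := hD.deg_BH ((BH_of_homotopic h).comp hφ)
    rw [hD.deg_unique (hdg f) h1, hD.deg_unique (hdg g) h2]
  have hmul : ∀ f g : GenLoop (Fin 2) Y y, dg (GenLoop.transAt 1 f g) = dg f + dg g := by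
    intro f g
    have hb : (φ ∘ f) ![0, 0] = (φ ∘ g) ![0, 0] := by
      show φ (f.1 ![0, 0]) = φ (g.1 ![0, 0])
      rw [f.2 _ (vec2_bd (Or.inl rfl)), g.2 _ (vec2_bd (Or.inl rfl))]
    refine hD.deg_unique (hdg _) ?_
    convert hD.deg_add hb (hdg f) (hdg g) using 1
    have hu : ∀ (s : Fin 2 → I) (b : I), Function.update s 1 b = ![s 0, b] := by
      intro s b; funext j; fin_cases j <;> simp
    funext s
    simp only [GenLoop.transAt, GenLoop.coe_copy, Function.comp, hu, half1, half2]
    split_ifs <;> rfl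
  let Θ : π_ 2 Y y → Multiplicative ℤ := Quotient.lift (fun f => Multiplicative.ofAdd (dg f)) (fun f g h => by
    show Multiplicative.ofAdd _ = Multiplicative.ofAdd _
    rw [hdgh f g h])
  have hΘ : ∀ a b : π_ 2 Y y, Θ (a * b) = Θ a * Θ b := by
    intro a b
    induction a using Quotient.inductionOn with
    | h f =>
    induction b using Quotient.inductionOn with
    | h g =>
    have := HomotopyGroup.mul_spec (i := (1 : Fin 2)) (p := f) (q := g)
    refine (congrArg Θ this).trans ?_
    show Multiplicative.ofAdd (dg _) = Multiplicative.ofAdd (dg f) * Multiplicative.ofAdd (dg g)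
    rw [hmul, ← ofAdd_add, add_comm]
  let Φ : π_ 2 Y y →* Multiplicative ℤ := MonoidHom.mk' Θ hΘ
  have hinjΦ : Function.Injective Φ := by
    rw [injective_iff_map_eq_one]
    intro a ha
    induction a using Quotient.inductionOn with
    | h f =>
    have h0 : dg f = 0 := Multiplicative.ofAdd.injective (ha : Multiplicative.ofAdd (dg f) = Multiplicative.ofAdd 0)
    have h1 : BNull (φ ∘ f) := hD.deg_zero hdim (h0 ▸ hdg f)
    obtain ⟨y', h2⟩ := hinj f f.1.continuous f.2 h1
    exact Quotient.sound (null_of_BH (by norm_num) f h2)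
  obtain ⟨f, hf, hfb, hfn⟩ := hnt
  let fL : GenLoop (Fin 2) Y y := ⟨⟨f, hf⟩, hfb⟩
  let a : π_ 2 Y y := Quotient.mk _ fL
  have hΦa : dg fL ≠ 0 := by
    intro h0
    exact hfn (hD.deg_zero hdim (h0 ▸ hdg fL))
  have : IsCyclic (π_ 2 Y y) := isCyclic_of_injective Φ hinjΦ
  have : Infinite (π_ 2 Y y) := by
    refine Infinite.of_injective (fun n : ℤ => a ^ n) fun m n hmn => ?_
    have h := congrArg Φ hmn
    simp only [map_zpow] at h
    have h2 := congrArg Multiplicative.toAdd h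
    have h3 : Φ a = Multiplicative.ofAdd (dg fL) := rfl
    rw [h3, toAdd_zpow, toAdd_zpow, toAdd_ofAdd] at h2
    simpa [hΦa] using h2
  exact ⟨(intCyclicMulEquiv).symm⟩

end Degree

end

section
set_option autoImplicit false
open Topology
set_option linter.unusedSectionVars false
set_option linter.unusedSimpArgs false
set_option linter.unusedVariables false

section ProjConstr

lemma proj_same {𝕜 V : Type} [RCLike 𝕜] [NormedAddCommGroup V] [InnerProductSpace 𝕜 V] {a b : V} (hb : b ≠ 0) {c : 𝕜}
    (hc : c ≠ 0) (h : a = c • b) (v : V) :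
    (inner 𝕜 a v / inner 𝕜 a a) • a = (inner 𝕜 b v / inner 𝕜 b b) • b := by
  have hbb : inner 𝕜 b b ≠ (0 : 𝕜) := inner_self_ne_zero.2 hb
  have hcc : (starRingEnd 𝕜) c ≠ 0 := by simpa using hc
  rw [h, smul_smul]
  congr 1
  simp only [inner_smul_left, inner_smul_right]
  field_simp

/-- projective data from a compact parametrisation of lines -/
theorem exists_projData (𝕜 : Type) {V Q K : Type} [RCLike 𝕜] [NormedAddCommGroup V] [InnerProductSpace 𝕜 V] [NormedSpace ℝ V]
    [IsScalarTower ℝ 𝕜 V] [TopologicalSpace Q] [T2Space Q] [TopologicalSpace K] [CompactSpace K]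
    {p : K → V} {π : K → Q} (hp : Continuous p) (hπ : Continuous π) (hπs : Function.Surjective π) (hp0 : ∀ a, p a ≠ 0)
    (hpar : ∀ a b, π a = π b ↔ ∃ c : 𝕜, p a = c • p b)
    (hex : ∀ v : V, v ≠ 0 → ∃ a, ∃ c : 𝕜, v = c • p a) :
    ∃ D : ProjData V Q, Function.Surjective D.q ∧ (∀ v w, D.q v = D.q w → ∃ r : 𝕜, w.1 = r • v.1) ∧
      (∀ (r : 𝕜) v (h : r • v.1 ≠ 0), D.q ⟨r • v.1, h⟩ = D.q v) ∧ (∀ a v, (∃ c : 𝕜, v.1 = c • p a) → D.q v = π a) := by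
  classical
  have hQ : CompactSpace Q := ⟨by rw [← hπs.range_eq]; exact isCompact_range hπ⟩
  choose lf hlf using hπs
  let R : K → V → V := fun a v => (inner 𝕜 (p a) v / inner 𝕜 (p a) (p a) : 𝕜) • p a
  have hR : Continuous fun x : K × V => R x.1 x.2 := by
    have h1 : Continuous fun x : K × V => p x.1 := hp.comp continuous_fst
    exact ((h1.inner continuous_snd).div (h1.inner h1) fun x => inner_self_ne_zero.2 (hp0 _)).smul h1
  have hRR : ∀ a b, π a = π b → R a = R b := by
    intro a b h
    obtain ⟨c, hc⟩ := (hpar a b).1 h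
    have hc0 : c ≠ 0 := fun h0 => hp0 a (by rw [hc, h0, zero_smul])
    funext v
    exact proj_same (hp0 b) hc0 hc v
  let P : Q → V → V := fun y => R (lf y)
  have hPπ : ∀ a, P (π a) = R a := fun a => hRR _ _ (hlf _)
  have hPc : Continuous fun x : Q × V => P x.1 x.2 := by
    have hpm : IsProperMap (Prod.map π (id : V → V)) := (hπ.isProperMap).prodMap isProperMap_id
    have hsj : Function.Surjective (Prod.map π (id : V → V)) :=
      Function.Surjective.prodMap (fun y => ⟨lf y, hlf y⟩) Function.surjective_id
    have hqm : IsQuotientMap (Prod.map π (id : V → V)) := hpm.isClosedMap.isQuotientMap hpm.continuous hsj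
    rw [hqm.continuous_iff]
    refine hR.congr fun x => ?_
    simp [hPπ]
  have hself : ∀ a (c : 𝕜), R a (c • p a) = c • p a := by
    intro a c
    have hbb : inner 𝕜 (p a) (p a) ≠ (0 : 𝕜) := inner_self_ne_zero.2 (hp0 a)
    simp only [R, inner_smul_right]
    rw [mul_div_assoc, div_self hbb, mul_one]
  have hexv : ∀ v : {v : V // v ≠ 0}, ∃ a, ∃ c : 𝕜, v.1 = c • p a := fun v => hex v.1 v.2
  choose qa qc hqa using hexv
  let q : {v : V // v ≠ 0} → Q := fun v => π (qa v)
  have hqu : ∀ a (v : {v : V // v ≠ 0}), (∃ c : 𝕜, v.1 = c • p a) → q v = π a := by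
    rintro a v ⟨c, hc⟩
    have hc0 : qc v ≠ 0 := fun h0 => v.2 (by rw [hqa v, h0, zero_smul])
    refine (hpar _ _).2 ⟨(qc v)⁻¹ * c, ?_⟩
    rw [mul_smul, ← hc, hqa v, smul_smul, inv_mul_cancel₀ hc0, one_smul]
  have hqP : ∀ y (v : {v : V // v ≠ 0}), P y v.1 = v.1 ↔ q v = y := by
    intro y v
    constructor
    · intro h
      rw [← hlf y]
      exact hqu _ _ ⟨_, h.symm⟩
    · rintro rfl
      rw [hPπ, hqa v]
      convert hself (qa v) (qc v)
  have hqc : Continuous q := by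
    rw [continuous_iff_isClosed]
    intro C hC
    have hcl : IsClosed {x : {v : V // v ≠ 0} × Q | x.2 ∈ C ∧ P x.2 x.1.1 = x.1.1} :=
      (hC.preimage continuous_snd).inter (isClosed_eq
        (hPc.comp (continuous_snd.prodMk (continuous_subtype_val.comp continuous_fst))) (continuous_subtype_val.comp continuous_fst))
    have := isClosedMap_fst_of_compactSpace _ hcl
    convert this using 1
    ext v
    simp only [Set.mem_preimage, Set.mem_image, Set.mem_ofPred_eq, Prod.exists]
    constructor
    · intro h; exact ⟨v, q v, ⟨h, (hqP _ _).2 rfl⟩, rfl⟩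
    · rintro ⟨v', y, ⟨h1, h2⟩, rfl⟩
      rw [(hqP _ _).1 h2]; exact h1
  refine ⟨⟨q, P, hqc, hPc, fun v => (hqP _ _).2 rfl, ?_, ?_⟩, ?_, ?_, ?_, ?_⟩
  · intro y v h
    have h2 := hqu (lf y) ⟨P y v, h⟩ ⟨_, rfl⟩
    rw [h2, hlf]
  · intro y r v
    simp only [P, R]
    have h1 : ∀ w : V, r • w = (r • (1 : 𝕜)) • w := fun w => by rw [smul_assoc, one_smul]
    rw [h1 v, h1 (_ • _), inner_smul_right, smul_smul, mul_div_assoc]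
  · intro y
    exact ⟨⟨p (lf y), hp0 _⟩, (hqu _ _ ⟨1, (one_smul _ _).symm⟩).trans (hlf y)⟩
  · intro v w h
    obtain ⟨c, hc⟩ := (hpar _ _).1 h
    have hc0 : c ≠ 0 := fun h0 => hp0 (qa v) (by rw [hc, h0, zero_smul])
    have hv0 : qc v ≠ 0 := fun h0 => v.2 (by rw [hqa v, h0, zero_smul])
    refine ⟨qc w * c⁻¹ * (qc v)⁻¹, ?_⟩
    have e1 : p (qa w) = c⁻¹ • p (qa v) := by rw [hc, smul_smul, inv_mul_cancel₀ hc0, one_smul]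
    have e2 : p (qa v) = (qc v)⁻¹ • v.1 := by
      conv_rhs => rw [hqa v]
      rw [smul_smul, inv_mul_cancel₀ hv0, one_smul]
    conv_lhs => rw [hqa w]
    rw [e1, e2, smul_smul, smul_smul, mul_assoc]
  · intro r v h
    exact hqu _ _ ⟨r * qc v, by rw [mul_smul, ← hqa v]⟩
  · exact hqu

end ProjConstr

end

section
set_option autoImplicit false
open Topology
set_option linter.unusedSectionVars false
set_option linter.unusedSimpArgs false
set_option linter.unusedVariables false

section CPn
open Polynomial

/-- linear form -/
def linF (x : ℂ × ℂ) : ℂ[X] := C x.1 * X + C x.2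

/-- unit vectors of `ℂ²` (sup norm) -/
abbrev S3 : Type := Metric.sphere (0 : ℂ × ℂ) 1

lemma linF_smul (c : ℂ) (x : ℂ × ℂ) : linF (c • x) = C c * linF x := by
  simp [linF]; ring

lemma linF_ne {x : ℂ × ℂ} (hx : x ≠ 0) : linF x ≠ 0 := by
  intro h
  apply hx
  have h1 := congrArg (fun p => coeff p 1) h
  have h0 := congrArg (fun p => coeff p 0) h
  simp [linF] at h1 h0
  exact Prod.ext h1 h0

lemma S3_ne (x : S3) : x.1 ≠ 0 := by
  have h := x.2
  intro h0
  rw [h0] at h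
  simp at h

lemma par_of {x y : ℂ × ℂ} (hx : x ≠ 0) (hy : y ≠ 0) (h : x.1 * y.2 = y.1 * x.2) : ∃ d : ℂ, d ≠ 0 ∧ x = d • y := by
  by_cases h1 : y.1 = 0
  · have h2 : y.2 ≠ 0 := fun h2 => hy (Prod.ext h1 h2)
    have h3 : x.1 = 0 := by
      rw [h1, zero_mul] at h
      exact (mul_eq_zero.1 h).resolve_right h2
    have h4 : x.2 ≠ 0 := fun h4 => hx (Prod.ext h3 h4)
    refine ⟨x.2 / y.2, div_ne_zero h4 h2, Prod.ext ?_ ?_⟩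
    · simp [h1, h3]
    · simp [h2]
  · have h3 : x.1 ≠ 0 := by
      intro h3
      rw [h3, zero_mul] at h
      exact hx (Prod.ext h3 ((mul_eq_zero.1 h.symm).resolve_left h1))
    refine ⟨x.1 / y.1, div_ne_zero h3 h1, Prod.ext ?_ ?_⟩
    · simp [h1]
    · simp only [Prod.smul_snd, smul_eq_mul]
      field_simp
      linear_combination -h

def S3n (x : ℂ × ℂ) (hx : x ≠ 0) : S3 := ⟨((‖x‖⁻¹ : ℝ) : ℂ) • x, by
  have : ‖x‖ ≠ 0 := norm_ne_zero_iff.2 hx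
  simp [norm_smul, this]⟩

lemma lin_unique {Z : Type} {h : S3 → Z} (hh : ∀ x y : S3, x.1.1 * y.1.2 = y.1.1 * x.1.2 → h x = h y) (s : Multiset S3) :
    ∀ (t : Multiset S3) (c : ℂ), c ≠ 0 → s.card = t.card →
      C c * (s.map fun x => linF x.1).prod = (t.map fun x => linF x.1).prod → s.map h = t.map h := by
  induction s using Multiset.induction_on with
  | empty =>
    intro t c _ hcard _
    have : t = 0 := Multiset.card_eq_zero.1 hcard.symm
    rw [this]
  | cons u s ih =>
    intro t c hc hcard heq
    have hex : ∃ u' ∈ t, u.1.1 * u'.1.2 = u'.1.1 * u.1.2 := by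
      by_cases hu : u.1.1 = 0
      · by_contra hno
        push Not at hno
        have hne : ∀ u' ∈ t, u'.1.1 ≠ 0 := by
          intro u' hu' h0
          exact hno u' hu' (by rw [hu, h0]; simp)
        have hd : (t.map fun x => linF x.1).prod.natDegree = t.card := by
          rw [natDegree_multiset_prod]
          · rw [Multiset.map_map, Multiset.map_congr rfl (g := fun _ => 1)]
            · simp
            · intro x hx
              exact natDegree_linear (hne x hx)
          · intro h0
            obtain ⟨x, hx, hx0⟩ := Multiset.mem_map.1 h0
            exact linF_ne (S3_ne x) hx0
        rw [← heq, ← hcard, Multiset.card_cons, Multiset.map_cons, Multiset.prod_cons] at hd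
        have h1 : linF u.1 = C u.1.2 := by simp [linF, hu]
        have h2 : ((s.map fun x : S3 => linF x.1).prod).natDegree ≤ s.card := by
          refine (natDegree_multiset_prod_le _).trans ?_
          rw [Multiset.map_map]
          refine (Multiset.sum_le_card_nsmul _ 1 ?_).trans ?_
          · intro x hx
            obtain ⟨y, _, rfl⟩ := Multiset.mem_map.1 hx
            exact natDegree_linear_le
          · simp
        rw [h1, ← mul_assoc, ← C_mul] at hd
        have := natDegree_C_mul_le (c * u.1.2) ((s.map fun x : S3 => linF x.1).prod)
        omega
      · have he := congrArg (eval (-u.1.2 / u.1.1)) heq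
        have h0 : eval (-u.1.2 / u.1.1) (linF u.1) = 0 := by
          simp [linF]; field_simp; ring
        rw [Multiset.map_cons, Multiset.prod_cons, eval_mul, eval_mul, h0, zero_mul, mul_zero, eval_multiset_prod] at he
        have := Multiset.prod_eq_zero_iff.1 he.symm
        rw [Multiset.map_map] at this
        obtain ⟨u', hu', h1⟩ := Multiset.mem_map.1 this
        refine ⟨u', hu', ?_⟩
        simp [linF] at h1
        field_simp at h1
        linear_combination h1
    obtain ⟨u', hu', hpar⟩ := hex
    obtain ⟨t', rfl⟩ := Multiset.exists_cons_of_mem hu'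
    obtain ⟨d, hd, hdu⟩ := par_of (S3_ne u) (S3_ne u') hpar
    rw [Multiset.map_cons, Multiset.map_cons, hh u u' hpar]
    congr 1
    refine ih t' (c * d) (mul_ne_zero hc hd) (by simpa using hcard) ?_
    apply mul_left_cancel₀ (linF_ne (S3_ne u'))
    rw [Multiset.map_cons, Multiset.map_cons, Multiset.prod_cons, Multiset.prod_cons, hdu, linF_smul] at heq
    rw [← heq, C_mul]; ring

lemma lin_exists (k : ℕ) : ∀ f : ℂ[X], f.natDegree ≤ k →
    ∃ s : Multiset S3, s.card = k ∧ ∃ c : ℂ, f = C c * (s.map fun x => linF x.1).prod := by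
  induction k with
  | zero =>
    intro f hf
    refine ⟨0, rfl, f.coeff 0, ?_⟩
    simpa using eq_C_of_natDegree_le_zero hf
  | succ k ih =>
    intro f hf
    by_cases h0 : f.natDegree = 0
    · obtain ⟨s, hs, c, hc⟩ := ih f (by omega)
      refine ⟨⟨(0, 1), by simp⟩ ::ₘ s, by simp [hs], c, ?_⟩
      rw [Multiset.map_cons, Multiset.prod_cons]
      simpa [linF] using hc
    · obtain ⟨r, hr⟩ := IsAlgClosed.exists_root f (fun h => h0 (natDegree_eq_of_degree_eq_some h))
      obtain ⟨g, hg⟩ := dvd_iff_isRoot.2 hr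
      have hf0 : f ≠ 0 := fun h => h0 (by simp [h])
      have hg0 : g ≠ 0 := by rintro rfl; simp at hg; exact hf0 hg
      have hdeg : g.natDegree ≤ k := by
        rw [hg, natDegree_mul (X_sub_C_ne_zero r) hg0, natDegree_X_sub_C] at hf
        omega
      obtain ⟨s, hs, c, hc⟩ := ih g hdeg
      have hx : ((1 : ℂ), -r) ≠ 0 := by simp
      have hx2 : ((‖((1 : ℂ), -r)‖⁻¹ : ℝ) : ℂ) ≠ 0 := by
        exact_mod_cast inv_ne_zero (norm_ne_zero_iff.2 hx)
      refine ⟨S3n (1, -r) hx ::ₘ s, by simp [hs], (((‖((1 : ℂ), -r)‖⁻¹ : ℝ) : ℂ))⁻¹ * c, ?_⟩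
      rw [Multiset.map_cons, Multiset.prod_cons]
      have : linF (S3n (1, -r) hx).1 = C ((‖((1 : ℂ), -r)‖⁻¹ : ℝ) : ℂ) * (X - C r) := by
        show linF (_ • _) = _
        rw [linF_smul]; simp [linF, sub_eq_add_neg]
      rw [this, hg, hc]
      generalize ((‖((1 : ℂ), -r)‖⁻¹ : ℝ) : ℂ) = μ at hx2
      have : C μ * C μ⁻¹ = (1 : ℂ[X]) := by rw [← C_mul, mul_inv_cancel₀ hx2, C_1]
      rw [C_mul]
      linear_combination (-(X - C r) * C c * (Multiset.map (fun x : S3 => linF x.1) s).prod) * this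

/-- coefficient vector -/
def cvec (d : ℕ) (f : ℂ[X]) : EuclideanSpace ℂ (Fin (d + 1)) := WithLp.toLp 2 fun i => f.coeff i

lemma cvec_inj {d : ℕ} {f g : ℂ[X]} (hf : f.natDegree ≤ d) (hg : g.natDegree ≤ d) (h : cvec d f = cvec d g) : f = g := by
  ext n
  by_cases hn : n ≤ d
  · exact congrArg (fun v : EuclideanSpace ℂ (Fin (d + 1)) => v ⟨n, by omega⟩) h
  · rw [coeff_eq_zero_of_natDegree_lt (by omega), coeff_eq_zero_of_natDegree_lt (by omega)]

lemma cvec_smul (d : ℕ) (c : ℂ) (f : ℂ[X]) : cvec d (C c * f) = c • cvec d f := by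
  ext i; simp [cvec]

lemma cvec_surj {d : ℕ} (v : EuclideanSpace ℂ (Fin (d + 1))) : ∃ f : ℂ[X], f.natDegree ≤ d ∧ cvec d f = v := by
  refine ⟨∑ i : Fin (d + 1), C (v i) * X ^ (i : ℕ), ?_, ?_⟩
  · refine natDegree_sum_le_of_forall_le _ _ fun i _ => (natDegree_C_mul_X_pow_le _ _).trans (by omega)
  · ext j
    simp only [cvec, finsetSum_coeff, coeff_C_mul, coeff_X_pow]
    simp [Fin.val_inj]

lemma continuous_coeff_prod {A : Type} [TopologicalSpace A] {ι : Type} (s : Finset ι) (f : A → ι → ℂ[X])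
    (hf : ∀ i n, Continuous fun a => (f a i).coeff n) (n : ℕ) : Continuous fun a => (∏ i ∈ s, f a i).coeff n := by
  classical
  induction s using Finset.induction_on generalizing n with
  | empty => simpa using continuous_const
  | insert i s hi ih =>
    simp only [Finset.prod_insert hi, coeff_mul]
    exact continuous_finsetSum _ fun x _ => (hf i x.1).mul (ih x.2)

lemma continuous_cvec {A : Type} [TopologicalSpace A] {d : ℕ} {f : A → ℂ[X]} (hf : ∀ n, Continuous fun a => (f a).coeff n) :
    Continuous fun a => cvec d (f a) :=
  (PiLp.continuous_toLp 2 _).comp (continuous_pi fun i => hf i)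

lemma linF_deg (x : ℂ × ℂ) : (linF x).natDegree ≤ 1 := natDegree_linear_le

lemma prod_lin_deg {k : ℕ} (s : Fin k → S3) : (∏ i, linF (s i).1).natDegree ≤ k := by
  refine (natDegree_prod_le _ _).trans ((Finset.sum_le_card_nsmul _ _ 1 fun i _ => linF_deg _).trans (by simp))

/-- Symmetric products of the sphere are projective spaces. -/
theorem cp_data {Z : Type} [TopologicalSpace Z] [T2Space Z] [NormalSpace Z] {h : S3 → Z} (hc : Continuous h) (hsur : Function.Surjective h)
    (hh : ∀ x y : S3, h x = h y ↔ x.1.1 * y.1.2 = y.1.1 * x.1.2) (k : ℕ) :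
    ∃ D : ProjData (EuclideanSpace ℂ (Fin (k + 1))) {m : Multiset Z // m.card = k}, D.IsCx ∧
      ∀ (s : Fin k → S3) (v : {v : EuclideanSpace ℂ (Fin (k + 1)) // v ≠ 0}),
        (∃ c : ℂ, v.1 = c • cvec k (∏ i, linF (s i).1)) → (D.q v).1 = msk k (h ∘ s) := by
  let p : (Fin k → S3) → EuclideanSpace ℂ (Fin (k + 1)) := fun s => cvec k (∏ i, linF (s i).1)
  let π : (Fin k → S3) → {m : Multiset Z // m.card = k} := fun s => ⟨msk k (h ∘ s), by simp [msk]⟩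
  have hp : Continuous p := by
    refine continuous_cvec fun n => continuous_coeff_prod _ _ ?_ n
    intro i n
    have h1 : Continuous fun a : Fin k → S3 => (a i).1 := continuous_subtype_val.comp (continuous_apply i)
    simp only [linF, coeff_add, coeff_C_mul, coeff_C, coeff_X]
    split_ifs <;> fun_prop
  have hπ : Continuous π := ((continuous_msk k).comp (continuous_pi fun i => hc.comp (continuous_apply i))).subtype_mk _
  have hπs : Function.Surjective π := by
    intro m
    obtain ⟨z, hz⟩ := msk_surj' m.1 m.2
    choose l hl using hsur
    refine ⟨l ∘ z, Subtype.ext ?_⟩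
    rw [← hz]
    show msk k (h ∘ l ∘ z) = _
    congr 1; funext i; exact hl _
  have hne : ∀ s : Fin k → S3, (∏ i, linF (s i).1) ≠ 0 := fun s => Finset.prod_ne_zero_iff.2 fun i _ => linF_ne (S3_ne _)
  have hp0 : ∀ s, p s ≠ 0 := by
    intro s hs
    apply hne s
    refine cvec_inj (d := k) (prod_lin_deg s) (by simp) ?_
    show p s = _
    rw [hs]; ext i; simp [cvec]
  have hprod : ∀ s : Fin k → S3, ((msk k s).map fun x => linF x.1).prod = ∏ i, linF (s i).1 := by
    intro s; simp only [msk, Multiset.map_map]; rfl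
  have hmap : ∀ s : Fin k → S3, (msk k s).map h = msk k (h ∘ s) := by
    intro s; simp only [msk, Multiset.map_map]
  obtain ⟨D, h1, h2, h3, h4⟩ := exists_projData ℂ (V := EuclideanSpace ℂ (Fin (k + 1))) (p := p) (π := π) hp hπ hπs hp0 (by
    intro a b
    constructor
    · intro hab
      have hab' : msk k (h ∘ a) = msk k (h ∘ b) := congrArg Subtype.val hab
      obtain ⟨e, he⟩ := (msk_eq_iff _ _).1 hab'
      have hpar : ∀ i, ∃ d : ℂ, d ≠ 0 ∧ (a i).1 = d • (b (e i)).1 := fun i =>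
        par_of (S3_ne _) (S3_ne _) ((hh _ _).1 (congrFun he i))
      choose d hd hda using hpar
      refine ⟨∏ i, d i, ?_⟩
      show cvec k _ = _ • cvec k _
      rw [← cvec_smul]
      congr 1
      simp only [hda, linF_smul]
      rw [Finset.prod_mul_distrib, map_prod, Equiv.prod_comp e (fun i => linF (b i).1)]
    · rintro ⟨c, hcab⟩
      have hc0 : c ≠ 0 := fun h0 => hp0 a (by rw [hcab, h0, zero_smul])
      have hE : ∏ i, linF (a i).1 = C c * ∏ i, linF (b i).1 := by
        refine cvec_inj (prod_lin_deg a) ((natDegree_C_mul_le _ _).trans (prod_lin_deg b)) ?_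
        rw [cvec_smul]; exact hcab
      apply Subtype.ext
      show msk k (h ∘ a) = msk k (h ∘ b)
      rw [← hmap, ← hmap]
      symm
      refine lin_unique (fun x y => (hh x y).2) _ _ c hc0 (by simp [msk]) ?_
      rw [hprod, hprod, hE]) (by
    intro v hv
    obtain ⟨f, hf, rfl⟩ := cvec_surj v
    obtain ⟨s, hs, c, hfc⟩ := lin_exists k f hf
    obtain ⟨z, rfl⟩ := msk_surj' s hs
    refine ⟨z, c, ?_⟩
    rw [hfc, hprod, cvec_smul])
  exact ⟨D, ⟨h1, h2, h3⟩, fun s v hv => congrArg Subtype.val (h4 s v hv)⟩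

lemma finrank_cp (k : ℕ) : Module.finrank ℝ (EuclideanSpace ℂ (Fin (k + 1))) = 2 * (k + 1) := by
  have h := Module.finrank_mul_finrank ℝ ℂ (EuclideanSpace ℂ (Fin (k + 1)))
  simp at h
  omega

end CPn

end

section
set_option autoImplicit false
open Topology
set_option linter.unusedSectionVars false
set_option linter.unusedSimpArgs false
set_option linter.unusedVariables false

section Hopf
open Polynomial ComplexConjugate

abbrev S2 : Type := Metric.sphere (0 : EuclideanSpace ℝ (Fin 3)) 1

def hN (x : ℂ × ℂ) : ℝ := Complex.normSq x.1 + Complex.normSq x.2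

lemma hN_pos {x : ℂ × ℂ} (hx : x ≠ 0) : 0 < hN x := by
  by_contra h
  have h1 := Complex.normSq_nonneg x.1
  have h2 := Complex.normSq_nonneg x.2
  unfold hN at h
  push Not at h
  have h3 : Complex.normSq x.1 = 0 := by linarith
  have h4 : Complex.normSq x.2 = 0 := by linarith
  exact hx (Prod.ext (Complex.normSq_eq_zero.1 h3) (Complex.normSq_eq_zero.1 h4))

def hopfV (x : ℂ × ℂ) : EuclideanSpace ℝ (Fin 3) :=
  !₂[2 * (x.1 * conj x.2).re / hN x, 2 * (x.1 * conj x.2).im / hN x, (Complex.normSq x.1 - Complex.normSq x.2) / hN x]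

lemma mem_S2 {a b c : ℝ} : !₂[a, b, c] ∈ Metric.sphere (0 : EuclideanSpace ℝ (Fin 3)) 1 ↔ a ^ 2 + b ^ 2 + c ^ 2 = 1 := by
  rw [mem_sphere_zero_iff_norm, EuclideanSpace.norm_eq, Real.sqrt_eq_one]
  simp [Fin.sum_univ_three]

def hopf (x : S3) : S2 := ⟨hopfV x.1, by
  have h := (hN_pos (S3_ne x)).ne'
  rw [hopfV, mem_S2]
  field_simp
  simp only [hN, Complex.normSq_apply, Complex.mul_re, Complex.mul_im, Complex.conj_re, Complex.conj_im]
  ring⟩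

lemma hopf_eq (x y : S3) : hopf x = hopf y ↔ x.1.1 * y.1.2 = y.1.1 * x.1.2 := by
  have hx := (hN_pos (S3_ne x)).ne'
  have hy := (hN_pos (S3_ne y)).ne'
  constructor
  · intro h
    have h := congrArg Subtype.val h
    have e0 : 2 * (x.1.1 * conj x.1.2).re / hN x.1 = 2 * (y.1.1 * conj y.1.2).re / hN y.1 :=
      congrArg (fun v : EuclideanSpace ℝ (Fin 3) => v 0) h
    have e1 : 2 * (x.1.1 * conj x.1.2).im / hN x.1 = 2 * (y.1.1 * conj y.1.2).im / hN y.1 :=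
      congrArg (fun v : EuclideanSpace ℝ (Fin 3) => v 1) h
    have e2 : (Complex.normSq x.1.1 - Complex.normSq x.1.2) / hN x.1 = (Complex.normSq y.1.1 - Complex.normSq y.1.2) / hN y.1 :=
      congrArg (fun v : EuclideanSpace ℝ (Fin 3) => v 2) h
    have f1 : (hN y.1 : ℂ) * (x.1.1 * conj x.1.2) = hN x.1 * (y.1.1 * conj y.1.2) := by
      apply Complex.ext
      · rw [Complex.re_ofReal_mul, Complex.re_ofReal_mul]
        field_simp at e0; linarith
      · rw [Complex.im_ofReal_mul, Complex.im_ofReal_mul]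
        field_simp at e1; linarith
    have f2 : hN y.1 * Complex.normSq x.1.1 = hN x.1 * Complex.normSq y.1.1 := by
      field_simp at e2
      simp only [hN] at e2 ⊢
      linarith
    have hxc : (hN x.1 : ℂ) ≠ 0 := by exact_mod_cast hx
    have hyc : (hN y.1 : ℂ) ≠ 0 := by exact_mod_cast hy
    by_cases hx1 : x.1.1 = 0
    · rw [hx1] at f2
      have : y.1.1 = 0 := by
        simp [hx] at f2; exact f2
      rw [hx1, this]; simp
    · have hy1 : y.1.1 ≠ 0 := by
        intro h0; rw [h0] at f2; simp [hy] at f2; exact hx1 f2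
      have f2' : (hN y.1 : ℂ) * (x.1.1 * conj x.1.1) = hN x.1 * (y.1.1 * conj y.1.1) := by
        rw [Complex.mul_conj, Complex.mul_conj]; exact_mod_cast f2
      have key : conj x.1.1 * conj y.1.2 = conj y.1.1 * conj x.1.2 := by
        have : (hN y.1 : ℂ) * hN x.1 * x.1.1 * y.1.1 * (conj x.1.1 * conj y.1.2) =
            (hN y.1 : ℂ) * hN x.1 * x.1.1 * y.1.1 * (conj y.1.1 * conj x.1.2) := by
          linear_combination hN x.1 * y.1.1 * conj y.1.2 * f2' - hN x.1 * y.1.1 * conj y.1.1 * f1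
        exact mul_left_cancel₀ (by positivity) this
      have := congrArg conj key
      simpa using this
  · intro h
    obtain ⟨d, hd, hdx⟩ := par_of (S3_ne x) (S3_ne y) h
    apply Subtype.ext
    show hopfV x.1 = hopfV y.1
    have hdn : Complex.normSq d ≠ 0 := fun h => hd (Complex.normSq_eq_zero.1 h)
    have h1 : x.1.1 * conj x.1.2 = Complex.normSq d * (y.1.1 * conj y.1.2) := by
      rw [hdx, ← Complex.mul_conj]; simp; ring
    have h2 : Complex.normSq x.1.1 = Complex.normSq d * Complex.normSq y.1.1 := by rw [hdx]; simp
    have h3 : Complex.normSq x.1.2 = Complex.normSq d * Complex.normSq y.1.2 := by rw [hdx]; simp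
    have h4 : hN x.1 = Complex.normSq d * hN y.1 := by unfold hN; rw [h2, h3]; ring
    unfold hopfV
    rw [h1, h2, h3, h4, Complex.re_ofReal_mul, Complex.im_ofReal_mul]
    congr 1
    funext i
    fin_cases i <;> (simp; field_simp)

lemma hopf_S3n (x : ℂ × ℂ) (hx : x ≠ 0) : (hopf (S3n x hx)).1 = hopfV x := by
  show hopfV (_ • _) = _
  have hr : ‖x‖⁻¹ ≠ 0 := inv_ne_zero (norm_ne_zero_iff.2 hx)
  generalize ‖x‖⁻¹ = r at hr
  have hN' := (hN_pos hx).ne'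
  have h4 : hN ((r : ℂ) • x) = r ^ 2 * hN x := by unfold hN; simp; ring
  unfold hopfV
  rw [h4]
  congr 1
  funext i
  fin_cases i <;> (simp; field_simp)

lemma hopf_surj : Function.Surjective hopf := by
  intro z
  have hz : (z.1 0) ^ 2 + (z.1 1) ^ 2 + (z.1 2) ^ 2 = 1 := by
    have hz1 : z.1 = !₂[z.1 0, z.1 1, z.1 2] := by
      ext i; fin_cases i <;> rfl
    rw [← mem_S2, ← hz1]
    exact z.2
  generalize ha : z.1 0 = a at hz
  generalize hb : z.1 1 = b at hz
  generalize hc : z.1 2 = c at hz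
  have hz' : z.1 = !₂[a, b, c] := by
    ext i; fin_cases i <;> simp [ha, hb, hc]
  by_cases h : c = -1
  · have h0 : a = 0 := by nlinarith
    have h1 : b = 0 := by nlinarith
    refine ⟨S3n (0, 1) (by simp), Subtype.ext ?_⟩
    rw [hopf_S3n, hz', hopfV, h0, h1, h]
    simp [hN]
  · have h1 : 1 + c ≠ 0 := fun h2 => h (by linarith)
    have hx : (((1 + c : ℝ) : ℂ), (⟨a, -b⟩ : ℂ)) ≠ 0 := by
      intro h2
      have h3 : ((1 + c : ℝ) : ℂ) = 0 := congrArg Prod.fst h2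
      exact h1 (by exact_mod_cast h3)
    refine ⟨S3n _ hx, Subtype.ext ?_⟩
    have hN2 : hN (((1 + c : ℝ) : ℂ), (⟨a, -b⟩ : ℂ)) = 2 * (1 + c) := by
      simp only [hN, Complex.normSq_apply, Complex.ofReal_re, Complex.ofReal_im]; linarith
    rw [hopf_S3n, hz', hopfV, hN2]
    simp only [Complex.normSq_apply, Complex.mul_re, Complex.mul_im, Complex.conj_re, Complex.conj_im, Complex.ofReal_re, Complex.ofReal_im]
    congr 1
    funext i
    fin_cases i
    · simp; field_simp
    · simp; field_simp
    · simp; field_simp; linarith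

lemma continuousOn_hopfV : ContinuousOn hopfV {x | x ≠ 0} := by
  have h1 : ContinuousOn hN {x | x ≠ 0} := by
    unfold hN
    exact ((Complex.continuous_normSq.comp continuous_fst).add (Complex.continuous_normSq.comp continuous_snd)).continuousOn
  have h2 : ∀ x ∈ {x : ℂ × ℂ | x ≠ 0}, hN x ≠ 0 := fun x hx => (hN_pos hx).ne'
  have c1 : Continuous fun x : ℂ × ℂ => x.1 * conj x.2 := continuous_fst.mul (Complex.continuous_conj.comp continuous_snd)
  refine (PiLp.continuous_toLp 2 _).comp_continuousOn (continuousOn_pi.2 fun i => ?_)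
  fin_cases i
  · exact ((Complex.continuous_re.comp c1).const_mul 2).continuousOn.div h1 h2
  · exact ((Complex.continuous_im.comp c1).const_mul 2).continuousOn.div h1 h2
  · exact ((Complex.continuous_normSq.comp continuous_fst).sub (Complex.continuous_normSq.comp continuous_snd)).continuousOn.div h1 h2

/-- the point at infinity -/
def S2inf : S2 := hopf ⟨(0, 1), by simp⟩

/-- the Hopf map on nonzero vectors -/
def hopf0 (x : {x : ℂ × ℂ // x ≠ 0}) : S2 := hopf (S3n x.1 x.2)

lemma continuous_hopf0 : Continuous hopf0 := by
  refine Continuous.subtype_mk ?_ _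
  refine (continuousOn_iff_continuous_domRestrict.1 continuousOn_hopfV).congr fun x => ?_
  exact (hopf_S3n x.1 x.2).symm

lemma hopf0_eq (x y : {x : ℂ × ℂ // x ≠ 0}) : hopf0 x = hopf0 y ↔ x.1.1 * y.1.2 = y.1.1 * x.1.2 := by
  rw [hopf0, hopf0, hopf_eq]
  have h1 : ((‖x.1‖⁻¹ : ℝ) : ℂ) ≠ 0 := by exact_mod_cast inv_ne_zero (norm_ne_zero_iff.2 x.2)
  have h2 : ((‖y.1‖⁻¹ : ℝ) : ℂ) ≠ 0 := by exact_mod_cast inv_ne_zero (norm_ne_zero_iff.2 y.2)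
  simp only [S3n, Prod.smul_fst, Prod.smul_snd, smul_eq_mul]
  generalize ((‖x.1‖⁻¹ : ℝ) : ℂ) = r at *
  generalize ((‖y.1‖⁻¹ : ℝ) : ℂ) = u at *
  constructor
  · intro h
    have : r * u * (x.1.1 * y.1.2) = r * u * (y.1.1 * x.1.2) := by linear_combination h
    exact mul_left_cancel₀ (mul_ne_zero h1 h2) this
  · intro h
    linear_combination (r * u) * h

lemma hopf0_surj : Function.Surjective hopf0 := by
  intro z
  obtain ⟨x, rfl⟩ := hopf_surj z
  refine ⟨⟨x.1, S3_ne x⟩, (hopf_eq _ _).2 ?_⟩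
  simp [S3n]

lemma hopf0_inf (x : {x : ℂ × ℂ // x ≠ 0}) (h : x.1.1 = 0) : hopf0 x = S2inf := by
  rw [hopf0, S2inf, hopf_eq]
  simp [S3n, h]

lemma continuous_hopf : Continuous hopf := by
  refine (continuous_hopf0.comp (f := fun x : S3 => (⟨x.1, S3_ne x⟩ : {x : ℂ × ℂ // x ≠ 0})) (by fun_prop)).congr fun x => ?_
  refine (hopf_eq _ _).2 ?_
  simp [S3n]

end Hopf

end

section
set_option autoImplicit false
open Topology
set_option linter.unusedSectionVars false
set_option linter.unusedSimpArgs false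
set_option linter.unusedVariables false

section SphereResults
open Polynomial

variable {X : Type} [TopologicalSpace X]

lemma BNull_sub_iff {i n : ℕ} {f : (Fin i → I) → {m : Multiset X // m.card = n}} : BNull (fun s => (f s).1) ↔ BNull f := by
  constructor
  · rintro ⟨y, H, hH, h0, h1, hb⟩
    have hc : ∀ p, (H p).card = n := BH_card (f := fun s => (f s).1) (g := fun s => (f s).1) hH (fun s => by rw [h0]; exact (f s).2)
    refine ⟨⟨y, ?_⟩, fun p => ⟨H p, hc p⟩, hH.subtype_mk _, fun s => Subtype.ext (h0 s), fun s => Subtype.ext (h1 s),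
      fun t s hs s' hs' => Subtype.ext (hb t s hs s' hs')⟩
    have := hc (1, fun _ => 0)
    rwa [h1] at this
  · intro h
    exact h.comp continuous_subtype_val

theorem cp_null {d k : ℕ} (hd : 3 ≤ d) (hdk : d < k) {f : (Fin d → I) → Multiset S2} (hf : Continuous f)
    (hc : ∀ s, (f s).card = k) (hb : ∀ s ∈ Cube.boundary (Fin d), f s = f (fun _ => 0)) : BNull f := by
  obtain ⟨D, hD, _⟩ := cp_data continuous_hopf hopf_surj hopf_eq k
  obtain ⟨i, rfl⟩ : ∃ i, d = i + 1 := ⟨d - 1, by omega⟩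
  refine (BNull_sub_iff (f := fun s => ⟨f s, hc s⟩)).2 ?_
  refine hD.null (by omega) (by rw [finrank_cp]; omega) (hf.subtype_mk _) ?_
  intro s hs
  exact Subtype.ext (hb s hs)

theorem ProjData.IsCx.deg_null {V Q : Type} [NormedAddCommGroup V] [TopologicalSpace Q] [InnerProductSpace ℂ V] [FiniteDimensional ℂ V]
    {D : ProjData V Q} (hD : D.IsCx) {f : (Fin 2 → I) → Q} {k : ℤ} (hk : D.IsDeg f k) (h : BNull f) : k = 0 := by
  obtain ⟨y, hy⟩ := h
  obtain ⟨l, h1, h2⟩ := hD.deg_BH hy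
  obtain ⟨v, hv⟩ := hD.hs y
  have h3 : D.IsDeg (fun _ => y) 0 :=
    ⟨v, fun _ => v, fun _ => 0, continuous_const, fun _ _ => hv, fun _ => rfl, fun _ => rfl, fun _ => rfl, continuous_const,
      fun _ => by simp, by simp⟩
  rw [hD.deg_unique hk h1, hD.deg_unique h2 h3]

def genV (p : I × I) : ℂ × ℂ :=
  (((p.1 : ℝ) * (1 - p.1) * p.2 * (1 - p.2) : ℝ), 1 - (p.1 : ℝ) + (p.1 : ℝ) * Complex.exp (((p.2 : ℝ) : ℂ) * (2 * Real.pi * Complex.I)))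

lemma genV_left (b : I) : genV (0, b) = (0, 1) := by simp [genV]
lemma genV_bot (a : I) : genV (a, 0) = (0, 1) := by simp [genV]
lemma genV_top (a : I) : genV (a, 1) = (0, 1) := by simp [genV]
lemma genV_right (b : I) : genV (1, b) = (0, Complex.exp (((b : ℝ) : ℂ) * (2 * Real.pi * Complex.I))) := by simp [genV]

lemma genV_ne (p : I × I) : genV p ≠ 0 := by
  obtain ⟨a, b⟩ := p
  intro h
  have h1 : (((a : ℝ) * (1 - a) * b * (1 - b) : ℝ) : ℂ) = 0 := congrArg Prod.fst h
  have h1' : ((a : ℝ) * (1 - a) * b * (1 - b) : ℝ) = 0 := by exact_mod_cast h1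
  have h2 := congrArg Prod.snd h
  simp only [mul_eq_zero] at h1'
  rcases h1' with ((h3 | h3) | h3) | h3
  · have : a = 0 := Subtype.ext h3
    subst this; rw [genV_left] at h2; simp at h2
  · have : a = 1 := Subtype.ext (show _ = (1:ℝ) by linarith)
    subst this; rw [genV_right] at h2; simp at h2
  · have : b = 0 := Subtype.ext h3
    subst this; rw [genV_bot] at h2; simp at h2
  · have : b = 1 := Subtype.ext (show _ = (1:ℝ) by linarith)
    subst this; rw [genV_top] at h2; simp at h2

lemma continuous_genV : Continuous genV := by
  unfold genV
  fun_prop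

/-- degree one loop in the sphere -/
def genZ (s : Fin 2 → I) : S2 := hopf0 ⟨genV (s 0, s 1), genV_ne _⟩

lemma continuous_genZ : Continuous genZ :=
  continuous_hopf0.comp ((continuous_genV.comp (by fun_prop)).subtype_mk _)

lemma genZ_bd (s : Fin 2 → I) (hs : s ∈ Cube.boundary (Fin 2)) : genZ s = S2inf := by
  refine hopf0_inf _ ?_
  obtain ⟨j, hj⟩ := hs
  show (genV (s 0, s 1)).1 = 0
  fin_cases j <;> rcases hj with hj | hj <;> simp only [Fin.zero_eta, Fin.mk_one] at hj <;> rw [hj] <;> simp [genV]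

theorem gen_not_null (k : ℕ) : ¬ BNull (fun s : Fin 2 → I => ({genZ s} : Multiset S2) + Multiset.replicate k S2inf) := by
  intro hn
  obtain ⟨D, hD, hq⟩ := cp_data continuous_hopf hopf_surj hopf_eq (k + 1)
  let f : (Fin 2 → I) → {m : Multiset S2 // m.card = k + 1} := fun s => ⟨{genZ s} + Multiset.replicate k S2inf, by simp⟩
  have hn' : BNull f := BNull_sub_iff.1 hn
  have hinj : ∀ x : ℂ × ℂ, x ≠ 0 → cvec (k + 1) (linF x) ≠ 0 := by
    intro x hx h
    refine linF_ne hx (cvec_inj (d := k + 1) ((linF_deg x).trans (by omega)) (by simp) (h.trans ?_))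
    ext i; simp [cvec]
  have hdeg : D.IsDeg f 1 := by
    refine ⟨⟨cvec (k + 1) (linF (0, 1)), hinj _ (by simp)⟩, fun p => ⟨cvec (k + 1) (linF (genV p)), hinj _ (genV_ne p)⟩,
      fun b => ((b : ℝ) : ℂ) * (2 * Real.pi * Complex.I), ?_, ?_, ?_, ?_, ?_, ?_, ?_, ?_⟩
    · refine (continuous_cvec fun n => ?_).subtype_mk _
      have := continuous_genV
      simp only [linF, coeff_add, coeff_C_mul, coeff_C, coeff_X]
      split_ifs <;> fun_prop
    · intro a b
      apply Subtype.ext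
      let x : S3 := ⟨(0, 1), by simp⟩
      let z : Fin (k + 1) → S3 := Fin.cons (S3n (genV (a, b)) (genV_ne _)) (fun _ => x)
      rw [hq z]
      · have : hopf ∘ z = Fin.cons (genZ ![a, b]) (fun _ => S2inf) := by
          funext j
          refine Fin.cases ?_ (fun j => ?_) j
          · rfl
          · rfl
        rw [this]
        simp only [msk, f]
        rw [Fin.univ_succ]
        simp [Multiset.map_const', Function.comp_def]
        rfl
      · have h1 : ((‖genV (a, b)‖⁻¹ : ℝ) : ℂ) ≠ 0 := by exact_mod_cast inv_ne_zero (norm_ne_zero_iff.2 (genV_ne _))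
        refine ⟨((‖genV (a, b)‖⁻¹ : ℝ) : ℂ)⁻¹, ?_⟩
        rw [← cvec_smul, Fin.prod_univ_succ]
        show cvec (k + 1) (linF (genV (a, b))) = cvec (k + 1) (C _ * (linF (_ • genV (a, b)) * ∏ i : Fin k, linF x.1))
        have h2 : linF x.1 = 1 := by simp [linF, x]
        rw [h2, linF_smul, Finset.prod_const_one, mul_one, ← mul_assoc, ← C_mul, inv_mul_cancel₀ h1, C_1, one_mul]
    · intro b; apply Subtype.ext; simp only [genV_left]
    · intro b; apply Subtype.ext; simp only [genV_bot]
    · intro b; apply Subtype.ext; simp only [genV_top]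
    · fun_prop
    · intro b
      simp only [genV_right]
      rw [← cvec_smul, ← linF_smul]
      simp
    · simp
  exact one_ne_zero (hD.deg_null hdeg hn')

theorem pi2_of_map {n : ℕ} (hn : 1 ≤ n) {qb : X → S2} (hqb : Continuous qb) (x : SP n X)
    (hinj : ∀ f : (Fin 2 → I) → Multiset X, Continuous f → (∀ s, (f s).card = n) → (∀ s ∈ Cube.boundary (Fin 2), f s = spIn n x) →
      BNull (fun s => (f s).map qb) → BNull f)
    (hnt : ∃ f : (Fin 2 → I) → Multiset X, Continuous f ∧ (∀ s, (f s).card = n) ∧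
      (∀ s ∈ Cube.boundary (Fin 2), f s = spIn n x) ∧ ¬ BNull (fun s => (f s).map qb)) :
    Nonempty ((π_ 2 (SP n X) x) ≃* Multiplicative ℤ) := by
  obtain ⟨D, hD, _⟩ := cp_data continuous_hopf hopf_surj hopf_eq n
  have hcard : ∀ y : SP n X, (spIn n y).card = n := by
    intro y
    have : spIn n y ∈ Set.range (spIn (X := X) n) := ⟨_, rfl⟩
    rw [range_spIn] at this; exact this
  let φ : SP n X → {m : Multiset S2 // m.card = n} := fun y => ⟨(spIn n y).map qb, by rw [Multiset.card_map, hcard]⟩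
  have hφ : Continuous φ := ((continuous_ms_map' hqb).comp (isOpenEmbedding_spIn n).continuous).subtype_mk _
  refine hD.pi2 (by rw [finrank_cp]; omega) hφ x ?_ ?_
  · intro f hf hfb hnull
    refine BNull_sp (hinj _ ((isOpenEmbedding_spIn n).continuous.comp hf) (fun s => hcard _) (fun s hs => congrArg (spIn n) (hfb s hs)) ?_)
    exact hnull.comp continuous_subtype_val
  · obtain ⟨f, hf, hfc, hfb, hfn⟩ := hnt
    have hr : ∀ s, ∃ y, spIn n y = f s := by
      intro s
      have : f s ∈ Set.range (spIn (X := X) n) := by rw [range_spIn]; exact hfc s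
      exact this
    choose g hg using hr
    refine ⟨g, ?_, ?_, ?_⟩
    · rw [(isOpenEmbedding_spIn (X := X) n).isInducing.continuous_iff]
      exact hf.congr fun s => (hg s).symm
    · intro s hs
      exact (isOpenEmbedding_spIn (X := X) n).injective (by rw [hg, hfb s hs])
    · intro h
      apply hfn
      have h2 := h.comp continuous_subtype_val
      have : (fun s => (f s).map qb) = Subtype.val ∘ (φ ∘ g) := by
        funext s
        simp only [Function.comp, φ, hg]
      rw [this]; exact h2

end SphereResults

end

section
set_option autoImplicit false
open Topology
set_option linter.unusedSectionVars false
set_option linter.unusedSimpArgs false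
set_option linter.unusedVariables false

section RPn
open Polynomial ComplexConjugate

/-- unit sphere of `ℂ × ℝ` (sup norm) -/
abbrev SR : Type := Metric.sphere (0 : ℂ × ℝ) 1

lemma SR_ne (x : SR) : x.1 ≠ 0 := by
  have h := x.2
  intro h0
  rw [h0] at h
  simp at h

def SRn (x : ℂ × ℝ) (hx : x ≠ 0) : SR := ⟨‖x‖⁻¹ • x, by
  have : ‖x‖ ≠ 0 := norm_ne_zero_iff.2 hx
  simp [norm_smul, this]⟩

def quadF (x : ℂ × ℝ) : ℂ[X] := C (-x.1) * X ^ 2 + C (2 * (x.2 : ℂ)) * X + C (conj x.1)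

lemma quadF_smul (r : ℝ) (x : ℂ × ℝ) : quadF (r • x) = C (r : ℂ) * quadF x := by
  simp [quadF]; ring

lemma quadF_eval (x : ℂ × ℝ) (r : ℂ) : eval r (quadF x) = -x.1 * r ^ 2 + 2 * x.2 * r + conj x.1 := by
  simp [quadF]

lemma quadF_ne {x : ℂ × ℝ} (hx : x ≠ 0) : quadF x ≠ 0 := by
  intro h
  apply hx
  have h1 := congrArg (fun p => coeff p 1) h
  have h0 := congrArg (fun p => coeff p 0) h
  simp [quadF, coeff_X, coeff_C] at h1 h0
  exact Prod.ext h0 h1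

lemma quadF_deg (x : ℂ × ℝ) : (quadF x).natDegree ≤ 2 := natDegree_quadratic_le

/-- the base solution with a prescribed root -/
def rootV (r : ℂ) : ℂ × ℝ := (2 * conj r, Complex.normSq r - 1)

lemma quadF_rootV (r : ℂ) : quadF (rootV r) = C (-2) * ((C (conj r) * X + 1) * (X - C r)) := by
  have h : C ((Complex.normSq r : ℝ) : ℂ) = C (conj r) * C r := by rw [← C_mul, ← Complex.normSq_eq_conj_mul_self]
  simp only [quadF, rootV, map_mul, Complex.conj_conj, Complex.ofReal_sub, Complex.ofReal_one, C_sub, h, C_neg, map_ofNat, C_1]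
  ring

lemma rootV_ne (r : ℂ) : rootV r ≠ 0 := by
  intro h
  have h1 : 2 * conj r = 0 := congrArg Prod.fst h
  have h2 : Complex.normSq r - 1 = 0 := congrArg Prod.snd h
  have : r = 0 := by simpa using h1
  rw [this] at h2
  simp at h2

lemma root_par {x : ℂ × ℝ} {r : ℂ} (h : eval r (quadF x) = 0) : ∃ l : ℝ, x = l • rootV r := by
  rw [quadF_eval] at h
  have hc := congrArg conj h
  simp only [map_add, map_mul, map_neg, map_pow, Complex.conj_conj, Complex.conj_ofReal, map_ofNat, map_zero] at hc
  have hn : r * conj r = Complex.normSq r := Complex.mul_conj r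
  set q : ℝ := Complex.normSq r with hq
  have hq0 : 0 ≤ q := Complex.normSq_nonneg r
  have hq1 : (q : ℂ) + 1 ≠ 0 := by
    have : (q + 1 : ℝ) ≠ 0 := by positivity
    exact_mod_cast this
  have hA : x.1 * (q - 1) = 2 * x.2 * conj r := by
    have : (q + 1 : ℂ) * (x.1 * (q - 1)) = (q + 1) * (2 * x.2 * conj r) := by
      rw [← hn]
      linear_combination (-(conj r) ^ 2) * h - hc
    exact mul_left_cancel₀ hq1 this
  by_cases h1 : q = 1
  · rw [h1] at hA hn
    simp only [Complex.ofReal_one] at hA hn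
    have hcr : conj r ≠ 0 := fun h0 => by rw [h0] at hn; simp at hn
    have ht : (x.2 : ℂ) = 0 := by
      have : 2 * (x.2 : ℂ) * conj r = 0 := by rw [← hA]; ring
      simpa [hcr] using this
    have hre : conj (x.1 * r) = x.1 * r := by
      rw [map_mul]
      linear_combination conj r * h - 2 * r * conj r * ht + x.1 * r * hn
    obtain ⟨l, hl⟩ := Complex.conj_eq_iff_real.1 hre
    refine ⟨l / 2, Prod.ext ?_ ?_⟩
    · simp only [rootV, Prod.smul_fst, Complex.real_smul]
      push_cast
      rw [← hl]
      linear_combination -x.1 * hn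
    · have : x.2 = 0 := by exact_mod_cast ht
      simp only [rootV, Prod.smul_snd, smul_eq_mul, this, ← hq, h1]; ring
  · have h2 : q - 1 ≠ 0 := sub_ne_zero.2 h1
    have h3 : (q : ℂ) - 1 ≠ 0 := by exact_mod_cast h2
    refine ⟨x.2 / (q - 1), Prod.ext ?_ ?_⟩
    · simp only [rootV, Prod.smul_fst, Complex.real_smul]
      push_cast
      field_simp
      linear_combination hA
    · simp only [rootV, Prod.smul_snd, smul_eq_mul, ← hq]
      field_simp

lemma quad_root {x : ℂ × ℝ} (hx : x ≠ 0) : ∃ r, eval r (quadF x) = 0 := by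
  refine IsAlgClosed.exists_root (quadF x) fun h => ?_
  have h0 : (quadF x).natDegree = 0 := natDegree_eq_of_degree_eq_some h
  have h1 : (quadF x).coeff 1 = 0 := coeff_eq_zero_of_natDegree_lt (by omega)
  have h2 : (quadF x).coeff 2 = 0 := coeff_eq_zero_of_natDegree_lt (by omega)
  simp [quadF, coeff_X, coeff_C] at h1 h2
  exact hx (Prod.ext h2 h1)

lemma quad_unique {Z : Type} {h : SR → Z} (hh : ∀ x y : SR, (∃ l : ℝ, x.1 = l • y.1) → h x = h y) (s : Multiset SR) :
    ∀ (t : Multiset SR) (c : ℂ), c ≠ 0 →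
      C c * (s.map fun x => quadF x.1).prod = (t.map fun x => quadF x.1).prod → s.map h = t.map h := by
  induction s using Multiset.induction_on with
  | empty =>
    intro t c hc heq
    induction t using Multiset.induction_on with
    | empty => rfl
    | cons u t _ =>
      exfalso
      obtain ⟨r, hr⟩ := quad_root (SR_ne u)
      have := congrArg (eval r) heq
      rw [Multiset.map_cons, Multiset.prod_cons, eval_mul, eval_mul, hr] at this
      simp at this
      exact hc this
  | cons u s ih =>
    intro t c hc heq
    obtain ⟨r, hr⟩ := quad_root (SR_ne u)
    have he := congrArg (eval r) heq
    rw [Multiset.map_cons, Multiset.prod_cons, eval_mul, eval_mul, hr, zero_mul, mul_zero, eval_multiset_prod] at he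
    have := Multiset.prod_eq_zero_iff.1 he.symm
    rw [Multiset.map_map] at this
    obtain ⟨u', hu', h1⟩ := Multiset.mem_map.1 this
    obtain ⟨t', rfl⟩ := Multiset.exists_cons_of_mem hu'
    obtain ⟨l, hl⟩ := root_par hr
    obtain ⟨l', hl'⟩ := root_par h1
    have hl0 : l ≠ 0 := fun h0 => SR_ne u (by rw [hl, h0, zero_smul])
    have hl0' : l' ≠ 0 := fun h0 => SR_ne u' (by rw [hl', h0, zero_smul])
    have hpar : u.1 = (l * l'⁻¹) • u'.1 := by
      rw [hl, hl', smul_smul, mul_assoc, inv_mul_cancel₀ hl0', mul_one]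
    rw [Multiset.map_cons, Multiset.map_cons, hh u u' ⟨_, hpar⟩]
    congr 1
    refine ih t' (c * ((l * l'⁻¹ : ℝ) : ℂ)) (mul_ne_zero hc (by exact_mod_cast mul_ne_zero hl0 (inv_ne_zero hl0'))) ?_
    apply mul_left_cancel₀ (quadF_ne (SR_ne u'))
    rw [Multiset.map_cons, Multiset.map_cons, Multiset.prod_cons, Multiset.prod_cons, hpar, quadF_smul] at heq
    rw [← heq, C_mul]; ring

/-- twist -/
def twist : ℂ[X] →+* ℂ[X] := eval₂RingHom (C.comp (starRingEnd ℂ)) (-X)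

lemma twist_C (a : ℂ) : twist (C a) = C (conj a) := by simp [twist]
lemma twist_X : twist X = -X := by simp [twist]

lemma twist_coeff (f : ℂ[X]) (n : ℕ) : (twist f).coeff n = (-1) ^ n * conj (f.coeff n) := by
  induction f using Polynomial.induction_on' with
  | add p q hp hq => rw [map_add, coeff_add, coeff_add, hp, hq, map_add]; ring
  | monomial m a =>
    rw [← C_mul_X_pow_eq_monomial, map_mul, map_pow, twist_C, twist_X, neg_pow, mul_comm ((-1) ^ m), ← mul_assoc]
    have : ((-1 : ℂ[X]) ^ m) = C ((-1) ^ m) := by simp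
    rw [this, coeff_mul_C, coeff_C_mul, coeff_C_mul, coeff_X_pow]
    split_ifs with h
    · subst h; simp; ring
    · simp

lemma twist_deg (f : ℂ[X]) : (twist f).natDegree ≤ f.natDegree := by
  refine natDegree_le_iff_coeff_eq_zero.2 fun n hn => ?_
  rw [twist_coeff, coeff_eq_zero_of_natDegree_lt hn]; simp

def tau (k : ℕ) (f : ℂ[X]) : ℂ[X] := C ((-1) ^ k) * reflect (2 * k) (twist f)

lemma tau_mul {a b : ℕ} {f g : ℂ[X]} (hf : f.natDegree ≤ 2 * a) (hg : g.natDegree ≤ 2 * b) :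
    tau (a + b) (f * g) = tau a f * tau b g := by
  simp only [tau]
  rw [map_mul, mul_add, reflect_mul _ _ ((twist_deg f).trans hf) ((twist_deg g).trans hg), pow_add, C_mul]
  ring

lemma tau_coeff (k : ℕ) (f : ℂ[X]) (i : ℕ) (hi : i ≤ 2 * k) : (tau k f).coeff i = (-1) ^ (k + i) * conj (f.coeff (2 * k - i)) := by
  rw [tau, coeff_C_mul, coeff_reflect, revAt_le hi, twist_coeff, pow_add, mul_assoc]
  congr 2
  have h1 : (-1 : ℂ) ^ (2 * k - i) * (-1) ^ i = 1 := by
    rw [← pow_add, Nat.sub_add_cancel hi, pow_mul]; simp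
  have h2 : (-1 : ℂ) ^ i * (-1) ^ i = 1 := by rw [← pow_add, ← two_mul, pow_mul]; simp
  linear_combination (-1 : ℂ) ^ i * h1 - (-1 : ℂ) ^ (2 * k - i) * h2

lemma tau_deg {k : ℕ} {f : ℂ[X]} (hf : f.natDegree ≤ 2 * k) : (tau k f).natDegree ≤ 2 * k := by
  refine natDegree_le_iff_coeff_eq_zero.2 fun n hn => ?_
  rw [tau, coeff_C_mul, coeff_reflect, revAt_eq_self_of_lt hn, twist_coeff, coeff_eq_zero_of_natDegree_lt (by omega)]; simp

lemma tau_quad (x : ℂ × ℝ) : tau 1 (quadF x) = quadF x := by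
  ext i
  by_cases hi : i ≤ 2
  · rw [tau_coeff 1 _ _ (by omega)]
    interval_cases i
    · simp [quadF, coeff_X, coeff_C]
    · simp [quadF, coeff_X, coeff_C]
      left; exact map_ofNat _ 2
    · simp [quadF, coeff_X, coeff_C]
      ring
  · rw [coeff_eq_zero_of_natDegree_lt ((tau_deg (quadF_deg x)).trans_lt (by omega)),
      coeff_eq_zero_of_natDegree_lt ((quadF_deg x).trans_lt (by omega))]

end RPn

end

section
set_option autoImplicit false
open Topology
set_option linter.unusedSectionVars false
set_option linter.unusedSimpArgs false
set_option linter.unusedVariables false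

section RPn2
open Polynomial ComplexConjugate

lemma exists_SR_scale (x : ℂ × ℝ) (hx : x ≠ 0) : ∃ c : ℝ, quadF x = C (c : ℂ) * quadF (SRn x hx).1 := by
  refine ⟨‖x‖, ?_⟩
  rw [← quadF_smul]
  congr 1
  show x = ‖x‖ • ‖x‖⁻¹ • x
  rw [smul_smul, mul_inv_cancel₀ (norm_ne_zero_iff.2 hx), one_smul]

lemma quad_exists (k : ℕ) : ∀ f : ℂ[X], f.natDegree ≤ 2 * k → tau k f = f →
    ∃ s : Multiset SR, s.card = k ∧ ∃ c : ℝ, f = C (c : ℂ) * (s.map fun x => quadF x.1).prod := by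
  induction k with
  | zero =>
    intro f hf ht
    have h0 := eq_C_of_natDegree_le_zero hf
    have h1 : conj (f.coeff 0) = f.coeff 0 := by
      have : (tau 0 f).coeff 0 = f.coeff 0 := by rw [ht]
      rw [tau_coeff 0 f 0 (by omega)] at this
      simpa using this
    obtain ⟨c, hc⟩ := Complex.conj_eq_iff_real.1 h1
    refine ⟨0, rfl, c, ?_⟩
    rw [h0, hc]; simp
  | succ k ih =>
    intro f hf ht
    by_cases hf0 : f = 0
    · exact ⟨Multiset.replicate (k + 1) (SRn (rootV 0) (rootV_ne 0)), by simp, 0, by simp [hf0]⟩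
    have hsymm : f.coeff 0 = 0 → f.natDegree ≤ 2 * k + 1 := by
      intro h
      have h2 : f.coeff (2 * (k + 1)) = 0 := by
        rw [← ht, tau_coeff _ _ _ le_rfl, Nat.sub_self, h]; simp
      refine natDegree_le_iff_coeff_eq_zero.2 fun n hn => ?_
      rcases Nat.lt_or_ge (2 * (k + 1)) n with h3 | h3
      · exact coeff_eq_zero_of_natDegree_lt (by omega)
      · have : n = 2 * (k + 1) := by omega
        rw [this, h2]
    have hd0 : f.natDegree ≠ 0 := by
      intro h
      have h1 : f.coeff 0 = 0 := by
        rw [← ht, tau_coeff _ _ _ (by omega), coeff_eq_zero_of_natDegree_lt (by omega)]; simp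
      apply hf0
      rw [eq_C_of_natDegree_le_zero h.le, h1, C_0]
    obtain ⟨r, hr⟩ := IsAlgClosed.exists_root f (fun h => hd0 (natDegree_eq_of_degree_eq_some h))
    have hdv1 : (X - C r) ∣ f := dvd_iff_isRoot.2 hr
    have hdv2 : (C (conj r) * X + 1) ∣ f := by
      obtain ⟨g, hg⟩ := hdv1
      have hg0 : g ≠ 0 := by rintro rfl; simp at hg; exact hf0 hg
      have hgd : g.natDegree ≤ 2 * k + 1 := by
        rw [hg, natDegree_mul (X_sub_C_ne_zero r) hg0, natDegree_X_sub_C] at hf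
        omega
      have h1 : reflect (2 * (k + 1)) (twist f) = reflect 1 (twist (X - C r)) * reflect (2 * k + 1) (twist g) := by
        rw [hg, map_mul, show 2 * (k + 1) = 1 + (2 * k + 1) by ring]
        exact reflect_mul _ _ ((twist_deg _).trans (natDegree_X_sub_C_le r)) ((twist_deg _).trans hgd)
      have h2 : reflect 1 (twist (X - C r)) = -(C (conj r) * X + 1) := by
        rw [map_sub, twist_C, twist_X]
        have : -X - C (conj r) = C (-1) * X ^ 1 + C (-conj r) := by simp; ring
        rw [this, reflect_add, reflect_C_mul_X_pow, reflect_C, revAt_le le_rfl]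
        simp
      rw [← ht, tau, h1, h2]
      exact Dvd.dvd.mul_left (Dvd.dvd.mul_right (dvd_neg.2 dvd_rfl) _) _
    have hcop : IsCoprime (C (conj r) * X + 1) (X - C r) := by
      have hq : ((Complex.normSq r : ℝ) : ℂ) + 1 ≠ 0 := by
        have := Complex.normSq_nonneg r
        have h2 : (Complex.normSq r + 1 : ℝ) ≠ 0 := by positivity
        exact_mod_cast h2
      refine ⟨C ((((Complex.normSq r : ℝ) : ℂ) + 1)⁻¹), C (-(((Complex.normSq r : ℝ) : ℂ) + 1)⁻¹ * conj r), ?_⟩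
      have h3 : C ((((Complex.normSq r : ℝ) : ℂ) + 1)⁻¹) * (C (conj r) * C r + 1) = (1 : ℂ[X]) := by
        rw [← C_mul, ← Complex.normSq_eq_conj_mul_self, ← C_1, ← C_add, ← C_mul, inv_mul_cancel₀ hq]
      rw [C_mul, C_neg]
      linear_combination h3
    have hdv : quadF (rootV r) ∣ f := by
      obtain ⟨g, hg⟩ := hcop.mul_dvd hdv2 hdv1
      refine ⟨C (-2)⁻¹ * g, ?_⟩
      rw [quadF_rootV]
      have : C (-2 : ℂ) * C (-2 : ℂ)⁻¹ = 1 := by rw [← C_mul, mul_inv_cancel₀ (by norm_num), C_1]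
      calc f = 1 * f := by ring
        _ = (C (-2 : ℂ) * C (-2 : ℂ)⁻¹) * f := by rw [this]
        _ = _ := by rw [hg]; ring
    obtain ⟨g, hg⟩ := hdv
    have hg0 : g ≠ 0 := by rintro rfl; simp at hg; exact hf0 hg
    have hgd : g.natDegree ≤ 2 * k := by
      have h1 := natDegree_mul (quadF_ne (rootV_ne r)) hg0
      rw [← hg] at h1
      by_cases hr0 : r = 0
      · have h2 : f.coeff 0 = 0 := by
          rw [hr0] at hr
          rw [coeff_zero_eq_eval_zero]; exact hr
        have h3 : (quadF (rootV r)).natDegree ≠ 0 := by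
          intro h
          have : (quadF (rootV r)).coeff 1 = 0 := coeff_eq_zero_of_natDegree_lt (by omega)
          simp [quadF, rootV, hr0, coeff_X, coeff_C] at this
        have := hsymm h2
        omega
      · have h3 : 2 ≤ (quadF (rootV r)).natDegree := by
          refine le_natDegree_of_ne_zero ?_
          rw [quadF, coeff_add, coeff_add, coeff_C_mul, coeff_X_pow, coeff_C_mul, coeff_X, coeff_C]
          simp [rootV, hr0]
        omega
    have hgt : tau k g = g := by
      have h1 := tau_mul (a := 1) (b := k) (quadF_deg (rootV r)) hgd
      rw [← hg, tau_quad, add_comm, ht, hg] at h1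
      exact (mul_left_cancel₀ (quadF_ne (rootV_ne r)) h1).symm
    obtain ⟨s, hs, c, hc⟩ := ih g hgd hgt
    obtain ⟨c', hc'⟩ := exists_SR_scale (rootV r) (rootV_ne r)
    refine ⟨SRn (rootV r) (rootV_ne r) ::ₘ s, by simp [hs], c' * c, ?_⟩
    rw [Multiset.map_cons, Multiset.prod_cons, hg, hc', hc]
    push_cast
    rw [C_mul]; ring

/-- the antilinear involution on coefficient vectors -/
def tauL (k : ℕ) : EuclideanSpace ℂ (Fin (2 * k + 1)) →ₗ[ℝ] EuclideanSpace ℂ (Fin (2 * k + 1)) where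
  toFun v := WithLp.toLp 2 fun i => (-1) ^ (k + (i : ℕ)) * conj (v i.rev)
  map_add' v w := by ext i; simp [mul_add]
  map_smul' r v := by ext i; simp; ring

lemma tauL_cvec {k : ℕ} {f : ℂ[X]} : tauL k (cvec (2 * k) f) = cvec (2 * k) (tau k f) := by
  ext i
  show (-1) ^ (k + (i : ℕ)) * conj (f.coeff (i.rev : ℕ)) = (tau k f).coeff i
  rw [tau_coeff _ _ _ (by omega)]
  congr 3
  simp [Fin.val_rev]

lemma tauL_tauL (k : ℕ) (v : EuclideanSpace ℂ (Fin (2 * k + 1))) : tauL k (tauL k v) = v := by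
  ext i
  show (-1) ^ (k + (i : ℕ)) * conj ((-1) ^ (k + (i.rev : ℕ)) * conj (v i.rev.rev)) = v i
  rw [Fin.rev_rev, map_mul, Complex.conj_conj, map_pow, ← mul_assoc]
  simp only [map_neg, map_one]
  rw [← pow_add]
  have : k + (i : ℕ) + (k + (i.rev : ℕ)) = 2 * (2 * k) := by
    rw [Fin.val_rev]; omega
  rw [this, pow_mul]; simp

def RV (k : ℕ) : Submodule ℝ (EuclideanSpace ℂ (Fin (2 * k + 1))) := LinearMap.eqLocus (tauL k) LinearMap.id

lemma mem_RV {k : ℕ} {v : EuclideanSpace ℂ (Fin (2 * k + 1))} : v ∈ RV k ↔ tauL k v = v := Iff.rfl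

lemma tauL_I (k : ℕ) (v : EuclideanSpace ℂ (Fin (2 * k + 1))) : tauL k (Complex.I • v) = -(Complex.I • tauL k v) := by
  ext i; simp [tauL]; ring

lemma finrank_RV (k : ℕ) : 2 * k + 1 ≤ Module.finrank ℝ (RV k) := by
  let L : (RV k × RV k) →ₗ[ℝ] EuclideanSpace ℂ (Fin (2 * k + 1)) :=
    { toFun := fun p => p.1.1 + Complex.I • p.2.1
      map_add' := by intro p q; ext i; simp; ring
      map_smul' := by intro r p; ext i; simp; ring }
  have hL : Function.Surjective L := by
    intro v
    have h1 : (2 : ℝ)⁻¹ • (v + tauL k v) ∈ RV k := by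
      rw [mem_RV, map_smul, map_add, tauL_tauL, add_comm (tauL k v) v]
    have h2 : (2 : ℝ)⁻¹ • (-(Complex.I • v) + Complex.I • tauL k v) ∈ RV k := by
      rw [mem_RV, map_smul, map_add, map_neg, tauL_I, tauL_I, tauL_tauL, neg_neg, add_comm (Complex.I • tauL k v)]
    refine ⟨(⟨_, h1⟩, ⟨_, h2⟩), ?_⟩
    show (2 : ℝ)⁻¹ • (v + tauL k v) + Complex.I • ((2 : ℝ)⁻¹ • (-(Complex.I • v) + Complex.I • tauL k v)) = v
    ext i
    simp
    have := Complex.I_mul_I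
    linear_combination (2⁻¹ * (tauL k v i) - 2⁻¹ * v i) * this
  have h := LinearMap.finrank_le_finrank_of_surjective (f := L) hL
  rw [Module.finrank_prod] at h
  have h3 : Module.finrank ℝ (EuclideanSpace ℂ (Fin (2 * k + 1))) = 2 * (2 * k + 1) := finrank_cp (2 * k)
  omega

end RPn2

end

section
set_option autoImplicit false
open Topology
set_option linter.unusedSectionVars false
set_option linter.unusedSimpArgs false
set_option linter.unusedVariables false

section RPn3
open Polynomial ComplexConjugate

lemma tau_prod {k : ℕ} (s : Fin k → SR) : (∏ i, quadF (s i).1).natDegree ≤ 2 * k ∧ tau k (∏ i, quadF (s i).1) = ∏ i, quadF (s i).1 := by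
  induction k with
  | zero =>
    refine ⟨by simp, ?_⟩
    simp [tau, reflect_one]
  | succ k ih =>
    obtain ⟨h1, h2⟩ := ih (fun i => s i.succ)
    rw [Fin.prod_univ_succ]
    refine ⟨(natDegree_mul_le).trans ?_, ?_⟩
    · have := quadF_deg (s 0).1
      omega
    · have h3 := tau_mul (a := 1) (b := k) (quadF_deg (s 0).1) h1
      rw [tau_quad, h2] at h3
      rw [Nat.add_comm 1 k] at h3
      exact h3

theorem rp_data {Z : Type} [TopologicalSpace Z] [T2Space Z] [NormalSpace Z] {h : SR → Z} (hc : Continuous h) (hsur : Function.Surjective h)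
    (hh : ∀ x y : SR, h x = h y ↔ ∃ l : ℝ, x.1 = l • y.1) (k : ℕ) :
    ∃ D : ProjData (RV k) {m : Multiset Z // m.card = k}, Function.Surjective D.q ∧
      (∀ v w, D.q v = D.q w → ∃ r : ℝ, w.1 = r • v.1) ∧
      (∀ (r : ℝ) v (h : r • v.1 ≠ 0), D.q ⟨r • v.1, h⟩ = D.q v) := by
  let p : (Fin k → SR) → RV k := fun s => ⟨cvec (2 * k) (∏ i, quadF (s i).1), by rw [mem_RV, tauL_cvec, (tau_prod s).2]⟩
  let π : (Fin k → SR) → {m : Multiset Z // m.card = k} := fun s => ⟨msk k (h ∘ s), by simp [msk]⟩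
  have hp : Continuous p := by
    refine Continuous.subtype_mk (continuous_cvec fun n => continuous_coeff_prod _ _ ?_ n) _
    intro i n
    have h1 : Continuous fun a : Fin k → SR => (a i).1 := continuous_subtype_val.comp (continuous_apply i)
    simp only [quadF, coeff_add, coeff_C_mul, coeff_C, coeff_X, coeff_X_pow]
    split_ifs <;> fun_prop
  have hπ : Continuous π := ((continuous_msk k).comp (continuous_pi fun i => hc.comp (continuous_apply i))).subtype_mk _
  have hπs : Function.Surjective π := by
    intro m
    obtain ⟨z, hz⟩ := msk_surj' m.1 m.2
    choose l hl using hsur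
    refine ⟨l ∘ z, Subtype.ext ?_⟩
    rw [← hz]
    show msk k (h ∘ l ∘ z) = _
    congr 1; funext i; exact hl _
  have hne : ∀ s : Fin k → SR, (∏ i, quadF (s i).1) ≠ 0 := fun s => Finset.prod_ne_zero_iff.2 fun i _ => quadF_ne (SR_ne _)
  have hp0 : ∀ s, p s ≠ 0 := by
    intro s hs
    apply hne s
    refine cvec_inj (d := 2 * k) (tau_prod s).1 (by simp) ?_
    show (p s).1 = _
    rw [hs]; ext i; simp [cvec]
  have hprod : ∀ s : Fin k → SR, ((msk k s).map fun x => quadF x.1).prod = ∏ i, quadF (s i).1 := by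
    intro s; simp only [msk, Multiset.map_map]; rfl
  have hmap : ∀ s : Fin k → SR, (msk k s).map h = msk k (h ∘ s) := by
    intro s; simp only [msk, Multiset.map_map]
  have hsm : ∀ (r : ℝ) (f : ℂ[X]), cvec (2 * k) (C (r : ℂ) * f) = r • cvec (2 * k) f := by
    intro r f; rw [cvec_smul]; ext i; simp
  obtain ⟨D, h1, h2, h3, h4⟩ := exists_projData ℝ (V := RV k) (p := p) (π := π) hp hπ hπs hp0 (by
    intro a b
    constructor
    · intro hab
      have hab' : msk k (h ∘ a) = msk k (h ∘ b) := congrArg Subtype.val hab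
      obtain ⟨e, he⟩ := (msk_eq_iff _ _).1 hab'
      have hpar : ∀ i, ∃ d : ℝ, (a i).1 = d • (b (e i)).1 := fun i => (hh _ _).1 (congrFun he i)
      choose d hda using hpar
      refine ⟨∏ i, d i, ?_⟩
      apply Subtype.ext
      show cvec (2 * k) _ = _ • cvec (2 * k) _
      rw [← hsm]
      congr 1
      simp only [hda, quadF_smul]
      rw [Finset.prod_mul_distrib, Complex.ofReal_prod, map_prod, Equiv.prod_comp e (fun i => quadF (b i).1)]
    · rintro ⟨c, hcab⟩
      have hc0 : c ≠ 0 := fun h0 => hp0 a (by rw [hcab, h0, zero_smul])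
      have hE : ∏ i, quadF (a i).1 = C (c : ℂ) * ∏ i, quadF (b i).1 := by
        refine cvec_inj (tau_prod a).1 ((natDegree_C_mul_le _ _).trans (tau_prod b).1) ?_
        rw [hsm]; exact congrArg Subtype.val hcab
      apply Subtype.ext
      show msk k (h ∘ a) = msk k (h ∘ b)
      rw [← hmap, ← hmap]
      symm
      refine quad_unique (fun x y => (hh x y).2) _ _ (c : ℂ) (by exact_mod_cast hc0) ?_
      rw [hprod, hprod, hE]) (by
    rintro ⟨v, hvm⟩ hv
    obtain ⟨f, hf, rfl⟩ := cvec_surj v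
    have ht : tau k f = f := by
      refine cvec_inj (tau_deg hf) hf ?_
      rw [← tauL_cvec]; exact hvm
    obtain ⟨s, hs, c, hfc⟩ := quad_exists k f hf ht
    obtain ⟨z, rfl⟩ := msk_surj' s hs
    refine ⟨z, c, Subtype.ext ?_⟩
    show _ = c • cvec (2 * k) _
    rw [← hsm, ← hprod, ← hfc])
  exact ⟨D, h1, h2, h3⟩

abbrev NZR : Type := {x : ℂ × ℝ // x ≠ 0}

def vN (x : ℂ × ℝ) : ℝ := Complex.normSq x.1 + x.2 ^ 2

lemma vN_pos (x : NZR) : 0 < vN x.1 := by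
  by_contra h
  have h1 := Complex.normSq_nonneg x.1.1
  have h2 := sq_nonneg x.1.2
  unfold vN at h
  push Not at h
  have h3 : Complex.normSq x.1.1 = 0 := by linarith
  have h4 : x.1.2 ^ 2 = 0 := by linarith
  exact x.2 (Prod.ext (Complex.normSq_eq_zero.1 h3) (by simpa using h4))

def verV (x : NZR) : ℂ × ℂ × ℝ := (x.1.1 ^ 2 / vN x.1, x.1.1 * x.1.2 / vN x.1, x.1.2 ^ 2 / vN x.1)

lemma continuous_verV : Continuous verV := by
  have h1 : Continuous fun x : NZR => vN x.1 := by
    unfold vN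
    have : Continuous fun x : NZR => Complex.normSq x.1.1 := Complex.continuous_normSq.comp (by fun_prop)
    fun_prop
  have h2 : Continuous fun x : NZR => (vN x.1 : ℂ) := by fun_prop
  have h3 : ∀ x : NZR, (vN x.1 : ℂ) ≠ 0 := fun x => by exact_mod_cast (vN_pos x).ne'
  unfold verV
  refine Continuous.prodMk ?_ (Continuous.prodMk ?_ ?_)
  · exact Continuous.div (by fun_prop) h2 h3
  · exact Continuous.div (by fun_prop) h2 h3
  · exact Continuous.div (by fun_prop) h1 fun x => (vN_pos x).ne'

lemma verV_smul {x y : NZR} {l : ℝ} (h : x.1 = l • y.1) : verV x = verV y := by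
  have hl : l ≠ 0 := by rintro rfl; exact x.2 (by simpa using h)
  have hy := (vN_pos y).ne'
  have hN : vN x.1 = l ^ 2 * vN y.1 := by
    rw [h]; simp [vN, Complex.normSq_mul]; ring
  have hlc : (l : ℂ) ≠ 0 := by exact_mod_cast hl
  have hyc : (vN y.1 : ℂ) ≠ 0 := by exact_mod_cast hy
  have h1 : x.1.1 = l * y.1.1 := by rw [h]; simp
  have h2 : x.1.2 = l * y.1.2 := by rw [h]; simp
  unfold verV
  rw [hN, h1, h2]
  push_cast
  refine Prod.ext ?_ (Prod.ext ?_ ?_)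
  · show _ = _ / _
    field_simp
  · show _ = _ / _
    field_simp
  · show _ = _ / _
    field_simp

lemma verV_eq (x y : NZR) : verV x = verV y ↔ ∃ l : ℝ, x.1 = l • y.1 := by
  constructor
  · intro h
    have hx := vN_pos x
    have hy := vN_pos y
    set r := Real.sqrt (vN x.1 / vN y.1) with hr
    have hr2 : r ^ 2 = vN x.1 / vN y.1 := Real.sq_sqrt (by positivity)
    have hr2c : (r : ℂ) ^ 2 = vN x.1 / vN y.1 := by exact_mod_cast hr2
    have hxc : (vN x.1 : ℂ) ≠ 0 := by exact_mod_cast hx.ne'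
    have hyc : (vN y.1 : ℂ) ≠ 0 := by exact_mod_cast hy.ne'
    have h1 : x.1.1 ^ 2 / vN x.1 = y.1.1 ^ 2 / vN y.1 := congrArg Prod.fst h
    have h2 : x.1.1 * x.1.2 / vN x.1 = y.1.1 * y.1.2 / vN y.1 := congrArg (fun p => p.2.1) h
    have h3 : x.1.2 ^ 2 / vN x.1 = y.1.2 ^ 2 / vN y.1 := congrArg (fun p => p.2.2) h
    have e1 : x.1.1 ^ 2 = (r * y.1.1) ^ 2 := by
      rw [mul_pow, hr2c]; field_simp; field_simp at h1; linear_combination h1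
    have e2 : x.1.1 * x.1.2 = (r * y.1.1) * (r * y.1.2 : ℝ) := by
      push_cast
      rw [show (r * y.1.1 : ℂ) * (r * y.1.2) = r ^ 2 * (y.1.1 * y.1.2) by ring, hr2c]
      field_simp; field_simp at h2; linear_combination h2
    have e3 : x.1.2 ^ 2 = (r * y.1.2) ^ 2 := by
      rw [mul_pow, hr2]; field_simp; field_simp at h3; linear_combination h3
    have key : ∃ e : ℝ, x.1.1 = e * (r * y.1.1) ∧ x.1.2 = e * (r * y.1.2) := by
      by_cases hz : x.1.2 = 0
      · have hz' : r * y.1.2 = 0 := by rw [hz] at e3; simpa using e3.symm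
        rcases sq_eq_sq_iff_eq_or_eq_neg.1 e1 with h4 | h4
        · exact ⟨1, by simpa using h4, by rw [hz, hz']; simp⟩
        · exact ⟨-1, by simpa using h4, by rw [hz, hz']; simp⟩
      · have hzc : (x.1.2 : ℂ) ≠ 0 := by exact_mod_cast hz
        rcases sq_eq_sq_iff_eq_or_eq_neg.1 e3 with h4 | h4
        · refine ⟨1, ?_, by simpa using h4⟩
          rw [← h4] at e2
          simpa using mul_right_cancel₀ hzc e2
        · refine ⟨-1, ?_, by simpa using h4⟩
          rw [show r * y.1.2 = -x.1.2 by linarith] at e2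
          apply mul_right_cancel₀ hzc
          rw [e2]; push_cast; ring
    obtain ⟨e, k1, k2⟩ := key
    refine ⟨e * r, Prod.ext ?_ ?_⟩
    · rw [k1]; simp; ring
    · rw [k2]; simp; ring
  · rintro ⟨l, hl⟩; exact verV_smul hl

def RP2 : Type := Set.range verV
instance : TopologicalSpace RP2 := inferInstanceAs (TopologicalSpace (Set.range verV))
instance : T2Space RP2 := inferInstanceAs (T2Space (Set.range verV))

def ver (x : NZR) : RP2 := ⟨verV x, x, rfl⟩
lemma continuous_ver : Continuous ver := continuous_verV.subtype_mk _
lemma ver_eq (x y : NZR) : ver x = ver y ↔ ∃ l : ℝ, x.1 = l • y.1 := by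
  rw [← verV_eq]; exact Subtype.ext_iff
lemma ver_surj : Function.Surjective ver := by
  rintro ⟨_, x, rfl⟩; exact ⟨x, rfl⟩

def verS (x : SR) : RP2 := ver ⟨x.1, SR_ne x⟩
lemma continuous_verS : Continuous verS := continuous_ver.comp (by fun_prop)
lemma verS_surj : Function.Surjective verS := by
  intro z
  obtain ⟨x, rfl⟩ := ver_surj z
  refine ⟨SRn x.1 x.2, (ver_eq _ _).2 ⟨‖x.1‖⁻¹, rfl⟩⟩

instance : CompactSpace RP2 := ⟨by rw [← verS_surj.range_eq]; exact isCompact_range continuous_verS⟩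

theorem rp_null {d k : ℕ} (hd : 2 ≤ d) (hdk : d < k) {f : (Fin d → I) → Multiset RP2} (hf : Continuous f)
    (hc : ∀ s, (f s).card = k) (hb : ∀ s ∈ Cube.boundary (Fin d), f s = f (fun _ => 0)) : BNull f := by
  obtain ⟨D, h1, h2, h3⟩ := rp_data continuous_verS verS_surj (fun x y => ver_eq _ _) k
  obtain ⟨i, rfl⟩ : ∃ i, d = i + 1 := ⟨d - 1, by omega⟩
  refine (BNull_sub_iff (f := fun s => ⟨f s, hc s⟩)).2 ?_
  have h4 : i + 2 < Module.finrank ℝ (RV k) := lt_of_lt_of_le (show i + 2 < 2 * k + 1 by omega) (finrank_RV k)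
  have h5 : 1 ≤ i := by omega
  have h6 : Continuous (fun s => (⟨f s, hc s⟩ : {m : Multiset RP2 // m.card = k})) := hf.subtype_mk _
  refine ProjData.null_real (V := RV k) D h1 h2 h3 h5 h4 h6 ?_
  intro s hs
  exact Subtype.ext (hb s hs)

end RPn3

end

section
set_option autoImplicit false
open Topology
set_option linter.unusedSectionVars false
set_option linter.unusedSimpArgs false
set_option linter.unusedVariables false

section Charts
variable {X : Type} [TopologicalSpace X]

/-- the trace of `T` in the chart is contained in countably many lines -/
def LineCh (T : Set X) (e : OpenPartialHomeomorph X ℂ) : Prop :=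
  ∃ C : Set (ℂ × ℂ), C.Countable ∧ ∀ x ∈ e.source, x ∈ T → ∃ q ∈ C, ∃ r : ℝ, e x = q.1 + (r : ℂ) * q.2

lemma LineCh.restr {T : Set X} {e : OpenPartialHomeomorph X ℂ} (h : LineCh T e) (U : Set X) (hU : IsOpen U) :
    LineCh T (e.restrOpen U hU) := by
  obtain ⟨C, hC, h⟩ := h
  refine ⟨C, hC, fun x hx hT => ?_⟩
  rw [OpenPartialHomeomorph.restrOpen_source] at hx
  exact h x hx.1 hT

lemma LineCh.translate {T : Set X} {e : OpenPartialHomeomorph X ℂ} (h : LineCh T e) (v : ℂ) :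
    LineCh T (e.transHomeomorph (Homeomorph.addRight v)) := by
  obtain ⟨C, hC, h⟩ := h
  refine ⟨(fun q => (q.1 + v, q.2)) '' C, hC.image _, fun x hx hT => ?_⟩
  obtain ⟨q, hq, r, hr⟩ := h x hx hT
  refine ⟨_, ⟨q, hq, rfl⟩, r, ?_⟩
  show e x + v = q.1 + v + _
  rw [hr]; ring

lemma exists_ch [T2Space X] {T : Set X} (hT : ∀ p ∈ T, ∃ e : OpenPartialHomeomorph X ℂ, p ∈ e.source ∧ LineCh T e)
    {p0 : X} (hp0 : p0 ∈ T)
    (F : Finset X) (hF : ∀ p ∈ F, p ∈ T) :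
    ∃ e : OpenPartialHomeomorph X ℂ, (∀ p ∈ F, p ∈ e.source) ∧ LineCh T e ∧ ∃ R : ℝ, ∀ y ∈ e.source, ‖e y‖ < R := by
  classical
  induction F using Finset.induction_on with
  | empty =>
    obtain ⟨e, he, hl⟩ := hT p0 hp0
    refine ⟨e.restrOpen ∅ isOpen_empty, by simp, hl.restr _ _, 0, ?_⟩
    intro y hy
    rw [OpenPartialHomeomorph.restrOpen_source] at hy
    exact absurd hy.2 (by simp)
  | insert p F hpF ih =>
    obtain ⟨e, he, hl, R, hR⟩ := ih fun q hq => hF q (Finset.mem_insert_of_mem hq)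
    obtain ⟨e', he', hl'⟩ := hT p (hF p (Finset.mem_insert_self _ _))
    obtain ⟨U, V, hU, hV, hFU, hpV, hd⟩ := SeparatedNhds.of_finset_finset F {p} (by simpa using hpF)
    have hW : IsOpen (e'.source ∩ e' ⁻¹' Metric.ball (e' p) 1) := e'.isOpen_inter_preimage Metric.isOpen_ball
    set W := V ∩ (e'.source ∩ e' ⁻¹' Metric.ball (e' p) 1) with hWd
    have hWo : IsOpen W := hV.inter hW
    let e1 := e.restrOpen U hU
    let v : ℂ := ((|R| + ‖e' p‖ + 2 : ℝ) : ℂ)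
    let e2 := (e'.restrOpen W hWo).transHomeomorph (Homeomorph.addRight v)
    have hs1 : e1.source = e.source ∩ U := OpenPartialHomeomorph.restrOpen_source _ _ _
    have hs2 : e2.source = e'.source ∩ W := OpenPartialHomeomorph.restrOpen_source e' W hWo
    have hb2 : ∀ y ∈ e2.source, ‖e' y‖ < ‖e' p‖ + 1 := by
      intro y hy
      rw [hs2] at hy
      have h1 : ‖e' y - e' p‖ < 1 := by
        have := hy.2.2.2
        rwa [Set.mem_preimage, Metric.mem_ball, dist_eq_norm] at this
      have := norm_sub_norm_le (e' y) (e' p)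
      linarith
    have hv : ‖v‖ = |R| + ‖e' p‖ + 2 := by
      rw [Complex.norm_real, Real.norm_eq_abs, abs_of_nonneg (by positivity)]
    have hsd : Disjoint e1.source e2.source := by
      rw [hs1, hs2, Set.disjoint_left]
      intro y hy hy'
      exact Set.disjoint_left.1 hd hy.2 hy'.2.1
    have htd : Disjoint e1.target e2.target := by
      rw [Set.disjoint_left]
      intro z hz hz'
      have h1 := hR (e1.symm z) (by have := e1.map_target hz; rw [hs1] at this; exact this.1)
      have h2 : e (e1.symm z) = z := e1.right_inv hz
      have h3 := hb2 _ (e2.map_target hz')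
      have h4 : e' (e2.symm z) + v = z := e2.right_inv hz'
      rw [h2, ← h4] at h1
      have h5 := norm_sub_norm_le v (-(e' (e2.symm z)))
      rw [norm_neg, sub_neg_eq_add, add_comm v] at h5
      have := le_abs_self R
      linarith
    let e3 := e1.disjointUnion e2 hsd htd
    have hs3 : e3.source = e1.source ∪ e2.source := rfl
    have ha1 : ∀ y ∈ e1.source, e3 y = e y := fun y hy => Set.piecewise_eq_of_mem _ _ _ hy
    have ha2 : ∀ y ∈ e2.source, e3 y = e2 y := fun y hy =>
      Set.piecewise_eq_of_notMem _ _ _ (fun h => Set.disjoint_left.1 hsd h hy)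
    refine ⟨e3, ?_, ?_, |R| + ‖v‖ + ‖e' p‖ + 1, ?_⟩
    · intro q hq
      rw [hs3]
      rcases Finset.mem_insert.1 hq with rfl | hq
      · right
        rw [hs2]
        exact ⟨he', hpV (by simp), he', by simp⟩
      · left
        rw [hs1]
        exact ⟨he q hq, hFU hq⟩
    · obtain ⟨C1, hC1, h1⟩ := hl.restr U hU
      obtain ⟨C2, hC2, h2⟩ := (hl'.restr W hWo).translate v
      refine ⟨C1 ∪ C2, hC1.union hC2, fun x hx hxT => ?_⟩
      rw [hs3] at hx
      rcases hx with hx | hx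
      · rw [ha1 x hx]
        obtain ⟨q, hq, hr⟩ := h1 x hx hxT
        exact ⟨q, Or.inl hq, hr⟩
      · rw [ha2 x hx]
        obtain ⟨q, hq, hr⟩ := h2 x hx hxT
        exact ⟨q, Or.inr hq, hr⟩
    · intro y hy
      have h0 := norm_nonneg (e' p)
      have h1 := norm_nonneg v
      rw [hs3] at hy
      rcases hy with hy | hy
      · rw [ha1 y hy]
        rw [hs1] at hy
        have := hR y hy.1
        have := le_abs_self R
        linarith
      · rw [ha2 y hy]
        have h3 := hb2 y hy
        have h4 : ‖e' y + v‖ ≤ _ := norm_add_le _ _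
        have : e2 y = e' y + v := rfl
        rw [this]
        have := abs_nonneg R
        linarith

/-- the induced chart on configurations -/
lemma ms_chart (e : OpenPartialHomeomorph X ℂ) {T : Set X} (hl : LineCh T e) {m : ℕ} {t0 : {t : Multiset X // t.card = m}}
    (ht0 : ∀ x ∈ t0.1, x ∈ e.source) :
    ∃ E : OpenPartialHomeomorph {t : Multiset X // t.card = m} (Fin m → ℂ), t0 ∈ E.source ∧
      ∃ (ic : Type) (_ : Countable ic) (c : ic → (Fin m → ℝ) → (Fin m → ℂ)), (∀ l, ContDiff ℝ 1 (c l)) ∧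
        ∀ t ∈ E.source, (∀ x ∈ t.1, x ∈ T) → ∃ l, E t ∈ Set.range (c l) := by
  let U := e.source
  let W := {t : Multiset U // t.card = m}
  have hb0 : IsOpenEmbedding (Subtype.val : U → X) := e.open_source.isOpenEmbedding_subtypeVal
  have ha0 : IsOpenEmbedding (fun u : U => e u.1) := e.isOpenEmbedding_restrict
  have hsub : ∀ {Z : Type} [TopologicalSpace Z], IsOpenEmbedding (Subtype.val : {t : Multiset Z // t.card = m} → Multiset Z) :=
    fun {Z} _ => (isClopen_ms_card m).isOpen.isOpenEmbedding_subtypeVal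
  let b : W → {t : Multiset X // t.card = m} := fun t => ⟨t.1.map Subtype.val, by rw [Multiset.card_map]; exact t.2⟩
  let a : W → MSC m := fun t => ⟨t.1.map (fun u : U => e u.1), by rw [Multiset.card_map]; exact t.2⟩
  have hb : IsOpenEmbedding b := by
    refine IsOpenEmbedding.of_comp _ hsub ?_
    exact (isOpenEmbedding_ms_map hb0).comp hsub
  have ha : IsOpenEmbedding a := by
    refine IsOpenEmbedding.of_comp _ hsub ?_
    exact (isOpenEmbedding_ms_map ha0).comp hsub
  have ha' : IsOpenEmbedding (fun t => rootHomeo m (a t)) := (rootHomeo m).isOpenEmbedding.comp ha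
  have hw : ∃ w : W, b w = t0 := by
    refine ⟨⟨t0.1.attach.map fun x => ⟨x.1, ht0 x.1 x.2⟩, by rw [Multiset.card_map, Multiset.card_attach]; exact t0.2⟩, Subtype.ext ?_⟩
    show Multiset.map _ (Multiset.map _ _) = _
    rw [Multiset.map_map]
    exact Multiset.attach_map_val _
  obtain ⟨w0, hw0⟩ := hw
  have hne : Nonempty W := ⟨w0⟩
  let Eb := hb.toOpenPartialHomeomorph b
  let Ea := ha'.toOpenPartialHomeomorph _
  obtain ⟨C, hC, h⟩ := hl
  have hCc : Countable C := hC
  refine ⟨Eb.symm.trans Ea, ?_, (Fin m → C), inferInstance, fun l r => rootHomeo m ⟨msk m (fun i => (l i).1.1 + (r i : ℂ) * (l i).1.2), msk_card m _⟩, ?_, ?_⟩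
  · rw [OpenPartialHomeomorph.trans_source]
    refine ⟨⟨w0, trivial, hw0⟩, trivial⟩
  · intro l
    have := contDiff_rootHomeo m
    refine this.comp (contDiff_pi.2 fun i => ?_)
    have h2 : ContDiff ℝ 1 (fun r : Fin m → ℝ => (r i : ℂ)) := Complex.ofRealCLM.contDiff.comp (contDiff_apply ℝ ℝ i)
    exact contDiff_const.add (h2.mul contDiff_const)
  · intro t ht hT
    rw [OpenPartialHomeomorph.trans_source] at ht
    obtain ⟨w, _, hw⟩ := ht.1
    have hw : b w = t := hw
    have h1 : Eb.symm t = w := by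
      rw [← hw]; exact Eb.left_inv (Set.mem_univ w)
    have h2 : (Eb.symm.trans Ea) t = rootHomeo m (a w) := by
      show Ea (Eb.symm t) = _
      rw [h1]; rfl
    obtain ⟨z, hz⟩ := msk_surj' w.1 w.2
    have hzT : ∀ i, (z i).1 ∈ T := by
      intro i
      apply hT
      rw [← hw]
      show (z i).1 ∈ Multiset.map _ _
      rw [← hz]
      exact Multiset.mem_map_of_mem _ (Multiset.mem_map_of_mem _ (Finset.mem_univ i))
    choose q hq r hr using fun i => h (z i).1 (z i).2 (hzT i)
    refine ⟨fun i => ⟨q i, hq i⟩, r, ?_⟩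
    rw [h2]
    show rootHomeo m _ = _
    congr 1
    apply Subtype.ext
    show msk m _ = Multiset.map _ w.1
    rw [← hz, msk_map]
    simp only [msk]
    congr 1
    funext i
    exact (hr i).symm

end Charts

end

section
set_option autoImplicit false
open Topology
set_option linter.unusedSectionVars false
set_option linter.unusedSimpArgs false
set_option linter.unusedVariables false

section StabGP
variable {X : Type} [TopologicalSpace X]

lemma isCompact_msT {T : Set X} (hT : IsCompact T) (m : ℕ) :
    IsCompact {t : {t : Multiset X // t.card = m} | ∀ x ∈ t.1, x ∈ T} := by
  have hTc : CompactSpace T := isCompact_iff_compactSpace.1 hT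
  let r : (Fin m → T) → {t : Multiset X // t.card = m} := fun z => ⟨msk m (fun i => (z i).1), msk_card m _⟩
  have hr : Continuous r := ((continuous_msk m).comp (by fun_prop)).subtype_mk _
  have : {t : {t : Multiset X // t.card = m} | ∀ x ∈ t.1, x ∈ T} = Set.range r := by
    ext t
    constructor
    · intro ht
      obtain ⟨z, hz⟩ := msk_surj' t.1 t.2
      refine ⟨fun i => ⟨z i, ht _ ?_⟩, Subtype.ext hz⟩
      rw [← hz]; exact Multiset.mem_map_of_mem _ (Finset.mem_univ i)
    · rintro ⟨z, rfl⟩ x hx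
      have hx : x ∈ Multiset.map (fun i => (z i).1) Finset.univ.val := hx
      obtain ⟨i, _, rfl⟩ := Multiset.mem_map.1 hx
      exact (z i).2
  rw [this]
  exact isCompact_range hr

theorem ST_gp [T2Space X] [CompactSpace X] {T : Set X} (hTc : IsClosed T)
    (hT : ∀ p ∈ T, ∃ e : OpenPartialHomeomorph X ℂ, p ∈ e.source ∧ LineCh T e) {m d : ℕ} (hdm : d < m)
    (F : C(Fin d → I, {t : Multiset X // t.card = m})) {A : Set (Fin d → I)} (hA : IsClosed A)
    (hFA : ∀ x ∈ A, ∃ y ∈ (F x).1, y ∉ T) :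
    ∃ G : C(Fin d → I, {t : Multiset X // t.card = m}), ContinuousMap.HomotopicRel F G A ∧ ∀ x, ∃ y ∈ (G x).1, y ∉ T := by
  classical
  have hYc : CompactSpace {t : Multiset X // t.card = m} := isCompact_iff_compactSpace.1 (isCompact_ms_card m)
  set MT : Set {t : Multiset X // t.card = m} := {t | ∀ x ∈ t.1, x ∈ T} with hMT
  have hMTc : IsCompact MT := isCompact_msT hTc.isCompact m
  have key : ∀ t0 ∈ MT, ∃ N ∈ 𝓝 t0, IsCompact N ∧ ∃ E : OpenPartialHomeomorph {t : Multiset X // t.card = m} (Fin m → ℂ), N ⊆ E.source ∧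
      ∃ (ic : Type) (_ : Countable ic) (c : ic → (Fin m → ℝ) → (Fin m → ℂ)), (∀ l, ContDiff ℝ 1 (c l)) ∧
        ∀ t ∈ E.source, (∀ x ∈ t.1, x ∈ T) → ∃ l, E t ∈ Set.range (c l) := by
    intro t0 ht0
    have hpos : 0 < t0.1.card := by rw [t0.2]; omega
    obtain ⟨p0, hp0⟩ := Multiset.card_pos_iff_exists_mem.1 hpos
    obtain ⟨e, he, hl, -⟩ := exists_ch hT (ht0 p0 hp0) t0.1.toFinset (fun p hp => ht0 p (Multiset.mem_toFinset.1 hp))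
    obtain ⟨E, hE, hc⟩ := ms_chart e hl (t0 := t0) (fun x hx => he x (Multiset.mem_toFinset.2 hx))
    obtain ⟨N, hN, hNs, hNc⟩ := local_compact_nhds (E.open_source.mem_nhds hE)
    exact ⟨N, hN, hNc, E, hNs, hc⟩
  let Nf : {t : Multiset X // t.card = m} → Set {t : Multiset X // t.card = m} :=
    fun t => if h : t ∈ MT then (key t h).choose else ∅
  have hNf : ∀ t (h : t ∈ MT), Nf t = (key t h).choose := fun t h => dif_pos h
  obtain ⟨ts, hts, hcov⟩ := hMTc.elim_nhds_subcover Nf (fun t ht => by rw [hNf t ht]; exact (key t ht).choose_spec.1)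
  have main : ∀ ts : Finset {t : Multiset X // t.card = m}, (∀ t ∈ ts, t ∈ MT) →
      ∃ G : C(Fin d → I, {t : Multiset X // t.card = m}), ContinuousMap.HomotopicRel F G A ∧
        ∀ x, G x ∉ ⋃ t ∈ ts, Nf t ∩ MT := by
    intro ts
    induction ts using Finset.induction_on with
    | empty => intro _; exact ⟨F, ContinuousMap.HomotopicRel.refl F, by simp⟩
    | insert t ts htn ih =>
      intro h
      obtain ⟨G, hG, hGn⟩ := ih fun t ht => h t (Finset.mem_insert_of_mem ht)
      have htM := h t (Finset.mem_insert_self _ _)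
      obtain ⟨hN, hNc, E, hNE, ic, hic, c, hc, hcv⟩ := (key t htM).choose_spec
      rw [← hNf t htM] at hN hNc hNE
      have hcpt : ∀ t' ∈ MT, IsCompact (Nf t' ∩ MT) := by
        intro t' ht'
        rw [hNf t' ht']
        exact (key t' ht').choose_spec.2.1.inter hMTc
      have hO : IsOpen (⋃ t ∈ ts, Nf t ∩ MT)ᶜ := by
        rw [isOpen_compl_iff]
        exact (ts.isCompact_biUnion fun t ht => hcpt t (h t (Finset.mem_insert_of_mem ht))).isClosed
      have hGA : ∀ x ∈ A, G x = F x := by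
        obtain ⟨H⟩ := hG
        intro x hx
        have h1 := H.eq_fst 1 hx
        rw [← h1]; exact (H.apply_one x).symm
      have hfr : Module.finrank ℝ (Fin m → ℂ) = 2 * m := by
        rw [Module.finrank_pi_fintype]; simp; ring
      obtain ⟨H, hHc, hH0, hHO, hH1, hHA⟩ := GP1 E (isClosedEmbedding_cubeIn d) c hc
        (by rw [hfr]; simp; omega) (hcpt t htM) (fun y hy => hNE hy.1) (fun y hy => hcv y (hNE hy.1) hy.2)
        G.continuous hO (fun x => hGn x) hA (fun x hx h2 => by
          rw [hGA x hx] at h2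
          obtain ⟨y, hy, hyT⟩ := hFA x hx
          exact hyT (h2.2 y hy))
      refine ⟨⟨fun x => H (1, x), by fun_prop⟩, hG.trans ⟨⟨⟨⟨H, hHc⟩, hH0, fun x => rfl⟩, fun s x hx => ?_⟩⟩, ?_⟩
      · exact hHA s x hx
      · intro x hx
        rw [Finset.set_biUnion_insert] at hx
        rcases hx with hx | hx
        · exact hH1 x hx
        · exact hHO (1, x) hx
  obtain ⟨G, hG, hGn⟩ := main ts hts
  refine ⟨G, hG, fun x => ?_⟩
  by_contra hcon
  push Not at hcon
  have h1 : G x ∈ MT := hcon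
  have h2 := hcov h1
  obtain ⟨t, ht, hx⟩ := Set.mem_iUnion₂.1 h2
  exact hGn x (Set.mem_iUnion₂.2 ⟨t, ht, hx, h1⟩)

end StabGP

end

section
set_option autoImplicit false
open Topology
set_option linter.unusedSectionVars false
set_option linter.unusedSimpArgs false
set_option linter.unusedVariables false

section Stab
variable {X : Type} [TopologicalSpace X]

/-- Data giving a spine of the complement of a point. -/
structure StabX (X : Type) [TopologicalSpace X] (o : X) where
  θ : X → ℝ
  hθ : Continuous θ
  hθ0 : ∀ x, 0 ≤ θ x
  hθo : θ o ≠ 0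
  ch : ∀ p, θ p = 0 → ∃ e : OpenPartialHomeomorph X ℂ, p ∈ e.source ∧ LineCh {x | θ x = 0} e
  sq : ∀ ε : ℝ, 0 < ε → ∃ φ : I × X → X, Continuous φ ∧ (∀ x, φ (0, x) = x) ∧ (∀ t, φ (t, o) = o) ∧ ∀ x, ε ≤ θ x → φ (1, x) = o

lemma map_rep {o : X} {φ : X → X} (h : φ o = o) (n : ℕ) : (Multiset.replicate n o).map φ = Multiset.replicate n o := by
  rw [Multiset.map_replicate, h]

theorem StabX.push [T2Space X] [CompactSpace X] {o : X} (h : StabX X o) {m d : ℕ} (hdm : d < m)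
    (F : C(Fin d → I, {t : Multiset X // t.card = m})) {A : Set (Fin d → I)} (hA : IsClosed A)
    (hFA : ∀ x ∈ A, o ∈ (F x).1) :
    ∃ φ : I × X → X, Continuous φ ∧ (∀ x, φ (0, x) = x) ∧ (∀ t, φ (t, o) = o) ∧
    ∃ G : C(Fin d → I, {t : Multiset X // t.card = m}), ContinuousMap.HomotopicRel F G A ∧
      ∀ x, o ∈ (G x).1.map (fun y => φ (1, y)) := by
  obtain ⟨G, hG, hGn⟩ := ST_gp (T := {x | h.θ x = 0}) (isClosed_singleton.preimage h.hθ) h.ch hdm F hA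
    (fun x hx => ⟨o, hFA x hx, h.hθo⟩)
  have hc : Continuous fun x => ((G x).1.map h.θ).sum :=
    (continuous_ms_sum' h.hθ).comp (continuous_subtype_val.comp G.continuous)
  obtain ⟨x0, -, hx0⟩ := isCompact_univ.exists_isMinOn (Set.univ_nonempty (α := Fin d → I)) hc.continuousOn
  have hmin : ∀ x, ((G x0).1.map h.θ).sum ≤ ((G x).1.map h.θ).sum := fun x => hx0 (Set.mem_univ x)
  have hpos : 0 < ((G x0).1.map h.θ).sum := by
    obtain ⟨y, hy, hyT⟩ := hGn x0
    have h1 : h.θ y ≤ ((G x0).1.map h.θ).sum := Multiset.single_le_sum (by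
      intro z hz
      obtain ⟨w, _, rfl⟩ := Multiset.mem_map.1 hz
      exact h.hθ0 w) _ (Multiset.mem_map_of_mem _ hy)
    exact lt_of_lt_of_le (lt_of_le_of_ne (h.hθ0 y) (Ne.symm hyT)) h1
  have hm : (0 : ℝ) < m := by exact_mod_cast (by omega : 0 < m)
  obtain ⟨φ, h1, h2, h3, h4⟩ := h.sq (((G x0).1.map h.θ).sum / m) (by positivity)
  refine ⟨φ, h1, h2, h3, G, hG, fun x => ?_⟩
  by_contra hcon
  have hlt : ∀ y ∈ (G x).1, h.θ y < ((G x0).1.map h.θ).sum / m := by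
    intro y hy
    by_contra hle
    push Not at hle
    exact hcon (Multiset.mem_map.2 ⟨y, hy, h4 y hle⟩)
  have hne : (G x).1 ≠ 0 := by
    intro h0
    have := (G x).2
    rw [h0] at this
    simp at this
    omega
  have h5 : ((G x).1.map h.θ).sum < ((G x).1.map (fun _ => ((G x0).1.map h.θ).sum / m)).sum :=
    Multiset.sum_lt_sum_of_nonempty hne hlt
  rw [Multiset.map_const', Multiset.sum_replicate, (G x).2, nsmul_eq_mul, mul_div_cancel₀ _ hm.ne'] at h5
  exact absurd (hmin x) (not_le.2 h5)

lemma sub_cont [T2Space X] [CompactSpace X] {Z : Type} [TopologicalSpace Z] {o : X} {m : ℕ} {f : Z → Multiset X} (hf : Continuous f)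
    (hc : ∀ z, (f z).card = m + 1) (ho : ∀ z, o ∈ f z) :
    ∃ g : Z → Multiset X, Continuous g ∧ (∀ z, (g z).card = m) ∧ ∀ z, f z = g z + {o} := by
  classical
  have hYc : CompactSpace {t : Multiset X // t.card = m} := isCompact_iff_compactSpace.1 (isCompact_ms_card m)
  let a : {t : Multiset X // t.card = m} → Multiset X := fun t => t.1 + {o}
  have ha : IsClosedEmbedding a := Continuous.isClosedEmbedding (continuous_subtype_val.add continuous_const) (by
    intro t t' h
    exact Subtype.ext (add_right_cancel h))
  have he : ∀ z, (f z).erase o + {o} = f z := fun z => by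
    rw [add_comm, Multiset.singleton_add]; exact Multiset.cons_erase (ho z)
  have hcd : ∀ z, ((f z).erase o).card = m := fun z => by
    have := congrArg Multiset.card (he z)
    rw [Multiset.card_add, hc] at this
    simpa using this
  refine ⟨fun z => (f z).erase o, ?_, hcd, fun z => (he z).symm⟩
  have : Continuous (fun z => (⟨(f z).erase o, hcd z⟩ : {t : Multiset X // t.card = m})) := by
    rw [ha.isEmbedding.continuous_iff]
    have : a ∘ (fun z => (⟨(f z).erase o, hcd z⟩ : {t : Multiset X // t.card = m})) = f := funext he
    rw [this]; exact hf
  exact continuous_subtype_val.comp this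

lemma BH_map {i : ℕ} {f : (Fin i → I) → Multiset X} (hf : Continuous f)
    (hb : ∀ s ∈ Cube.boundary (Fin i), ∀ s' ∈ Cube.boundary (Fin i), f s = f s') {φ : I × X → X} (hφ : Continuous φ)
    (h0 : ∀ x, φ (0, x) = x) : BH f (fun s => (f s).map fun x => φ (1, x)) := by
  have h := BH.ofHomotopy hf hb (G := fun p : I × Multiset X => p.2.map fun x => φ (p.1, x))
    (continuous_ms_map (h := fun t x => φ (t, x)) hφ)
  simpa [h0] using h

lemma scons_bd {i : ℕ} {s : Fin (i + 1) → I} (hs : s ∈ Cube.boundary (Fin (i + 1))) :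
    s 0 = 0 ∨ s 0 = 1 ∨ (fun j => s j.succ) ∈ Cube.boundary (Fin i) := by
  obtain ⟨j, hj⟩ := hs
  rcases Fin.eq_zero_or_eq_succ j with rfl | ⟨k, rfl⟩
  · rcases hj with hj | hj
    · exact Or.inl hj
    · exact Or.inr (Or.inl hj)
  · exact Or.inr (Or.inr ⟨k, hj⟩)

theorem StabX.inj1 [T2Space X] [CompactSpace X] {o : X} (h : StabX X o) {i n : ℕ} (hi : 0 < i) (hin : i < n)
    {f : (Fin i → I) → Multiset X} (hf : Continuous f) (hc : ∀ s, (f s).card = n)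
    (hb : ∀ s ∈ Cube.boundary (Fin i), f s = Multiset.replicate n o) (hN : BNull fun s => f s + {o}) : BNull f := by
  obtain ⟨y, hy⟩ := hN
  let gl : GenLoop (Fin i) (Multiset X) (Multiset.replicate (n + 1) o) :=
    ⟨⟨fun s => f s + {o}, by fun_prop⟩, fun s hs => by
      show f s + {o} = _
      rw [hb s hs, Multiset.replicate_succ, add_comm, Multiset.singleton_add]⟩
  obtain ⟨F⟩ := null_of_BH hi gl hy
  have hF0 : ∀ s, F (0, s) = f s + {o} := fun s => F.apply_zero s
  have hF1 : ∀ s, F (1, s) = Multiset.replicate (n + 1) o := fun s => F.apply_one s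
  have hFb : ∀ t, ∀ s ∈ Cube.boundary (Fin i), F (t, s) = Multiset.replicate (n + 1) o := fun t s hs =>
    (F.eq_fst t hs).trans (gl.2 s hs)
  have hcard : ∀ p, (F p).card = n + 1 :=
    BH_card (f := fun s => f s) (g := fun s => f s) F.continuous (fun s => by rw [hF0, Multiset.card_add, hc]; rfl)
  let F' : C(Fin (i + 1) → I, {t : Multiset X // t.card = n + 1}) :=
    ⟨fun s => ⟨F (s 0, fun j => s j.succ), hcard _⟩, (F.continuous.comp (by fun_prop)).subtype_mk _⟩
  have hmem : o ∈ Multiset.replicate (n + 1) o := Multiset.mem_replicate.2 ⟨by omega, rfl⟩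
  obtain ⟨φ, hφ, hφ0, hφo, G, hG, hGo⟩ := h.push (by omega) F' (isClosed_cube_boundary (i + 1)) (by
    intro s hs
    show o ∈ F _
    rcases scons_bd hs with h1 | h1 | h1
    · rw [h1, hF0]; simp
    · rw [h1, hF1]; exact hmem
    · rw [hFb _ _ h1]; exact hmem)
  have hGF : ∀ s ∈ Cube.boundary (Fin (i + 1)), (G s).1 = F (s 0, fun j => s j.succ) := by
    obtain ⟨H⟩ := hG
    intro x hx
    have h1 := H.eq_fst 1 hx
    exact congrArg Subtype.val ((H.apply_one x).symm.trans h1)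
  have hφ1 : Continuous fun x => φ (1, x) := by fun_prop
  obtain ⟨g, hg, hgc, hgo⟩ := sub_cont (o := o) (m := n) (f := fun s => (G s).1.map fun y => φ (1, y))
    ((continuous_ms_map' hφ1).comp (continuous_subtype_val.comp G.continuous))
    (fun s => by rw [Multiset.card_map]; exact (G s).2) hGo
  have hrep : ∀ s ∈ Cube.boundary (Fin (i + 1)), F (s 0, fun j => s j.succ) = Multiset.replicate (n + 1) o → g s = Multiset.replicate n o := by
    intro s hs h1
    have h2 : (G s).1.map (fun y => φ (1, y)) = g s + {o} := hgo s
    rw [hGF s hs, h1, map_rep (hφo 1), Multiset.replicate_succ, ← Multiset.singleton_add, add_comm] at h2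
    exact (add_right_cancel h2).symm
  have hbd : ∀ (t : I) (s : Fin i → I), (t = 0 ∨ t = 1 ∨ s ∈ Cube.boundary (Fin i)) → (Fin.cons t s : Fin (i + 1) → I) ∈ Cube.boundary (Fin (i + 1)) := by
    rintro t s (h1 | h1 | ⟨j, hj⟩)
    · exact ⟨0, Or.inl h1⟩
    · exact ⟨0, Or.inr h1⟩
    · exact ⟨j.succ, hj⟩
  have hb' : ∀ s ∈ Cube.boundary (Fin i), ∀ s' ∈ Cube.boundary (Fin i), f s = f s' := fun s hs s' hs' => by rw [hb s hs, hb s' hs']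
  refine BNull.of_BH ?_ (BH_map hf hb' hφ hφ0)
  refine ⟨Multiset.replicate n o, fun p => g (Fin.cons p.1 p.2), hg.comp ?_, fun s => ?_, fun s => ?_, ?_⟩
  · refine continuous_pi fun j => ?_
    refine Fin.cases ?_ (fun j => ?_) j
    · simp only [Fin.cons_zero]; fun_prop
    · simp only [Fin.cons_succ]; fun_prop
  · have h2 := hgo (Fin.cons 0 s)
    have h3 : (G (Fin.cons 0 s)).1 = f s + {o} := (hGF _ (hbd 0 s (Or.inl rfl))).trans (hF0 s)
    simp only [h3, Multiset.map_add, Multiset.map_singleton, hφo] at h2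
    exact (add_right_cancel h2).symm
  · exact hrep _ (hbd 1 s (Or.inr (Or.inl rfl))) (hF1 s)
  · intro t s hs s' hs'
    show g _ = g _
    rw [hrep _ (hbd t s (Or.inr (Or.inr hs))) (hFb t s hs), hrep _ (hbd t s' (Or.inr (Or.inr hs'))) (hFb t s' hs')]

theorem StabX.inj [T2Space X] [CompactSpace X] {o : X} (h : StabX X o) {i n : ℕ} (hi : 0 < i) (hin : i < n) (r : ℕ)
    {f : (Fin i → I) → Multiset X} (hf : Continuous f) (hc : ∀ s, (f s).card = n)
    (hb : ∀ s ∈ Cube.boundary (Fin i), f s = Multiset.replicate n o) (hN : BNull fun s => f s + Multiset.replicate r o) : BNull f := by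
  induction r with
  | zero => simpa using hN
  | succ r ih =>
    apply ih
    refine h.inj1 (n := n + r) hi (by omega) (hf.add (continuous_const (y := Multiset.replicate r o))) (fun s => by simp [hc]) ?_ ?_
    · intro s hs
      rw [hb s hs, Multiset.replicate_add]
    · convert hN using 2 with s
      rw [add_assoc, add_comm (Multiset.replicate r o), Multiset.singleton_add, ← Multiset.replicate_succ]

theorem StabX.surj1 [T2Space X] [CompactSpace X] {o : X} (h : StabX X o) {i n : ℕ} (hin : i < n + 1)
    {f : (Fin i → I) → Multiset X} (hf : Continuous f) (hc : ∀ s, (f s).card = n + 1)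
    (hb : ∀ s ∈ Cube.boundary (Fin i), f s = Multiset.replicate (n + 1) o) :
    ∃ g : (Fin i → I) → Multiset X, Continuous g ∧ (∀ s, (g s).card = n) ∧
      (∀ s ∈ Cube.boundary (Fin i), g s = Multiset.replicate n o) ∧ BH f (fun s => g s + {o}) := by
  have hmem : o ∈ Multiset.replicate (n + 1) o := Multiset.mem_replicate.2 ⟨by omega, rfl⟩
  let F' : C(Fin i → I, {t : Multiset X // t.card = n + 1}) := ⟨fun s => ⟨f s, hc _⟩, hf.subtype_mk _⟩
  obtain ⟨φ, hφ, hφ0, hφo, G, hG, hGo⟩ := h.push (by omega) F' (isClosed_cube_boundary i) (by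
    intro s hs
    show o ∈ f s
    rw [hb s hs]; exact hmem)
  obtain ⟨H⟩ := hG
  have hGf : ∀ s ∈ Cube.boundary (Fin i), (G s).1 = f s := by
    intro x hx
    have h1 := H.eq_fst 1 hx
    exact congrArg Subtype.val ((H.apply_one x).symm.trans h1)
  have hφ1 : Continuous fun x => φ (1, x) := by fun_prop
  have hGc : Continuous fun s => (G s).1 := continuous_subtype_val.comp G.continuous
  obtain ⟨g, hg, hgc, hgo⟩ := sub_cont (o := o) (m := n) (f := fun s => (G s).1.map fun y => φ (1, y))
    ((continuous_ms_map' hφ1).comp hGc)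
    (fun s => by rw [Multiset.card_map]; exact (G s).2) hGo
  refine ⟨g, hg, hgc, ?_, ?_⟩
  · intro s hs
    have h2 : (G s).1.map (fun y => φ (1, y)) = g s + {o} := hgo s
    rw [hGf s hs, hb s hs, map_rep (hφo 1), Multiset.replicate_succ, ← Multiset.singleton_add, add_comm] at h2
    exact (add_right_cancel h2).symm
  · have h1 : BH f (fun s => (G s).1) := by
      refine ⟨fun p => (H p).1, continuous_subtype_val.comp H.continuous, fun s => ?_, fun s => ?_, ?_⟩
      · exact congrArg Subtype.val (H.apply_zero s)
      · exact congrArg Subtype.val (H.apply_one s)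
      · intro t s hs s' hs'
        have h1 : (H (t, s)).1 = f s := congrArg Subtype.val (H.eq_fst t hs)
        have h2 : (H (t, s')).1 = f s' := congrArg Subtype.val (H.eq_fst t hs')
        show (H (t, s)).1 = (H (t, s')).1
        rw [h1, h2, hb s hs, hb s' hs']
    have h2 := BH_map hGc (fun s hs s' hs' => by rw [hGf s hs, hGf s' hs', hb s hs, hb s' hs']) hφ hφ0
    have h3 := h1.trans h2
    simpa only [hgo] using h3

theorem StabX.surj [T2Space X] [CompactSpace X] {o : X} (h : StabX X o) {i n : ℕ} (hin : i ≤ n) (r : ℕ) :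
    ∀ {f : (Fin i → I) → Multiset X}, Continuous f → (∀ s, (f s).card = n + r) →
    (∀ s ∈ Cube.boundary (Fin i), f s = Multiset.replicate (n + r) o) →
    ∃ g : (Fin i → I) → Multiset X, Continuous g ∧ (∀ s, (g s).card = n) ∧
      (∀ s ∈ Cube.boundary (Fin i), g s = Multiset.replicate n o) ∧ BH f (fun s => g s + Multiset.replicate r o) := by
  induction r with
  | zero =>
    intro f hf hc hb
    refine ⟨f, hf, hc, hb, ?_⟩
    simpa using BH.refl hf (fun s hs s' hs' => by rw [hb s hs, hb s' hs'])
  | succ r ih =>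
    intro f hf hc hb
    obtain ⟨g, hg, hgc, hgb, hB⟩ := h.surj1 (n := n + r) (by omega) hf hc hb
    obtain ⟨g', hg', hgc', hgb', hB'⟩ := ih hg hgc hgb
    refine ⟨g', hg', hgc', hgb', hB.trans ?_⟩
    have h1 := hB'.comp (φ := fun t => t + {o}) (by fun_prop)
    have h2 : (fun s => g' s + Multiset.replicate (r + 1) o) = (fun t => t + {o}) ∘ fun s => g' s + Multiset.replicate r o := by
      funext s
      show _ = g' s + _ + _
      rw [add_assoc, add_comm (Multiset.replicate r o), Multiset.singleton_add, ← Multiset.replicate_succ]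
    rw [h2]; exact h1

end Stab

end

section
set_option autoImplicit false
open Topology
set_option linter.unusedSectionVars false
set_option linter.unusedSimpArgs false
set_option linter.unusedVariables false

section Poly

/-- `e^{2 π i t}` on the circle. -/
def ce (t : ℝ) : Circle := Circle.exp (2 * Real.pi * t)

lemma continuous_ce : Continuous ce := Circle.exp.continuous.comp (by fun_prop)

lemma ce_add (a b : ℝ) : ce (a + b) = ce a * ce b := by
  unfold ce; rw [mul_add, Circle.exp_add]

lemma ce_zero : ce 0 = 1 := by simp [ce]

lemma ce_neg (a : ℝ) : ce (-a) = (ce a)⁻¹ := by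
  unfold ce; rw [mul_neg, Circle.exp_neg]

lemma ce_eq {a b : ℝ} : ce a = ce b ↔ ∃ m : ℤ, a = b + m := by
  unfold ce
  rw [Circle.exp_eq_exp]
  have hpi := Real.pi_pos
  refine exists_congr fun m => ?_
  constructor
  · intro h
    have : 2 * Real.pi * a = 2 * Real.pi * (b + m) := by rw [h]; ring
    exact mul_left_cancel₀ (by positivity) this
  · intro h; rw [h]; ring

lemma ce_int (m : ℤ) : ce m = 1 := by
  rw [← ce_zero, ce_eq]; exact ⟨m, by ring⟩

lemma ce_one : ce 1 = 1 := by simpa using ce_int 1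

lemma ce_coe (t : ℝ) : (ce t : ℂ) = Complex.exp (2 * Real.pi * Complex.I * t) := by
  unfold ce; rw [Circle.coe_exp]; congr 1; push_cast; ring

lemma ce_surj (z : Circle) : ∃ t : ℝ, 0 ≤ t ∧ t < 1 ∧ ce t = z := by
  obtain ⟨a, rfl⟩ := Circle.exp_surjective z
  have hpi := Real.pi_pos
  refine ⟨Int.fract (a / (2 * Real.pi)), Int.fract_nonneg _, Int.fract_lt_one _, ?_⟩
  have : Circle.exp a = ce (a / (2 * Real.pi)) := by unfold ce; congr 1; field_simp
  rw [this, ce_eq]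
  refine ⟨-⌊a / (2 * Real.pi)⌋, ?_⟩
  have := Int.fract_add_floor (a / (2 * Real.pi))
  push_cast; linarith

/-- clamp to `[0,1]` -/
def cl01 (x : ℝ) : ℝ := max 0 (min 1 x)

@[fun_prop] lemma continuous_cl01 : Continuous cl01 := by unfold cl01; fun_prop

lemma cl01_mem (x : ℝ) : 0 ≤ cl01 x ∧ cl01 x ≤ 1 := by unfold cl01; simp

lemma cl01_of_mem {x : ℝ} (h0 : 0 ≤ x) (h1 : x ≤ 1) : cl01 x = x := by unfold cl01; simp [h0, h1]

lemma cl01_ge {x : ℝ} (h1 : 1 ≤ x) : cl01 x = 1 := by unfold cl01; simp [h1]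

lemma cl01_le {x : ℝ} (h1 : x ≤ 0) : cl01 x = 0 := by
  unfold cl01; rw [min_eq_right (by linarith), max_eq_left h1]

lemma cl01_int {k k' : ℕ} (h : k ≠ k') {t : ℝ} (h0 : 0 ≤ t) (h1 : t ≤ 1) : cl01 ((k : ℝ) + t - k') = if k' < k then 1 else 0 := by
  split_ifs with hk
  · apply cl01_ge
    have : (k' : ℝ) + 1 ≤ k := by exact_mod_cast hk
    linarith
  · apply cl01_le
    have : (k : ℝ) + 1 ≤ k' := by exact_mod_cast (by omega : k + 1 ≤ k')
    linarith

/-- An edge word. -/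
structure PW where
  N : ℕ
  hN : 0 < N
  L : Type
  fL : Fintype L
  dL : DecidableEq L
  ed : L × Bool ≃ Fin N
  tw : Bool

namespace PW
variable (w : PW)

instance : Fintype w.L := w.fL
instance : DecidableEq w.L := w.dL

def Rs : Set (ℝ × ℝ) := Set.Icc 0 1 ×ˢ Set.Icc 0 (w.N : ℝ)

lemma isCompact_Rs : IsCompact w.Rs := isCompact_Icc.prod isCompact_Icc

lemma mem_Rs {p : ℝ × ℝ} : p ∈ w.Rs ↔ (0 ≤ p.1 ∧ p.1 ≤ 1) ∧ 0 ≤ p.2 ∧ p.2 ≤ w.N := Iff.rfl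

def sg (b : Bool) : ℝ := if w.tw && b then -1 else 1
def pp (b : Bool) (t : ℝ) : ℝ := if w.tw && b then 1 - t else t
def en (l : w.L) (b : Bool) : ℕ := (w.ed (l, b) : ℕ)
def h (l : w.L) (x : ℝ) : ℝ := ∑ b : Bool, w.sg b * cl01 (x - w.en l b)
def c (l : w.L) (x : ℝ) : Circle := ce (w.h l x)

lemma NR : (0 : ℝ) < w.N := by exact_mod_cast w.hN

lemma continuous_h (l : w.L) : Continuous (w.h l) := by unfold h; fun_prop

lemma continuous_c (l : w.L) : Continuous (w.c l) := continuous_ce.comp (w.continuous_h l)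

lemma en_lt (l b) : w.en l b < w.N := (w.ed (l, b)).2

lemma en_inj {l b l' b'} (h : w.en l b = w.en l' b') : l = l' ∧ b = b' := by
  have := w.ed.injective (Fin.ext h : w.ed (l, b) = w.ed (l', b'))
  simpa using this

lemma en_surj {k : ℕ} (hk : k < w.N) : ∃ l b, w.en l b = k := by
  obtain ⟨⟨l, b⟩, h⟩ := w.ed.surjective ⟨k, hk⟩
  exact ⟨l, b, congrArg Fin.val h⟩

lemma sg_cases (b : Bool) : w.sg b = 1 ∨ w.sg b = -1 := by
  unfold sg; split_ifs <;> simp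

lemma ce_sg_pp (b : Bool) (t : ℝ) : ce (w.sg b * w.pp b t) = ce t := by
  unfold sg pp
  split_ifs
  · rw [ce_eq]; exact ⟨-1, by push_cast; ring⟩
  · simp

lemma pp_pp (b : Bool) (t : ℝ) : w.pp b (w.pp b t) = t := by
  unfold pp; split_ifs <;> ring

lemma pp_mem (b : Bool) {t : ℝ} (h0 : 0 ≤ t) (h1 : t ≤ 1) : 0 ≤ w.pp b t ∧ w.pp b t ≤ 1 := by
  unfold pp; split_ifs <;> constructor <;> linarith

lemma pp_mem' (b : Bool) {t : ℝ} (h0 : 0 < t) (h1 : t < 1) : 0 < w.pp b t ∧ w.pp b t < 1 := by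
  unfold pp; split_ifs <;> constructor <;> linarith

lemma ce_sg_ind (b : Bool) (P : Prop) [Decidable P] : ce (w.sg b * (if P then 1 else 0)) = 1 := by
  rcases w.sg_cases b with h | h <;> rw [h] <;> split_ifs
  · simpa using ce_one
  · simpa using ce_zero
  · rw [mul_one, ce_neg, ce_one, inv_one]
  · simpa using ce_zero

lemma c_eq (l : w.L) (x : ℝ) : w.c l x = ce (w.sg true * cl01 (x - w.en l true)) * ce (w.sg false * cl01 (x - w.en l false)) := by
  unfold c h; rw [Fintype.sum_bool, ce_add]

lemma c_same (l : w.L) (b : Bool) {t : ℝ} (h0 : 0 ≤ t) (h1 : t ≤ 1) : w.c l (w.en l b + t) = ce (w.sg b * t) := by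
  rw [c_eq]
  have hne : ∀ b', b ≠ b' → w.en l b ≠ w.en l b' := fun b' hb h => hb (w.en_inj h).2
  cases b
  · rw [cl01_int (hne true (by simp)) h0 h1, ce_sg_ind, one_mul, add_sub_cancel_left, cl01_of_mem h0 h1]
  · rw [cl01_int (hne false (by simp)) h0 h1, ce_sg_ind, mul_one, add_sub_cancel_left, cl01_of_mem h0 h1]

lemma c_other {l l' : w.L} (hl : l ≠ l') (b : Bool) {t : ℝ} (h0 : 0 ≤ t) (h1 : t ≤ 1) : w.c l' (w.en l b + t) = 1 := by
  rw [c_eq]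
  have hne : ∀ b', w.en l b ≠ w.en l' b' := fun b' h => hl (w.en_inj h).1
  rw [cl01_int (hne true) h0 h1, cl01_int (hne false) h0 h1, ce_sg_ind, ce_sg_ind, one_mul]

lemma exists_edge {x : ℝ} (h0 : 0 ≤ x) (h1 : x ≤ w.N) : ∃ l b t, 0 ≤ t ∧ t ≤ 1 ∧ x = w.en l b + t := by
  rcases h1.eq_or_lt with h1 | h1
  · obtain ⟨l, b, hk⟩ := w.en_surj (k := w.N - 1) (by have := w.hN; omega)
    refine ⟨l, b, 1, by norm_num, le_rfl, ?_⟩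
    rw [hk, h1]
    have := w.hN
    push_cast [Nat.cast_sub (Nat.succ_le_of_lt this)]; ring
  · obtain ⟨l, b, hk⟩ := w.en_surj (k := ⌊x⌋₊) ((Nat.floor_lt h0).2 h1)
    refine ⟨l, b, x - ⌊x⌋₊, ?_, ?_, ?_⟩
    · have := Nat.floor_le h0; linarith
    · have := Nat.lt_floor_add_one x; linarith
    · rw [hk]; ring

lemma c_int {k : ℕ} (hk : k ≤ w.N) (l : w.L) : w.c l k = 1 := by
  obtain ⟨l', b, t, h0, h1, hx⟩ := w.exists_edge (x := k) (by positivity) (by exact_mod_cast hk)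
  rw [hx]
  by_cases hl : l' = l
  · subst hl
    rw [w.c_same _ _ h0 h1]
    have ht : ∃ m : ℤ, t = m := ⟨k - w.en l' b, by push_cast; linarith⟩
    obtain ⟨m, rfl⟩ := ht
    rcases w.sg_cases b with h | h <;> rw [h]
    · rw [one_mul, ce_int]
    · rw [neg_one_mul, ce_neg, ce_int, inv_one]
  · exact w.c_other hl _ h0 h1

lemma ce_eq_one_iff {t : ℝ} (h0 : 0 ≤ t) (h1 : t ≤ 1) : ce t = 1 ↔ t = 0 ∨ t = 1 := by
  constructor
  · intro h
    rw [← ce_zero, ce_eq] at h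
    obtain ⟨m, hm⟩ := h
    rw [zero_add] at hm
    rw [hm] at h0 h1 ⊢
    have h0 : 0 ≤ m := by exact_mod_cast h0
    have h1 : m ≤ 1 := by exact_mod_cast h1
    have : m = 0 ∨ m = 1 := by omega
    rcases this with rfl | rfl <;> simp
  · rintro (rfl | rfl)
    · exact ce_zero
    · exact ce_one

lemma ce_sg (b : Bool) (t : ℝ) : ce (w.sg b * t) = ce (w.pp b t) := by
  have := w.ce_sg_pp b (w.pp b t)
  rw [pp_pp] at this; exact this

lemma pp_cases (b : Bool) (t : ℝ) : (w.pp b t = 0 ∨ w.pp b t = 1) → t = 0 ∨ t = 1 := by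
  unfold pp; split_ifs
  · rintro (h | h)
    · right; linarith
    · left; linarith
  · exact id

lemma ce_inj {t t' : ℝ} (h0 : 0 < t) (h1 : t < 1) (h0' : 0 < t') (h1' : t' < 1) (h : ce t = ce t') : t = t' := by
  obtain ⟨m, hm⟩ := ce_eq.1 h
  have h2 : (-1 : ℝ) < m := by linarith
  have h3 : (m : ℝ) < 1 := by linarith
  have h2 : -1 < m := by exact_mod_cast h2
  have h3 : m < 1 := by exact_mod_cast h3
  have : m = 0 := by omega
  rw [hm, this]; simp

/-- The basic analysis of boundary points with equal label coordinates. -/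
lemma edge_cases {x x' : ℝ} (hx : 0 ≤ x ∧ x ≤ w.N) (hx' : 0 ≤ x' ∧ x' ≤ w.N) (hc : ∀ l, w.c l x = w.c l x') :
    (∃ k k' : ℕ, k ≤ w.N ∧ k' ≤ w.N ∧ x = k ∧ x' = k') ∨
    ∃ l b b' t, 0 < t ∧ t < 1 ∧ x = w.en l b + w.pp b t ∧ x' = w.en l b' + w.pp b' t := by
  obtain ⟨l, b, t, h0, h1, rfl⟩ := w.exists_edge hx.1 hx.2
  obtain ⟨l', b', t', h0', h1', rfl⟩ := w.exists_edge hx'.1 hx'.2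
  have hkey : ∀ (l : w.L) (b : Bool) (t : ℝ), t = 0 ∨ t = 1 → ∃ k : ℕ, k ≤ w.N ∧ (w.en l b : ℝ) + t = k := by
    intro l b t h
    have := w.en_lt l b
    rcases h with rfl | rfl
    · exact ⟨w.en l b, by omega, by simp⟩
    · exact ⟨w.en l b + 1, by omega, by simp⟩
  by_cases ht : t = 0 ∨ t = 1
  · have hcl : w.c l' (w.en l b + t) = 1 := by
      obtain ⟨k, hk, hk'⟩ := hkey l b t ht
      rw [hk', w.c_int hk]
    rw [hc, w.c_same _ _ h0' h1', ce_sg, ce_eq_one_iff (w.pp_mem b' h0' h1').1 (w.pp_mem b' h0' h1').2] at hcl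
    obtain ⟨k, hk, hk1⟩ := hkey l b t ht
    obtain ⟨k', hk', hk1'⟩ := hkey l' b' t' (w.pp_cases _ _ hcl)
    exact Or.inl ⟨k, k', hk, hk', hk1, hk1'⟩
  · have hne : ce (w.pp b t) ≠ 1 := by
      intro h
      exact ht (w.pp_cases _ _ ((ce_eq_one_iff (w.pp_mem b h0 h1).1 (w.pp_mem b h0 h1).2).1 h))
    have h2 := hc l
    rw [w.c_same _ _ h0 h1, ce_sg] at h2
    have hll : l' = l := by
      by_contra hll
      rw [w.c_other hll b' h0' h1'] at h2
      exact hne h2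
    subst hll
    rw [w.c_same _ _ h0' h1', ce_sg] at h2
    push Not at ht
    have h3 := w.pp_mem' b (lt_of_le_of_ne h0 (Ne.symm ht.1)) (lt_of_le_of_ne h1 ht.2)
    have h4 : t' ≠ 0 ∧ t' ≠ 1 := by
      rw [← not_or]
      intro h
      apply hne
      rw [h2, ← ce_sg, ← w.c_same l' b' h0' h1']
      obtain ⟨k, hk, hk'⟩ := hkey l' b' t' h
      rw [hk', w.c_int hk]
    have h5 := w.pp_mem' b' (lt_of_le_of_ne h0' (Ne.symm h4.1)) (lt_of_le_of_ne h1' h4.2)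
    have h6 := ce_inj h3.1 h3.2 h5.1 h5.2 h2
    refine Or.inr ⟨l', b, b', w.pp b t, h3.1, h3.2, by rw [pp_pp], ?_⟩
    rw [h6, pp_pp]

lemma ceN_eq {x x' : ℝ} (hx : 0 ≤ x ∧ x ≤ w.N) (hx' : 0 ≤ x' ∧ x' ≤ w.N) (h : ce (x / w.N) = ce (x' / w.N)) :
    x = x' ∨ (x = 0 ∧ x' = w.N) ∨ (x = w.N ∧ x' = 0) := by
  obtain ⟨m, hm⟩ := ce_eq.1 h
  have hN := w.NR
  have h1 : x = x' + m * w.N := by field_simp at hm; linarith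
  have h2 : -1 ≤ m := by
    by_contra hc
    have : (m : ℝ) ≤ -2 := by exact_mod_cast (by omega : m ≤ -2)
    nlinarith
  have h3 : m ≤ 1 := by
    by_contra hc
    have : (2 : ℝ) ≤ m := by exact_mod_cast (by omega : 2 ≤ m)
    nlinarith
  have : m = -1 ∨ m = 0 ∨ m = 1 := by omega
  rcases this with rfl | rfl | rfl
  · right; left; push_cast at h1; constructor <;> linarith
  · left; simpa using h1
  · right; right; push_cast at h1; constructor <;> linarith

/-- The fibre relation of the polygon. -/
def Fib (p q : ℝ × ℝ) : Prop :=
  p.1 = q.1 ∧ (p.1 = 0 ∨ ce (p.2 / w.N) = ce (q.2 / w.N) ∨ (p.1 = 1 ∧ ∀ l, w.c l p.2 = w.c l q.2))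

/-- Compatible functions on the polar rectangle. -/
structure Compat {Y : Type} (F : ℝ × ℝ → Y) : Prop where
  z : ∀ x x' : ℝ, 0 ≤ x → x ≤ w.N → 0 ≤ x' → x' ≤ w.N → F (0, x) = F (0, x')
  p : ∀ ρ, 0 ≤ ρ → ρ ≤ 1 → F (ρ, 0) = F (ρ, w.N)
  b : ∀ x x' : ℝ, 0 ≤ x → x ≤ w.N → 0 ≤ x' → x' ≤ w.N → (∀ l, w.c l x = w.c l x') → F (1, x) = F (1, x')

lemma Compat.fib {w : PW} {Y : Type} {F : ℝ × ℝ → Y} (h : w.Compat F) {p q : ℝ × ℝ} (hp : p ∈ w.Rs) (hq : q ∈ w.Rs)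
    (hf : w.Fib p q) : F p = F q := by
  obtain ⟨a, x⟩ := p
  obtain ⟨a', x'⟩ := q
  obtain ⟨h1, h2⟩ := hf
  obtain ⟨hp1, hp2⟩ := hp
  obtain ⟨hq1, hq2⟩ := hq
  simp only at h1 h2 hp1 hp2 hq1 hq2
  subst h1
  rcases h2 with h2 | h2 | ⟨h2, h3⟩
  · subst h2; exact h.z _ _ hp2.1 hp2.2 hq2.1 hq2.2
  · rcases w.ceN_eq hp2 hq2 h2 with h3 | ⟨h3, h4⟩ | ⟨h3, h4⟩
    · rw [h3]
    · rw [h3, h4]; exact h.p _ hp1.1 hp1.2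
    · rw [h3, h4]; exact (h.p _ hp1.1 hp1.2).symm
  · subst h2; exact h.b _ _ hp2.1 hp2.2 hq2.1 hq2.2 h3

/-- `S` is a model of the polygon with identifications. -/
structure Mod (S : Type) [TopologicalSpace S] (pr : ℝ × ℝ → S) : Prop where
  cont : Continuous pr
  surj : ∀ s, ∃ p ∈ w.Rs, pr p = s
  quot : ∀ U : Set S, IsOpen {p : w.Rs | pr p ∈ U} → IsOpen U
  fib : ∀ p ∈ w.Rs, ∀ q ∈ w.Rs, (pr p = pr q ↔ w.Fib p q)

def Psi (p : ℝ × ℝ) : ℝ × ℂ × (w.L → ℂ) :=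
  (p.1, ((p.1 * (1 - p.1) : ℝ) : ℂ) * (ce (p.2 / w.N) : ℂ), fun l => (p.1 : ℂ) * (w.c l p.2 : ℂ))

lemma continuous_Psi : Continuous w.Psi := by
  unfold Psi
  have h1 := continuous_ce
  have h2 := w.continuous_c
  have h3 : Continuous fun p : ℝ × ℝ => (ce (p.2 / w.N) : ℂ) := continuous_subtype_val.comp (h1.comp (by fun_prop))
  have h4 : ∀ l, Continuous fun p : ℝ × ℝ => (w.c l p.2 : ℂ) := fun l => continuous_subtype_val.comp ((h2 l).comp (by fun_prop))
  refine Continuous.prodMk (by fun_prop) (Continuous.prodMk ?_ (continuous_pi fun l => ?_))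
  · exact (Complex.continuous_ofReal.comp (by fun_prop)).mul h3
  · exact (Complex.continuous_ofReal.comp (by fun_prop)).mul (h4 l)

lemma c_zero (l : w.L) : w.c l 0 = 1 := by
  simpa using w.c_int (k := 0) (by omega) l

lemma c_N (l : w.L) : w.c l w.N = 1 := w.c_int le_rfl l

lemma Psi_compat : w.Compat w.Psi := by
  refine ⟨?_, ?_, ?_⟩
  · intros; simp [Psi]
  · intro ρ _ _
    have := w.NR
    simp only [Psi, c_zero, c_N, zero_div, div_self this.ne', ce_zero, ce_one]
  · intro x x' _ _ _ _ h
    simp [Psi, h]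

lemma Psi_fib {p q : ℝ × ℝ} (h : w.Psi p = w.Psi q) : w.Fib p q := by
  simp only [Psi, Prod.mk.injEq] at h
  obtain ⟨h1, h2, h3⟩ := h
  refine ⟨h1, ?_⟩
  by_cases h4 : p.1 = 0
  · exact Or.inl h4
  by_cases h5 : p.1 = 1
  · refine Or.inr (Or.inr ⟨h5, fun l => ?_⟩)
    have := congrFun h3 l
    rw [← h1, h5] at this
    exact Circle.ext (by simpa using this)
  · refine Or.inr (Or.inl ?_)
    rw [← h1] at h2
    have hne : ((p.1 * (1 - p.1) : ℝ) : ℂ) ≠ 0 := by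
      rw [Complex.ofReal_ne_zero]
      exact mul_ne_zero h4 (fun h => h5 (by linarith))
    exact Circle.ext (mul_left_cancel₀ hne h2)

namespace Mod
variable {w} {S : Type} [TopologicalSpace S] {pr : ℝ × ℝ → S}

lemma compat (m : w.Mod S pr) : w.Compat pr := by
  have hN := w.NR
  have hR : ∀ {a x : ℝ}, 0 ≤ a → a ≤ 1 → 0 ≤ x → x ≤ w.N → (a, x) ∈ w.Rs := fun a b c d => ⟨⟨a, b⟩, ⟨c, d⟩⟩
  refine ⟨fun x x' h1 h2 h3 h4 => ?_, fun ρ h1 h2 => ?_, fun x x' h1 h2 h3 h4 h => ?_⟩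
  · exact (m.fib _ (hR le_rfl zero_le_one h1 h2) _ (hR le_rfl zero_le_one h3 h4)).2 ⟨rfl, Or.inl rfl⟩
  · exact (m.fib _ (hR h1 h2 le_rfl hN.le) _ (hR h1 h2 hN.le le_rfl)).2 ⟨rfl, Or.inr (Or.inl (by
      simp only [zero_div, div_self hN.ne', ce_zero, ce_one]))⟩
  · exact (m.fib _ (hR zero_le_one le_rfl h1 h2) _ (hR zero_le_one le_rfl h3 h4)).2 ⟨rfl, Or.inr (Or.inr ⟨rfl, h⟩)⟩

end Mod
end PW
end Poly

end

section
set_option autoImplicit false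
open Topology
set_option linter.unusedSectionVars false
set_option linter.unusedSimpArgs false
set_option linter.unusedVariables false

section Poly2
namespace PW
namespace Mod
variable {w : PW} {S : Type} [TopologicalSpace S] {pr : ℝ × ℝ → S}

lemma mkRs {a x : ℝ} (h1 : 0 ≤ a) (h2 : a ≤ 1) (h3 : 0 ≤ x) (h4 : x ≤ w.N) : (a, x) ∈ w.Rs := ⟨⟨h1, h2⟩, ⟨h3, h4⟩⟩

lemma image_eq (m : w.Mod S pr) : pr '' w.Rs = Set.univ := by
  ext s; simp only [Set.mem_image, Set.mem_univ, iff_true]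
  obtain ⟨p, hp, h⟩ := m.surj s
  exact ⟨p, hp, h⟩

lemma compact (m : w.Mod S pr) : CompactSpace S :=
  ⟨by rw [← m.image_eq]; exact w.isCompact_Rs.image m.cont⟩

lemma pathc (m : w.Mod S pr) : PathConnectedSpace S := by
  rw [pathConnectedSpace_iff_univ, ← m.image_eq]
  refine IsPathConnected.image ?_ m.cont
  have hc : Convex ℝ w.Rs := (convex_Icc 0 1).prod (convex_Icc 0 _)
  exact hc.isPathConnected ⟨(0, 0), mkRs le_rfl zero_le_one le_rfl w.NR.le⟩

lemma desc_aux (m : w.Mod S pr) {Y : Type} [TopologicalSpace Y] {F : ℝ × ℝ → Y} (hF : Continuous F) (hc : w.Compat F) :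
    ∃ G : S → Y, Continuous G ∧ ∀ p ∈ w.Rs, G (pr p) = F p := by
  choose sec hsec hpr using m.surj
  have hG : ∀ p ∈ w.Rs, F (sec (pr p)) = F p := fun p hp =>
    hc.fib (hsec _) hp ((m.fib _ (hsec _) _ hp).1 (hpr _))
  refine ⟨fun s => F (sec s), ?_, hG⟩
  refine continuous_def.2 fun U hU => m.quot _ ?_
  have : {p : w.Rs | pr p ∈ (fun s => F (sec s)) ⁻¹' U} = (fun p : w.Rs => F p) ⁻¹' U := by
    ext p
    simp only [Set.mem_ofPred_eq, Set.mem_preimage, hG p.1 p.2]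
  rw [this]
  exact hU.preimage (hF.comp continuous_subtype_val)

lemma t2 (m : w.Mod S pr) : T2Space S := by
  obtain ⟨G, hG, hGp⟩ := m.desc_aux w.continuous_Psi w.Psi_compat
  refine T2Space.of_injective_continuous (f := G) ?_ hG
  intro s s' h
  obtain ⟨p, hp, rfl⟩ := m.surj s
  obtain ⟨q, hq, rfl⟩ := m.surj s'
  rw [hGp p hp, hGp q hq] at h
  exact (m.fib p hp q hq).2 (w.Psi_fib h)

lemma desc (m : w.Mod S pr) {A Y : Type} [TopologicalSpace A] [TopologicalSpace Y] {F : A × ℝ × ℝ → Y}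
    (hF : ContinuousOn F (Set.univ ×ˢ w.Rs)) (hc : ∀ a, w.Compat fun p => F (a, p)) :
    ∃ G : A × S → Y, Continuous G ∧ ∀ a, ∀ p ∈ w.Rs, G (a, pr p) = F (a, p) := by
  choose sec hsec hpr using m.surj
  have hG : ∀ a, ∀ p ∈ w.Rs, F (a, sec (pr p)) = F (a, p) := fun a p hp =>
    (hc a).fib (hsec _) hp ((m.fib _ (hsec _) _ hp).1 (hpr _))
  refine ⟨fun s => F (s.1, sec s.2), ?_, hG⟩
  have h2 := m.t2
  have hcR : CompactSpace w.Rs := isCompact_iff_compactSpace.1 w.isCompact_Rs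
  have hpm : IsProperMap (fun p : w.Rs => pr p) := (m.cont.comp continuous_subtype_val).isProperMap
  have hP : IsProperMap (Prod.map (id : A → A) (fun p : w.Rs => pr p)) := isProperMap_id.prodMap hpm
  have hQ : IsQuotientMap (Prod.map (id : A → A) (fun p : w.Rs => pr p)) := by
    refine hP.isClosedMap.isQuotientMap hP.continuous ?_
    rintro ⟨a, s⟩
    obtain ⟨p, hp, rfl⟩ := m.surj s
    exact ⟨(a, ⟨p, hp⟩), rfl⟩
  rw [hQ.continuous_iff]
  have : (fun s : A × S => F (s.1, sec s.2)) ∘ Prod.map (id : A → A) (fun p : w.Rs => pr p) = fun q : A × w.Rs => F (q.1, q.2.1) := by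
    funext q
    exact hG q.1 q.2.1 q.2.2
  rw [this]
  exact hF.comp_continuous (by fun_prop) (fun q => ⟨trivial, q.2.2⟩)

lemma desc1 (m : w.Mod S pr) {Y : Type} [TopologicalSpace Y] {F : ℝ × ℝ → Y}
    (hF : ContinuousOn F w.Rs) (hc : w.Compat F) :
    ∃ G : S → Y, Continuous G ∧ ∀ p ∈ w.Rs, G (pr p) = F p := by
  obtain ⟨G, hG, h⟩ := m.desc (A := Unit) (F := fun q => F q.2) (hF.comp (by fun_prop) (fun q hq => hq.2)) (fun _ => hc)
  exact ⟨fun s => G ((), s), by fun_prop, fun p hp => h () p hp⟩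

lemma edge_mem (l : w.L) (b : Bool) {t : ℝ} (h0 : 0 ≤ t) (h1 : t ≤ 1) : 0 ≤ (w.en l b : ℝ) + t ∧ (w.en l b : ℝ) + t ≤ w.N := by
  have : (w.en l b : ℝ) + 1 ≤ w.N := by exact_mod_cast w.en_lt l b
  constructor
  · positivity
  · linarith

lemma c_edge (l l' : w.L) (b : Bool) {t : ℝ} (h0 : 0 ≤ t) (h1 : t ≤ 1) :
    w.c l' (w.en l b + w.pp b t) = if l = l' then ce t else 1 := by
  obtain ⟨h2, h3⟩ := w.pp_mem b h0 h1
  split_ifs with h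
  · subst h; rw [w.c_same _ _ h2 h3, w.ce_sg_pp]
  · rw [w.c_other h _ h2 h3]

lemma edge (m : w.Mod S pr) (l : w.L) (b b' : Bool) {t : ℝ} (h0 : 0 ≤ t) (h1 : t ≤ 1) :
    pr (1, w.en l b + w.pp b t) = pr (1, w.en l b' + w.pp b' t) := by
  have h2 := w.pp_mem b h0 h1
  have h3 := w.pp_mem b' h0 h1
  have h4 := edge_mem (w := w) l b h2.1 h2.2
  have h5 := edge_mem (w := w) l b' h3.1 h3.2
  exact m.compat.b _ _ h4.1 h4.2 h5.1 h5.2 (fun l' => by rw [c_edge l l' b h0 h1, c_edge l l' b' h0 h1])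

lemma vertex (m : w.Mod S pr) {k : ℕ} (hk : k ≤ w.N) : pr (1, k) = pr (1, 0) :=
  m.compat.b _ _ (by positivity) (by exact_mod_cast hk) le_rfl w.NR.le (fun l => by rw [w.c_int hk, w.c_zero])

end Mod

/-- Compatibility criterion in terms of edges. -/
lemma Compat.mk' {w : PW} {Y : Type} {F : ℝ × ℝ → Y}
    (hz : ∀ x x' : ℝ, 0 ≤ x → x ≤ w.N → 0 ≤ x' → x' ≤ w.N → F (0, x) = F (0, x'))
    (hp : ∀ ρ, 0 ≤ ρ → ρ ≤ 1 → F (ρ, 0) = F (ρ, w.N))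
    (hv : ∀ k : ℕ, k ≤ w.N → F (1, k) = F (1, 0))
    (he : ∀ l b b' t, 0 < t → t < 1 → F (1, w.en l b + w.pp b t) = F (1, w.en l b' + w.pp b' t)) : w.Compat F := by
  refine ⟨hz, hp, fun x x' h1 h2 h3 h4 hc => ?_⟩
  rcases w.edge_cases ⟨h1, h2⟩ ⟨h3, h4⟩ hc with ⟨k, k', hk, hk', rfl, rfl⟩ | ⟨l, b, b', t, ht0, ht1, rfl, rfl⟩
  · rw [hv k hk, hv k' hk']
  · exact he l b b' t ht0 ht1

/-- disc point with polar coordinates -/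
def dp (N : ℕ) (p : ℝ × ℝ) : Disc := ⟨(cl01 p.1 : ℂ) * (ce (p.2 / N) : ℂ), by
  rw [norm_mul, Circle.norm_coe, mul_one, Complex.norm_real, Real.norm_of_nonneg (cl01_mem _).1]
  exact (cl01_mem _).2⟩

lemma continuous_dp (N : ℕ) : Continuous (dp N) := by
  refine Continuous.subtype_mk ?_ _
  have h : Continuous fun p : ℝ × ℝ => (ce (p.2 / N) : ℂ) := continuous_subtype_val.comp (continuous_ce.comp (by fun_prop))
  exact (Complex.continuous_ofReal.comp (by fun_prop)).mul h

lemma dp_bd (N k : ℕ) (t : ℝ) : (dp N (1, k + t) : ℂ) = polyBP N k t := by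
  unfold dp polyBP
  show (cl01 1 : ℂ) * (ce ((k + t) / N) : ℂ) = _
  rw [cl01_of_mem zero_le_one le_rfl, ce_coe]
  push_cast; rw [one_mul]

lemma dp_surj (w : PW) (z : Disc) : ∃ p ∈ w.Rs, dp w.N p = z := by
  obtain ⟨z, hz⟩ := z
  have hN := w.NR
  by_cases h0 : z = 0
  · refine ⟨(0, 0), Mod.mkRs le_rfl zero_le_one le_rfl hN.le, Subtype.ext ?_⟩
    show (cl01 0 : ℂ) * _ = z
    rw [cl01_le le_rfl, h0]; simp
  · have hn : ‖z‖ ≠ 0 := norm_ne_zero_iff.2 h0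
    obtain ⟨t, ht0, ht1, ht⟩ := ce_surj ⟨z / ‖z‖, by
      rw [Submonoid.unitSphere]
      show z / (‖z‖ : ℂ) ∈ Metric.sphere (0 : ℂ) 1
      rw [mem_sphere_zero_iff_norm, norm_div, Complex.norm_real, norm_norm, div_self hn]⟩
    refine ⟨(‖z‖, w.N * t), Mod.mkRs (norm_nonneg _) hz (by positivity) (by nlinarith), Subtype.ext ?_⟩
    show (cl01 ‖z‖ : ℂ) * (ce (w.N * t / w.N) : ℂ) = z
    rw [cl01_of_mem (norm_nonneg _) hz, mul_div_cancel_left₀ _ hN.ne', ht]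
    show (‖z‖ : ℂ) * (z / ‖z‖) = z
    rw [mul_div_cancel₀]
    exact_mod_cast hn

lemma dp_fib (w : PW) {p q : ℝ × ℝ} (hp : p ∈ w.Rs) (hq : q ∈ w.Rs) (h : dp w.N p = dp w.N q) : w.Fib p q := by
  have h1 : (cl01 p.1 : ℂ) * (ce (p.2 / w.N) : ℂ) = (cl01 q.1 : ℂ) * (ce (q.2 / w.N) : ℂ) := congrArg Subtype.val h
  rw [cl01_of_mem hp.1.1 hp.1.2, cl01_of_mem hq.1.1 hq.1.2] at h1
  have h2 : p.1 = q.1 := by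
    have := congrArg norm h1
    rwa [norm_mul, norm_mul, Circle.norm_coe, Circle.norm_coe, mul_one, mul_one, Complex.norm_real, Complex.norm_real,
      Real.norm_of_nonneg hp.1.1, Real.norm_of_nonneg hq.1.1] at this
  refine ⟨h2, ?_⟩
  by_cases h3 : p.1 = 0
  · exact Or.inl h3
  · right; left
    rw [← h2] at h1
    exact Circle.ext (mul_left_cancel₀ (Complex.ofReal_ne_zero.2 h3) h1)

theorem mod_of_rel (w : PW) (r : Disc → Disc → Prop)
    (h1 : ∀ z z', r z z' → ∃ l t, 0 ≤ t ∧ t ≤ 1 ∧ z = dp w.N (1, w.en l false + w.pp false t) ∧ z' = dp w.N (1, w.en l true + w.pp true t))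
    (h2 : ∀ l t, 0 ≤ t → t ≤ 1 → r (dp w.N (1, w.en l false + w.pp false t)) (dp w.N (1, w.en l true + w.pp true t)))
    (h3 : ∀ k : ℕ, k ≤ w.N → Quot.mk r (dp w.N (1, k)) = Quot.mk r (dp w.N (1, 0))) :
    w.Mod (Quot r) (fun p => Quot.mk r (dp w.N p)) := by
  have hcR : CompactSpace w.Rs := isCompact_iff_compactSpace.1 w.isCompact_Rs
  have hcont : Continuous (fun p => Quot.mk r (dp w.N p)) := continuous_quot_mk.comp (continuous_dp _)
  have hcomp : w.Compat (fun p => Quot.mk r (dp w.N p)) := by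
    refine Compat.mk' ?_ ?_ h3 ?_
    · intro x x' _ _ _ _
      refine congrArg (Quot.mk r) (Subtype.ext ?_)
      show (cl01 0 : ℂ) * _ = (cl01 0 : ℂ) * _
      rw [cl01_le le_rfl]; simp
    · intro ρ _ _
      refine congrArg (Quot.mk r) (Subtype.ext ?_)
      show (cl01 ρ : ℂ) * (ce (0 / w.N) : ℂ) = (cl01 ρ : ℂ) * (ce (w.N / w.N) : ℂ)
      rw [zero_div, div_self w.NR.ne', ce_zero, ce_one]
    · intro l b b' t h0 h1
      have := Quot.sound (h2 l t h0.le h1.le)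
      cases b <;> cases b' <;> first | rfl | exact this | exact this.symm
  refine ⟨hcont, ?_, ?_, ?_⟩
  · intro s
    obtain ⟨z, rfl⟩ := Quot.exists_rep s
    obtain ⟨p, hp, rfl⟩ := dp_surj w z
    exact ⟨p, hp, rfl⟩
  · intro U hU
    have hq : IsQuotientMap (fun p : w.Rs => dp w.N p) := by
      have hc : Continuous (fun p : w.Rs => dp w.N p) := (continuous_dp _).comp continuous_subtype_val
      refine hc.isClosedMap.isQuotientMap hc ?_
      intro z
      obtain ⟨p, hp, rfl⟩ := dp_surj w z
      exact ⟨⟨p, hp⟩, rfl⟩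
    have hq2 : IsQuotientMap ((Quot.mk r) ∘ (fun p : w.Rs => dp w.N p)) := isQuotientMap_quot_mk.comp hq
    exact hq2.isOpen_preimage.1 hU
  · intro p hp q hq
    constructor
    · intro h
      choose sec hsec hdp using dp_surj w
      have key : ∀ z z', r z z' → w.Psi (sec z) = w.Psi (sec z') := by
        intro z z' hr
        obtain ⟨l, t, h0, h1, hz, hz'⟩ := h1 z z' hr
        have ha := w.pp_mem false h0 h1
        have hb := w.pp_mem true h0 h1
        have ha' := Mod.edge_mem (w := w) l false ha.1 ha.2
        have hb' := Mod.edge_mem (w := w) l true hb.1 hb.2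
        have hA := Mod.mkRs (w := w) zero_le_one le_rfl ha'.1 ha'.2
        have hB := Mod.mkRs (w := w) zero_le_one le_rfl hb'.1 hb'.2
        rw [w.Psi_compat.fib (hsec z) hA (dp_fib w (hsec z) hA ((hdp z).trans hz)),
          w.Psi_compat.fib (hsec z') hB (dp_fib w (hsec z') hB ((hdp z').trans hz'))]
        exact w.Psi_compat.b _ _ ha'.1 ha'.2 hb'.1 hb'.2 (fun l' => by
          rw [Mod.c_edge l l' false h0 h1, Mod.c_edge l l' true h0 h1])
      have h4 := congrArg (Quot.lift (fun z => w.Psi (sec z)) key) h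
      have h5 : ∀ p ∈ w.Rs, w.Psi (sec (dp w.N p)) = w.Psi p := fun p hp =>
        w.Psi_compat.fib (hsec _) hp (dp_fib w (hsec _) hp (hdp _))
      have h6 : w.Psi (sec (dp w.N p)) = w.Psi (sec (dp w.N q)) := h4
      rw [h5 p hp, h5 q hq] at h6
      exact w.Psi_fib h6
    · exact hcomp.fib hp hq

/-- The word of the orientable surface of genus `g + 1`. -/
def wM (g : ℕ) : PW where
  N := 4 * (g + 1)
  hN := by omega
  L := Fin (g + 1) × Fin 2
  fL := inferInstance
  dL := inferInstance
  ed := {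
    toFun := fun q => ⟨4 * q.1.1 + q.1.2 + 2 * (if q.2 then 1 else 0), by
      have := q.1.1.2; have := q.1.2.2; split_ifs <;> omega⟩
    invFun := fun k => ((⟨k / 4, by omega⟩, ⟨k % 2, by omega⟩), decide (2 ≤ (k : ℕ) % 4))
    left_inv := by
      rintro ⟨⟨⟨a, ha⟩, ⟨b, hb⟩⟩, c⟩
      cases c
      · simp only [Prod.mk.injEq, Fin.mk.injEq, Bool.false_eq_true, if_false]
        refine ⟨⟨by omega, by omega⟩, ?_⟩
        simp; omega
      · simp only [Prod.mk.injEq, Fin.mk.injEq, if_true]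
        refine ⟨⟨by omega, by omega⟩, ?_⟩
        simp; omega
    right_inv := by
      rintro ⟨k, hk⟩
      apply Fin.ext
      simp only [decide_eq_true_eq]
      split_ifs <;> omega }
  tw := true

/-- The word of the non-orientable surface of genus `g + 1`. -/
def wN (g : ℕ) : PW where
  N := 2 * (g + 1)
  hN := by omega
  L := Fin (g + 1)
  fL := inferInstance
  dL := inferInstance
  ed := {
    toFun := fun q => ⟨2 * q.1 + (if q.2 then 1 else 0), by
      have := q.1.2; split_ifs <;> omega⟩
    invFun := fun k => (⟨k / 2, by omega⟩, decide (1 ≤ (k : ℕ) % 2))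
    left_inv := by
      rintro ⟨⟨a, ha⟩, c⟩
      cases c
      · simp only [Prod.mk.injEq, Fin.mk.injEq, Bool.false_eq_true, if_false]
        refine ⟨by omega, ?_⟩
        simp
      · simp only [Prod.mk.injEq, Fin.mk.injEq, if_true]
        refine ⟨by omega, ?_⟩
        simp
    right_inv := by
      rintro ⟨k, hk⟩
      apply Fin.ext
      simp only [decide_eq_true_eq]
      split_ifs <;> omega }
  tw := false

lemma dp_bd' (N k : ℕ) (t : ℝ) (z : Disc) : (z : ℂ) = polyBP N k t ↔ z = dp N (1, k + t) := by
  rw [← dp_bd, Subtype.ext_iff]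

theorem mod_M (g : ℕ) : (wM g).Mod (Quot (orientRel (g + 1))) (fun p => Quot.mk _ (dp (wM g).N p)) := by
  have e0 : ∀ (j : Fin (g + 1)) (r : Fin 2), (wM g).en (j, r) false = 4 * j + r := fun j r => by
    show 4 * (j : ℕ) + r + 2 * (if false then 1 else 0) = _
    simp
  have e1 : ∀ (j : Fin (g + 1)) (r : Fin 2), (wM g).en (j, r) true = 4 * j + r + 2 := fun j r => by
    show 4 * (j : ℕ) + r + 2 * (if true then 1 else 0) = _
    simp
  have p0 : ∀ t, (wM g).pp false t = t := fun t => rfl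
  have p1 : ∀ t, (wM g).pp true t = 1 - t := fun t => rfl
  have h2 : ∀ l t, 0 ≤ t → t ≤ 1 → orientRel (g + 1) (dp (wM g).N (1, (wM g).en l false + (wM g).pp false t)) (dp (wM g).N (1, (wM g).en l true + (wM g).pp true t)) := by
    rintro ⟨j, r⟩ t h0 h1
    exact ⟨j, r, t, h0, h1, by rw [e0, p0, dp_bd]; rfl, by rw [e1, p1, dp_bd]; rfl⟩
  refine mod_of_rel _ _ ?_ h2 ?_
  · rintro z z' ⟨j, r, t, h0, h1, hz, hz'⟩
    refine ⟨(j, r), t, h0, h1, ?_, ?_⟩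
    · rw [e0, p0]; exact (dp_bd' _ _ _ _).1 hz
    · rw [e1, p1]; exact (dp_bd' _ _ _ _).1 hz'
  · let v : ℕ → Quot (orientRel (g + 1)) := fun k => Quot.mk _ (dp (wM g).N (1, k))
    have s0 : ∀ (j : Fin (g + 1)) (r : Fin 2), v (4 * j + r) = v (4 * j + r + 3) := fun j r => by
      have := Quot.sound (h2 (j, r) 0 le_rfl zero_le_one)
      rw [e0, p0, e1, p1] at this
      convert this using 4 <;> push_cast <;> ring
    have s1 : ∀ (j : Fin (g + 1)) (r : Fin 2), v (4 * j + r + 1) = v (4 * j + r + 2) := fun j r => by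
      have := Quot.sound (h2 (j, r) 1 zero_le_one le_rfl)
      rw [e0, p0, e1, p1] at this
      convert this using 4 <;> push_cast <;> ring
    have key : ∀ j, j < g + 1 → v (4 * j + 3) = v (4 * j) ∧ v (4 * j + 2) = v (4 * j) ∧ v (4 * j + 1) = v (4 * j) ∧ v (4 * j + 4) = v (4 * j) := by
      intro j hj
      have a0 := s0 ⟨j, hj⟩ 0
      have a1 := s0 ⟨j, hj⟩ 1
      have b0 := s1 ⟨j, hj⟩ 0
      have b1 := s1 ⟨j, hj⟩ 1
      simp only [Fin.val_zero, Fin.val_one, add_zero, add_assoc] at a0 a1 b0 b1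
      norm_num at a0 a1 b0 b1
      refine ⟨a0.symm, ?_, ?_, ?_⟩
      · rw [b1, a0]
      · rw [b0, b1, a0]
      · rw [← a1, b0, b1, a0]
    have k4 : ∀ j, j ≤ g + 1 → v (4 * j) = v 0 := by
      intro j
      induction j with
      | zero => intro _; rfl
      | succ j ih =>
        intro hj
        rw [mul_add, mul_one, (key j (by omega)).2.2.2, ih (by omega)]
    intro k hk
    have : v k = v 0 := by
      have hk' : k ≤ 4 * (g + 1) := hk
      by_cases hj : k / 4 < g + 1
      · obtain ⟨q3, q2, q1, -⟩ := key (k / 4) hj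
        have this' := k4 (k / 4) hj.le
        have h4 : k = 4 * (k / 4) + k % 4 := by omega
        have : k % 4 = 0 ∨ k % 4 = 1 ∨ k % 4 = 2 ∨ k % 4 = 3 := by omega
        rcases this with h | h | h | h <;> rw [h] at h4 <;> rw [h4]
        · exact this'
        · rw [q1, this']
        · rw [q2, this']
        · rw [q3, this']
      · have : k = 4 * (g + 1) := by omega
        rw [this, k4 _ le_rfl]
    simpa [v] using this

theorem mod_N (g : ℕ) : (wN g).Mod (Quot (nonorientRel (g + 1))) (fun p => Quot.mk _ (dp (wN g).N p)) := by
  have e0 : ∀ (j : Fin (g + 1)), (wN g).en j false = 2 * j := fun j => by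
    show 2 * (j : ℕ) + (if false then 1 else 0) = _
    simp
  have e1 : ∀ (j : Fin (g + 1)), (wN g).en j true = 2 * j + 1 := fun j => by
    show 2 * (j : ℕ) + (if true then 1 else 0) = _
    simp
  have p0 : ∀ b t, (wN g).pp b t = t := fun b t => rfl
  have h2 : ∀ (l : Fin (g + 1)) t, 0 ≤ t → t ≤ 1 → nonorientRel (g + 1) (dp (wN g).N (1, (wN g).en l false + (wN g).pp false t)) (dp (wN g).N (1, (wN g).en l true + (wN g).pp true t)) := by
    intro j t h0 h1
    exact ⟨j, t, h0, h1, by rw [e0, p0, dp_bd]; rfl, by rw [e1, p0, dp_bd]; rfl⟩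
  refine mod_of_rel _ _ ?_ h2 ?_
  · rintro z z' ⟨j, t, h0, h1, hz, hz'⟩
    refine ⟨j, t, h0, h1, ?_, ?_⟩
    · rw [e0, p0]; exact (dp_bd' _ _ _ _).1 hz
    · rw [e1, p0]; exact (dp_bd' _ _ _ _).1 hz'
  · let v : ℕ → Quot (nonorientRel (g + 1)) := fun k => Quot.mk _ (dp (wN g).N (1, k))
    have s0 : ∀ (j : Fin (g + 1)), v (2 * j) = v (2 * j + 1) := fun j => by
      have := Quot.sound (h2 j 0 le_rfl zero_le_one)
      rw [e0, p0, e1, p0] at this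
      convert this using 4 <;> push_cast <;> ring
    have s1 : ∀ (j : Fin (g + 1)), v (2 * j + 1) = v (2 * j + 2) := fun j => by
      have := Quot.sound (h2 j 1 zero_le_one le_rfl)
      rw [e0, p0, e1, p0] at this
      convert this using 4 <;> push_cast <;> ring
    have key : ∀ k, k ≤ 2 * (g + 1) → v k = v 0 := by
      intro k
      induction k with
      | zero => intro _; rfl
      | succ k ih =>
        intro hk
        rw [← ih (by omega)]
        have a0 := s0 ⟨k / 2, by omega⟩
        have a1 := s1 ⟨k / 2, by omega⟩
        simp only at a0 a1
        rcases Nat.even_or_odd' k with ⟨c, rfl | rfl⟩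
        · rw [show 2 * c / 2 = c by omega] at a0; exact a0.symm
        · rw [show (2 * c + 1) / 2 = c by omega] at a1; exact a1.symm
    intro k hk
    have := key k hk
    simpa [v] using this

end PW
end Poly2

end

section
set_option autoImplicit false
open Topology
set_option linter.unusedSectionVars false
set_option linter.unusedSimpArgs false
set_option linter.unusedVariables false

section Charts
namespace PW

lemma ch_of_emb {S : Type} [TopologicalSpace S] {U : Set ℂ} (hU : IsOpen U) {b : ℂ → S} (hb : ContinuousOn b U) (hinj : Set.InjOn b U)
    (ho : ∀ O ⊆ U, IsOpen O → IsOpen (b '' O)) {p : S} (hp : p ∈ b '' U) {T : Set S} {C : Set (ℂ × ℂ)} (hC : C.Countable)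
    (hT : ∀ z ∈ U, b z ∈ T → ∃ q ∈ C, ∃ r : ℝ, z = q.1 + (r : ℂ) * q.2) :
    ∃ e : OpenPartialHomeomorph S ℂ, p ∈ e.source ∧ LineCh T e := by
  have hne : Nonempty ℂ := ⟨0⟩
  let E : PartialEquiv ℂ S := hinj.toPartialEquiv
  let e : OpenPartialHomeomorph ℂ S := OpenPartialHomeomorph.ofContinuousOpenRestrict E hb (by
    intro O hO
    have : (E.source.domRestrict E) '' O = b '' (Subtype.val '' O) := by
      rw [Set.image_image]; rfl
    rw [this]
    refine ho _ ?_ ?_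
    · rintro _ ⟨x, _, rfl⟩; exact x.2
    · exact hU.isOpenMap_subtype_val _ hO) hU
  have hs : e.source = U := rfl
  have hv : ∀ z, e z = b z := fun z => rfl
  have ht : e.target = b '' U := rfl
  refine ⟨e.symm, by rw [OpenPartialHomeomorph.symm_source, ht]; exact hp, C, hC, ?_⟩
  intro x hx hxT
  rw [OpenPartialHomeomorph.symm_source] at hx
  have h1 := e.map_target hx
  rw [hs] at h1
  have h2 : b (e.symm x) = x := e.right_inv hx
  exact hT _ h1 (by rw [h2]; exact hxT)

namespace Mod
variable {w : PW} {S : Type} [TopologicalSpace S] {pr : ℝ × ℝ → S}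

lemma isQ_dp (w : PW) : IsQuotientMap (fun p : w.Rs => dp w.N p) := by
  have hcR : CompactSpace w.Rs := isCompact_iff_compactSpace.1 w.isCompact_Rs
  have hc : Continuous (fun p : w.Rs => dp w.N p) := (continuous_dp _).comp continuous_subtype_val
  refine hc.isClosedMap.isQuotientMap hc ?_
  intro z
  obtain ⟨p, hp, rfl⟩ := dp_surj w z
  exact ⟨⟨p, hp⟩, rfl⟩

lemma disc (m : w.Mod S pr) : ∃ q : Disc → S, Continuous q ∧ ∀ p ∈ w.Rs, q (dp w.N p) = pr p := by
  choose sec hsec hdp using dp_surj w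
  have key : ∀ p ∈ w.Rs, pr (sec (dp w.N p)) = pr p := fun p hp =>
    (m.fib _ (hsec _) _ hp).2 (dp_fib w (hsec _) hp (hdp _))
  refine ⟨fun z => pr (sec z), ?_, key⟩
  rw [(isQ_dp w).continuous_iff]
  have : (fun z => pr (sec z)) ∘ (fun p : w.Rs => dp w.N p) = fun p : w.Rs => pr p := funext fun p => key p.1 p.2
  rw [this]
  exact m.cont.comp continuous_subtype_val

lemma dp_val {p : ℝ × ℝ} (hp : p ∈ w.Rs) : (dp w.N p : ℂ) = (p.1 : ℂ) * (ce (p.2 / w.N) : ℂ) := by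
  show (cl01 p.1 : ℂ) * _ = _
  rw [cl01_of_mem hp.1.1 hp.1.2]

lemma dp_norm {p : ℝ × ℝ} (hp : p ∈ w.Rs) : ‖(dp w.N p : ℂ)‖ = p.1 := by
  rw [dp_val hp, norm_mul, Circle.norm_coe, mul_one, Complex.norm_real, Real.norm_of_nonneg hp.1.1]

lemma dp_of_pr (m : w.Mod S pr) {p q : ℝ × ℝ} (hp : p ∈ w.Rs) (hq : q ∈ w.Rs) (h : pr p = pr q) (h1 : q.1 < 1) :
    dp w.N p = dp w.N q := by
  obtain ⟨h2, h3⟩ := (m.fib p hp q hq).1 h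
  apply Subtype.ext
  rw [dp_val hp, dp_val hq, ← h2]
  rcases h3 with h3 | h3 | ⟨h3, -⟩
  · rw [h3]; simp
  · rw [h3]
  · linarith

/-- Disc chart. -/
lemma chart_disc (m : w.Mod S pr) {T : Set S} {C : Set (ℂ × ℂ)} (hC : C.Countable)
    (hT : ∀ p ∈ w.Rs, p.1 < 1 → pr p ∈ T → ∃ q ∈ C, ∃ r : ℝ, (dp w.N p : ℂ) = q.1 + (r : ℂ) * q.2)
    {p : ℝ × ℝ} (hp : p ∈ w.Rs) (hp1 : p.1 < 1) :
    ∃ e : OpenPartialHomeomorph S ℂ, pr p ∈ e.source ∧ LineCh T e := by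
  obtain ⟨q, hq, hqp⟩ := m.disc
  let nd : ℂ → Disc := fun z => ⟨((max 1 ‖z‖)⁻¹ : ℝ) • z, by
    rw [norm_smul, norm_inv, Real.norm_of_nonneg (by positivity), inv_mul_le_iff₀ (by positivity), mul_one]
    exact le_max_right _ _⟩
  have hnd : Continuous nd := by
    refine Continuous.subtype_mk ?_ _
    have h1 : Continuous fun z : ℂ => max 1 ‖z‖ := by fun_prop
    exact (h1.inv₀ (fun z => by positivity)).smul continuous_id
  have hnd1 : ∀ z : Disc, nd z.1 = z := by
    intro z
    apply Subtype.ext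
    show ((max 1 ‖z.1‖)⁻¹ : ℝ) • z.1 = z.1
    rw [max_eq_left z.2]; simp
  have hb : ∀ p ∈ w.Rs, q (nd (dp w.N p)) = pr p := fun p hp => by rw [hnd1, hqp p hp]
  have hU : ∀ z ∈ Metric.ball (0 : ℂ) 1, ∃ p ∈ w.Rs, p.1 < 1 ∧ (dp w.N p : ℂ) = z := by
    intro z hz
    rw [mem_ball_zero_iff] at hz
    obtain ⟨p, hp, h⟩ := dp_surj w ⟨z, hz.le⟩
    have h' : (dp w.N p : ℂ) = z := congrArg Subtype.val h
    refine ⟨p, hp, ?_, h'⟩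
    rw [← dp_norm hp, h']; exact hz
  refine ch_of_emb (U := Metric.ball 0 1) Metric.isOpen_ball (b := fun z => q (nd z)) (hq.comp hnd).continuousOn ?_ ?_ ?_ hC ?_
  · intro z hz z' hz' h
    obtain ⟨p, hp, hp1, rfl⟩ := hU z hz
    obtain ⟨p', hp', hp1', rfl⟩ := hU z' hz'
    simp only [hb p hp, hb p' hp'] at h
    exact congrArg Subtype.val (m.dp_of_pr hp hp' h hp1')
  · intro O hO hOo
    apply m.quot
    have : {p : w.Rs | pr p ∈ (fun z => q (nd z)) '' O} = (fun p : w.Rs => (dp w.N p : ℂ)) ⁻¹' O := by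
      ext ⟨p, hp⟩
      constructor
      · rintro ⟨z, hz, h⟩
        obtain ⟨p', hp', hp1', rfl⟩ := hU z (hO hz)
        simp only [hb p' hp'] at h
        have := m.dp_of_pr hp hp' h.symm hp1'
        show (dp w.N p : ℂ) ∈ O
        rw [this]; exact hz
      · intro h
        exact ⟨_, h, hb p hp⟩
    rw [this]
    exact hOo.preimage (continuous_subtype_val.comp ((continuous_dp _).comp continuous_subtype_val))
  · exact ⟨dp w.N p, by rw [mem_ball_zero_iff, dp_norm hp]; exact hp1, hb p hp⟩
  · intro z hz h
    obtain ⟨p, hp, hp1, rfl⟩ := hU z hz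
    simp only [hb p hp] at h
    exact hT p hp hp1 h

lemma pp_continuous (b : Bool) : Continuous (w.pp b) := by
  unfold pp; split_ifs <;> fun_prop

lemma strip_fib (m : w.Mod S pr) (l : w.L) {b : Bool} {ρ t : ℝ} (h0 : 0 < ρ) (h1 : ρ ≤ 1) (ht0 : 0 < t) (ht1 : t < 1)
    {p : ℝ × ℝ} (hp : p ∈ w.Rs) (h : pr p = pr (ρ, w.en l b + w.pp b t)) :
    ∃ b', p = (ρ, w.en l b' + w.pp b' t) ∧ (b' = b ∨ ρ = 1) := by
  have hpp := w.pp_mem' b ht0 ht1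
  have he := edge_mem (w := w) l b hpp.1.le hpp.2.le
  have he1 : (w.en l b : ℝ) + 1 ≤ w.N := by exact_mod_cast w.en_lt l b
  have he2 : (0 : ℝ) ≤ w.en l b := by positivity
  obtain ⟨h2, h3⟩ := (m.fib p hp _ (mkRs h0.le h1 he.1 he.2)).1 h
  simp only at h2 h3
  obtain ⟨a, x⟩ := p
  simp only at h2 h3
  subst h2
  rcases h3 with h3 | h3 | ⟨h3, h4⟩
  · exact absurd h3 h0.ne'
  · refine ⟨b, ?_, Or.inl rfl⟩
    rcases w.ceN_eq hp.2 he h3 with h4 | ⟨-, h4⟩ | ⟨-, h4⟩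
    · exact Prod.ext rfl h4
    · linarith
    · linarith
  · rcases w.edge_cases hp.2 he h4 with ⟨k, k', hk, hk', -, h5⟩ | ⟨l', b', b'', t', ht0', ht1', h5, h6⟩
    · exfalso
      have h6 := c_edge l l b ht0.le ht1.le
      rw [h5, w.c_int hk', if_pos rfl] at h6
      rcases (ce_eq_one_iff ht0.le ht1.le).1 h6.symm with h | h <;> linarith
    · have h7 := c_edge l l b ht0.le ht1.le
      rw [h6, c_edge l' l b'' ht0'.le ht1'.le, if_pos rfl] at h7
      split_ifs at h7 with hl
      · subst hl
        have := ce_inj ht0' ht1' ht0 ht1 h7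
        rw [this] at h5
        exact ⟨b', by rw [← h5], Or.inr h3⟩
      · exfalso
        rcases (ce_eq_one_iff ht0.le ht1.le).1 h7.symm with h | h <;> linarith

lemma strip_eq {l : w.L} {b b' : Bool} {t t' : ℝ} (ht0 : 0 < t) (ht1 : t < 1) (ht0' : 0 < t') (ht1' : t' < 1)
    (h : (w.en l b : ℝ) + w.pp b t = w.en l b' + w.pp b' t') : b = b' ∧ t = t' := by
  have h1 := w.pp_mem' b ht0 ht1
  have h2 := w.pp_mem' b' ht0' ht1'
  have h3 : (w.en l b : ℝ) < w.en l b' + 1 := by linarith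
  have h4 : (w.en l b' : ℝ) < w.en l b + 1 := by linarith
  have h3 : w.en l b < w.en l b' + 1 := by exact_mod_cast h3
  have h4 : w.en l b' < w.en l b + 1 := by exact_mod_cast h4
  have h5 := (w.en_inj (by omega : w.en l b = w.en l b')).2
  subst h5
  refine ⟨rfl, ?_⟩
  have : w.pp b t = w.pp b t' := by linarith
  rw [← w.pp_pp b t, this, w.pp_pp]

/-- Strip chart. -/
lemma chart_strip (m : w.Mod S pr) (l : w.L) {T : Set S}
    (hT : ∀ b ρ t, 0 < ρ → ρ ≤ 1 → 0 < t → t < 1 → pr (ρ, w.en l b + w.pp b t) ∈ T → t = 1 / 2)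
    {b : Bool} {t : ℝ} (ht0 : 0 < t) (ht1 : t < 1) :
    ∃ e : OpenPartialHomeomorph S ℂ, pr (1, w.en l b + w.pp b t) ∈ e.source ∧ LineCh T e := by
  let U : Set ℂ := {z | 0 < z.re ∧ z.re < 1 ∧ -1 < z.im ∧ z.im < 1}
  have hUo : IsOpen U := by
    refine IsOpen.and (isOpen_lt continuous_const Complex.continuous_re) (IsOpen.and (isOpen_lt Complex.continuous_re continuous_const)
      (IsOpen.and (isOpen_lt continuous_const Complex.continuous_im) (isOpen_lt Complex.continuous_im continuous_const)))
  let f : ℂ → S := fun z => if 0 ≤ z.im then pr (1 - z.im, w.en l false + w.pp false (cl01 z.re)) else pr (1 + z.im, w.en l true + w.pp true (cl01 z.re))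
  have hpc := fun b => pp_continuous (w := w) b
  have hf : Continuous f := by
    refine Continuous.if_le ?_ ?_ continuous_const Complex.continuous_im ?_
    · exact m.cont.comp (by fun_prop)
    · exact m.cont.comp (by fun_prop)
    · intro z hz
      rw [← hz, sub_zero, add_zero]
      exact m.edge l _ _ (cl01_mem _).1 (cl01_mem _).2
  let sgb : Bool → ℝ := fun b => if b then -1 else 1
  have hfz : ∀ z ∈ U, ∃ b ρ t, 0 < ρ ∧ ρ ≤ 1 ∧ 0 < t ∧ t < 1 ∧ f z = pr (ρ, w.en l b + w.pp b t) ∧ z.re = t ∧ z.im = sgb b * (1 - ρ) := by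
    rintro z ⟨h1, h2, h3, h4⟩
    by_cases hz : 0 ≤ z.im
    · refine ⟨false, 1 - z.im, z.re, by linarith, by linarith, h1, h2, ?_, rfl, by simp [sgb]⟩
      simp only [f, if_pos hz, cl01_of_mem h1.le h2.le]
    · refine ⟨true, 1 + z.im, z.re, by linarith, by linarith, h1, h2, ?_, rfl, by simp [sgb]⟩
      simp only [f, if_neg hz, cl01_of_mem h1.le h2.le]
  have hfk : ∀ b ρ t (z : ℂ), ρ ≤ 1 → 0 ≤ t → t ≤ 1 → z.re = t → z.im = sgb b * (1 - ρ) → f z = pr (ρ, w.en l b + w.pp b t) := by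
    intro b ρ t z h2 h3 h4 h5 h6
    cases b
    · have h6 : z.im = 1 - ρ := by simpa [sgb] using h6
      simp only [f, h6, h5, if_pos (sub_nonneg.2 h2), cl01_of_mem h3 h4, sub_sub_cancel]
    · have h6 : z.im = -(1 - ρ) := by simpa [sgb] using h6
      by_cases hz : 0 ≤ z.im
      · have h7 : ρ = 1 := by linarith
        simp only [f, if_pos hz, h5, cl01_of_mem h3 h4, h6, h7]
        rw [m.edge l true false h3 h4]; norm_num
      · simp only [f, if_neg hz, h5, cl01_of_mem h3 h4, h6]
        congr 2; ring
  have hemem : ∀ {b ρ t}, 0 < ρ → ρ ≤ 1 → 0 < t → t < 1 → (ρ, (w.en l b : ℝ) + w.pp b t) ∈ w.Rs := by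
    intro b ρ t h1 h2 h3 h4
    have h5 := w.pp_mem b h3.le h4.le
    have h6 := edge_mem (w := w) l b h5.1 h5.2
    exact mkRs h1.le h2 h6.1 h6.2
  refine ch_of_emb hUo (b := f) hf.continuousOn ?_ ?_ ?_ (C := {((1 / 2 : ℂ), Complex.I)}) (Set.countable_singleton _) ?_
  · intro z hz z' hz' h
    obtain ⟨b, ρ, t, a1, a2, a3, a4, a5, a6, a7⟩ := hfz z hz
    obtain ⟨b', ρ', t', a1', a2', a3', a4', a5', a6', a7'⟩ := hfz z' hz'
    rw [a5, a5'] at h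
    obtain ⟨b'', h1, h2⟩ := m.strip_fib l a1' a2' a3' a4' (hemem a1 a2 a3 a4) h
    rw [Prod.mk.injEq] at h1
    obtain ⟨h3, h4⟩ := strip_eq a3 a4 a3' a4' h1.2
    subst h3
    apply Complex.ext
    · rw [a6, a6', h4]
    · rw [a7, a7', h1.1]
      rcases h2 with rfl | h2
      · rfl
      · rw [h2]; simp
  · intro O hO hOo
    apply m.quot
    let k : Bool → w.Rs → ℂ := fun b p => ((w.pp b (p.1.2 - w.en l b) : ℝ) : ℂ) + ((sgb b * (1 - p.1.1) : ℝ) : ℂ) * Complex.I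
    have hk : ∀ b, Continuous (k b) := by
      intro b
      have := hpc b
      refine Continuous.add (Complex.continuous_ofReal.comp (this.comp (by fun_prop))) (Continuous.mul (Complex.continuous_ofReal.comp (by fun_prop)) continuous_const)
    have hkre : ∀ b p, (k b p).re = w.pp b (p.1.2 - w.en l b) := fun b p => by simp [k]
    have hkim : ∀ b p, (k b p).im = sgb b * (1 - p.1.1) := fun b p => by simp [k]
    have : {p : w.Rs | pr p ∈ f '' O} = ⋃ b, (k b) ⁻¹' O := by
      ext ⟨p, hp⟩
      rw [Set.mem_iUnion]
      constructor
      · rintro ⟨z, hz, h⟩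
        obtain ⟨b, ρ, t, a1, a2, a3, a4, a5, a6, a7⟩ := hfz z (hO hz)
        obtain ⟨b', h1, h2⟩ := m.strip_fib l a1 a2 a3 a4 hp (h.symm.trans a5)
        refine ⟨b', ?_⟩
        show k b' ⟨p, hp⟩ ∈ O
        have : k b' ⟨p, hp⟩ = z := by
          apply Complex.ext
          · rw [hkre, a6]
            simp only [h1, add_sub_cancel_left, w.pp_pp]
          · rw [hkim, a7]
            simp only [h1]
            rcases h2 with rfl | h2
            · rfl
            · rw [h2]; simp
        rw [this]; exact hz
      · rintro ⟨b, h⟩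
        refine ⟨_, h, ?_⟩
        obtain ⟨h1, h2, -, -⟩ := hO h
        rw [hkre] at h1 h2
        rw [hfk b p.1 _ _ hp.1.2 h1.le h2.le (hkre b _) (hkim b _), w.pp_pp]
        simp
    rw [this]
    exact isOpen_iUnion fun b => hOo.preimage (hk b)
  · refine ⟨t, ⟨by simpa using ht0, by simpa using ht1, by simp, by simp⟩, ?_⟩
    exact hfk b 1 t t le_rfl ht0.le ht1.le (by simp) (by simp)
  · intro z hz h
    obtain ⟨b, ρ, t, a1, a2, a3, a4, a5, a6, a7⟩ := hfz z hz
    rw [a5] at h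
    refine ⟨_, rfl, z.im, ?_⟩
    have := hT b ρ t a1 a2 a3 a4 h
    apply Complex.ext
    · rw [a6, this]; simp
    · simp

end Mod
end PW
end Charts

end

section
set_option autoImplicit false
open Topology
set_option linter.unusedSectionVars false
set_option linter.unusedSimpArgs false
set_option linter.unusedVariables false

section Squash
namespace PW

def psi (K t : ℝ) : ℝ := cl01 (1 / 2 + (1 + K) * (t - 1 / 2))

lemma continuous_psi : Continuous fun q : ℝ × ℝ => psi q.1 q.2 := by unfold psi; fun_prop

lemma cl01_symm (y : ℝ) : cl01 (1 - y) = 1 - cl01 y := by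
  unfold cl01
  rcases le_total y 0 with h | h
  · rw [min_eq_left (by linarith), min_eq_right (by linarith), max_eq_right zero_le_one, max_eq_left h]; ring
  · rcases le_total y 1 with h1 | h1
    · rw [min_eq_right (by linarith), min_eq_right h1, max_eq_right (by linarith), max_eq_right h]
    · rw [min_eq_right (by linarith), min_eq_left h1, max_eq_left (by linarith), max_eq_right zero_le_one]; ring

lemma psi_symm (K t : ℝ) : psi K (1 - t) = 1 - psi K t := by
  unfold psi; rw [← cl01_symm]; congr 1; ring

lemma psi_zero {K : ℝ} (hK : 0 ≤ K) : psi K 0 = 0 := cl01_le (by linarith)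

lemma psi_one {K : ℝ} (hK : 0 ≤ K) : psi K 1 = 1 := cl01_ge (by linarith)

lemma psi_K0 {t : ℝ} (h0 : 0 ≤ t) (h1 : t ≤ 1) : psi 0 t = t := by
  unfold psi; rw [cl01_of_mem] <;> linarith

lemma psi_pp (w : PW) (b : Bool) (K t : ℝ) : psi K (w.pp b t) = w.pp b (psi K t) := by
  unfold pp; split_ifs
  · exact psi_symm K t
  · rfl

def sqx (w : PW) (K x : ℝ) : ℝ := ∑ k ∈ Finset.range w.N, psi K (cl01 (x - k))

lemma continuous_sqx (w : PW) : Continuous fun q : ℝ × ℝ => w.sqx q.1 q.2 := by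
  unfold sqx
  refine continuous_finsetSum _ fun k _ => ?_
  exact continuous_psi.comp (by fun_prop : Continuous fun q : ℝ × ℝ => (q.1, cl01 (q.2 - k)))

lemma sqx_edge (w : PW) {K : ℝ} (hK : 0 ≤ K) {j : ℕ} (hj : j < w.N) {t : ℝ} (h0 : 0 ≤ t) (h1 : t ≤ 1) :
    w.sqx K (j + t) = j + psi K t := by
  unfold sqx
  have : ∀ k ∈ Finset.range w.N, psi K (cl01 ((j : ℝ) + t - k)) = (if k < j then 1 else 0) + (if k = j then psi K t else 0) := by
    intro k _
    by_cases hk : k = j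
    · subst hk
      simp [cl01_of_mem h0 h1]
    · rw [cl01_int (Ne.symm hk) h0 h1, if_neg hk, add_zero]
      split_ifs
      · exact psi_one hK
      · exact psi_zero hK
  rw [Finset.sum_congr rfl this, Finset.sum_add_distrib, Finset.sum_ite_eq', if_pos (Finset.mem_range.2 hj), Finset.sum_boole]
  congr 2
  have : Finset.filter (fun k => k < j) (Finset.range w.N) = Finset.range j := by
    ext k; simp only [Finset.mem_filter, Finset.mem_range]; omega
  rw [this, Finset.card_range]

lemma sqx_int (w : PW) {K : ℝ} (hK : 0 ≤ K) {j : ℕ} (hj : j ≤ w.N) : w.sqx K j = j := by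
  rcases hj.eq_or_lt with h | h
  · have hN := w.hN
    have h1 := w.sqx_edge hK (j := w.N - 1) (by omega) zero_le_one le_rfl
    rw [psi_one hK] at h1
    have h2 : ((w.N - 1 : ℕ) : ℝ) + 1 = w.N := by push_cast [Nat.cast_sub (Nat.succ_le_of_lt hN)]; ring
    rw [h, ← h2]; exact h1
  · have h1 := w.sqx_edge hK h le_rfl zero_le_one
    rw [psi_zero hK] at h1
    simpa using h1

lemma psi_mem (K t : ℝ) : 0 ≤ psi K t ∧ psi K t ≤ 1 := cl01_mem _

lemma sqx_mem (w : PW) {K : ℝ} (hK : 0 ≤ K) {x : ℝ} (h0 : 0 ≤ x) (h1 : x ≤ w.N) : 0 ≤ w.sqx K x ∧ w.sqx K x ≤ w.N := by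
  obtain ⟨l, b, t, ht0, ht1, rfl⟩ := w.exists_edge h0 h1
  rw [w.sqx_edge hK (w.en_lt l b) ht0 ht1]
  exact Mod.edge_mem l b (psi_mem _ _).1 (psi_mem _ _).2

lemma sqx_K0 (w : PW) {x : ℝ} (h0 : 0 ≤ x) (h1 : x ≤ w.N) : w.sqx 0 x = x := by
  obtain ⟨l, b, t, ht0, ht1, rfl⟩ := w.exists_edge h0 h1
  rw [w.sqx_edge le_rfl (w.en_lt l b) ht0 ht1, psi_K0 ht0 ht1]

lemma cos_edge (k : ℕ) (t : ℝ) : Real.cos (2 * Real.pi * (k + t)) = Real.cos (2 * Real.pi * t) := by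
  rw [show 2 * Real.pi * (k + t) = 2 * Real.pi * t + k * (2 * Real.pi) by ring, Real.cos_add_nat_mul_two_pi]

lemma cos_pp (w : PW) (b : Bool) (t : ℝ) : Real.cos (2 * Real.pi * w.pp b t) = Real.cos (2 * Real.pi * t) := by
  unfold pp; split_ifs
  · rw [show 2 * Real.pi * (1 - t) = 2 * Real.pi - 2 * Real.pi * t by ring, Real.cos_two_pi_sub]
  · rfl

lemma cos_neg_one {t : ℝ} (h0 : 0 ≤ t) (h1 : t ≤ 1) (h : Real.cos (2 * Real.pi * t) = -1) : t = 1 / 2 := by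
  obtain ⟨k, hk⟩ := Real.cos_eq_neg_one_iff.1 h
  have hpi := Real.pi_pos
  have h2 : 2 * t = 1 + 2 * k := by
    have : Real.pi * (2 * t) = Real.pi * (1 + 2 * k) := by linarith
    exact mul_left_cancel₀ hpi.ne' this
  have h3 : (k : ℝ) < 1 := by linarith
  have h4 : (-1 : ℝ) < k := by linarith
  have h3 : k < 1 := by exact_mod_cast h3
  have h4 : -1 < k := by exact_mod_cast h4
  have : k = 0 := by omega
  rw [this] at h2
  push_cast at h2; linarith

lemma psi_big {K ε t : ℝ} (hε : 0 < ε) (hK : K = 3 / ε) (h0 : 0 ≤ t) (h1 : t ≤ 1) (h : ε ≤ 1 + Real.cos (2 * Real.pi * t)) :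
    psi K t = 0 ∨ psi K t = 1 := by
  have hpi := Real.pi_pos
  have hpi2 := Real.pi_lt_d2
  have hK0 : 0 < K := by rw [hK]; positivity
  have hKe : K * ε = 3 := by rw [hK]; field_simp
  have h2 := Real.one_sub_sq_div_two_le_cos (x := 2 * Real.pi * t - Real.pi)
  rw [Real.cos_sub_pi] at h2
  have h3 : ε ≤ 20 * (t - 1 / 2) ^ 2 := by
    have : (2 * Real.pi * t - Real.pi) ^ 2 / 2 = 2 * Real.pi ^ 2 * (t - 1 / 2) ^ 2 := by ring
    rw [this] at h2
    have h4 : Real.pi ^ 2 ≤ 10 := by nlinarith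
    nlinarith [sq_nonneg (t - 1 / 2)]
  have h4 : 1 / 4 ≤ ((1 + K) * (t - 1 / 2)) ^ 2 := by
    have h5 : ((1 + K) * (t - 1 / 2)) ^ 2 = (1 + K) ^ 2 * (t - 1 / 2) ^ 2 := by ring
    rw [h5]
    have h6 : 2 * K * (t - 1 / 2) ^ 2 ≤ (1 + K) ^ 2 * (t - 1 / 2) ^ 2 := by
      apply mul_le_mul_of_nonneg_right _ (sq_nonneg _)
      nlinarith
    nlinarith
  unfold psi
  by_cases hs : 0 ≤ (1 + K) * (t - 1 / 2)
  · right; apply cl01_ge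
    nlinarith
  · left; apply cl01_le
    push Not at hs
    nlinarith

namespace Mod
variable {w : PW} {S : Type} [TopologicalSpace S] {pr : ℝ × ℝ → S}

theorem stab (m : w.Mod S pr) : Nonempty (StabX S (pr (1, 0))) := by
  have hpi := Real.pi_pos
  have hN := w.NR
  obtain ⟨θ, hθc, hθ⟩ := m.desc1 (F := fun p : ℝ × ℝ => p.1 * (1 + Real.cos (2 * Real.pi * p.2))) (Continuous.continuousOn (by fun_prop)) (by
    refine Compat.mk' ?_ ?_ ?_ ?_
    · intros; simp
    · intro ρ _ _
      have := cos_edge w.N 0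
      rw [add_zero] at this
      simp only [this]
    · intro k _
      have := cos_edge k 0
      rw [add_zero] at this
      simp only [this]
    · intro l b b' t _ _
      simp only [cos_edge, cos_pp])
  have hθnn : ∀ x, 0 ≤ θ x := by
    intro x
    obtain ⟨p, hp, rfl⟩ := m.surj x
    rw [hθ p hp]
    have := Real.neg_one_le_cos (2 * Real.pi * p.2)
    exact mul_nonneg hp.1.1 (by linarith)
  have hθz : ∀ p ∈ w.Rs, θ (pr p) = 0 → p.1 = 0 ∨ ∃ l b, p.2 = w.en l b + 1 / 2 := by
    intro p hp h
    rw [hθ p hp] at h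
    rcases mul_eq_zero.1 h with h | h
    · exact Or.inl h
    · right
      obtain ⟨l, b, t, h0, h1, hx⟩ := w.exists_edge hp.2.1 hp.2.2
      rw [hx, cos_edge] at h
      have := cos_neg_one h0 h1 (by linarith)
      exact ⟨l, b, by rw [hx, this]⟩
  have ho : θ (pr (1, 0)) ≠ 0 := by
    rw [hθ _ (mkRs zero_le_one le_rfl le_rfl hN.le)]; norm_num
  refine ⟨⟨θ, hθc, hθnn, ho, ?_, ?_⟩⟩
  · intro s hs
    obtain ⟨p, hp, rfl⟩ := m.surj s
    rcases hp.1.2.lt_or_eq with hp1 | hp1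
    · refine m.chart_disc (C := Set.range fun k : Fin w.N => ((0 : ℂ), (ce (((k : ℕ) + 1 / 2) / w.N) : ℂ))) (Set.countable_range _) ?_ hp hp1
      intro q hq hq1 hqT
      rcases hθz q hq hqT with h | ⟨l, b, h⟩
      · refine ⟨_, ⟨⟨0, w.hN⟩, rfl⟩, 0, ?_⟩
        rw [dp_val hq, h]; simp
      · refine ⟨_, ⟨⟨w.en l b, w.en_lt l b⟩, rfl⟩, q.1, ?_⟩
        rw [dp_val hq, h]; simp
    · rcases hθz p hp hs with h | ⟨l, b, h⟩
      · rw [hp1] at h; norm_num at h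
      · have h2 : p = (1, w.en l b + w.pp b (1 / 2)) := by
          refine Prod.ext hp1 ?_
          rw [h]; unfold pp; split_ifs <;> norm_num
        rw [h2]
        refine m.chart_strip l ?_ (by norm_num) (by norm_num)
        intro b ρ t h1 h2 h3 h4 h5
        have h6 := w.pp_mem b h3.le h4.le
        have h7 := edge_mem (w := w) l b h6.1 h6.2
        have h5 : θ (pr (ρ, w.en l b + w.pp b t)) = 0 := h5
        rw [hθ _ (mkRs h1.le h2 h7.1 h7.2)] at h5
        simp only [cos_edge, cos_pp] at h5
        rcases mul_eq_zero.1 h5 with h8 | h8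
        · exact absurd h8 h1.ne'
        · exact cos_neg_one h3.le h4.le (by linarith)
  · intro ε hε
    let K : ℝ := 3 / ε
    have hK : 0 < K := by positivity
    have hKe : K * ε = 3 := by simp only [K]; field_simp
    have huK : ∀ u : I, 0 ≤ (u : ℝ) * K := fun u => mul_nonneg u.2.1 hK.le
    obtain ⟨φ, hφ, hφp⟩ := m.desc (A := I) (F := fun q : I × ℝ × ℝ => pr (min 1 ((1 + q.1 * K) * q.2.1), w.sqx (q.1 * K) q.2.2))
      (Continuous.continuousOn (by
        have h1 := w.continuous_sqx
        have h2 : Continuous fun q : I × ℝ × ℝ => w.sqx (q.1 * K) q.2.2 :=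
          h1.comp (by fun_prop : Continuous fun q : I × ℝ × ℝ => ((q.1 : ℝ) * K, q.2.2))
        exact m.cont.comp (Continuous.prodMk (by fun_prop) h2))) (by
      intro u
      have hm1 : min 1 ((1 + (u : ℝ) * K) * 1) = 1 := min_eq_left (by have := huK u; linarith)
      refine Compat.mk' ?_ ?_ ?_ ?_
      · intro x x' h1 h2 h3 h4
        have h5 := w.sqx_mem (huK u) h1 h2
        have h6 := w.sqx_mem (huK u) h3 h4
        simp only [mul_zero, min_eq_right zero_le_one]
        exact m.compat.z _ _ h5.1 h5.2 h6.1 h6.2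
      · intro ρ h1 h2
        have h3 := w.sqx_int (huK u) (j := 0) (by omega)
        have h4 := w.sqx_int (huK u) (j := w.N) le_rfl
        rw [Nat.cast_zero] at h3
        simp only [h3, h4]
        exact m.compat.p _ (le_min zero_le_one (mul_nonneg (by have := huK u; linarith) h1)) (min_le_left _ _)
      · intro k hk
        have h3 := w.sqx_int (huK u) (j := 0) (by omega)
        have h4 := w.sqx_int (huK u) hk
        rw [Nat.cast_zero] at h3
        simp only [h3, h4, hm1]
        exact m.vertex hk
      · intro l b b' t h0 h1
        have h2 := w.pp_mem b h0.le h1.le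
        have h3 := w.pp_mem b' h0.le h1.le
        simp only [hm1]
        rw [w.sqx_edge (huK u) (w.en_lt l b) h2.1 h2.2, w.sqx_edge (huK u) (w.en_lt l b') h3.1 h3.2, psi_pp, psi_pp]
        exact m.edge l b b' (psi_mem _ _).1 (psi_mem _ _).2)
    refine ⟨φ, hφ, ?_, ?_, ?_⟩
    · intro s
      obtain ⟨p, hp, rfl⟩ := m.surj s
      rw [hφp 0 p hp]
      simp only [Set.Icc.coe_zero, zero_mul, add_zero, one_mul, min_eq_right hp.1.2, w.sqx_K0 hp.2.1 hp.2.2]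
    · intro t
      rw [hφp t _ (mkRs zero_le_one le_rfl le_rfl hN.le)]
      have h3 := w.sqx_int (huK t) (j := 0) (by omega)
      rw [Nat.cast_zero] at h3
      simp only [h3, min_eq_left (by have := huK t; linarith : (1 : ℝ) ≤ (1 + (t : ℝ) * K) * 1)]
    · intro s hs
      obtain ⟨p, hp, rfl⟩ := m.surj s
      rw [hθ p hp] at hs
      rw [hφp 1 p hp]
      have hc1 := Real.cos_le_one (2 * Real.pi * p.2)
      have hc2 := Real.neg_one_le_cos (2 * Real.pi * p.2)
      have hp1 := hp.1.1
      have hp2 := hp.1.2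
      have h1 : ε ≤ 2 * p.1 := by nlinarith
      have h2 : ε ≤ 1 + Real.cos (2 * Real.pi * p.2) := by nlinarith
      have h3 : min 1 ((1 + K) * p.1) = 1 := by
        apply min_eq_left
        nlinarith
      simp only [Set.Icc.coe_one, one_mul, h3]
      obtain ⟨l, b, t, h0, h1', hx⟩ := w.exists_edge hp.2.1 hp.2.2
      rw [hx, cos_edge] at h2
      rw [hx, w.sqx_edge hK.le (w.en_lt l b) h0 h1']
      have := w.en_lt l b
      rcases psi_big hε rfl h0 h1' h2 with h4 | h4 <;> rw [h4]
      · rw [add_zero]; exact m.vertex this.le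
      · have := m.vertex (k := w.en l b + 1) (by omega)
        push_cast at this; exact this

end Mod
end PW
end Squash

end

section
set_option autoImplicit false
open Topology
set_option linter.unusedSectionVars false
set_option linter.unusedSimpArgs false
set_option linter.unusedVariables false

section Kap
/-- Parametrised descent along a surjection from a compact set. -/
lemma cdesc {A E Z Y : Type} [TopologicalSpace A] [TopologicalSpace E] [TopologicalSpace Z] [TopologicalSpace Y] [T2Space Z]
    {K : Set E} (hK : IsCompact K) {f : E → Z} (hf : ContinuousOn f K) (hs : ∀ z, ∃ p ∈ K, f p = z)
    {F : A × E → Y} (hF : ContinuousOn F (Set.univ ×ˢ K))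
    (hc : ∀ a, ∀ p ∈ K, ∀ q ∈ K, f p = f q → F (a, p) = F (a, q)) :
    ∃ G : A × Z → Y, Continuous G ∧ ∀ a, ∀ p ∈ K, G (a, f p) = F (a, p) := by
  choose sec hsec hpr using hs
  have hG : ∀ a, ∀ p ∈ K, F (a, sec (f p)) = F (a, p) := fun a p hp => hc a _ (hsec _) _ hp (hpr _)
  refine ⟨fun s => F (s.1, sec s.2), ?_, hG⟩
  have hcR : CompactSpace K := isCompact_iff_compactSpace.1 hK
  have hpm : IsProperMap (fun p : K => f p) := (continuousOn_iff_continuous_domRestrict.1 hf).isProperMap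
  have hP : IsProperMap (Prod.map (id : A → A) (fun p : K => f p)) := isProperMap_id.prodMap hpm
  have hQ : IsQuotientMap (Prod.map (id : A → A) (fun p : K => f p)) := by
    refine hP.isClosedMap.isQuotientMap hP.continuous ?_
    rintro ⟨a, s⟩
    exact ⟨(a, ⟨sec s, hsec s⟩), Prod.ext rfl (hpr s)⟩
  rw [hQ.continuous_iff]
  have : (fun s : A × Z => F (s.1, sec s.2)) ∘ Prod.map (id : A → A) (fun p : K => f p) = fun q : A × K => F (q.1, q.2.1) := by
    funext q
    exact hG q.1 q.2.1 q.2.2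
  rw [this]
  exact hF.comp_continuous (by fun_prop) (fun q => ⟨trivial, q.2.2⟩)

lemma cdesc1 {E Z Y : Type} [TopologicalSpace E] [TopologicalSpace Z] [TopologicalSpace Y] [T2Space Z]
    {K : Set E} (hK : IsCompact K) {f : E → Z} (hf : ContinuousOn f K) (hs : ∀ z, ∃ p ∈ K, f p = z)
    {F : E → Y} (hF : ContinuousOn F K)
    (hc : ∀ p ∈ K, ∀ q ∈ K, f p = f q → F p = F q) :
    ∃ G : Z → Y, Continuous G ∧ ∀ p ∈ K, G (f p) = F p := by
  obtain ⟨G, hG, h⟩ := cdesc (A := Unit) hK hf hs (F := fun q => F q.2) (hF.comp (by fun_prop) (fun q hq => hq.2)) (fun _ => hc)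
  exact ⟨fun s => G ((), s), by fun_prop, fun p hp => h () p hp⟩

lemma circ_pm (z : Circle) : Circle.exp (Real.arccos (z : ℂ).re) = z ∨ Circle.exp (Real.arccos (z : ℂ).re) = z⁻¹ := by
  have hn : ‖(z : ℂ)‖ = 1 := Circle.norm_coe z
  have hq : (z : ℂ).re ^ 2 + (z : ℂ).im ^ 2 = 1 := by
    have := Complex.sq_norm (z : ℂ)
    rw [hn, Complex.normSq_apply] at this
    nlinarith
  have h1 : (Circle.exp (Real.arccos (z : ℂ).re) : ℂ).re = (z : ℂ).re := by
    rw [Circle.coe_exp, Complex.exp_ofReal_mul_I_re, Real.cos_arccos] <;> nlinarith [sq_nonneg (z:ℂ).im]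
  have h2 : (Circle.exp (Real.arccos (z : ℂ).re) : ℂ).im = |(z : ℂ).im| := by
    rw [Circle.coe_exp, Complex.exp_ofReal_mul_I_im, Real.sin_arccos, ← Real.sqrt_sq_eq_abs]
    congr 1; linarith
  rcases abs_choice (z : ℂ).im with h | h
  · left
    exact Circle.ext (Complex.ext h1 (h2.trans h))
  · right
    refine Circle.ext ?_
    rw [Circle.coe_inv_eq_conj]
    exact Complex.ext (by simpa using h1) (by simpa [h] using h2)

namespace PW
namespace Mod
variable {w : PW} {S : Type} [TopologicalSpace S] {pr : ℝ × ℝ → S}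

lemma kappa (m : w.Mod S pr) (l : w.L) : ∃ k : Circle → S, Continuous k ∧ ∀ t : ℝ, 0 ≤ t → t ≤ 1 → k (ce t) = pr (1, w.en l false + t) := by
  have hv : ∀ k : ℕ, k ≤ w.N → pr (1, (k : ℝ)) = pr (1, 0) := fun k hk => m.vertex hk
  have hcast : ((w.en l false : ℝ) + 1) = ((w.en l false + 1 : ℕ) : ℝ) := by push_cast; ring
  have e0 : pr (1, w.en l false + 0) = pr (1, 0) := by rw [add_zero]; exact hv _ (w.en_lt _ _).le
  have e1 : pr (1, w.en l false + 1) = pr (1, 0) := by rw [hcast]; exact hv _ (w.en_lt _ _)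
  obtain ⟨G, hG, h⟩ := cdesc1 (isCompact_Icc (a := (0:ℝ)) (b := 1)) continuous_ce.continuousOn
    (fun z => by obtain ⟨t, h0, h1, h2⟩ := ce_surj z; exact ⟨t, ⟨h0, h1.le⟩, h2⟩)
    (F := fun t => pr (1, w.en l false + t)) ((m.cont.comp (by fun_prop)).continuousOn) (by
      intro p hp q hq he
      have hb : ∀ t : ℝ, 0 ≤ t → t ≤ 1 → (ce t = 1 ↔ t = 0 ∨ t = 1) := fun t h0 h1 => ce_eq_one_iff h0 h1
      by_cases h1 : ce p = 1
      · have h2 : ce q = 1 := he ▸ h1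
        rcases (hb p hp.1 hp.2).1 h1 with rfl | rfl <;> rcases (hb q hq.1 hq.2).1 h2 with rfl | rfl <;> simp only [e0, e1]
      · have h2 : ce q ≠ 1 := he ▸ h1
        have hp' := mt (hb p hp.1 hp.2).2 h1
        have hq' := mt (hb q hq.1 hq.2).2 h2
        push Not at hp' hq'
        rw [ce_inj (lt_of_le_of_ne hp.1 hp'.1.symm) (lt_of_le_of_ne hp.2 hp'.2) (lt_of_le_of_ne hq.1 hq'.1.symm) (lt_of_le_of_ne hq.2 hq'.2) he])
  exact ⟨G, hG, fun t h0 h1 => h t ⟨h0, h1⟩⟩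

def kap (m : w.Mod S pr) (l : w.L) : Circle → S := (m.kappa l).choose
lemma continuous_kap (m : w.Mod S pr) (l : w.L) : Continuous (m.kap l) := (m.kappa l).choose_spec.1
lemma kap_ce (m : w.Mod S pr) (l : w.L) {t : ℝ} (h0 : 0 ≤ t) (h1 : t ≤ 1) : m.kap l (ce t) = pr (1, w.en l false + t) :=
  (m.kappa l).choose_spec.2 t h0 h1
lemma kap_one (m : w.Mod S pr) (l : w.L) : m.kap l 1 = pr (1, 0) := by
  rw [← ce_zero, m.kap_ce l le_rfl zero_le_one, add_zero]
  exact m.vertex (w.en_lt _ _).le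
lemma kap_bd (m : w.Mod S pr) (l : w.L) (z : Circle) : ∃ x : ℝ, 0 ≤ x ∧ x ≤ w.N ∧ m.kap l z = pr (1, x) := by
  obtain ⟨t, h0, h1, rfl⟩ := ce_surj z
  have := edge_mem (w := w) l false h0 h1.le
  exact ⟨_, this.1, this.2, m.kap_ce l h0 h1.le⟩
lemma kap_split (m : w.Mod S pr) {x : ℝ} (h0 : 0 ≤ x) (h1 : x ≤ w.N) :
    ∃ l, (∀ l', l' ≠ l → w.c l' x = 1) ∧ pr (1, x) = m.kap l (w.c l x) := by
  obtain ⟨l, b, t, ht0, ht1, rfl⟩ := w.exists_edge h0 h1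
  obtain ⟨h2, h3⟩ := w.pp_mem b ht0 ht1
  refine ⟨l, fun l' hl => w.c_other (Ne.symm hl) b ht0 ht1, ?_⟩
  rw [w.c_same _ _ ht0 ht1, w.ce_sg, m.kap_ce l h2 h3]
  have := m.edge l b false h2 h3
  rw [w.pp_pp] at this
  rw [this]
  simp [pp]
end Mod
end PW
end Kap

end

section
set_option autoImplicit false
open Topology
set_option linter.unusedSectionVars false
set_option linter.unusedSimpArgs false
set_option linter.unusedVariables false

section FacS
/-- Data describing a surjection of the surface onto a sphere or projective plane. -/
structure Fac (w : PW) (S : Type) [TopologicalSpace S] (pr : ℝ × ℝ → S) (Z : Type) [TopologicalSpace Z] where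
  m : w.Mod S pr
  zq : ℝ × ℝ → Z
  zcont : ContinuousOn zq w.Rs
  zsurj : ∀ z, ∃ p ∈ w.Rs, zq p = z
  zcompat : w.Compat zq
  L0 : Finset w.L
  hs : ℝ → ℝ
  hscont : Continuous hs
  hs0 : hs 0 = 0
  hsN : ∀ j ∈ L0, w.h j w.N = hs w.N
  ceN : ce (hs w.N) = 1
  h0 : ∀ j ∈ L0, w.h j 0 = 0
  ks : Circle → S
  kscont : Continuous ks
  ks1 : ks 1 = pr (1, 0)
  ksbd : ∀ z, ∃ x : ℝ, 0 ≤ x ∧ x ≤ w.N ∧ ks z = pr (1, x)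
  split : ∀ x : ℝ, 0 ≤ x → x ≤ w.N →
    (∃ j ∈ L0, (∀ j' ∈ L0, j' ≠ j → w.c j' x = 1) ∧ ce (hs x) = 1 ∧ pr (1, x) = m.kap j (w.c j x)) ∨
    ((∀ j ∈ L0, w.c j x = 1) ∧ pr (1, x) = ks (ce (hs x)))
  sdep : ∀ x x' : ℝ, 0 ≤ x → x ≤ w.N → 0 ≤ x' → x' ≤ w.N → (∀ l, w.c l x = w.c l x') → ce (hs x) = ce (hs x')
  zfib : ∀ p ∈ w.Rs, ∀ q ∈ w.Rs, zq p = zq q → w.Fib p q ∨ (p.1 = 1 ∧ q.1 = 1 ∧ ce (hs p.2) = ce (hs q.2))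

namespace Fac
variable {w : PW} {S : Type} [TopologicalSpace S] {pr : ℝ × ℝ → S} {Z : Type} [TopologicalSpace Z] (F : Fac w S pr Z)

/-- base point -/
def o (F : Fac w S pr Z) : S := pr (1, 0)

lemma exists_q : ∃ q : S → Z, Continuous q ∧ ∀ p ∈ w.Rs, q (pr p) = F.zq p := F.m.desc1 F.zcont F.zcompat
def q : S → Z := F.exists_q.choose
lemma continuous_q : Continuous F.q := F.exists_q.choose_spec.1
lemma q_pr {p : ℝ × ℝ} (hp : p ∈ w.Rs) : F.q (pr p) = F.zq p := F.exists_q.choose_spec.2 p hp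

/-- Inverse loops. -/
def gi (j : w.L) (p : ℝ × ℝ) : Circle := ce (-(p.1 * (w.h j p.2 - F.hs p.2)))

lemma continuous_gi (j : w.L) : Continuous (F.gi j) :=
  continuous_ce.comp (((continuous_fst.mul (((w.continuous_h j).comp continuous_snd).sub (F.hscont.comp continuous_snd)))).neg)

lemma gi_one (j : w.L) (x : ℝ) : F.gi j (1, x) = (w.c j x)⁻¹ * ce (F.hs x) := by
  unfold gi PW.c
  rw [← ce_neg, ← ce_add]; congr 1; ring

lemma gi_compat {j : w.L} (hj : j ∈ F.L0) : w.Compat (F.gi j) := by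
  refine ⟨?_, ?_, ?_⟩
  · intro x x' _ _ _ _
    simp [gi]
  · intro ρ _ _
    simp [gi, F.h0 j hj, F.hsN j hj, F.hs0]
  · intro x x' h1 h2 h3 h4 hc
    rw [gi_one, gi_one, hc j, F.sdep x x' h1 h2 h3 h4 hc]

lemma exists_ga (j : w.L) (hj : j ∈ F.L0) : ∃ q : S → Circle, Continuous q ∧ ∀ p ∈ w.Rs, q (pr p) = F.gi j p :=
  F.m.desc1 (F.continuous_gi j).continuousOn (F.gi_compat hj)

lemma exists_ga' : ∃ ga : w.L → S → Circle, ∀ j ∈ F.L0, Continuous (ga j) ∧ ∀ p ∈ w.Rs, ga j (pr p) = F.gi j p := by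
  classical
  refine ⟨fun j => if h : j ∈ F.L0 then (F.exists_ga j h).choose else fun _ => 1, fun j hj => ?_⟩
  simp only [hj, dif_pos]
  exact (F.exists_ga j hj).choose_spec

/-- The inner part. -/
def dl (p : ℝ × ℝ) : Multiset S :=
  {pr p} + Multiset.replicate F.L0.card (pr (1, 0)) + ∑ j ∈ F.L0, ({F.m.kap j (F.gi j p)} : Multiset S)

def aa (j : w.L) (x : ℝ) : ℝ := Real.arccos ((w.c j x : Circle) : ℂ).re

lemma continuous_aa (j : w.L) : Continuous (aa (w := w) j) :=
  Real.continuous_arccos.comp (Complex.continuous_re.comp (continuous_subtype_val.comp (w.continuous_c j)))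

/-- The outer part. -/
def du (v x : ℝ) : Multiset S :=
  (∑ j ∈ F.L0, (({F.m.kap j (Circle.exp ((1 - v) * aa j x))} : Multiset S) + {F.m.kap j ((Circle.exp ((1 - v) * aa j x))⁻¹ * ce (F.hs x))})) +
    {F.ks (ce (F.hs x))}

lemma continuous_dl : Continuous F.dl := by
  unfold dl
  refine Continuous.add (Continuous.add (continuous_ms_singleton.comp F.m.cont) continuous_const) ?_
  exact continuous_finsetSum _ fun j _ => continuous_ms_singleton.comp ((F.m.continuous_kap j).comp (F.continuous_gi j))

lemma continuous_du : Continuous fun p : ℝ × ℝ => F.du p.1 p.2 := by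
  unfold du
  have hh : Continuous fun p : ℝ × ℝ => ce (F.hs p.2) := continuous_ce.comp (F.hscont.comp continuous_snd)
  refine Continuous.add (continuous_finsetSum _ fun j _ => ?_) (continuous_ms_singleton.comp (F.kscont.comp hh))
  have he : Continuous fun p : ℝ × ℝ => Circle.exp ((1 - p.1) * aa (w := w) j p.2) :=
    Circle.exp.continuous.comp ((continuous_const.sub continuous_fst).mul ((continuous_aa j).comp continuous_snd))
  exact (continuous_ms_singleton.comp ((F.m.continuous_kap j).comp he)).add
    (continuous_ms_singleton.comp ((F.m.continuous_kap j).comp (he.inv.mul hh)))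

lemma sum_stars {ι : Type} (s : Finset ι) (a : S) : ∑ _j ∈ s, ({a} : Multiset S) = Multiset.replicate s.card a := by
  rw [Finset.sum_const, Multiset.nsmul_singleton]

lemma du_eq_dl {x : ℝ} (h0 : 0 ≤ x) (h1 : x ≤ w.N) : F.du 0 x = F.dl (1, x) := by
  classical
  unfold du dl
  simp only [sub_zero, one_mul, gi_one]
  have h11 : ∀ z : Circle, z = 1 → Circle.exp (Real.arccos (z : ℂ).re) = 1 := by
    rintro z rfl; simp
  rcases F.split x h0 h1 with ⟨j, hj, ho, hs, hp⟩ | ⟨ha, hp⟩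
  · rw [hs, hp, F.ks1]
    have e : ∀ j' ∈ F.L0.erase j, (({F.m.kap j' (Circle.exp (aa j' x))} : Multiset S) + {F.m.kap j' ((Circle.exp (aa j' x))⁻¹ * 1)}) = {pr (1,0)} + {pr (1,0)} := by
      intro j' hj'
      rw [Finset.mem_erase] at hj'
      rw [aa, h11 _ (ho j' hj'.2 hj'.1), inv_one, one_mul, F.m.kap_one]
    have e' : ∀ j' ∈ F.L0.erase j, ({F.m.kap j' ((w.c j' x)⁻¹ * 1)} : Multiset S) = {pr (1,0)} := by
      intro j' hj'
      rw [Finset.mem_erase] at hj'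
      rw [ho j' hj'.2 hj'.1, inv_one, one_mul, F.m.kap_one]
    rw [← Finset.add_sum_erase _ _ hj, ← Finset.add_sum_erase _ _ hj, Finset.sum_congr rfl e, Finset.sum_congr rfl e', Finset.sum_add_distrib,
      sum_stars, ← Finset.card_erase_add_one hj, Multiset.replicate_add, Multiset.replicate_one]
    have e2 : ({F.m.kap j (Circle.exp (aa j x))} : Multiset S) + {F.m.kap j ((Circle.exp (aa j x))⁻¹ * 1)} = {F.m.kap j (w.c j x)} + {F.m.kap j ((w.c j x)⁻¹ * 1)} := by
      rcases circ_pm (w.c j x) with h | h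
      · rw [aa, h]
      · rw [aa, h, mul_one, mul_one, inv_inv, add_comm]
    rw [e2]
    abel
  · rw [hp]
    have e : ∀ j' ∈ F.L0, (({F.m.kap j' (Circle.exp (aa j' x))} : Multiset S) + {F.m.kap j' ((Circle.exp (aa j' x))⁻¹ * ce (F.hs x))}) = {pr (1,0)} + {F.m.kap j' (ce (F.hs x))} := by
      intro j' hj'
      rw [aa, h11 _ (ha j' hj'), inv_one, one_mul, F.m.kap_one]
    have e' : ∀ j' ∈ F.L0, ({F.m.kap j' ((w.c j' x)⁻¹ * ce (F.hs x))} : Multiset S) = {F.m.kap j' (ce (F.hs x))} := by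
      intro j' hj'
      rw [ha j' hj', inv_one, one_mul]
    rw [Finset.sum_congr rfl e, Finset.sum_congr rfl e', Finset.sum_add_distrib, sum_stars]
    abel

/-- The full map. -/
def Dl (r x : ℝ) : Multiset S := if r ≤ 1 then F.dl (r, x) else F.du (r - 1) x

lemma Dl_ge {r x : ℝ} (hr : 1 ≤ r) (h0 : 0 ≤ x) (h1 : x ≤ w.N) : F.Dl r x = F.du (r - 1) x := by
  unfold Dl
  split_ifs with h
  · obtain rfl : r = 1 := le_antisymm h hr
    rw [sub_self, F.du_eq_dl h0 h1]
  · rfl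

lemma Dl_le {r x : ℝ} (hr : r ≤ 1) : F.Dl r x = F.dl (r, x) := if_pos hr

def clN (w : PW) (x : ℝ) : ℝ := max 0 (min w.N x)
lemma clN_mem (x : ℝ) : 0 ≤ clN w x ∧ clN w x ≤ w.N := by
  unfold clN; have := w.NR
  exact ⟨le_max_left _ _, max_le this.le (min_le_left _ _)⟩
lemma clN_of {x : ℝ} (h0 : 0 ≤ x) (h1 : x ≤ w.N) : clN w x = x := by
  unfold clN; simp [h0, h1]

lemma continuous_Dl : Continuous fun p : ℝ × ℝ => F.Dl p.1 (clN w p.2) := by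
  have hc : Continuous (clN w) := by unfold clN; fun_prop
  unfold Dl
  refine Continuous.if_le (F.continuous_dl.comp (by fun_prop)) (F.continuous_du.comp (f := fun p : ℝ × ℝ => (p.1 - 1, clN w p.2)) (by fun_prop)) continuous_fst continuous_const ?_
  intro p hp
  rw [hp, sub_self]
  exact (F.du_eq_dl (clN_mem _).1 (clN_mem _).2).symm

lemma Dl_contOn : ContinuousOn (fun p : I × ℝ × ℝ => F.Dl ((1 + p.1) * p.2.1) p.2.2) (Set.univ ×ˢ w.Rs) := by
  have h : Continuous fun p : I × ℝ × ℝ => F.Dl ((1 + p.1) * p.2.1) (clN w p.2.2) :=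
    F.continuous_Dl.comp (f := fun p : I × ℝ × ℝ => ((1 + (p.1 : ℝ)) * p.2.1, p.2.2)) (by fun_prop)
  refine h.continuousOn.congr ?_
  rintro ⟨u, p⟩ ⟨_, hp⟩
  show _ = F.Dl _ (clN w p.2)
  rw [clN_of hp.2.1 hp.2.2]

lemma dl_per {r : ℝ} (h0 : 0 ≤ r) (h1 : r ≤ 1) : F.dl (r, 0) = F.dl (r, w.N) := by
  unfold dl
  rw [F.m.compat.p r h0 h1]
  congr 1
  exact Finset.sum_congr rfl fun j hj => by rw [(F.gi_compat hj).p r h0 h1]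

lemma dl_zero (x x' : ℝ) (h1 : 0 ≤ x) (h2 : x ≤ w.N) (h3 : 0 ≤ x') (h4 : x' ≤ w.N) : F.dl (0, x) = F.dl (0, x') := by
  unfold dl
  rw [F.m.compat.z x x' h1 h2 h3 h4]
  congr 1
  exact Finset.sum_congr rfl fun j hj => by rw [(F.gi_compat hj).z x x' h1 h2 h3 h4]

lemma du_dep (v x x' : ℝ) (hc : ∀ l, w.c l x = w.c l x') (hs : ce (F.hs x) = ce (F.hs x')) : F.du v x = F.du v x' := by
  unfold du aa
  simp only [hc, hs]

lemma du_one (x x' : ℝ) (hs : ce (F.hs x) = ce (F.hs x')) : F.du 1 x = F.du 1 x' := by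
  unfold du
  simp only [sub_self, zero_mul, hs]

lemma Dl_compat (u : I) : w.Compat fun p => F.Dl ((1 + u) * p.1) p.2 := by
  have hu0 : 0 ≤ (u : ℝ) := u.2.1
  refine ⟨?_, ?_, ?_⟩
  · intro x x' h1 h2 h3 h4
    simp only [mul_zero]
    rw [F.Dl_le zero_le_one, F.Dl_le zero_le_one, F.dl_zero x x' h1 h2 h3 h4]
  · intro ρ h0 h1
    simp only
    rcases le_total ((1 + (u : ℝ)) * ρ) 1 with h | h
    · rw [F.Dl_le h, F.Dl_le h, F.dl_per (by positivity) h]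
    · rw [F.Dl_ge h le_rfl w.NR.le, F.Dl_ge h w.NR.le le_rfl]
      exact F.du_dep _ _ _ (fun l => by rw [w.c_zero, w.c_N]) (by rw [F.ceN, F.hs0, ce_zero])
  · intro x x' h1 h2 h3 h4 hc
    simp only [mul_one]
    have h : (1 : ℝ) ≤ 1 + u := by linarith
    rw [F.Dl_ge h h1 h2, F.Dl_ge h h3 h4]
    exact F.du_dep _ _ _ hc (F.sdep x x' h1 h2 h3 h4 hc)

lemma exists_H : ∃ H : I × S → Multiset S, Continuous H ∧ ∀ u, ∀ p ∈ w.Rs, H (u, pr p) = F.Dl ((1 + u) * p.1) p.2 :=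
  F.m.desc F.Dl_contOn F.Dl_compat

lemma exists_beta [T2Space Z] : ∃ b : Z → Multiset S, Continuous b ∧ ∀ p ∈ w.Rs, b (F.zq p) = F.Dl (2 * p.1) p.2 := by
  refine cdesc1 w.isCompact_Rs F.zcont F.zsurj (F := fun p => F.Dl (2 * p.1) p.2) ?_ ?_
  · have := F.Dl_contOn.comp (f := fun p : ℝ × ℝ => ((1 : I), p)) (s := w.Rs) (by fun_prop) (fun p hp => ⟨trivial, hp⟩)
    refine this.congr fun p hp => ?_
    show _ = F.Dl ((1 + ((1 : I) : ℝ)) * p.1) p.2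
    norm_num
  · intro p hp q hq h
    rcases F.zfib p hp q hq h with h1 | ⟨h1, h2, h3⟩
    · have := (F.Dl_compat 1).fib hp hq h1
      norm_num at this
      exact this
    · rw [h1, h2, F.Dl_ge (by norm_num) hp.2.1 hp.2.2, F.Dl_ge (by norm_num) hq.2.1 hq.2.2]
      norm_num
      exact F.du_one _ _ h3

lemma du_mem {v x : ℝ} {s : S} (hs : s ∈ F.du v x) : ∃ y : ℝ, 0 ≤ y ∧ y ≤ w.N ∧ s = pr (1, y) := by
  unfold du at hs
  rw [Multiset.mem_add, Multiset.mem_sum] at hs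
  rcases hs with ⟨j, _, hs⟩ | hs
  · rw [Multiset.mem_add, Multiset.mem_singleton, Multiset.mem_singleton] at hs
    rcases hs with rfl | rfl <;> exact F.m.kap_bd j _
  · rw [Multiset.mem_singleton] at hs
    subst hs
    exact F.ksbd _

lemma dl_card (p : ℝ × ℝ) : Multiset.card (F.dl p) = 2 * F.L0.card + 1 := by
  unfold dl
  simp [Multiset.card_sum]; omega

lemma du_card (v x : ℝ) : Multiset.card (F.du v x) = 2 * F.L0.card + 1 := by
  unfold du
  simp [Multiset.card_sum]; omega

lemma du_zero (v : ℝ) : F.du v 0 = Multiset.replicate (2 * F.L0.card + 1) (pr (1, 0)) := by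
  rw [Multiset.eq_replicate]
  refine ⟨F.du_card _ _, fun s hs => ?_⟩
  unfold du at hs
  rw [Multiset.mem_add, Multiset.mem_sum] at hs
  have ha : ∀ j, aa (w := w) j 0 = 0 := fun j => by rw [aa, w.c_zero]; simp
  rcases hs with ⟨j, _, hs⟩ | hs
  · rw [Multiset.mem_add, Multiset.mem_singleton, Multiset.mem_singleton, ha, F.hs0, ce_zero, mul_zero, Circle.exp_zero, inv_one, one_mul, F.m.kap_one] at hs
    rcases hs with rfl | rfl <;> rfl
  · rw [Multiset.mem_singleton, F.hs0, ce_zero, F.ks1] at hs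
    exact hs

end Fac
end FacS

end

section
set_option autoImplicit false
open Topology
set_option linter.unusedSectionVars false
set_option linter.unusedSimpArgs false
set_option linter.unusedVariables false

section FacN

lemma BNull.sum {i : ℕ} {ι Y : Type} [TopologicalSpace Y] [AddCommMonoid Y] [ContinuousAdd Y] (T : Finset ι) (g : ι → (Fin i → I) → Y)
    (h : ∀ j ∈ T, BNull (g j)) : BNull (fun s => ∑ j ∈ T, g j s) := by
  classical
  induction T using Finset.induction_on with
  | empty => exact ⟨0, by simpa using BH.refl continuous_const fun _ _ _ _ => rfl⟩
  | insert a T ha ih =>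
    obtain ⟨y, hy⟩ := ih fun j hj => h j (Finset.mem_insert_of_mem hj)
    obtain ⟨z, hz⟩ := h a (Finset.mem_insert_self _ _)
    refine ⟨z + y, ?_⟩
    simp only [Finset.sum_insert ha]
    exact BH.comp2 hz hy (φ := fun p => p.1 + p.2) continuous_add

lemma joined_rep {X : Type} [TopologicalSpace X] [PathConnectedSpace X] (o : X) (C : Multiset X) :
    Joined C (Multiset.replicate C.card o) := by
  induction C using Multiset.induction_on with
  | empty => simpa using Joined.refl _
  | cons a C ih =>
    have h1 : Joined ({a} : Multiset X) {o} := (PathConnectedSpace.joined a o).map continuous_ms_singleton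
    have h2 := h1.add ih
    simpa [Multiset.singleton_add, Multiset.replicate_succ] using h2

lemma BH_add_joined {X : Type} [TopologicalSpace X] {i : ℕ} {f : (Fin i → I) → Multiset X} (hf : Continuous f)
    (hb : ∀ s ∈ Cube.boundary (Fin i), ∀ s' ∈ Cube.boundary (Fin i), f s = f s') {C D : Multiset X} (h : Joined C D) :
    BH (fun s => f s + C) (fun s => f s + D) := by
  obtain ⟨γ⟩ := h
  refine ⟨fun p => f p.2 + γ p.1, by fun_prop, fun s => by simp, fun s => by simp, fun t s hs s' hs' => ?_⟩
  simp only [hb s hs s' hs']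

lemma BH.card {X : Type} [TopologicalSpace X] {i n : ℕ} {f g : (Fin i → I) → Multiset X} (h : BH f g) (hc : ∀ s, (f s).card = n) :
    ∀ s, (g s).card = n := by
  obtain ⟨H, hH, h0, h1, -⟩ := h
  intro s
  rw [← h1]
  exact BH_card (f := f) (g := f) hH (fun s => by rw [h0, hc]) _

/-- Change of boundary value. -/
lemma move_bd {X : Type} [TopologicalSpace X] [PathConnectedSpace X] {i n : ℕ} (hi : 0 < i) {f : (Fin i → I) → Multiset X} (hf : Continuous f)
    (hc : ∀ s, (f s).card = n) {y y' : Multiset X} (hb : ∀ s ∈ Cube.boundary (Fin i), f s = y) (hy' : y'.card = n) :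
    ∃ f', BH f f' ∧ Continuous f' ∧ (∀ s, (f' s).card = n) ∧ ∀ s ∈ Cube.boundary (Fin i), f' s = y' := by
  have hyc : y.card = n := by rw [← hb _ (zero_mem_bd hi), hc]
  have hj : Joined y y' := by
    obtain ⟨o⟩ := (inferInstance : Nonempty X)
    have h1 := joined_rep o y
    have h2 := joined_rep o y'
    rw [hyc] at h1
    rw [hy'] at h2
    exact h1.trans h2.symm
  obtain ⟨γ⟩ := hj
  obtain ⟨f', h1, h2⟩ := BH_transport hi hf hb γ
  exact ⟨f', h1, h1.cont_right, h1.card hc, h2⟩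

namespace Fac
variable {w : PW} {S : Type} [TopologicalSpace S] {pr : ℝ × ℝ → S} {Z : Type} [TopologicalSpace Z] (F : Fac w S pr Z)

lemma one_zero_mem : ((1 : ℝ), (0 : ℝ)) ∈ w.Rs := PW.Mod.mkRs zero_le_one le_rfl le_rfl w.NR.le

theorem null [T2Space Z] {i n : ℕ} (hi : 2 ≤ i) (hin : i < n) {f : (Fin i → I) → Multiset S} (hf : Continuous f) (hc : ∀ s, (f s).card = n)
    (hb : ∀ s ∈ Cube.boundary (Fin i), f s = Multiset.replicate n (pr (1, 0))) (hN : BNull fun s => (f s).map F.q) : BNull f := by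
  have := F.m.t2
  have := F.m.compact
  have := F.m.pathc
  obtain ⟨st⟩ := F.m.stab
  obtain ⟨H, hH, hHp⟩ := F.exists_H
  obtain ⟨b, hbc, hbp⟩ := F.exists_beta
  obtain ⟨ga, hga⟩ := F.exists_ga'
  have hbb : ∀ s ∈ Cube.boundary (Fin i), ∀ s' ∈ Cube.boundary (Fin i), f s = f s' := fun s hs s' hs' => by rw [hb s hs, hb s' hs']
  have hz := zero_mem_bd (i := i) (by omega)
  have H1 : ∀ s, H (1, s) = b (F.q s) := by
    intro s
    obtain ⟨p, hp, rfl⟩ := F.m.surj s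
    rw [hHp _ p hp, F.q_pr hp, hbp p hp]
    norm_num
  have H0 : ∀ s, H (0, s) = {s} + Multiset.replicate F.L0.card (pr (1, 0)) + ∑ j ∈ F.L0, ({F.m.kap j (ga j s)} : Multiset S) := by
    intro s
    obtain ⟨p, hp, rfl⟩ := F.m.surj s
    rw [hHp _ p hp]
    have : (1 + ((0 : I) : ℝ)) * p.1 = p.1 := by norm_num
    rw [this, F.Dl_le hp.1.2]
    unfold dl
    congr 1
    exact Finset.sum_congr rfl fun j hj => by rw [(hga j hj).2 p hp]
  have E : ∀ m : Multiset S, (m.map fun s => H (0, s)).sum = m + (m.card • Multiset.replicate F.L0.card (pr (1, 0))) +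
      ∑ j ∈ F.L0, (m.map (ga j)).map (F.m.kap j) := by
    intro m
    induction m using Multiset.induction_on with
    | empty => simp
    | cons a m ih =>
      rw [Multiset.map_cons, Multiset.sum_cons, ih, H0]
      simp only [Multiset.map_cons, Multiset.card_cons, add_smul, one_smul]
      simp only [← Multiset.singleton_add, Finset.sum_add_distrib]
      abel
  have hHs : Continuous fun p : I × Multiset S => (p.2.map fun s => H (p.1, s)).sum :=
    continuous_ms_sum (h := fun u s => H (u, s)) hH
  have B1 := BH.ofHomotopy hf hbb hHs
  simp only [E, H1, hc] at B1
  have N1 : BNull (fun s => ((f s).map fun s => b (F.q s)).sum) := by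
    have := hN.comp (continuous_ms_sum' hbc)
    refine this.of_BH ?_
    have e : (fun s => ((f s).map fun s => b (F.q s)).sum) = (fun m : Multiset Z => (m.map b).sum) ∘ (fun s => (f s).map F.q) := by
      funext s
      simp [Multiset.map_map]
    rw [← e]
    exact B1.symm.trans B1
  have N2 := N1.of_BH B1
  obtain ⟨Y, hY⟩ := BNull.sum F.L0 (fun j s => ((f s).map (ga j)).map (F.m.kap j)) (fun j hj => by
    have h1 : BNull fun s => (f s).map (ga j) := circle_ms_null (m := n) hi ((continuous_ms_map' (hga j hj).1).comp hf)
      (fun s => by simp [hc]) (fun s hs => by rw [hb s hs, hb _ hz])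
    exact h1.comp (continuous_ms_map' (F.m.continuous_kap j)))
  have B2 := BH.comp2 (BH.refl hf hbb) hY (φ := fun p : Multiset S × Multiset S => p.1 + (n • Multiset.replicate F.L0.card (pr (1, 0))) + p.2)
    (by fun_prop)
  have N3 := N2.of_BH B2.symm
  have B3 := BH_add_joined hf hbb (joined_rep (pr (1, 0)) ((n • Multiset.replicate F.L0.card (pr (1, 0))) + Y))
  simp only [← add_assoc] at B3
  exact st.inj (by omega) hin _ hf hc hb (N3.of_BH B3.symm)

theorem null' [T2Space Z] {i n : ℕ} (hi : 2 ≤ i) (hin : i < n) {f : (Fin i → I) → Multiset S} (hf : Continuous f) (hc : ∀ s, (f s).card = n)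
    {y : Multiset S} (hb : ∀ s ∈ Cube.boundary (Fin i), f s = y) (hN : BNull fun s => (f s).map F.q) : BNull f := by
  have := F.m.pathc
  obtain ⟨f', h1, h2, h3, h4⟩ := move_bd (by omega) hf hc hb (y' := Multiset.replicate n (pr (1, 0))) (by simp)
  refine (F.null hi hin h2 h3 h4 ?_).of_BH h1
  exact hN.of_BH ((h1.comp (continuous_ms_map' F.continuous_q)).symm)

/-- Nontriviality transfer. -/
theorem nontriv [T2Space Z] (hM : ∀ x : ℝ, 0 ≤ x → x ≤ w.N → F.zq (1, x) = F.zq (1, 0)) {n : ℕ} (hn : 2 ≤ n)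
    {e : (Fin 2 → I) → Z} (he : Continuous e) (heb : ∀ s ∈ Cube.boundary (Fin 2), e s = F.zq (1, 0))
    (hnt : ∀ k, ¬ BNull (fun s => ({e s} : Multiset Z) + Multiset.replicate k (F.zq (1, 0)))) {y : Multiset S} (hy : y.card = n) :
    ∃ f : (Fin 2 → I) → Multiset S, Continuous f ∧ (∀ s, (f s).card = n) ∧
      (∀ s ∈ Cube.boundary (Fin 2), f s = y) ∧ ¬ BNull (fun s => (f s).map F.q) := by
  have := F.m.t2
  have := F.m.compact
  have := F.m.pathc
  obtain ⟨st⟩ := F.m.stab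
  obtain ⟨b, hbc, hbp⟩ := F.exists_beta
  have hqu : ∀ v x, (F.du v x).map F.q = Multiset.replicate (2 * F.L0.card + 1) (F.zq (1, 0)) := by
    intro v x
    rw [Multiset.eq_replicate]
    refine ⟨by rw [Multiset.card_map, F.du_card], fun z hz => ?_⟩
    obtain ⟨s, hs, rfl⟩ := Multiset.mem_map.1 hz
    obtain ⟨t, h0, h1, rfl⟩ := F.du_mem hs
    rw [F.q_pr (PW.Mod.mkRs zero_le_one le_rfl h0 h1), hM t h0 h1]
  have hqk : ∀ j z, F.q (F.m.kap j z) = F.zq (1, 0) := by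
    intro j z
    obtain ⟨t, h0, h1, e⟩ := F.m.kap_bd j z
    rw [e, F.q_pr (PW.Mod.mkRs zero_le_one le_rfl h0 h1), hM t h0 h1]
  have hqo : F.q (pr (1, 0)) = F.zq (1, 0) := F.q_pr one_zero_mem
  have hqd : ∀ p ∈ w.Rs, (F.dl p).map F.q = {F.zq p} + Multiset.replicate (2 * F.L0.card) (F.zq (1, 0)) := by
    intro p hp
    unfold dl
    have e1 : ∀ T : Finset w.L, (∑ j ∈ T, ({F.m.kap j (F.gi j p)} : Multiset S)).map F.q = Multiset.replicate T.card (F.zq (1, 0)) := by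
      intro T
      classical
      induction T using Finset.induction_on with
      | empty => simp
      | insert a T ha ih =>
        rw [Finset.sum_insert ha, Multiset.map_add, ih, Multiset.map_singleton, hqk, Finset.card_insert_of_notMem ha, Multiset.replicate_succ, Multiset.singleton_add]
    rw [Multiset.map_add, Multiset.map_add, e1, Multiset.map_singleton, F.q_pr hp, Multiset.map_replicate, hqo, add_assoc, ← Multiset.replicate_add, two_mul]
  obtain ⟨W, hW, hWp⟩ := cdesc (A := I) w.isCompact_Rs F.zcont F.zsurj (F := fun p : I × ℝ × ℝ => (F.Dl ((1 + p.1) * p.2.1) p.2.2).map F.q)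
    ((continuous_ms_map' F.continuous_q).comp_continuousOn F.Dl_contOn) (by
      intro u p hp q hq h
      rcases F.zfib p hp q hq h with h1 | ⟨h1, h2, h3⟩
      · exact congrArg (Multiset.map F.q) ((F.Dl_compat u).fib hp hq h1)
      · have hu : (1 : ℝ) ≤ 1 + u := by linarith [u.2.1]
        simp only [h1, h2, mul_one]
        rw [F.Dl_ge hu hp.2.1 hp.2.2, F.Dl_ge hu hq.2.1 hq.2.2, hqu, hqu])
  have W0 : ∀ z, W (0, z) = {z} + Multiset.replicate (2 * F.L0.card) (F.zq (1, 0)) := by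
    intro z
    obtain ⟨p, hp, rfl⟩ := F.zsurj z
    rw [hWp _ p hp]
    have : (1 + ((0 : I) : ℝ)) * p.1 = p.1 := by norm_num
    simp only [this]
    rw [F.Dl_le hp.1.2, hqd p hp]
  have W1 : ∀ z, W (1, z) = (b z).map F.q := by
    intro z
    obtain ⟨p, hp, rfl⟩ := F.zsurj z
    rw [hWp _ p hp, hbp p hp]
    norm_num
  have hbcard : ∀ z, (b z).card = 2 * F.L0.card + 1 := by
    intro z
    obtain ⟨p, hp, rfl⟩ := F.zsurj z
    rw [hbp p hp]
    unfold Dl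
    split_ifs
    · exact F.dl_card _
    · exact F.du_card _ _
  have hbo : b (F.zq (1, 0)) = Multiset.replicate (2 * F.L0.card + 1) (pr (1, 0)) := by
    rw [hbp _ one_zero_mem, F.Dl_ge (by norm_num) le_rfl w.NR.le, F.du_zero]
  obtain ⟨f, f1, f2, f3, f4⟩ := st.surj hn (2 * F.L0.card + 1) (f := fun s => b (e s) + Multiset.replicate n (pr (1, 0)))
    (by have := hbc.comp he; fun_prop) (fun s => by simp [hbcard]; omega) (fun s hs => by
      rw [heb s hs, hbo, ← Multiset.replicate_add, add_comm])
  obtain ⟨f', g1, g2, g3, g4⟩ := move_bd (by omega) f1 f2 f3 hy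
  refine ⟨f', g2, g3, g4, fun hN => hnt (2 * F.L0.card + n) ?_⟩
  have hN' : BNull (fun s => (f s).map F.q) := hN.of_BH (g1.comp (continuous_ms_map' F.continuous_q))
  have h5 := hN'.comp (φ := fun m : Multiset Z => m + Multiset.replicate (2 * F.L0.card + 1) (F.zq (1, 0))) (by fun_prop)
  have h6 := f4.comp (continuous_ms_map' F.continuous_q)
  have heb' : ∀ s ∈ Cube.boundary (Fin 2), ∀ s' ∈ Cube.boundary (Fin 2), e s = e s' := fun s hs s' hs' => by rw [heb s hs, heb s' hs']
  have h7 := BH.ofHomotopy he heb' (G := fun p : I × Z => W p + Multiset.replicate n (F.zq (1, 0))) (by fun_prop)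
  have e1 : (fun s => ({e s} : Multiset Z) + Multiset.replicate (2 * F.L0.card + n) (F.zq (1, 0))) = fun s => W (0, e s) + Multiset.replicate n (F.zq (1, 0)) := by
    funext s
    rw [W0, add_assoc, Multiset.replicate_add]
  have e2 : (fun s => W (1, e s) + Multiset.replicate n (F.zq (1, 0))) = Multiset.map F.q ∘ fun s => b (e s) + Multiset.replicate n (pr (1, 0)) := by
    funext s
    simp [W1, hqo]
  have e3 : (Multiset.map F.q ∘ fun s => f s + Multiset.replicate (2 * F.L0.card + 1) (pr (1, 0))) =
      (fun m : Multiset Z => m + Multiset.replicate (2 * F.L0.card + 1) (F.zq (1, 0))) ∘ fun s => (f s).map F.q := by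
    funext s
    simp [hqo]
  rw [e1]
  rw [e2] at h7
  rw [e3] at h6
  exact (h5.of_BH h6).of_BH h7

end Fac
end FacN

end

section
set_option autoImplicit false
open Topology
set_option linter.unusedSectionVars false
set_option linter.unusedSimpArgs false
set_option linter.unusedVariables false

section FacC

lemma polar_ce (b : ℂ) : ∃ t : ℝ, 0 ≤ t ∧ t < 1 ∧ b = (‖b‖ : ℂ) * (ce t : ℂ) := by
  by_cases h0 : b = 0
  · exact ⟨0, le_rfl, one_pos, by simp [h0]⟩
  · have hn : ‖b‖ ≠ 0 := norm_ne_zero_iff.2 h0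
    obtain ⟨t, ht0, ht1, ht⟩ := ce_surj ⟨b / ‖b‖, by
      rw [Submonoid.unitSphere]
      show b / (‖b‖ : ℂ) ∈ Metric.sphere (0 : ℂ) 1
      rw [mem_sphere_zero_iff_norm, norm_div, Complex.norm_real, norm_norm, div_self hn]⟩
    refine ⟨t, ht0, ht1, ?_⟩
    rw [ht]
    show b = (‖b‖ : ℂ) * (b / ‖b‖)
    rw [mul_div_cancel₀]
    exact_mod_cast hn

namespace PW
variable (w : PW)
lemma h_zero (l : w.L) : w.h l 0 = 0 := by
  unfold h
  refine Finset.sum_eq_zero fun b _ => ?_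
  rw [cl01_le (by simp), mul_zero]

lemma h_N (l : w.L) : w.h l w.N = ∑ b : Bool, w.sg b := by
  unfold h
  refine Finset.sum_congr rfl fun b _ => ?_
  have : (w.en l b : ℝ) + 1 ≤ w.N := by exact_mod_cast w.en_lt l b
  rw [cl01_ge (by linarith), mul_one]

lemma h_N_true (ht : w.tw = true) (l : w.L) : w.h l w.N = 0 := by
  rw [h_N]; simp [sg, ht]

lemma h_N_false (ht : w.tw = false) (l : w.L) : w.h l w.N = 2 := by
  rw [h_N]; simp [sg, ht]

lemma h_mono (ht : w.tw = false) (l : w.L) : Monotone (w.h l) := by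
  intro x y hxy
  unfold h
  refine Finset.sum_le_sum fun b _ => ?_
  have : w.sg b = 1 := by simp [sg, ht]
  rw [this, one_mul, one_mul]
  unfold cl01
  gcongr
end PW

def zM (w : PW) (p : ℝ × ℝ) : S2 := hopf0 ⟨(((1 - p.1 : ℝ) : ℂ), ((p.1 : ℝ) : ℂ) * (ce (p.2 / w.N) : ℂ)), by
  intro h
  rw [Prod.mk_eq_zero] at h
  obtain ⟨h1, h2⟩ := h
  have h1 : p.1 = 1 := by have : 1 - p.1 = 0 := by exact_mod_cast h1
                          linarith
  rw [h1] at h2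
  exact Circle.coe_ne_zero (ce (p.2 / w.N)) (by simpa using h2)⟩

lemma continuous_zM (w : PW) : Continuous (zM w) := by
  refine continuous_hopf0.comp (Continuous.subtype_mk ?_ _)
  have h : Continuous fun p : ℝ × ℝ => (ce (p.2 / w.N) : ℂ) := continuous_subtype_val.comp (continuous_ce.comp (by fun_prop))
  have h1 : Continuous fun p : ℝ × ℝ => ((p.1 : ℝ) : ℂ) := Complex.continuous_ofReal.comp continuous_fst
  have h2 : Continuous fun p : ℝ × ℝ => ((1 - p.1 : ℝ) : ℂ) := Complex.continuous_ofReal.comp (by fun_prop)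
  exact h2.prodMk (h1.mul h)

lemma zM_eq (w : PW) (p q : ℝ × ℝ) : zM w p = zM w q ↔
    ((1 - p.1 : ℝ) : ℂ) * (((q.1 : ℝ) : ℂ) * (ce (q.2 / w.N) : ℂ)) = ((1 - q.1 : ℝ) : ℂ) * (((p.1 : ℝ) : ℂ) * (ce (p.2 / w.N) : ℂ)) :=
  hopf0_eq _ _

lemma zM_one (w : PW) (x : ℝ) : zM w (1, x) = S2inf := hopf0_inf _ (by simp)

lemma zM_surj (w : PW) (z : S2) : ∃ p ∈ w.Rs, zM w p = z := by
  obtain ⟨⟨⟨a, b⟩, hab⟩, rfl⟩ := hopf0_surj z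
  have hN := w.NR
  by_cases ha : a = 0
  · exact ⟨(1, 0), Fac.one_zero_mem, by rw [zM_one, hopf0_inf _ ha]⟩
  · obtain ⟨t, t0, t1, hb⟩ := polar_ce (b / a)
    set r := ‖b / a‖ with hr
    have hr0 : 0 ≤ r := norm_nonneg _
    have hr1 : (1 + r : ℝ) ≠ 0 := by positivity
    refine ⟨(r / (1 + r), w.N * t), PW.Mod.mkRs (by positivity) (by rw [div_le_one (by positivity)]; linarith) (by positivity) (by nlinarith), ?_⟩
    refine (hopf0_eq _ _).2 ?_
    show ((1 - r / (1 + r) : ℝ) : ℂ) * b = a * (((r / (1 + r) : ℝ) : ℂ) * (ce (w.N * t / w.N) : ℂ))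
    rw [mul_div_cancel_left₀ _ hN.ne']
    have hb' : b = a * ((r : ℂ) * (ce t : ℂ)) := by rw [← hb, mul_div_cancel₀ _ ha]
    have e : 1 - r / (1 + r) = 1 / (1 + r) := by field_simp; ring
    rw [e, hb']
    push_cast
    ring

lemma zM_fib (w : PW) (p : ℝ × ℝ) (hp : p ∈ w.Rs) (q : ℝ × ℝ) (hq : q ∈ w.Rs) (h : zM w p = zM w q) :
    w.Fib p q ∨ (p.1 = 1 ∧ q.1 = 1 ∧ True) := by
  rw [zM_eq] at h
  have h1 : (1 - p.1) * q.1 = (1 - q.1) * p.1 := by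
    have := congrArg norm h
    simp only [norm_mul, Circle.norm_coe, mul_one, Complex.norm_real] at this
    rwa [Real.norm_of_nonneg (by linarith [hp.1.2] : 0 ≤ 1 - p.1), Real.norm_of_nonneg (by linarith [hq.1.2] : 0 ≤ 1 - q.1), Real.norm_of_nonneg hp.1.1,
      Real.norm_of_nonneg hq.1.1] at this
  have h2 : p.1 = q.1 := by linarith
  by_cases h3 : p.1 = 1
  · exact Or.inr ⟨h3, h2 ▸ h3, trivial⟩
  · refine Or.inl ⟨h2, ?_⟩
    by_cases h4 : p.1 = 0
    · exact Or.inl h4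
    · right; left
      rw [← h2] at h
      have h5 : ((1 - p.1 : ℝ) : ℂ) ≠ 0 := by
        exact_mod_cast (fun h => h3 (by linarith) : 1 - p.1 ≠ 0)
      have h6 : ((p.1 : ℝ) : ℂ) ≠ 0 := by exact_mod_cast h4
      exact (Circle.ext (mul_left_cancel₀ h6 (mul_left_cancel₀ h5 h))).symm

def facM {w : PW} {S : Type} [TopologicalSpace S] {pr : ℝ × ℝ → S} (m : w.Mod S pr) (ht : w.tw = true) : Fac w S pr S2 where
  m := m
  zq := zM w
  zcont := (continuous_zM w).continuousOn
  zsurj := zM_surj w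
  zcompat := by
    refine ⟨fun x x' _ _ _ _ => ?_, fun ρ _ _ => ?_, fun x x' _ _ _ _ _ => ?_⟩
    · rw [zM_eq]; simp
    · rw [zM_eq]; simp [w.NR.ne', ce_zero, ce_one]
    · rw [zM_one, zM_one]
  L0 := Finset.univ
  hs := fun _ => 0
  hscont := continuous_const
  hs0 := rfl
  hsN := fun j _ => w.h_N_true ht j
  ceN := ce_zero
  h0 := fun j _ => w.h_zero j
  ks := fun _ => pr (1, 0)
  kscont := continuous_const
  ks1 := rfl
  ksbd := fun _ => ⟨0, le_rfl, w.NR.le, rfl⟩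
  split := fun x h0 h1 => by
    obtain ⟨l, h2, h3⟩ := m.kap_split h0 h1
    exact Or.inl ⟨l, Finset.mem_univ _, fun j _ hj => h2 j hj, ce_zero, h3⟩
  sdep := fun _ _ _ _ _ _ _ => rfl
  zfib := fun p hp q hq h => by
    rcases zM_fib w p hp q hq h with h | ⟨h, h', -⟩
    · exact Or.inl h
    · exact Or.inr ⟨h, h', rfl⟩

def phN (w : PW) (l : w.L) (p : ℝ × ℝ) : ℝ := (1 - p.1) * (p.2 / w.N) + p.1 * (w.h l p.2 / 2)

lemma continuous_phN (w : PW) (l : w.L) : Continuous (phN w l) := by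
  unfold phN
  have := w.continuous_h l
  fun_prop

def zN (w : PW) (l : w.L) (p : ℝ × ℝ) : RP2 := ver ⟨(((p.1 : ℝ) : ℂ) * (ce (phN w l p) : ℂ), 1 - p.1), by
  intro h
  rw [Prod.mk_eq_zero] at h
  obtain ⟨h2, h1⟩ := h
  have h1 : p.1 = 1 := by linarith
  rw [h1] at h2
  exact Circle.coe_ne_zero (ce (phN w l p)) (by simpa using h2)⟩

lemma continuous_zN (w : PW) (l : w.L) : Continuous (zN w l) := by
  refine continuous_ver.comp (Continuous.subtype_mk ?_ _)
  have h : Continuous fun p : ℝ × ℝ => (ce (phN w l p) : ℂ) := continuous_subtype_val.comp (continuous_ce.comp (continuous_phN w l))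
  have h1 : Continuous fun p : ℝ × ℝ => ((p.1 : ℝ) : ℂ) := Complex.continuous_ofReal.comp continuous_fst
  exact (h1.mul h).prodMk (by fun_prop)

lemma zN_eq (w : PW) (l : w.L) (p q : ℝ × ℝ) : zN w l p = zN w l q ↔ ∃ r : ℝ,
    ((p.1 : ℝ) : ℂ) * (ce (phN w l p) : ℂ) = r * (((q.1 : ℝ) : ℂ) * (ce (phN w l q) : ℂ)) ∧ 1 - p.1 = r * (1 - q.1) := by
  rw [zN, zN, ver_eq]
  simp only [Prod.ext_iff, Prod.smul_fst, Prod.smul_snd, Complex.real_smul, smul_eq_mul]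

lemma phN_zero (w : PW) (l : w.L) (r : ℝ) : phN w l (r, 0) = 0 := by simp [phN, w.h_zero]
lemma phN_N (w : PW) (ht : w.tw = false) (l : w.L) (r : ℝ) : phN w l (r, w.N) = 1 := by
  simp [phN, w.h_N_false ht, w.NR.ne']

lemma phN_mono (w : PW) (ht : w.tw = false) (l : w.L) {r : ℝ} (h0 : 0 ≤ r) (h1 : r ≤ 1) : Monotone fun x => phN w l (r, x) := by
  intro x y hxy
  have := w.h_mono ht l hxy
  have hN := w.NR
  have h2 : 0 ≤ 1 - r := by linarith
  unfold phN
  dsimp only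
  gcongr

lemma phN_smono (w : PW) (ht : w.tw = false) (l : w.L) {r : ℝ} (h0 : 0 ≤ r) (h1 : r < 1) : StrictMono fun x => phN w l (r, x) := by
  intro x y hxy
  have h3 := w.h_mono ht l hxy.le
  have hN := w.NR
  have h2 : 0 < 1 - r := by linarith
  unfold phN
  dsimp only
  have h4 : (1 - r) * (x / w.N) < (1 - r) * (y / w.N) := by gcongr
  have h5 : r * (w.h l x / 2) ≤ r * (w.h l y / 2) := by gcongr
  linarith

lemma zN_surj (w : PW) (ht : w.tw = false) (l : w.L) (z : RP2) : ∃ p ∈ w.Rs, zN w l p = z := by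
  obtain ⟨⟨⟨a, t⟩, hat⟩, rfl⟩ := ver_surj z
  have hN := w.NR
  have hpos : 0 < ‖a‖ + |t| := by
    rcases eq_or_ne a 0 with rfl | h
    · have : t ≠ 0 := fun h => hat (by rw [h]; rfl)
      have := abs_pos.2 this
      simpa using this
    · have := norm_pos_iff.2 h
      positivity
  obtain ⟨e, he, het⟩ : ∃ e : ℝ, |e| = 1 ∧ e * t = |t| := by
    rcases le_total 0 t with h | h
    · exact ⟨1, by simp, by rw [abs_of_nonneg h, one_mul]⟩
    · exact ⟨-1, by simp, by rw [abs_of_nonpos h]; ring⟩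
  obtain ⟨τ, t0, t1, hb⟩ := polar_ce ((e : ℂ) * a)
  have hne : ‖(e : ℂ) * a‖ = ‖a‖ := by rw [norm_mul, Complex.norm_real, Real.norm_eq_abs, he, one_mul]
  rw [hne] at hb
  set r := ‖a‖ / (‖a‖ + |t|) with hr
  have hr0 : 0 ≤ r := by positivity
  have hr1 : r ≤ 1 := by rw [hr, div_le_one hpos]; linarith [abs_nonneg t]
  obtain ⟨x, hx, hxt⟩ : ∃ x ∈ Set.Icc (0 : ℝ) w.N, phN w l (r, x) = τ := by
    have h1 : ContinuousOn (fun x : ℝ => phN w l (r, x)) (Set.Icc (0 : ℝ) w.N) :=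
      ((continuous_phN w l).comp (by fun_prop)).continuousOn
    have := intermediate_value_Icc hN.le h1
    simp only [phN_zero, phN_N w ht] at this
    exact this ⟨t0, t1.le⟩
  refine ⟨(r, x), PW.Mod.mkRs hr0 hr1 hx.1 hx.2, ?_⟩
  refine (ver_eq _ _).2 ⟨e / (‖a‖ + |t|), ?_⟩
  show (((r : ℝ) : ℂ) * (ce (phN w l (r, x)) : ℂ), 1 - r) = (e / (‖a‖ + |t|)) • (a, t)
  have hpos' : ((‖a‖ : ℂ) + (|t| : ℝ)) ≠ 0 := by exact_mod_cast hpos.ne'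
  rw [hxt, Prod.smul_mk, Complex.real_smul, smul_eq_mul, Prod.mk.injEq]
  constructor
  · rw [hr]
    push_cast
    rw [div_mul_eq_mul_div, div_mul_eq_mul_div, hb]
  · rw [div_mul_eq_mul_div, het, hr]
    field_simp
    ring

lemma zN_fib (w : PW) (ht : w.tw = false) (l : w.L) (p : ℝ × ℝ) (hp : p ∈ w.Rs) (q : ℝ × ℝ) (hq : q ∈ w.Rs) (h : zN w l p = zN w l q) :
    w.Fib p q ∨ (p.1 = 1 ∧ q.1 = 1 ∧ ce (w.h l p.2) = ce (w.h l q.2)) := by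
  obtain ⟨r, x⟩ := p
  obtain ⟨r', x'⟩ := q
  obtain ⟨⟨hr0, hr1⟩, hx0, hx1⟩ := hp
  obtain ⟨⟨hr0', hr1'⟩, hx0', hx1'⟩ := hq
  simp only at hr0 hr1 hx0 hx1 hr0' hr1' hx0' hx1'
  have hN := w.NR
  obtain ⟨k, h1, h2⟩ := (zN_eq _ _ _ _).1 h
  simp only at h1 h2 ⊢
  have h3 : r = |k| * r' := by
    have := congrArg norm h1
    simp only [norm_mul, Circle.norm_coe, mul_one, Complex.norm_real] at this
    rwa [Real.norm_of_nonneg hr0, Real.norm_of_nonneg hr0', Real.norm_eq_abs] at this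
  by_cases h4 : r = 1
  · subst h4
    have hk : k ≠ 0 := by rintro rfl; simp at h3
    have h5 : r' = 1 := by
      have : k * (1 - r') = 0 := by linarith
      rcases mul_eq_zero.1 this with h | h
      · exact absurd h hk
      · linarith
    subst h5
    refine Or.inr ⟨rfl, rfl, ?_⟩
    have hk2 : k ^ 2 = 1 := by rw [← sq_abs]; rw [mul_one] at h3; rw [← h3]; norm_num
    have e : ∀ y, (ce (w.h l y) : ℂ) = (ce (phN w l (1, y)) : ℂ) ^ 2 := by
      intro y
      have : w.h l y = phN w l (1, y) + phN w l (1, y) := by unfold phN; ring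
      rw [this, ce_add, Circle.coe_mul, sq]
    refine Circle.ext ?_
    rw [e, e]
    have h6 : (ce (phN w l (1, x)) : ℂ) = k * (ce (phN w l (1, x')) : ℂ) := by simpa using h1
    rw [h6, mul_pow]
    have : (k : ℂ) ^ 2 = 1 := by exact_mod_cast hk2
    rw [this, one_mul]
  · have h5 : r < 1 := lt_of_le_of_ne hr1 h4
    have hk : 0 < k := by
      by_contra hk
      push Not at hk
      nlinarith
    rw [abs_of_pos hk] at h3
    have hk1 : k = 1 := by linarith
    subst hk1
    have h6 : r = r' := by linarith
    subst h6
    refine Or.inl ⟨rfl, ?_⟩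
    by_cases h7 : r = 0
    · exact Or.inl h7
    · right; left
      have h8 : ce (phN w l (r, x)) = ce (phN w l (r, x')) := by
        refine Circle.ext ?_
        rw [Complex.ofReal_one, one_mul] at h1
        exact mul_left_cancel₀ (by exact_mod_cast h7) h1
      have hm := phN_mono w ht l hr0 hr1
      have hs := phN_smono w ht l hr0 h5
      have b0 := hm hx0
      have b1 := hm hx1
      have b0' := hm hx0'
      have b1' := hm hx1'
      simp only [phN_zero, phN_N w ht] at b0 b1 b0' b1'
      show ce (x / w.N) = ce (x' / w.N)
      obtain ⟨n, hn⟩ := ce_eq.1 h8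
      have n1 : (n : ℝ) ≤ 1 := by linarith
      have n2 : (-1 : ℝ) ≤ n := by linarith
      have n1' : n ≤ 1 := by exact_mod_cast n1
      have n2' : -1 ≤ n := by exact_mod_cast n2
      have n3 : n = -1 ∨ n = 0 ∨ n = 1 := by omega
      have inj : ∀ {y y' : ℝ}, phN w l (r, y) = phN w l (r, y') → y = y' := fun h => hs.injective h
      rcases n3 with rfl | rfl | rfl
      · push_cast at hn
        have e1 : x = 0 := inj (by rw [phN_zero]; linarith)
        have e2 : x' = w.N := inj (by rw [phN_N w ht]; linarith)
        rw [e1, e2, zero_div, div_self hN.ne', ce_zero, ce_one]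
      · push_cast at hn
        rw [inj (by linarith : phN w l (r, x) = phN w l (r, x'))]
      · push_cast at hn
        have e1 : x' = 0 := inj (by rw [phN_zero]; linarith)
        have e2 : x = w.N := inj (by rw [phN_N w ht]; linarith)
        rw [e1, e2, zero_div, div_self hN.ne', ce_zero, ce_one]

lemma zN_compat (w : PW) (ht : w.tw = false) (l : w.L) : w.Compat (zN w l) := by
  refine ⟨fun x x' _ _ _ _ => ?_, fun ρ _ _ => ?_, fun x x' _ _ _ _ h => ?_⟩
  · rw [zN_eq]; exact ⟨1, by simp, by simp⟩
  · rw [zN_eq]; exact ⟨1, by simp [phN_zero, phN_N w ht, ce_zero, ce_one], by simp⟩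
  · rw [zN_eq]
    obtain ⟨n, hn⟩ := ce_eq.1 (h l)
    have h1 : ce (phN w l (1, x)) = ce ((n : ℝ) / 2) * ce (phN w l (1, x')) := by
      rw [← ce_add]; congr 1; unfold phN; simp only [hn]; ring
    have h2 : (ce ((n : ℝ) / 2) : ℂ) ^ 2 = 1 := by
      rw [sq, ← Circle.coe_mul, ← ce_add, add_halves, ce_int, Circle.coe_one]
    rcases mul_self_eq_one_iff.1 ((sq _).symm.trans h2) with h3 | h3
    · exact ⟨1, by rw [h1, Circle.coe_mul, h3]; simp, by simp⟩
    · exact ⟨-1, by rw [h1, Circle.coe_mul, h3]; simp, by simp⟩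

def facN {w : PW} {S : Type} [TopologicalSpace S] {pr : ℝ × ℝ → S} (m : w.Mod S pr) (ht : w.tw = false) (l0 : w.L) : Fac w S pr RP2 where
  m := m
  zq := zN w l0
  zcont := (continuous_zN w l0).continuousOn
  zsurj := zN_surj w ht l0
  zcompat := zN_compat w ht l0
  L0 := Finset.univ.erase l0
  hs := w.h l0
  hscont := w.continuous_h l0
  hs0 := w.h_zero l0
  hsN := fun j _ => by rw [w.h_N_false ht, w.h_N_false ht]
  ceN := w.c_N l0
  h0 := fun j _ => w.h_zero j
  ks := m.kap l0
  kscont := m.continuous_kap l0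
  ks1 := m.kap_one l0
  ksbd := m.kap_bd l0
  split := fun x h0 h1 => by
    obtain ⟨l, h2, h3⟩ := m.kap_split h0 h1
    by_cases hl : l = l0
    · subst hl
      exact Or.inr ⟨fun j hj => h2 j (Finset.ne_of_mem_erase hj), h3⟩
    · exact Or.inl ⟨l, Finset.mem_erase.2 ⟨hl, Finset.mem_univ _⟩, fun j _ hj => h2 j hj, h2 l0 (Ne.symm hl), h3⟩
  sdep := fun _ _ _ _ _ _ h => h l0
  zfib := zN_fib w ht l0

end FacC

end

section
set_option autoImplicit false
open Topology
set_option linter.unusedSectionVars false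
set_option linter.unusedSimpArgs false
set_option linter.unusedVariables false

section Concl

lemma spIn_card_eq {X : Type} [TopologicalSpace X] {n : ℕ} (x : SP n X) : (spIn n x).card = n := by
  have : spIn n x ∈ Set.range (spIn (X := X) n) := ⟨x, rfl⟩
  rw [range_spIn] at this
  exact this

lemma continuous_spIn {X : Type} [TopologicalSpace X] (n : ℕ) : Continuous (spIn (X := X) n) :=
  (isOpenEmbedding_spIn n).continuous

lemma sub_of_null {X : Type} [TopologicalSpace X] {i n : ℕ} (hi : 0 < i) (x : SP n X)
    (h : ∀ f : (Fin i → I) → Multiset X, Continuous f → (∀ s, (f s).card = n) → (∀ s ∈ Cube.boundary (Fin i), f s = spIn n x) → BNull f) :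
    Subsingleton (π_ i (SP n X) x) := by
  refine subsingleton_pi hi fun f hf hb => BNull_sp ?_
  exact h _ ((continuous_spIn n).comp hf) (fun s => spIn_card_eq _) (fun s hs => by rw [hb s hs])

lemma S2_pathc : PathConnectedSpace S2 := by
  refine isPathConnected_iff_pathConnectedSpace.1 (isPathConnected_sphere ?_ _ zero_le_one)
  rw [← Module.finrank_eq_rank]
  simp

theorem piM0 {n i : ℕ} (hi : 3 ≤ i) (hin : i < n) (x : SP n S2) : Subsingleton (π_ i (SP n S2) x) :=
  sub_of_null (by omega) x fun f hf hc hb => cp_null hi hin hf hc fun s hs => by rw [hb s hs, hb _ (zero_mem_bd (by omega))]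

theorem pi2M0 {n : ℕ} (hn : 3 ≤ n) (x : SP n S2) : Nonempty ((π_ 2 (SP n S2) x) ≃* Multiplicative ℤ) := by
  have := S2_pathc
  refine pi2_of_map (by omega) (qb := id) continuous_id x (fun f _ _ _ h => by simpa using h) ?_
  obtain ⟨k, rfl⟩ : ∃ k, n = k + 1 := ⟨n - 1, by omega⟩
  have hgc : Continuous fun s => ({genZ s} : Multiset S2) := continuous_ms_singleton.comp continuous_genZ
  obtain ⟨f', h1, h2, h3, h4⟩ := move_bd (i := 2) (n := k + 1) (by omega) (f := fun s => ({genZ s} : Multiset S2) + Multiset.replicate k S2inf)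
    (by fun_prop) (fun s => by simp) (fun s hs => by rw [genZ_bd s hs]) (spIn_card_eq x)
  refine ⟨f', h2, h3, h4, fun hN => gen_not_null k ?_⟩
  simp only [Multiset.map_id] at hN
  exact hN.of_BH h1

section
variable {w : PW} {S : Type} [TopologicalSpace S] {pr : ℝ × ℝ → S}

theorem piM {n i : ℕ} (m : w.Mod S pr) (ht : w.tw = true) (hi : 3 ≤ i) (hin : i < n) (x : SP n S) : Subsingleton (π_ i (SP n S) x) :=
  sub_of_null (by omega) x fun f hf hc hb => (facM m ht).null' (by omega) hin hf hc hb
    (cp_null hi hin ((continuous_ms_map' (facM m ht).continuous_q).comp hf) (fun s => by simp [hc])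
      fun s hs => by rw [hb s hs, hb _ (zero_mem_bd (by omega))])

theorem piN {n i : ℕ} (m : w.Mod S pr) (ht : w.tw = false) (l0 : w.L) (hi : 2 ≤ i) (hin : i < n) (x : SP n S) : Subsingleton (π_ i (SP n S) x) :=
  sub_of_null (by omega) x fun f hf hc hb => (facN m ht l0).null' (by omega) hin hf hc hb
    (rp_null hi hin ((continuous_ms_map' (facN m ht l0).continuous_q).comp hf) (fun s => by simp [hc])
      fun s hs => by rw [hb s hs, hb _ (zero_mem_bd (by omega))])

theorem pi2M {n : ℕ} (m : w.Mod S pr) (ht : w.tw = true) (hn : 3 ≤ n) (x : SP n S) : Nonempty ((π_ 2 (SP n S) x) ≃* Multiplicative ℤ) := by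
  have hz : ∀ x, (facM m ht).zq (1, x) = S2inf := fun x => zM_one w x
  refine pi2_of_map (by omega) (facM m ht).continuous_q x (fun f hf hc hb h => (facM m ht).null' le_rfl (by omega) hf hc hb h) ?_
  refine (facM m ht).nontriv (fun x _ _ => by rw [hz, hz]) (by omega) continuous_genZ (fun s hs => by rw [genZ_bd s hs, hz]) (fun k => ?_) (spIn_card_eq x)
  rw [hz]
  exact gen_not_null k
end

end Concl

end

/-- **Theorem E.** For a closed surface `S` and `3 ≤ i < n`, `πᵢ(SPⁿ(S)) = 0`;
moreover for `n ≥ 3`, `π₂(SPⁿ(M_g)) ≅ ℤ` and `π₂(SPⁿ(N_g)) = 0`. -/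
theorem homotopyGroups_SP_surfaces :
    (∀ g n i : ℕ, 3 ≤ i → i < n →
      ∀ x : SP n (Mg g), Subsingleton (π_ i (SP n (Mg g)) x)) ∧
    (∀ g n i : ℕ, 1 ≤ g → 3 ≤ i → i < n →
      ∀ x : SP n (Ng g), Subsingleton (π_ i (SP n (Ng g)) x)) ∧
    (∀ g n : ℕ, 3 ≤ n →
      ∀ x : SP n (Mg g), Nonempty ((π_ 2 (SP n (Mg g)) x) ≃* Multiplicative ℤ)) ∧
    (∀ g n : ℕ, 1 ≤ g → 3 ≤ n →
      ∀ x : SP n (Ng g), Subsingleton (π_ 2 (SP n (Ng g)) x)) := by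
  refine ⟨?_, ?_, ?_, ?_⟩
  · intro g n i h3 hin
    cases g with
    | zero => exact fun x => piM0 h3 hin x
    | succ g => exact fun x => piM (PW.mod_M g) rfl h3 hin x
  · intro g n i hg h3 hin
    obtain ⟨g, rfl⟩ : ∃ k, g = k + 1 := ⟨g - 1, by omega⟩
    exact fun x => piN (PW.mod_N g) rfl (0 : Fin (g + 1)) (by omega) hin x
  · intro g n hn
    cases g with
    | zero => exact fun x => pi2M0 hn x
    | succ g => exact fun x => pi2M (PW.mod_M g) rfl hn x
  · intro g n hg hn
    obtain ⟨g, rfl⟩ : ∃ k, g = k + 1 := ⟨g - 1, by omega⟩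
    exact fun x => piN (PW.mod_N g) rfl (0 : Fin (g + 1)) le_rfl (by omega) x

end
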